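/- Let K be a finite geometric simplicial complex of dimension m ≥ 3. There exists a continuous map f : |K| → ℝ^{2m} without 2-Tverberg points (an almost-embedding) if and only if there exists an S_2-equivariant continuous map F : K^2_Δ → S^{2m−1}. -/

import Mathlib

open Set

noncomputable section

/-- `s` is a face of `K` containing `x` in its relative interior; i.e. `s` is the
support of `x` in `K`. -/
def IsSupportFace {n : ℕ} (K : Geometry.SimplicialComplex ℝ (EuclideanSpace ℝ (Fin n)))
    (x : EuclideanSpace ℝ (Fin n)) (s : Finset (EuclideanSpace ℝ (Fin n))) : Prop :=
  s ∈ K.faces ∧ x ∈ intrinsicInterior ℝ (convexHull ℝ (↑s : Set (EuclideanSpace ℝ (Fin n))))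

/-- The continuous map `f : |K| → ℝ^d` has an `r`-Tverberg point: there are `r` points of
`|K|` with pairwise (vertex-)disjoint supports mapped to the same point. -/
def HasTverbergPoint {n d : ℕ} (K : Geometry.SimplicialComplex ℝ (EuclideanSpace ℝ (Fin n)))
    (r : ℕ) (f : EuclideanSpace ℝ (Fin n) → EuclideanSpace ℝ (Fin d)) : Prop :=
  ∃ (x : Fin r → EuclideanSpace ℝ (Fin n)) (s : Fin r → Finset (EuclideanSpace ℝ (Fin n))),
    (∀ i, IsSupportFace K (x i) (s i)) ∧
    (Pairwise fun i j => Disjoint (s i) (s j)) ∧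
    (∀ i j, f (x i) = f (x j))

/-- The `r`-fold deleted product `K^r_Δ` of `K`, as a subspace of `((ℝ^n))^r`. -/
def deletedProduct {n : ℕ} (K : Geometry.SimplicialComplex ℝ (EuclideanSpace ℝ (Fin n)))
    (r : ℕ) : Set (Fin r → EuclideanSpace ℝ (Fin n)) :=
  {x | ∃ s : Fin r → Finset (EuclideanSpace ℝ (Fin n)),
    (∀ i, IsSupportFace K (x i) (s i)) ∧ Pairwise fun i j => Disjoint (s i) (s j)}

/-- The sphere `S^{d(r-1)-1} = {(y_1,…,y_r) ∈ (ℝ^d)^r : Σ y_i = 0, Σ ‖y_i‖² = 1}`. -/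
def tvSphere (d r : ℕ) : Set (Fin r → EuclideanSpace ℝ (Fin d)) :=
  {y | (∑ i, y i) = 0 ∧ (∑ i, ‖y i‖ ^ 2) = 1}

/-- There exists an `S_r`-equivariant continuous map `K^r_Δ → S^{d(r-1)-1}`. -/
def ExistsEquivariantMap {n : ℕ} (K : Geometry.SimplicialComplex ℝ (EuclideanSpace ℝ (Fin n)))
    (r d : ℕ) : Prop :=
  ∃ F : (Fin r → EuclideanSpace ℝ (Fin n)) → (Fin r → EuclideanSpace ℝ (Fin d)),
    ContinuousOn F (deletedProduct K r) ∧
    MapsTo F (deletedProduct K r) (tvSphere d r) ∧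
    ∀ x ∈ deletedProduct K r, ∀ π : Equiv.Perm (Fin r),
      F (fun i => x (π i)) = fun i => F x (π i)

/-- `K` has dimension `m`: every face has at most `m+1` vertices and some face has
exactly `m+1` vertices. -/
def HasDimension {n : ℕ} (K : Geometry.SimplicialComplex ℝ (EuclideanSpace ℝ (Fin n)))
    (m : ℕ) : Prop :=
  (∀ s ∈ K.faces, s.card ≤ m + 1) ∧ ∃ s ∈ K.faces, s.card = m + 1

open Set
noncomputable section
namespace VK
set_option linter.unusedVariables false
open Topology Filter

/-- Homotopy of maps on `S` through maps into `C`. -/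
def Hmt {X E : Type*} [TopologicalSpace X] [TopologicalSpace E] (S : Set X) (C : Set E)
    (φ ψ : X → E) : Prop :=
  ∃ h : ℝ × X → E, ContinuousOn h (Icc 0 1 ×ˢ S) ∧ MapsTo h (Icc 0 1 ×ˢ S) C ∧
    (∀ x ∈ S, h (0, x) = φ x) ∧ (∀ x ∈ S, h (1, x) = ψ x)

section
variable {X Y E : Type*} [TopologicalSpace X] [TopologicalSpace Y] [TopologicalSpace E]
  {S : Set X} {C : Set E} {φ ψ χ : X → E}

theorem Hmt.refl (hφ : ContinuousOn φ S) (hC : MapsTo φ S C) : Hmt S C φ φ :=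
  ⟨fun p => φ p.2, hφ.comp continuousOn_snd (fun p hp => hp.2), fun p hp => hC hp.2,
    fun _ _ => rfl, fun _ _ => rfl⟩

theorem Hmt.congr {φ' ψ' : X → E} (h : Hmt S C φ ψ) (h1 : EqOn φ' φ S) (h2 : EqOn ψ' ψ S) :
    Hmt S C φ' ψ' := by
  obtain ⟨H, a, b, c, d⟩ := h
  exact ⟨H, a, b, fun x hx => (c x hx).trans (h1 hx).symm, fun x hx => (d x hx).trans (h2 hx).symm⟩

theorem Hmt.mono {S' : Set X} {C' : Set E} (h : Hmt S C φ ψ) (hS : S' ⊆ S) (hC : C ⊆ C') :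
    Hmt S' C' φ ψ := by
  obtain ⟨H, a, b, c, d⟩ := h
  exact ⟨H, a.mono (prod_mono_right hS), fun p hp => hC (b ⟨hp.1, hS hp.2⟩),
    fun x hx => c x (hS hx), fun x hx => d x (hS hx)⟩

theorem Hmt.symm (h : Hmt S C φ ψ) : Hmt S C ψ φ := by
  obtain ⟨H, a, b, c, d⟩ := h
  have key : MapsTo (fun p : ℝ × X => (1 - p.1, p.2)) (Icc 0 1 ×ˢ S) (Icc 0 1 ×ˢ S) := by
    rintro ⟨t, x⟩ ⟨ht, hx⟩
    simp only [mem_Icc] at ht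
    exact ⟨⟨by simp only; linarith [ht.2], by simp only; linarith [ht.1]⟩, hx⟩
  refine ⟨fun p => H (1 - p.1, p.2), ?_, ?_, ?_, ?_⟩
  · exact a.comp (by fun_prop) key
  · exact fun p hp => b (key hp)
  · intro x hx; simpa using d x hx
  · intro x hx; simpa using c x hx

theorem Hmt.trans (h1 : Hmt S C φ ψ) (h2 : Hmt S C ψ χ) : Hmt S C φ χ := by
  obtain ⟨H, a, b, c, d⟩ := h1
  obtain ⟨H', a', b', c', d'⟩ := h2
  have k1 : MapsTo (fun p : ℝ × X => (2 * p.1, p.2)) (Icc 0 (1/2) ×ˢ S) (Icc 0 1 ×ˢ S) := by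
    rintro ⟨t, x⟩ ⟨ht, hx⟩
    simp only [mem_Icc] at ht
    exact ⟨⟨by simp only; linarith [ht.1], by simp only; linarith [ht.2]⟩, hx⟩
  have k2 : MapsTo (fun p : ℝ × X => (2 * p.1 - 1, p.2)) (Icc (1/2) 1 ×ˢ S) (Icc 0 1 ×ˢ S) := by
    rintro ⟨t, x⟩ ⟨ht, hx⟩
    simp only [mem_Icc] at ht
    exact ⟨⟨by simp only; linarith [ht.1], by simp only; linarith [ht.2]⟩, hx⟩
  have e1 : ∀ p : ℝ × X, p.2 ∈ S → p.1 ≤ 1/2 →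
      (if p.1 ≤ 1/2 then H (2 * p.1, p.2) else H' (2 * p.1 - 1, p.2)) = H (2 * p.1, p.2) :=
    fun p _ hp => if_pos hp
  have e2 : ∀ p : ℝ × X, p.2 ∈ S → 1/2 ≤ p.1 →
      (if p.1 ≤ 1/2 then H (2 * p.1, p.2) else H' (2 * p.1 - 1, p.2)) = H' (2 * p.1 - 1, p.2) := by
    intro p hp hp'
    split_ifs with hh
    · have : p.1 = 1/2 := le_antisymm hh hp'
      rw [this]; norm_num [d p.2 hp, c' p.2 hp]
    · rfl
  refine ⟨fun p => if p.1 ≤ 1/2 then H (2 * p.1, p.2) else H' (2 * p.1 - 1, p.2), ?_, ?_, ?_, ?_⟩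
  · have : (Icc 0 1 ×ˢ S : Set (ℝ × X)) =
        ((Icc 0 1 ×ˢ S) ∩ {p | p.1 ≤ 1/2}) ∪ ((Icc 0 1 ×ˢ S) ∩ {p | 1/2 ≤ p.1}) := by
      rw [← inter_union_distrib_left]
      ext p; simp [le_total]
    intro p hp
    have c1 : ContinuousOn (fun p : ℝ × X =>
        if p.1 ≤ 1/2 then H (2 * p.1, p.2) else H' (2 * p.1 - 1, p.2))
        ((Icc 0 1 ×ˢ S) ∩ {p | p.1 ≤ 1/2}) := by
      refine ContinuousOn.congr (f := fun p => H (2 * p.1, p.2)) ?_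
        (fun p hp => e1 p hp.1.2 hp.2)
      exact a.comp (by fun_prop) (fun p hp => k1 ⟨⟨hp.1.1.1, hp.2⟩, hp.1.2⟩)
    have c2 : ContinuousOn (fun p : ℝ × X =>
        if p.1 ≤ 1/2 then H (2 * p.1, p.2) else H' (2 * p.1 - 1, p.2))
        ((Icc 0 1 ×ˢ S) ∩ {p | 1/2 ≤ p.1}) := by
      refine ContinuousOn.congr (f := fun p => H' (2 * p.1 - 1, p.2)) ?_
        (fun p hp => e2 p hp.1.2 hp.2)
      exact a'.comp (by fun_prop) (fun p hp => k2 ⟨⟨hp.2, hp.1.1.2⟩, hp.1.2⟩)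
    rw [this]
    have cl1 : IsClosed {p : ℝ × X | p.1 ≤ 1/2} := isClosed_le continuous_fst continuous_const
    have cl2 : IsClosed {p : ℝ × X | 1/2 ≤ p.1} := isClosed_le continuous_const continuous_fst
    rw [ContinuousWithinAt, nhdsWithin_union, tendsto_sup]
    constructor
    · by_cases h : p.1 ≤ 1/2
      · exact c1 p ⟨hp, h⟩
      · have : 𝓝[(Icc 0 1 ×ˢ S) ∩ {p | p.1 ≤ 1/2}] p = ⊥ := by
          rw [← notMem_closure_iff_nhdsWithin_eq_bot]
          intro hc
          exact h (cl1.closure_subset_iff.2 inter_subset_right hc)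
        rw [this]; exact tendsto_bot
    · by_cases h : 1/2 ≤ p.1
      · exact c2 p ⟨hp, h⟩
      · have : 𝓝[(Icc 0 1 ×ˢ S) ∩ {p | 1/2 ≤ p.1}] p = ⊥ := by
          rw [← notMem_closure_iff_nhdsWithin_eq_bot]
          intro hc
          exact h (cl2.closure_subset_iff.2 inter_subset_right hc)
        rw [this]; exact tendsto_bot
  · rintro p ⟨hp1, hp2⟩
    simp only
    split_ifs with h
    · exact b (k1 ⟨⟨hp1.1, h⟩, hp2⟩)
    · exact b' (k2 ⟨⟨(not_le.1 h).le, hp1.2⟩, hp2⟩)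
  · intro x hx
    simp only
    rw [if_pos (by norm_num)]; simpa using c x hx
  · intro x hx
    simp only
    rw [if_neg (by norm_num)]; norm_num [d' x hx]

theorem Hmt.comp {T : Set Y} (h : Hmt S C φ ψ) {k : Y → X} (hk : ContinuousOn k T)
    (hm : MapsTo k T S) : Hmt T C (φ ∘ k) (ψ ∘ k) := by
  obtain ⟨H, a, b, c, d⟩ := h
  refine ⟨fun p => H (p.1, k p.2), ?_, fun p hp => b ⟨hp.1, hm hp.2⟩, fun x hx => c _ (hm hx),
    fun x hx => d _ (hm hx)⟩
  refine a.comp ?_ (fun p hp => ⟨hp.1, hm hp.2⟩)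
  exact continuousOn_fst.prodMk (hk.comp continuousOn_snd (fun p hp => hp.2))

end

section
variable {X E : Type*} [TopologicalSpace X] [NormedAddCommGroup E] [NormedSpace ℝ E]
  {S : Set X} {C : Set E} {φ ψ χ : X → E}

theorem Hmt.segment (hφ : ContinuousOn φ S) (hψ : ContinuousOn ψ S)
    (h : ∀ x ∈ S, ∀ t ∈ Icc (0:ℝ) 1, (1 - t) • φ x + t • ψ x ∈ C) : Hmt S C φ ψ := by
  refine ⟨fun p => (1 - p.1) • φ p.2 + p.1 • ψ p.2, ?_, fun p hp => h _ hp.2 _ hp.1,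
    fun x _ => by simp, fun x _ => by simp⟩
  have h2 : MapsTo (Prod.snd : ℝ × X → X) (Icc 0 1 ×ˢ S) S := fun p hp => hp.2
  have := hφ.comp continuousOn_snd h2
  have := hψ.comp continuousOn_snd h2
  fun_prop

end

/-- Tietze for `ContinuousOn`. -/
theorem exists_extension {X E : Type*} [TopologicalSpace X] [NormalSpace X]
    [NormedAddCommGroup E] [NormedSpace ℝ E] [FiniteDimensional ℝ E] {A : Set X} (hA : IsClosed A)
    {f : X → E} (hf : ContinuousOn f A) : ∃ g : X → E, Continuous g ∧ EqOn g f A := by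
  have : TietzeExtension E := RCLike.instTietzeExtensionTVS (𝕜 := ℝ)
  obtain ⟨g, hg⟩ := ContinuousMap.exists_restrict_eq hA ⟨A.domRestrict f, hf.domRestrict⟩
  refine ⟨g, g.continuous, fun x hx => ?_⟩
  exact congrArg (fun k => k ⟨x, hx⟩) hg

/-- continuity on a union of two closed sets -/
theorem continuousOn_union_closed {X Y : Type*} [TopologicalSpace X] [TopologicalSpace Y]
    {A B : Set X} (hA : IsClosed A) (hB : IsClosed B) {f : X → Y} (h1 : ContinuousOn f A)
    (h2 : ContinuousOn f B) : ContinuousOn f (A ∪ B) := by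
  intro p hp
  rw [ContinuousWithinAt, nhdsWithin_union, tendsto_sup]
  constructor
  · by_cases h : p ∈ A
    · exact h1 p h
    · have : 𝓝[A] p = ⊥ := by
        rw [← notMem_closure_iff_nhdsWithin_eq_bot, hA.closure_eq]; exact h
      rw [this]; exact tendsto_bot
  · by_cases h : p ∈ B
    · exact h2 p h
    · have : 𝓝[B] p = ⊥ := by
        rw [← notMem_closure_iff_nhdsWithin_eq_bot, hB.closure_eq]; exact h
      rw [this]; exact tendsto_bot

/-- Borsuk homotopy extension: if `φ` is homotopic on `D` to `ψ` in the open set `C` and `ψ`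
extends over `S` in `C`, so does `φ`. -/
theorem extend_of_hmt {X E : Type*} [MetricSpace X]
    [NormedAddCommGroup E] [NormedSpace ℝ E] [FiniteDimensional ℝ E]
    {S D : Set X} (hS : IsCompact S) (hD : IsClosed D) (hDS : D ⊆ S) {C : Set E} (hC : IsOpen C)
    {φ ψ : X → E} (h : Hmt D C φ ψ) (hψ : ContinuousOn ψ S) (hψC : MapsTo ψ S C) :
    ∃ φ' : X → E, ContinuousOn φ' S ∧ MapsTo φ' S C ∧ EqOn φ' φ D := by
  obtain ⟨H, a, b, c, d⟩ := h
  classical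
  set H1 : ℝ × X → E := fun p => if p.1 = 1 then ψ p.2 else H p with hH1
  have hA1 : IsClosed (Icc (0:ℝ) 1 ×ˢ D) := isClosed_Icc.prod hD
  have hA2 : IsClosed ({(1:ℝ)} ×ˢ S) := isClosed_singleton.prod hS.isClosed
  have e1 : EqOn H1 H (Icc (0:ℝ) 1 ×ˢ D) := by
    rintro ⟨t, x⟩ ⟨ht, hx⟩
    simp only [hH1]
    split_ifs with h1
    · rw [h1]; exact (d x hx).symm
    · rfl
  have e2 : EqOn H1 (fun p => ψ p.2) ({(1:ℝ)} ×ˢ S) := by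
    rintro ⟨t, x⟩ ⟨ht, hx⟩
    simp only [hH1]
    rw [if_pos (mem_singleton_iff.1 ht)]
  have hc : ContinuousOn H1 ((Icc (0:ℝ) 1 ×ˢ D) ∪ ({(1:ℝ)} ×ˢ S)) :=
    continuousOn_union_closed hA1 hA2 (a.congr e1)
      ((hψ.comp continuousOn_snd (fun p hp => hp.2)).congr e2)
  obtain ⟨G, hG, hGe⟩ := exists_extension (hA1.union hA2) hc
  set K0 : Set X := Prod.snd '' ((Icc (0:ℝ) 1 ×ˢ S) ∩ G ⁻¹' Cᶜ) with hK0
  have hK0c : IsCompact K0 := by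
    refine IsCompact.image ?_ continuous_snd
    exact (isCompact_Icc.prod hS).inter_right (hC.isClosed_compl.preimage hG)
  have hdisj : Disjoint D K0 := by
    rw [disjoint_left]
    rintro x hx ⟨⟨t, y⟩, ⟨⟨ht, hy⟩, hn⟩, rfl⟩
    apply hn
    rw [hGe (Or.inl ⟨ht, hx⟩), e1 ⟨ht, hx⟩]
    exact b ⟨ht, hx⟩
  obtain ⟨χ, hχ0, hχ1, hχ⟩ := exists_continuous_zero_one_of_isClosed hD hK0c.isClosed hdisj
  refine ⟨fun x => G (χ x, x), ?_, ?_, ?_⟩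
  · exact (hG.comp (by fun_prop)).continuousOn
  · intro x hx
    by_cases hk : x ∈ K0
    · simp only [hχ1 hk, Pi.one_apply]
      rw [hGe (Or.inr ⟨mem_singleton _, hx⟩), e2 ⟨mem_singleton _, hx⟩]
      exact hψC hx
    · by_contra hcon
      exact hk ⟨(χ x, x), ⟨⟨hχ x, hx⟩, hcon⟩, rfl⟩
  · intro x hx
    simp only [hχ0 hx, Pi.zero_apply]
    rw [hGe (Or.inl ⟨⟨le_rfl, zero_le_one⟩, hx⟩), e1 ⟨⟨le_rfl, zero_le_one⟩, hx⟩]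
    exact c x hx

/-- smooth approximation on a compact set -/
theorem exists_smooth_approx {X E : Type*} [NormedAddCommGroup X] [NormedSpace ℝ X]
    [FiniteDimensional ℝ X] [NormedAddCommGroup E] [NormedSpace ℝ E] [FiniteDimensional ℝ E]
    {S : Set X} (hS : IsCompact S) {f : X → E} (hf : ContinuousOn f S) {ε : ℝ} (hε : 0 < ε) :
    ∃ g : X → E, ContDiff ℝ (⊤ : ℕ∞) g ∧ ∀ x ∈ S, ‖g x - f x‖ < ε := by
  obtain ⟨f1, hf1, hfe⟩ := exists_extension hS.isClosed hf
  have : CompleteSpace E := FiniteDimensional.complete ℝ E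
  have : ProperSpace X := FiniteDimensional.proper ℝ X
  have hu : UniformContinuousOn f1 (Metric.cthickening 1 S) :=
    hS.cthickening.uniformContinuousOn_of_continuous hf1.continuousOn
  rcases Metric.uniformContinuousOn_iff.mp hu (ε / 2) (half_pos hε) with ⟨δ, hδ, hfδ⟩
  rcases hf1.exists_contDiff_dist_le_of_forall_mem_ball_dist_le
    (lt_min one_pos hδ) with ⟨g, hgc, hg⟩
  refine ⟨g, hgc, fun x hx ↦ ?_⟩
  rw [← hfe hx, ← dist_eq_norm]
  refine (hg _ _ fun y hy ↦ ?_).trans_lt (half_lt_self hε)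
  rw [Metric.mem_ball, lt_min_iff] at hy
  exact hfδ _ (Metric.mem_cthickening_of_dist_le _ x _ _ hx hy.1.le) _
    (Metric.self_subset_cthickening _ hx) hy.2 |>.le

end VK

open Set
noncomputable section
namespace VK
set_option linter.unusedVariables false
set_option linter.unusedSectionVars false
open Topology Filter MeasureTheory

section
variable {Z W : Type*} [NormedAddCommGroup Z] [NormedSpace ℝ Z] [FiniteDimensional ℝ Z]
  [NormedAddCommGroup W] [NormedSpace ℝ W] [FiniteDimensional ℝ W]

/-- Lebesgue null sets. -/
structure Thin (s : Set Z) : Prop where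
  out : ∀ [MeasurableSpace Z] [BorelSpace Z], (Measure.addHaar : Measure Z) s = 0

theorem Thin.mono {s t : Set Z} (ht : Thin t) (h : s ⊆ t) : Thin s := by
  refine ⟨?_⟩
  intro _ _
  exact measure_mono_null h ht.out

theorem Thin.union {s t : Set Z} (hs : Thin s) (ht : Thin t) : Thin (s ∪ t) := by
  refine ⟨?_⟩
  intro _ _
  exact measure_union_null hs.out ht.out

theorem Thin.iUnion {ι : Sort*} [Countable ι] {s : ι → Set Z} (hs : ∀ i, Thin (s i)) :
    Thin (⋃ i, s i) := by
  refine ⟨?_⟩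
  intro _ _
  exact measure_iUnion_null (fun i => (hs i).out)

theorem thin_empty : Thin (∅ : Set Z) := by
  refine ⟨?_⟩
  intro _ _
  exact measure_empty

theorem Thin.exists_near {s : Set Z} (hs : Thin s) (z : Z) {ε : ℝ} (hε : 0 < ε) :
    ∃ w, ‖w - z‖ < ε ∧ w ∉ s := by
  borelize Z
  by_contra hcon
  push Not at hcon
  have h1 : Metric.ball z ε ⊆ s := fun w hw => hcon w (by rwa [← dist_eq_norm])
  have h2 : (Measure.addHaar : Measure Z) (Metric.ball z ε) = 0 := measure_mono_null h1 hs.out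
  exact (Metric.measure_ball_pos (Measure.addHaar : Measure Z) z hε).ne' h2

theorem thin_image {f : W → Z} {s : Set W} (f' : W → W →L[ℝ] Z)
    (hd : Module.finrank ℝ W ≤ Module.finrank ℝ Z)
    (hf : ∀ x ∈ s, HasFDerivWithinAt f (f' x) s x)
    (hs : ∀ x ∈ s, ¬ Function.Surjective (f' x)) : Thin (f '' s) := by
  refine ⟨?_⟩
  intro _ _
  obtain ⟨π, hπ⟩ : ∃ π : Z →L[ℝ] W, Function.Surjective π := by
    let e1 := (Module.finBasis ℝ Z).equivFun
    let e2 := (Module.finBasis ℝ W).equivFun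
    let p := LinearMap.funLeft ℝ ℝ (Fin.castLE hd)
    have hp : Function.Surjective p :=
      LinearMap.funLeft_surjective_of_injective ℝ ℝ _ (Fin.castLE_injective hd)
    refine ⟨LinearMap.toContinuousLinearMap (e2.symm.toLinearMap ∘ₗ p ∘ₗ e1.toLinearMap), ?_⟩
    exact e2.symm.surjective.comp (hp.comp e1.surjective)
  have hsub : f '' s ⊆ (fun z => f (π z)) '' (π ⁻¹' s) := by
    rintro _ ⟨x, hx, rfl⟩
    obtain ⟨z, rfl⟩ := hπ x
    exact ⟨z, hx, rfl⟩
  refine measure_mono_null hsub ?_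
  refine addHaar_image_eq_zero_of_det_fderivWithin_eq_zero (f' := fun z => (f' (π z)).comp π) _ ?_ ?_
  · intro z hz
    exact (hf (π z) hz).comp z π.hasFDerivWithinAt (fun y hy => hy)
  · intro z hz
    by_contra hdet
    apply hs (π z) hz
    have : Function.Surjective ((f' (π z)).comp π) := by
      have h1 : IsUnit (((f' (π z)).comp π : Z →L[ℝ] Z) : Z →ₗ[ℝ] Z) := by
        rw [LinearMap.isUnit_iff_isUnit_det]
        exact isUnit_iff_ne_zero.2 hdet
      exact ((LinearMap.isUnit_iff_range_eq_top _).1 h1 |> LinearMap.range_eq_top.1)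
    exact Function.Surjective.of_comp (g := π) (fun y => this y)

theorem thin_image_lt {f : W → Z} {s : Set W}
    (hd : Module.finrank ℝ W < Module.finrank ℝ Z)
    (hf : ∀ x ∈ s, DifferentiableWithinAt ℝ f s x) : Thin (f '' s) := by
  refine thin_image (fun x => fderivWithin ℝ f s x) hd.le
    (fun x hx => (hf x hx).hasFDerivWithinAt) (fun x hx hsur => ?_)
  have := LinearMap.finrank_le_finrank_of_surjective (f := (fderivWithin ℝ f s x : W →ₗ[ℝ] Z)) hsur
  omega
end

section GP
variable {ι : Type*} [Fintype ι] [DecidableEq ι] {U E : Type*}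
  [NormedAddCommGroup U] [NormedSpace ℝ U] [FiniteDimensional ℝ U]
  [NormedAddCommGroup E] [NormedSpace ℝ E] [FiniteDimensional ℝ E]

/-- solve the equation for the coordinate `v0` -/
def solveAt (r : U → ι → ℝ) (α : U → E) (v0 : ι) (p : U × ({v : ι // v ≠ v0} → E)) : ι → E :=
  fun v => if h : v = v0 then (r p.1 v0)⁻¹ • (α p.1 - ∑ w : {v : ι // v ≠ v0}, r p.1 w • p.2 w)
    else p.2 ⟨v, h⟩

theorem solveAt_spec (r : U → ι → ℝ) (α : U → E) (v0 : ι) (p : U × ({v : ι // v ≠ v0} → E))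
    (h : r p.1 v0 ≠ 0) : ∑ v, r p.1 v • solveAt r α v0 p v = α p.1 := by
  have hs := Fintype.sum_eq_add_sum_subtype_ne (fun v => r p.1 v • solveAt r α v0 p v) v0
  rw [hs]
  have h2 : ∀ w : {v : ι // v ≠ v0}, r p.1 w • solveAt r α v0 p w = r p.1 w • p.2 w := by
    rintro ⟨w, hw⟩
    simp [solveAt, hw]
  rw [Finset.sum_congr rfl (fun w _ => h2 w)]
  simp [solveAt, smul_smul, h]

theorem solveAt_of_sol (r : U → ι → ℝ) (α : U → E) (v0 : ι) (u : U) (Θ : ι → E)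
    (h : r u v0 ≠ 0) (he : ∑ v, r u v • Θ v = α u) :
    solveAt r α v0 (u, fun w => Θ w) = Θ := by
  have hs := Fintype.sum_eq_add_sum_subtype_ne (fun v => r u v • Θ v) v0
  rw [he] at hs
  ext1 v
  by_cases hv : v = v0
  · subst hv
    simp [solveAt, hs, smul_smul, h]
  · simp [solveAt, hv]

theorem differentiableAt_solveAt {r : U → ι → ℝ} {α : U → E} (hr : Differentiable ℝ r)
    (hα : Differentiable ℝ α) (v0 : ι) (p : U × ({v : ι // v ≠ v0} → E))
    (h : r p.1 v0 ≠ 0) : DifferentiableAt ℝ (solveAt r α v0) p := by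
  have hr' : ∀ v, Differentiable ℝ (fun u => r u v) := fun v => differentiable_pi.1 hr v
  rw [differentiableAt_pi]
  intro v
  by_cases hv : v = v0
  · subst hv
    simp only [solveAt, dif_pos]
    refine DifferentiableAt.smul (DifferentiableAt.inv ?_ h) (DifferentiableAt.sub ?_ ?_)
    · exact ((hr' v) p.1).comp p differentiableAt_fst
    · exact (hα p.1).comp p differentiableAt_fst
    · refine DifferentiableAt.fun_sum (fun w _ => DifferentiableAt.smul ?_ ?_)
      · exact ((hr' w) p.1).comp p differentiableAt_fst
      · exact (differentiableAt_pi.1 (differentiableAt_snd (p := p)) w)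
  · simp only [solveAt, dif_neg hv]
    exact (differentiableAt_pi.1 (differentiableAt_snd (p := p)) (⟨v, hv⟩ : {v : ι // v ≠ v0}))

theorem finrank_solve (v0 : ι) : Module.finrank ℝ ({v : ι // v ≠ v0} → E) + Module.finrank ℝ E =
    Module.finrank ℝ (ι → E) := by
  rw [Module.finrank_pi_fintype, Module.finrank_pi_fintype]
  rw [Fintype.sum_eq_add_sum_subtype_ne (fun _ : ι => Module.finrank ℝ E) v0, add_comm]

/-- General position, one equation, regular solutions. -/
theorem gp_regular {r : U → ι → ℝ} {α : U → E} (hr : Differentiable ℝ r)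
    (hα : Differentiable ℝ α) (hd : Module.finrank ℝ U ≤ Module.finrank ℝ E) :
    Thin {Θ : ι → E | ∃ u, r u ≠ 0 ∧ ∑ v, r u v • Θ v = α u ∧
      ¬ Function.Surjective (fderiv ℝ (fun u => ∑ v, r u v • Θ v - α u) u)} := by
  have hr' : ∀ v, Differentiable ℝ (fun u => r u v) := fun v => differentiable_pi.1 hr v
  refine Thin.mono (t := ⋃ v0 : ι, solveAt r α v0 '' {p | r p.1 v0 ≠ 0 ∧
    ¬ Function.Surjective (fderiv ℝ (solveAt r α v0) p)}) ?_ ?_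
  · refine Thin.iUnion (fun v0 => ?_)
    refine thin_image (fun p => fderiv ℝ (solveAt r α v0) p) ?_ ?_ ?_
    · rw [Module.finrank_prod, ← finrank_solve v0]; omega
    · intro p hp
      exact (differentiableAt_solveAt hr hα v0 p hp.1).hasFDerivAt.hasFDerivWithinAt
    · exact fun p hp => hp.2
  · rintro Θ ⟨u, hu, he, hs⟩
    obtain ⟨v0, hv0⟩ : ∃ v0, r u v0 ≠ 0 := by
      by_contra hcon; push Not at hcon; exact hu (funext hcon)
    refine mem_iUnion.2 ⟨v0, (u, fun w => Θ w), ⟨hv0, ?_⟩, solveAt_of_sol r α v0 u Θ hv0 he⟩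
    intro hsur
    apply hs
    set p : U × ({v : ι // v ≠ v0} → E) := (u, fun w => Θ w) with hp
    set Φ' := fderiv ℝ (solveAt r α v0) p with hΦ'
    have hΦ : HasFDerivAt (solveAt r α v0) Φ' p :=
      (differentiableAt_solveAt hr hα v0 p hv0).hasFDerivAt
    have hpΘ : solveAt r α v0 p = Θ := solveAt_of_sol r α v0 u Θ hv0 he
    -- the identity H(u, Φ) = 0
    have h0 : (fun q : U × ({v : ι // v ≠ v0} → E) =>
        ∑ v, r q.1 v • solveAt r α v0 q v - α q.1) =ᶠ[𝓝 p] fun _ => 0 := by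
      have : ∀ᶠ q : U × ({v : ι // v ≠ v0} → E) in 𝓝 p, r q.1 v0 ≠ 0 := by
        have : ContinuousAt (fun q : U × ({v : ι // v ≠ v0} → E) => r q.1 v0) p :=
          ((hr' v0).continuous.comp continuous_fst).continuousAt
        exact this.eventually_ne hv0
      filter_upwards [this] with q hq
      rw [solveAt_spec r α v0 q hq, sub_self]
    have hrd : ∀ v, HasFDerivAt (fun q : U × ({v : ι // v ≠ v0} → E) => r q.1 v)
        ((fderiv ℝ (fun u => r u v) u).comp (ContinuousLinearMap.fst ℝ _ _)) p := fun v =>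
      HasFDerivAt.comp p (g := fun u => r u v) ((hr' v) u).hasFDerivAt hasFDerivAt_fst
    have had : HasFDerivAt (fun q : U × ({v : ι // v ≠ v0} → E) => α q.1)
        ((fderiv ℝ α u).comp (ContinuousLinearMap.fst ℝ _ _)) p :=
      HasFDerivAt.comp p (g := α) (hα u).hasFDerivAt hasFDerivAt_fst
    have hΦv : ∀ v, HasFDerivAt (fun q => solveAt r α v0 q v)
        ((ContinuousLinearMap.proj v).comp Φ') p := fun v =>
      (hasFDerivAt_pi'.1 hΦ) v
    have hder := (HasFDerivAt.fun_sum (u := Finset.univ)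
      (fun v _ => (hrd v).smul (hΦv v))).sub had
    have hz := hder.unique ((hasFDerivAt_const (0:E) p).congr_of_eventuallyEq h0)
    -- derivative of H in u
    have hDu := (HasFDerivAt.fun_sum (u := Finset.univ)
      (fun v _ => ((hr' v) u).hasFDerivAt.smul_const (Θ v))).fun_sub (hα u).hasFDerivAt
    rw [hDu.fderiv]
    intro e
    obtain ⟨δ, hδ⟩ := hsur (Pi.single v0 (-(r u v0)⁻¹ • e))
    refine ⟨δ.1, ?_⟩
    have hz' := congrArg (fun L => L δ) hz
    simp only [ContinuousLinearMap.sub_apply, ContinuousLinearMap.sum_apply,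
      ContinuousLinearMap.add_apply, ContinuousLinearMap.smul_apply,
      ContinuousLinearMap.comp_apply, ContinuousLinearMap.smulRight_apply,
      ContinuousLinearMap.proj_apply, ContinuousLinearMap.coe_fst',
      ContinuousLinearMap.zero_apply, hδ, hpΘ, Finset.sum_add_distrib] at hz' ⊢
    have h3 : ∑ v, r p.1 v • (Pi.single v0 (-(r u v0)⁻¹ • e) : ι → E) v = -e := by
      rw [Finset.sum_eq_single v0]
      · simp [hp, smul_smul, hv0]
      · intro v _ hv; simp [hv]
      · simp
    rw [h3] at hz'
    rw [add_sub_assoc, neg_add_eq_zero] at hz'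
    exact hz'.symm

theorem gp_avoid {r : U → ι → ℝ} {α : U → E} (hr : Differentiable ℝ r)
    (hα : Differentiable ℝ α) (hd : Module.finrank ℝ U < Module.finrank ℝ E) :
    Thin {Θ : ι → E | ∃ u, r u ≠ 0 ∧ ∑ v, r u v • Θ v = α u} := by
  refine (gp_regular hr hα hd.le).mono ?_
  rintro Θ ⟨u, hu, he⟩
  refine ⟨u, hu, he, fun hs => ?_⟩
  have := LinearMap.finrank_le_finrank_of_surjective
    (f := (fderiv ℝ (fun u => ∑ v, r u v • Θ v - α u) u : U →ₗ[ℝ] E)) hs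
  omega

/-- General position, two equations in triangular form, no solutions. -/
theorem gp_avoid₂ {r s : U → ι → ℝ} {α β : U → E} (hr : Differentiable ℝ r)
    (hs : Differentiable ℝ s)
    (hα : Differentiable ℝ α) (hβ : Differentiable ℝ β)
    (hd : Module.finrank ℝ U < 2 * Module.finrank ℝ E) :
    Thin {Θ : ι → E | ∃ u, (∃ v, r u v ≠ 0 ∧ s u v = 0) ∧ s u ≠ 0 ∧ ∑ v, r u v • Θ v = α u ∧
      ∑ v, s u v • Θ v = β u} := by
  have hr' : ∀ v, Differentiable ℝ (fun u => r u v) := fun v => differentiable_pi.1 hr v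
  have hs' : ∀ v, Differentiable ℝ (fun u => s u v) := fun v => differentiable_pi.1 hs v
  -- solve first for `v0` using `r`, with remaining coordinates solved for `v1` using `s`
  let A : (v0 : ι) → U → {v : ι // v ≠ v0} → ℝ := fun v0 u v => s u v
  have hA : ∀ v0, Differentiable ℝ (A v0) := fun v0 => differentiable_pi.2 (fun v => hs' v)
  let Φ : (v0 : ι) → (v1 : {v : ι // v ≠ v0}) →
      U × ({v : {v : ι // v ≠ v0} // v ≠ v1} → E) → ι → E :=
    fun v0 v1 p => solveAt r α v0 (p.1, solveAt (A v0) β v1 p)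
  refine Thin.mono (t := ⋃ v0 : ι, ⋃ v1 : {v : ι // v ≠ v0},
    Φ v0 v1 '' {p | r p.1 v0 ≠ 0 ∧ s p.1 v1 ≠ 0}) ?_ ?_
  · refine Thin.iUnion (fun v0 => Thin.iUnion (fun v1 => ?_))
    refine thin_image_lt ?_ ?_
    · rw [Module.finrank_prod, ← finrank_solve v0, ← finrank_solve v1]; omega
    · rintro p ⟨h1, h2⟩
      refine DifferentiableAt.differentiableWithinAt ?_
      have d1 := differentiableAt_solveAt (hA v0) hβ v1 p h2
      exact (differentiableAt_solveAt hr hα v0 (p.1, solveAt (A v0) β v1 p) h1).comp p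
        (differentiableAt_fst.prodMk d1)
  · rintro Θ ⟨u, ⟨v0, hv0, hv0'⟩, hu, he, he'⟩
    obtain ⟨v1, hv1⟩ : ∃ v1, s u v1 ≠ 0 := by
      by_contra hcon; push Not at hcon; exact hu (funext hcon)
    have hne : v1 ≠ v0 := by rintro rfl; exact hv1 hv0'
    refine mem_iUnion.2 ⟨v0, mem_iUnion.2 ⟨⟨v1, hne⟩, (u, fun w => Θ w), ⟨hv0, hv1⟩, ?_⟩⟩
    have e2 : solveAt (A v0) β ⟨v1, hne⟩ (u, fun w => Θ w) = fun w : {v : ι // v ≠ v0} => Θ w := by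
      refine solveAt_of_sol (A v0) β ⟨v1, hne⟩ u (fun w : {v : ι // v ≠ v0} => Θ w) hv1 ?_
      rw [Fintype.sum_eq_add_sum_subtype_ne (fun v => s u v • Θ v) v0, hv0', zero_smul,
        zero_add] at he'
      exact he'
    change solveAt r α v0 (u, solveAt (A v0) β ⟨v1, hne⟩ (u, fun w => Θ w)) = Θ
    rw [e2]
    exact solveAt_of_sol r α v0 u Θ hv0 he

end GP
end VK

open Set
noncomputable section
namespace VK
set_option linter.unusedVariables false
set_option linter.unusedSectionVars false
set_option linter.deprecated false
open Topology Filter MeasureTheory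

section NL
variable {X : Type*} [NormedAddCommGroup X] [NormedSpace ℝ X] [FiniteDimensional ℝ X]

theorem smul_sub_injective {L : ℝ} {s : ℝ} (hs : L < s) {k : X → X}
    (hk : ∀ x y, ‖k x - k y‖ ≤ L * ‖x - y‖) {x y : X} (h : s • x - k x = s • y - k y) : x = y := by
  have h1 : s • (x - y) = k x - k y := by
    rw [smul_sub]; rw [sub_eq_sub_iff_add_eq_add] at h ⊢
    rw [h, add_comm]
  have h2 := hk x y
  rw [← h1, norm_smul] at h2
  have h3 : s * ‖x - y‖ ≤ L * ‖x - y‖ := le_trans (mul_le_mul_of_nonneg_right (le_abs_self s)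
    (norm_nonneg _)) h2
  by_contra hne
  have : 0 < ‖x - y‖ := norm_pos_iff.2 (sub_ne_zero.2 hne)
  nlinarith

theorem smul_sub_surjective {L : ℝ} (hL : 0 ≤ L) {s : ℝ} (hs : L < s) {k : X → X}
    (hk : ∀ x y, ‖k x - k y‖ ≤ L * ‖x - y‖) (y : X) : ∃ x, s • x - k x = y := by
  have hs0 : 0 < s := lt_of_le_of_lt hL hs
  have : CompleteSpace X := FiniteDimensional.complete ℝ X
  have hc : ContractingWith (Real.toNNReal (L / s)) (fun x => s⁻¹ • (y + k x)) := by
    constructor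
    · rw [← NNReal.coe_lt_coe, Real.coe_toNNReal _ (by positivity), NNReal.coe_one]
      rw [div_lt_one hs0]; exact hs
    · refine LipschitzWith.of_dist_le_mul (fun a b => ?_)
      rw [dist_eq_norm, dist_eq_norm, ← smul_sub, norm_smul, add_sub_add_left_eq_sub]
      rw [Real.coe_toNNReal _ (by positivity)]
      simp only [norm_inv, Real.norm_eq_abs, abs_of_pos hs0]
      rw [div_mul_eq_mul_div, inv_mul_eq_div]
      gcongr
      exact hk a b
  refine ⟨ContractingWith.fixedPoint _ hc, ?_⟩
  have := hc.fixedPoint_isFixedPt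
  have h2 : s • ContractingWith.fixedPoint _ hc = y + k (ContractingWith.fixedPoint _ hc) := by
    conv_lhs => rw [← this.eq]
    rw [smul_smul, mul_inv_cancel₀ hs0.ne', one_smul]
  rw [h2, add_sub_cancel_right]

theorem det_smul_sub_pos {L : ℝ} {s : ℝ} (hL : 0 ≤ L) (hs : L < s) (A : X →L[ℝ] X) (hA : ‖A‖ ≤ L) :
    0 < (s • ContinuousLinearMap.id ℝ X - A).det := by
  have hs0 : 0 < s := lt_of_le_of_lt hL hs
  have hne : ∀ t ∈ Icc (0:ℝ) 1, (s • ContinuousLinearMap.id ℝ X - t • A).det ≠ 0 := by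
    intro t ht h0
    have hker : LinearMap.ker ((s • ContinuousLinearMap.id ℝ X - t • A : X →L[ℝ] X) : X →ₗ[ℝ] X) ≠ ⊥ := by
      intro hb
      have := LinearMap.isUnit_iff_ker_eq_bot _ |>.2 hb
      rw [LinearMap.isUnit_iff_isUnit_det] at this
      exact this.ne_zero h0
    obtain ⟨x, hx, hx0⟩ := Submodule.exists_mem_ne_zero_of_ne_bot hker
    have hx' : s • x = t • A x := by
      have : s • x - t • A x = 0 := hx
      exact sub_eq_zero.1 this
    have h1 : s * ‖x‖ ≤ L * ‖x‖ := by
      have := congrArg norm hx'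
      rw [norm_smul, norm_smul, Real.norm_eq_abs, abs_of_pos hs0, Real.norm_eq_abs,
        abs_of_nonneg ht.1] at this
      rw [this]
      have h2 : ‖A x‖ ≤ L * ‖x‖ := (A.le_opNorm x).trans (mul_le_mul_of_nonneg_right hA (norm_nonneg _))
      calc t * ‖A x‖ ≤ 1 * ‖A x‖ := mul_le_mul_of_nonneg_right ht.2 (norm_nonneg _)
        _ ≤ _ := by rw [one_mul]; exact h2
    have : 0 < ‖x‖ := norm_pos_iff.2 hx0
    nlinarith
  have hcont : Continuous (fun t : ℝ => (s • ContinuousLinearMap.id ℝ X - t • A).det) :=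
    ContinuousLinearMap.continuous_det.comp (by fun_prop)
  by_contra hneg
  push Not at hneg
  have h0 : 0 ≤ (s • ContinuousLinearMap.id ℝ X - (0:ℝ) • A).det := by
    rw [zero_smul, sub_zero, ContinuousLinearMap.det]
    simp only [ContinuousLinearMap.coe_smul, ContinuousLinearMap.coe_id, LinearMap.det_smul,
      LinearMap.det_id, mul_one]
    positivity
  obtain ⟨t, ht, h⟩ := intermediate_value_Icc' zero_le_one hcont.continuousOn
    (show (0:ℝ) ∈ Icc _ _ from ⟨by simpa using hneg, h0⟩)
  exact hne t ht h

variable [MeasurableSpace X] [BorelSpace X] (μ : Measure X) [μ.IsAddHaarMeasure]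

theorem integral_det_smul_sub {k : X → X} (hk : ContDiff ℝ 1 k) {L R : ℝ} (hL : 0 ≤ L)
    (hb : ∀ x, ‖fderiv ℝ k x‖ ≤ L) (hR : ∀ x, R ≤ ‖x‖ → k x = 0) {s : ℝ} (hs : L < s) :
    ∫ x in Metric.ball (0:X) R, (s • ContinuousLinearMap.id ℝ X - fderiv ℝ k x).det ∂μ =
      μ.real (Metric.ball (0:X) (s * R)) := by
  have hs0 : 0 < s := lt_of_le_of_lt hL hs
  have hlip : ∀ x y, ‖k x - k y‖ ≤ L * ‖x - y‖ := fun x y =>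
    Convex.norm_image_sub_le_of_norm_fderiv_le (s := univ)
      (fun x _ => (hk.differentiable (by norm_num)) x) (fun x _ => hb x) convex_univ trivial trivial
  set T : X → X := fun x => s • x - k x with hT
  have hTd : ∀ x, HasFDerivAt T (s • ContinuousLinearMap.id ℝ X - fderiv ℝ k x) x := fun x =>
    ((hasFDerivAt_id x).const_smul s).sub ((hk.differentiable (by norm_num)) x).hasFDerivAt
  have hinj : Function.Injective T := fun x y h => smul_sub_injective hs hlip h
  have himg : T '' Metric.ball 0 R = Metric.ball 0 (s * R) := by
    have hout : ∀ x, R ≤ ‖x‖ → T x = s • x := fun x hx => by simp [hT, hR x hx]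
    ext y
    simp only [mem_image, Metric.mem_ball, dist_zero_right]
    constructor
    · rintro ⟨x, hx, rfl⟩
      by_contra hcon
      push Not at hcon
      have h2 : R ≤ ‖s⁻¹ • T x‖ := by
        rw [norm_smul, norm_inv, Real.norm_eq_abs, abs_of_pos hs0, inv_mul_eq_div, le_div_iff₀ hs0]
        linarith
      have h1 : T (s⁻¹ • T x) = T x := by
        rw [hout _ h2, smul_smul, mul_inv_cancel₀ hs0.ne', one_smul]
      rw [hinj h1] at h2
      linarith
    · intro hy
      obtain ⟨x, hx⟩ := smul_sub_surjective hL hs hlip y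
      refine ⟨x, ?_, hx⟩
      by_contra hcon
      push Not at hcon
      have h1 : s • x = y := by rw [← hout x hcon]; exact hx
      rw [← h1, norm_smul, Real.norm_eq_abs, abs_of_pos hs0] at hy
      nlinarith
  have hcv := integral_image_eq_integral_abs_det_fderiv_smul μ
    (Metric.isOpen_ball (x := (0:X)) (ε := R)).measurableSet
    (fun x _ => (hTd x).hasFDerivWithinAt) hinj.injOn (fun _ => (1:ℝ))
  rw [himg] at hcv
  have : ∫ x in Metric.ball (0:X) (s * R), (1:ℝ) ∂μ = μ.real (Metric.ball (0:X) (s * R)) := by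
    simp
  rw [← this, hcv]
  refine integral_congr_ae (Eventually.of_forall (fun x => ?_))
  simp only [smul_eq_mul, mul_one]
  rw [abs_of_pos (det_smul_sub_pos hL hs _ (hb x))]

theorem integral_det_compact {k0 k1 : X → X} (h0 : ContDiff ℝ 1 k0) (h1 : ContDiff ℝ 1 k1)
    (c0 : HasCompactSupport k0) (c1 : HasCompactSupport k1) :
    ∃ R0 : ℝ, ∀ R, R0 ≤ R → ∫ x in Metric.ball (0:X) R, ((fderiv ℝ k1 x).det - (fderiv ℝ k0 x).det) ∂μ = 0 := by
  have cont0 : Continuous (fderiv ℝ k0) := h0.continuous_fderiv (by norm_num)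
  have cont1 : Continuous (fderiv ℝ k1) := h1.continuous_fderiv (by norm_num)
  obtain ⟨L0, hL0⟩ := (c0.fderiv ℝ).exists_bound_of_continuous cont0
  obtain ⟨L1, hL1⟩ := (c1.fderiv ℝ).exists_bound_of_continuous cont1
  obtain ⟨R0, hR0⟩ := c0.isCompact.isBounded.subset_ball (0:X)
  obtain ⟨R1, hR1⟩ := c1.isCompact.isBounded.subset_ball (0:X)
  set L := max (max L0 L1) 0
  refine ⟨max R0 R1, fun R hR => ?_⟩
  have z0 : ∀ x, R ≤ ‖x‖ → -k0 x = 0 := fun x hx => by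
    rw [neg_eq_zero]
    refine image_eq_zero_of_notMem_tsupport (f := k0) ?_
    intro hx'
    have := hR0 hx'
    rw [Metric.mem_ball, dist_zero_right] at this
    linarith [le_max_left R0 R1]
  have z1 : ∀ x, R ≤ ‖x‖ → -k1 x = 0 := fun x hx => by
    rw [neg_eq_zero]
    refine image_eq_zero_of_notMem_tsupport (f := k1) ?_
    intro hx'
    have := hR1 hx'
    rw [Metric.mem_ball, dist_zero_right] at this
    linarith [le_max_right R0 R1]
  have fn : ∀ (k : X → X) x, fderiv ℝ (fun x => -k x) x = - fderiv ℝ k x := fun k x => fderiv_fun_neg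
  -- nodes
  set N := Module.finrank ℝ X
  let v : ℕ → ℝ := fun i => L + 1 + i
  have hv : Set.InjOn v (Finset.range (N + 1)) := by
    intro a _ b _ hab
    simpa [v] using hab
  have hvL : ∀ i, L < v i := fun i => by
    simp only [v]
    have : (0:ℝ) ≤ i := Nat.cast_nonneg i
    linarith
  have key : ∀ A : X →L[ℝ] X, A.det = ∑ i ∈ Finset.range (N + 1),
      (v i • ContinuousLinearMap.id ℝ X + A).det *
        (Lagrange.basis (Finset.range (N+1)) v i).eval 0 := by
    intro A
    set P := (-(A : X →ₗ[ℝ] X)).charpoly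
    have hdeg : P.degree < (Finset.range (N+1)).card := by
      rw [Finset.card_range, Polynomial.degree_eq_natDegree (LinearMap.charpoly_monic _).ne_zero,
        LinearMap.charpoly_natDegree]
      exact_mod_cast Nat.lt_succ_self _
    have hev : ∀ t : ℝ, P.eval t = (t • ContinuousLinearMap.id ℝ X + A).det := by
      intro t
      rw [LinearMap.eval_charpoly, ContinuousLinearMap.det]
      congr 1
      ext x
      simp [Algebra.algebraMap_eq_smul_one]
    have h := congrArg (Polynomial.eval 0) (Lagrange.eq_interpolate hv hdeg)
    rw [hev 0, zero_smul, zero_add, Lagrange.interpolate_apply, Polynomial.eval_finset_sum] at h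
    rw [h]
    refine Finset.sum_congr rfl (fun i _ => ?_)
    rw [Polynomial.eval_mul, Polynomial.eval_C, hev]
  have hintg : ∀ (k : X → X), Continuous (fderiv ℝ k) → ∀ s : ℝ,
      IntegrableOn (fun x => (s • ContinuousLinearMap.id ℝ X + fderiv ℝ k x).det)
        (Metric.ball (0:X) R) μ := by
    intro k hk s
    have hc : Continuous (fun x => (s • ContinuousLinearMap.id ℝ X + fderiv ℝ k x).det) :=
      ContinuousLinearMap.continuous_det.comp (by fun_prop)
    have : ProperSpace X := FiniteDimensional.proper ℝ X
    exact (hc.continuousOn.integrableOn_compact (isCompact_closedBall 0 R)).mono_set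
      Metric.ball_subset_closedBall
  have hval : ∀ (k : X → X), ContDiff ℝ 1 k → (∀ x, ‖fderiv ℝ k x‖ ≤ L) → (∀ x, R ≤ ‖x‖ → -k x = 0) →
      ∀ i, ∫ x in Metric.ball (0:X) R, (v i • ContinuousLinearMap.id ℝ X + fderiv ℝ k x).det ∂μ =
        μ.real (Metric.ball (0:X) (v i * R)) := by
    intro k hk hkL hkR i
    have := integral_det_smul_sub μ (k := fun x => -k x) hk.neg (L := L) (le_max_right _ _)
      (fun x => by rw [fn, norm_neg]; exact hkL x) hkR (hvL i)
    rw [← this]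
    refine integral_congr_ae (Eventually.of_forall (fun x => ?_))
    simp only [fn, sub_neg_eq_add]
  have hsum : ∀ (k : X → X), ContDiff ℝ 1 k → (∀ x, ‖fderiv ℝ k x‖ ≤ L) → (∀ x, R ≤ ‖x‖ → -k x = 0) →
      ∫ x in Metric.ball (0:X) R, (fderiv ℝ k x).det ∂μ = ∑ i ∈ Finset.range (N + 1),
        μ.real (Metric.ball (0:X) (v i * R)) * (Lagrange.basis (Finset.range (N+1)) v i).eval 0 := by
    intro k hk hkL hkR
    have hkc : Continuous (fderiv ℝ k) := hk.continuous_fderiv (by norm_num)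
    simp_rw [fun x => key (fderiv ℝ k x)]
    rw [integral_finset_sum _ (fun i _ => (hintg k hkc (v i)).mul_const _)]
    refine Finset.sum_congr rfl (fun i _ => ?_)
    rw [integral_mul_const, hval k hk hkL hkR]
  have hi : ∀ (k : X → X), Continuous (fderiv ℝ k) → 
      IntegrableOn (fun x => (fderiv ℝ k x).det) (Metric.ball (0:X) R) μ := by
    intro k hk
    simpa using hintg k hk 0
  rw [integral_sub (hi _ cont1) (hi _ cont0),
    hsum k1 h1 (fun x => (hL1 x).trans ((le_max_right _ _).trans (le_max_left _ _))) z1,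
    hsum k0 h0 (fun x => (hL0 x).trans ((le_max_left _ _).trans (le_max_left _ _))) z0, sub_self]
end NL
end VK

open Set
noncomputable section
namespace VK
set_option linter.unusedVariables false
set_option linter.unusedSectionVars false
set_option linter.deprecated false
open Topology Filter MeasureTheory

section NL2
variable {X : Type*} [NormedAddCommGroup X] [NormedSpace ℝ X] [FiniteDimensional ℝ X]

theorem det_conj_clm {Y : Type*} [NormedAddCommGroup Y] [NormedSpace ℝ Y] (e : X ≃L[ℝ] Y)
    (A : Y →L[ℝ] Y) : ((e.symm : Y →L[ℝ] X).comp (A.comp (e : X →L[ℝ] Y))).det = A.det := by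
  have := LinearMap.det_conj (A : Y →ₗ[ℝ] Y) e.symm.toLinearEquiv
  exact this

theorem det_comp_clm (A B : X →L[ℝ] X) : (A.comp B).det = A.det * B.det := by
  exact LinearMap.det_comp (A : X →ₗ[ℝ] X) (B : X →ₗ[ℝ] X)

/-- a `C¹` map whose Jacobian is a bump function near zero -/
theorem exists_bump_map {ε : ℝ} (hε : 0 < ε) : ∃ Ψ : X → X, ContDiff ℝ 1 Ψ ∧
    (∀ y, 0 ≤ (fderiv ℝ Ψ y).det) ∧ 0 < (fderiv ℝ Ψ 0).det ∧
    ∀ y, ε ≤ ‖y‖ → (fderiv ℝ Ψ y).det = 0 := by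
  let b := Module.finBasis ℝ X
  let e : X ≃L[ℝ] (Fin (Module.finrank ℝ X) → ℝ) := b.equivFun.toContinuousLinearEquiv
  obtain ⟨C, hC, hCe⟩ : ∃ C : ℝ, 0 < C ∧ ∀ y, ‖y‖ ≤ C * ‖e y‖ := by
    refine ⟨‖(e.symm : (Fin (Module.finrank ℝ X) → ℝ) →L[ℝ] X)‖ + 1, by positivity, fun y => ?_⟩
    have h := (e.symm : (Fin (Module.finrank ℝ X) → ℝ) →L[ℝ] X).le_opNorm (e y)
    simp only [ContinuousLinearEquiv.coe_coe, ContinuousLinearEquiv.symm_apply_apply] at h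
    nlinarith [norm_nonneg (e y)]
  set δ := ε / C with hδ
  have hδ0 : 0 < δ := by positivity
  let ρ : ℝ → ℝ := fun t => max 0 (1 - |t| / δ)
  have hρ : Continuous ρ := by fun_prop
  let R : ℝ → ℝ := fun t => ∫ s in (0:ℝ)..t, ρ s
  have hR : ∀ t, HasDerivAt R (ρ t) t := fun t =>
    intervalIntegral.integral_hasDerivAt_right (hρ.intervalIntegrable _ _)
      (hρ.stronglyMeasurableAtFilter _ _) hρ.continuousAt
  have hR1 : ContDiff ℝ 1 R := by
    rw [contDiff_one_iff_deriv]
    refine ⟨fun t => (hR t).differentiableAt, ?_⟩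
    have : deriv R = ρ := funext fun t => (hR t).deriv
    rw [this]; exact hρ
  let Ψ0 : (Fin (Module.finrank ℝ X) → ℝ) → (Fin (Module.finrank ℝ X) → ℝ) := fun y i => R (y i)
  have hΨ0 : ContDiff ℝ 1 Ψ0 := contDiff_pi.2 fun i => hR1.comp (contDiff_apply ℝ ℝ i)
  have hdet0 : ∀ y, (fderiv ℝ Ψ0 y).det = ∏ i, ρ (y i) := by
    intro y
    have h1 : HasFDerivAt Ψ0 (ContinuousLinearMap.pi fun i =>
        (ρ (y i)) • ContinuousLinearMap.proj (R := ℝ) (φ := fun _ => ℝ) i) y := by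
      rw [hasFDerivAt_pi]
      intro i
      have h2 : HasFDerivAt (fun y : Fin (Module.finrank ℝ X) → ℝ => y i)
        (ContinuousLinearMap.proj (R := ℝ) (φ := fun _ => ℝ) i) y := hasFDerivAt_apply i y
      exact HasDerivAt.comp_hasFDerivAt y (hR (y i)) h2
    rw [h1.fderiv, ContinuousLinearMap.det, ← LinearMap.det_toMatrix']
    rw [← Matrix.det_diagonal]
    congr 1
    ext i j
    rw [LinearMap.toMatrix'_apply]
    by_cases hij : i = j
    · subst hij; simp
    · simp [Matrix.diagonal_apply_ne _ hij, Pi.single_apply, hij]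
  let Ψ : X → X := fun x => e.symm (Ψ0 (e x))
  have hΨ : ContDiff ℝ 1 Ψ := e.symm.contDiff.comp (hΨ0.comp e.contDiff)
  have hdet : ∀ y, (fderiv ℝ Ψ y).det = ∏ i, ρ (e y i) := by
    intro y
    have h1 : HasFDerivAt Ψ ((e.symm : (Fin (Module.finrank ℝ X) → ℝ) →L[ℝ] X).comp
        ((fderiv ℝ Ψ0 (e y)).comp (e : X →L[ℝ] (Fin (Module.finrank ℝ X) → ℝ)))) y :=
      e.symm.hasFDerivAt.comp y
        (((hΨ0.differentiable (by norm_num)) (e y)).hasFDerivAt.comp y e.hasFDerivAt)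
    rw [h1.fderiv, ← hdet0]
    exact det_conj_clm e _
  refine ⟨Ψ, hΨ, fun y => ?_, ?_, fun y hy => ?_⟩
  · rw [hdet]; exact Finset.prod_nonneg fun i _ => le_max_left _ _
  · rw [hdet]; simp [ρ]
  · rw [hdet]
    have h2 : δ ≤ ‖e y‖ := by
      rw [hδ, div_le_iff₀ hC]; linarith [hCe y]
    have : ∃ i, δ ≤ ‖e y i‖ := by
      by_contra hcon
      push Not at hcon
      have := (pi_norm_lt_iff hδ0).2 hcon
      linarith
    obtain ⟨i, hi⟩ := this
    refine Finset.prod_eq_zero (Finset.mem_univ i) (max_eq_left ?_)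
    rw [sub_nonpos, le_div_iff₀ hδ0, one_mul]
    exact hi

variable [MeasurableSpace X] [BorelSpace X] (μ : Measure X) [μ.IsAddHaarMeasure]

theorem integral_det_sub_eq_zero {k0 k1 : X → X} (h0 : ContDiff ℝ 1 k0) (h1 : ContDiff ℝ 1 k1)
    {S : Set X} (hS : IsCompact S) (heq : ∀ x, x ∉ S → k1 x = k0 x) :
    ∫ x, ((fderiv ℝ k1 x).det - (fderiv ℝ k0 x).det) ∂μ = 0 := by
  have : ProperSpace X := FiniteDimensional.proper ℝ X
  obtain ⟨r, hr⟩ := hS.isBounded.subset_closedBall (0:X)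
  set R := max r 0 + 1
  have hR : 0 < R := by positivity
  have hrR : max r 0 < R := lt_add_one _
  let χ : ContDiffBump (0:X) := ⟨R, R + 1, hR, by linarith⟩
  have hχ : ContDiff ℝ 1 χ := χ.contDiff
  have cs : ∀ k : X → X, HasCompactSupport (fun x => χ x • k x) := fun k => χ.hasCompactSupport.smul_right
  have hd : ∀ k : X → X, ∀ x, ‖x‖ < R → fderiv ℝ (fun x => χ x • k x) x = fderiv ℝ k x := by
    intro k x hx
    refine Filter.EventuallyEq.fderiv_eq ?_
    have : Metric.ball (0:X) R ∈ 𝓝 x := Metric.isOpen_ball.mem_nhds (by simpa using hx)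
    filter_upwards [this] with y hy
    rw [χ.one_of_mem_closedBall (Metric.ball_subset_closedBall hy), one_smul]
  have hout : ∀ j0 j1 : X → X, (∀ x, x ∉ S → j1 x = j0 x) → ∀ x, max r 0 < ‖x‖ →
      fderiv ℝ j1 x = fderiv ℝ j0 x := by
    intro j0 j1 hj x hx
    refine Filter.EventuallyEq.fderiv_eq ?_
    have : (Metric.closedBall (0:X) (max r 0))ᶜ ∈ 𝓝 x :=
      Metric.isClosed_closedBall.isOpen_compl.mem_nhds (by simpa using hx)
    filter_upwards [this] with y hy
    refine hj y (fun hyS => hy ?_)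
    have := hr hyS
    simp only [Metric.mem_closedBall, dist_zero_right] at this ⊢
    exact this.trans (le_max_left _ _)
  have hall : ∀ x, (fderiv ℝ k1 x).det - (fderiv ℝ k0 x).det =
      (fderiv ℝ (fun x => χ x • k1 x) x).det - (fderiv ℝ (fun x => χ x • k0 x) x).det := by
    intro x
    by_cases hx : ‖x‖ < R
    · rw [hd _ x hx, hd _ x hx]
    · have hx' : max r 0 < ‖x‖ := by linarith
      rw [hout k0 k1 heq x hx', hout (fun x => χ x • k0 x) (fun x => χ x • k1 x)
        (fun x hx => by simp only [heq x hx]) x hx', sub_self, sub_self]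
  obtain ⟨R0, hR0⟩ := integral_det_compact μ (k0 := fun x => χ x • k0 x) (k1 := fun x => χ x • k1 x)
    (hχ.smul h0) (hχ.smul h1) (cs k0) (cs k1)
  have := hR0 (max R0 R) (le_max_left _ _)
  rw [← this]
  simp_rw [hall]
  rw [setIntegral_eq_integral_of_forall_compl_eq_zero]
  intro x hx
  have hx' : max r 0 < ‖x‖ := by
    simp only [Metric.mem_ball, dist_zero_right, not_lt] at hx
    linarith [le_max_right R0 R]
  rw [hout (fun x => χ x • k0 x) (fun x => χ x • k1 x)
        (fun x hx => by simp only [heq x hx]) x hx', sub_self]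

theorem deg_aux {D : X → X} (hD : ContDiff ℝ 1 D) {B : Set X} (hB : IsCompact B) {G : X → X}
    (hG : ContinuousOn G B) (hG0 : ∀ x ∈ B, G x ≠ 0) (hfr : ∀ x ∈ frontier B, G x = D x) :
    ∃ c > 0, ∀ Ψ : X → X, ContDiff ℝ 1 Ψ → (∀ y, c ≤ ‖y‖ → (fderiv ℝ Ψ y).det = 0) →
      ∫ x in B, (fderiv ℝ Ψ (D x)).det * (fderiv ℝ D x).det ∂μ = 0 := by
  classical
  have : ProperSpace X := FiniteDimensional.proper ℝ X
  rcases B.eq_empty_or_nonempty with rfl | hBne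
  · exact ⟨1, one_pos, by simp⟩
  obtain ⟨c, hc, hGc⟩ : ∃ c > 0, ∀ x ∈ B, c ≤ ‖G x‖ := by
    obtain ⟨x0, hx0, hmin⟩ := hB.exists_isMinOn hBne hG.norm
    exact ⟨‖G x0‖, norm_pos_iff.2 (hG0 x0 hx0), fun x hx => hmin hx⟩
  let h : X → X := B.piecewise (fun x => G x - D x) (fun _ => 0)
  have hh : Continuous h := by
    refine continuous_piecewise ?_ ?_ continuousOn_const
    · intro x hx; rw [hfr x hx, sub_self]
    · rw [hB.isClosed.closure_eq]; exact hG.sub hD.continuous.continuousOn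
  have hhB : ∀ x ∈ B, h x = G x - D x := fun x hx => piecewise_eq_of_mem _ _ _ hx
  have hhc : ∀ x, x ∉ B → h x = 0 := fun x hx => piecewise_eq_of_notMem _ _ _ hx
  have hhs : HasCompactSupport h := HasCompactSupport.intro hB hhc
  have huc : UniformContinuous h := hhs.uniformContinuous_of_continuous hh
  have hcpt : IsCompact (Metric.cthickening 1 B) := hB.cthickening
  have hDuc := hcpt.uniformContinuousOn_of_continuous hD.continuous.continuousOn
  rw [Metric.uniformContinuous_iff] at huc
  rw [Metric.uniformContinuousOn_iff] at hDuc
  obtain ⟨r1, hr1, hr1'⟩ := huc (c/8) (by positivity)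
  obtain ⟨r2, hr2, hr2'⟩ := hDuc (c/8) (by positivity)
  set r := min 1 (min r1 r2) / 2 with hrdef
  have hm0 : 0 < min 1 (min r1 r2) := by positivity
  have hrm : r < min 1 (min r1 r2) := by rw [hrdef]; linarith
  have hr : 0 < r := by positivity
  obtain ⟨g, hg, hgd⟩ := hh.exists_contDiff_dist_le_of_forall_mem_ball_dist_le hr
  have hgh : ∀ a, ‖g a - h a‖ ≤ c / 8 := fun a => by
    rw [← dist_eq_norm]
    refine hgd a (c/8) (fun x hx => (hr1' ?_).le)
    exact lt_of_lt_of_le (lt_trans hx hrm) ((min_le_right _ _).trans (min_le_left _ _))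
  have hgz : ∀ a, (∀ b ∈ B, r ≤ dist b a) → g a = 0 := by
    intro a ha
    have haB : a ∉ B := fun hb => by have := ha a hb; rw [dist_self] at this; linarith
    have := hgd a 0 (fun x hx => by
      have hxB : x ∉ B := fun hb => by
        have := ha x hb
        rw [Metric.mem_ball] at hx; linarith
      rw [hhc x hxB, hhc a haB, dist_self])
    rw [hhc a haB] at this
    exact dist_le_zero.1 this
  let k1 : X → X := fun x => D x + g x
  have hk1 : ContDiff ℝ 1 k1 := hD.add (hg.of_le (by exact_mod_cast le_top))
  refine ⟨c/2, by positivity, fun Ψ hΨ hΨ0 => ?_⟩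
  have hin : ∀ a ∈ B, c/2 ≤ ‖k1 a‖ := by
    intro a ha
    have h1 : k1 a = G a + (g a - h a) := by simp only [k1, hhB a ha]; abel
    have h2 : ‖G a‖ - ‖g a - h a‖ ≤ ‖k1 a‖ := by
      rw [h1]
      have := norm_sub_norm_le (G a) (-(g a - h a))
      rw [norm_neg, sub_neg_eq_add] at this; exact this
    linarith [hgh a, hGc a ha]
  have hcol : ∀ a, a ∉ B → (∃ b ∈ B, dist b a ≤ r) → c/2 ≤ ‖D a‖ ∧ c/2 ≤ ‖k1 a‖ := by
    rintro a ha ⟨b, hb, hba⟩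
    have e1 : ‖h b‖ < c/8 := by
      have := hr1' (lt_of_lt_of_le (hba.trans_lt hrm) ((min_le_right _ _).trans (min_le_left _ _)))
      rwa [hhc a ha, dist_zero_right] at this
    have e2 : ‖D b - D a‖ < c/8 := by
      rw [← dist_eq_norm]
      refine hr2' b (Metric.self_subset_cthickening B hb) a ?_
        (lt_of_lt_of_le (hba.trans_lt hrm) ((min_le_right _ _).trans (min_le_right _ _)))
      refine Metric.mem_cthickening_of_dist_le a b 1 B hb ?_
      rw [dist_comm]; exact hba.trans (hrm.le.trans (min_le_left _ _))
    have e3 : c - c/8 ≤ ‖D b‖ := by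
      have : D b = G b - h b := by rw [hhB b hb]; abel
      rw [this]
      linarith [norm_sub_norm_le (G b) (h b), hGc b hb]
    have e4 : c - c/4 ≤ ‖D a‖ := by
      have := norm_sub_norm_le (D b) (D b - D a)
      rw [sub_sub_cancel] at this; linarith
    have e5 : ‖g a‖ ≤ c/8 := by have := hgh a; rwa [hhc a ha, sub_zero] at this
    have e6 : ‖D a‖ - ‖g a‖ ≤ ‖k1 a‖ := by
      have := norm_sub_norm_le (D a) (-(g a))
      rw [norm_neg, sub_neg_eq_add] at this; exact this
    constructor <;> linarith
  have hchain : ∀ k : X → X, ContDiff ℝ 1 k → ∀ x, (fderiv ℝ (fun x => Ψ (k x)) x).det =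
      (fderiv ℝ Ψ (k x)).det * (fderiv ℝ k x).det := by
    intro k hk x
    have : HasFDerivAt (fun x => Ψ (k x)) ((fderiv ℝ Ψ (k x)).comp (fderiv ℝ k x)) x :=
      ((hΨ.differentiable (by norm_num)) (k x)).hasFDerivAt.comp x
        ((hk.differentiable (by norm_num)) x).hasFDerivAt
    rw [this.fderiv, det_comp_clm]
  have hI := integral_det_sub_eq_zero μ (hΨ.comp hD) (hΨ.comp hk1) (hcpt) (k0 := fun x => Ψ (D x))
    (k1 := fun x => Ψ (k1 x)) (fun x hx => by
      have : g x = 0 := hgz x (fun b hb => by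
        by_contra hcon
        push Not at hcon
        refine hx (Metric.mem_cthickening_of_dist_le x b 1 B hb ?_)
        rw [dist_comm]; exact hcon.le.trans (hrm.le.trans (min_le_left _ _)))
      simp only [k1, this, add_zero])
  have hpt : ∀ x, (fderiv ℝ (fun x => Ψ (k1 x)) x).det - (fderiv ℝ (fun x => Ψ (D x)) x).det =
      B.indicator (fun x => -((fderiv ℝ Ψ (D x)).det * (fderiv ℝ D x).det)) x := by
    intro x
    rw [hchain k1 hk1, hchain D hD]
    by_cases hx : x ∈ B
    · rw [indicator_of_mem hx, hΨ0 _ (hin x hx)]; ring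
    · rw [indicator_of_notMem hx]
      by_cases hb : ∃ b ∈ B, dist b x ≤ r
      · rw [hΨ0 _ (hcol x hx hb).1, hΨ0 _ (hcol x hx hb).2]; ring
      · push Not at hb
        have : k1 =ᶠ[𝓝 x] D := by
          have hop : IsOpen {y : X | r < Metric.infDist y B} :=
            isOpen_lt continuous_const (Metric.continuous_infDist_pt B)
          have hxo : r < Metric.infDist x B := by
            obtain ⟨b, hb', hbe⟩ := hB.exists_infDist_eq_dist hBne x
            rw [hbe, dist_comm]; exact hb b hb'
          filter_upwards [hop.mem_nhds hxo] with y hy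
          have : g y = 0 := hgz y (fun b hb => by
            rw [dist_comm]; exact (le_of_lt hy).trans (Metric.infDist_le_dist_of_mem hb))
          simp only [k1, this, add_zero]
        rw [this.fderiv_eq, this.eq_of_nhds, sub_self]
  simp_rw [hpt] at hI
  rw [integral_indicator hB.measurableSet, integral_neg, neg_eq_zero] at hI
  exact hI
end NL2
end VK

open Set
noncomputable section
namespace VK
set_option linter.unusedVariables false
set_option linter.unusedSectionVars false
set_option linter.deprecated false
open Topology Filter MeasureTheory

/-- sign, as an integer `±1` -/
def sg (x : ℝ) : ℤ := if 0 < x then 1 else -1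

theorem sg_mul_abs (x : ℝ) : x = (sg x : ℝ) * |x| := by
  unfold sg
  split_ifs with h
  · rw [abs_of_pos h]; simp
  · rw [abs_of_nonpos (not_lt.1 h)]; simp

section DEG
variable {X : Type*} [NormedAddCommGroup X] [NormedSpace ℝ X] [FiniteDimensional ℝ X]

theorem local_inj {Y : Type*} [NormedAddCommGroup Y] [NormedSpace ℝ Y] {D : X → Y} {z : X}
    {A : X ≃L[ℝ] Y} (hD : HasStrictFDerivAt D (A : X →L[ℝ] Y) z) {W : Set X} (hW : W ∈ 𝓝 z) :
    ∃ U, IsOpen U ∧ z ∈ U ∧ U ⊆ W ∧ InjOn D U ∧ D '' U ∈ 𝓝 (D z) := by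
  have : CompleteSpace X := FiniteDimensional.complete ℝ X
  set e := hD.toOpenPartialHomeomorph D
  have hs : e.source ∈ 𝓝 z := e.open_source.mem_nhds hD.mem_toOpenPartialHomeomorph_source
  obtain ⟨U, hUW, hU, hzU⟩ := mem_nhds_iff.1 (Filter.inter_mem hs hW)
  refine ⟨U, hU, hzU, fun x hx => (hUW hx).2, ?_, ?_⟩
  · have := e.injOn.mono (fun x hx => (hUW hx).1)
    exact this
  · rw [← hD.map_nhds_eq_of_equiv]
    exact Filter.image_mem_map (hU.mem_nhds hzU)

theorem equiv_of_det {A : X →L[ℝ] X} (h : A.det ≠ 0) : ∃ e : X ≃L[ℝ] X, (e : X →L[ℝ] X) = A :=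
  ⟨A.toContinuousLinearEquivOfDetNeZero h, A.coe_toContinuousLinearEquivOfDetNeZero h⟩

theorem zeros_finite {D : X → X} (hD : ContDiff ℝ 1 D) {B : Set X} (hB : IsCompact B)
    (hreg : ∀ x ∈ B, D x = 0 → (fderiv ℝ D x).det ≠ 0) : {x ∈ B | D x = 0}.Finite := by
  have hcl : IsCompact {x ∈ B | D x = 0} :=
    hB.inter_right (isClosed_eq hD.continuous continuous_const)
  refine hcl.finite (isDiscrete_iff_discreteTopology.2 ?_)
  rw [discreteTopology_subtype_iff']
  rintro z ⟨hzB, hz⟩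
  obtain ⟨e, he⟩ := equiv_of_det (hreg z hzB hz)
  have hst : HasStrictFDerivAt D (e : X →L[ℝ] X) z := by
    rw [he]; exact hD.contDiffAt.hasStrictFDerivAt (by norm_num)
  obtain ⟨U, hU, hzU, -, hinj, -⟩ := local_inj hst univ_mem
  refine ⟨U, hU, ?_⟩
  ext x
  simp only [mem_inter_iff, mem_setOf_eq, mem_singleton_iff]
  constructor
  · rintro ⟨h1, h2, h3⟩
    exact hinj h1 hzU (h3.trans hz.symm)
  · rintro rfl; exact ⟨hzU, hzB, hz⟩

variable [MeasurableSpace X] [BorelSpace X]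

theorem deg_zero {D : X → X} (hD : ContDiff ℝ 1 D) {B : Set X} (hB : IsCompact B) {G : X → X}
    (hG : ContinuousOn G B) (hG0 : ∀ x ∈ B, G x ≠ 0) (hfr : ∀ x ∈ frontier B, G x = D x)
    (Z : Finset X) (hZ : ∀ x, x ∈ Z ↔ x ∈ B ∧ D x = 0)
    (hreg : ∀ z ∈ Z, (fderiv ℝ D z).det ≠ 0) :
    ∑ z ∈ Z, sg (fderiv ℝ D z).det = 0 := by
  classical
  have : ProperSpace X := FiniteDimensional.proper ℝ X
  let μ : Measure X := Measure.addHaar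
  obtain ⟨c, hc, hcΨ⟩ := deg_aux μ hD hB hG hG0 hfr
  have hDc : Continuous D := hD.continuous
  have hDd : Continuous (fun x => (fderiv ℝ D x).det) :=
    ContinuousLinearMap.continuous_det.comp (hD.continuous_fderiv (by norm_num))
  obtain ⟨V, hV, hVd⟩ := Z.finite_toSet.t2_separation
  have hintg : ∀ z ∈ Z, z ∈ interior B := by
    intro z hz
    have hzB := ((hZ z).1 hz).1
    by_contra hcon
    have hfz : z ∈ frontier B := ⟨subset_closure hzB, hcon⟩
    have := hfr z hfz
    exact hG0 z hzB (this.trans ((hZ z).1 hz).2)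
  have hsg : ∀ z ∈ Z, {x | sg (fderiv ℝ D x).det = sg (fderiv ℝ D z).det} ∈ 𝓝 z := by
    intro z hz
    rcases lt_or_gt_of_ne (hreg z hz) with h | h
    · filter_upwards [hDd.continuousAt.eventually_lt continuousAt_const h] with x hx
      simp [sg, not_lt.2 hx.le, not_lt.2 h.le]
    · filter_upwards [(continuousAt_const (y := (0:ℝ))).eventually_lt hDd.continuousAt h] with x hx
      simp [sg, hx, h]
  have hloc : ∀ z : X, ∃ U : Set X, z ∈ Z → (IsOpen U ∧ z ∈ U ∧ U ⊆ V z ∩ interior B ∧ InjOn D U ∧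
      D '' U ∈ 𝓝 (0:X) ∧ ∀ x ∈ U, sg (fderiv ℝ D x).det = sg (fderiv ℝ D z).det) := by
    intro z
    by_cases hz : z ∈ Z
    · obtain ⟨e, he⟩ := equiv_of_det (hreg z hz)
      have hst : HasStrictFDerivAt D (e : X →L[ℝ] X) z := by
        rw [he]; exact hD.contDiffAt.hasStrictFDerivAt (by norm_num)
      obtain ⟨U, hU, hzU, hUW, hinj, himg⟩ := local_inj hst (Filter.inter_mem (Filter.inter_mem
        ((hV z).2.mem_nhds (hV z).1) (isOpen_interior.mem_nhds (hintg z hz))) (hsg z hz))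
      rw [((hZ z).1 hz).2] at himg
      exact ⟨U, fun _ => ⟨hU, hzU, fun x hx => (hUW hx).1, hinj, himg, fun x hx => (hUW hx).2⟩⟩
    · exact ⟨∅, fun h => absurd h hz⟩
  choose U hU using hloc
  -- lower bound off the neighbourhoods
  obtain ⟨c', hc', hDc'⟩ : ∃ c' > 0, ∀ x ∈ B, x ∉ (⋃ z ∈ Z, U z) → c' ≤ ‖D x‖ := by
    have hcp : IsCompact (B \ ⋃ z ∈ Z, U z) :=
      hB.diff (isOpen_biUnion fun z hz => (hU z hz).1)
    rcases (B \ ⋃ z ∈ Z, U z).eq_empty_or_nonempty with he | hne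
    · refine ⟨1, one_pos, fun x hx hx' => ?_⟩
      have : x ∈ B \ ⋃ z ∈ Z, U z := ⟨hx, hx'⟩
      rw [he] at this; exact absurd this (notMem_empty _)
    · obtain ⟨x0, hx0, hmin⟩ := hcp.exists_isMinOn hne hDc.norm.continuousOn
      refine ⟨‖D x0‖, norm_pos_iff.2 (fun h0 => hx0.2 ?_), fun x hx hx' => hmin ⟨hx, hx'⟩⟩
      have hz : x0 ∈ Z := (hZ x0).2 ⟨hx0.1, h0⟩
      exact mem_biUnion hz (hU x0 hz).2.1
  obtain ⟨ε, hε, hεc, hεc', hεU⟩ : ∃ ε > 0, ε ≤ c ∧ ε ≤ c' ∧ ∀ z ∈ Z, Metric.ball (0:X) ε ⊆ D '' U z := by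
    have : (⋂ z ∈ Z, D '' U z) ∈ 𝓝 (0:X) := (Filter.biInter_finset_mem Z).2 fun z hz => (hU z hz).2.2.2.2.1
    obtain ⟨ε0, h0, h0'⟩ := Metric.mem_nhds_iff.1 this
    refine ⟨min ε0 (min c c'), by positivity, (min_le_right _ _).trans (min_le_left _ _),
      (min_le_right _ _).trans (min_le_right _ _), fun z hz => ?_⟩
    refine (Metric.ball_subset_ball (min_le_left _ _)).trans (h0'.trans ?_)
    exact biInter_subset_of_mem hz
  obtain ⟨Ψ, hΨ, hΨ0, hΨ1, hΨ2⟩ := exists_bump_map (X := X) hε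
  have hI := hcΨ Ψ hΨ (fun y hy => hΨ2 y (hεc.trans hy))
  set φ : X → ℝ := fun y => (fderiv ℝ Ψ y).det
  have hφc : Continuous φ := ContinuousLinearMap.continuous_det.comp (hΨ.continuous_fderiv (by norm_num))
  have hφpos : 0 < ∫ y, φ y ∂μ := by
    refine hφc.integral_pos_of_hasCompactSupport_nonneg_nonzero ?_ hΨ0 (x := 0) hΨ1.ne'
    refine HasCompactSupport.intro (isCompact_closedBall (0:X) ε) (fun x hx => hΨ2 x ?_)
    simp only [Metric.mem_closedBall, dist_zero_right, not_le] at hx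
    exact hx.le
  have hsub : (⋃ z ∈ Z, U z) ⊆ B := iUnion₂_subset fun z hz =>
    ((hU z hz).2.2.1.trans inter_subset_right).trans interior_subset
  have hInt : IntegrableOn (fun x => φ (D x) * (fderiv ℝ D x).det) B μ :=
    ((hφc.comp hDc).mul hDd).continuousOn.integrableOn_compact hB
  rw [setIntegral_eq_of_subset_of_forall_diff_eq_zero hB.measurableSet hsub
    (fun x hx => by
      have : φ (D x) = 0 := hΨ2 _ (hεc'.trans (hDc' x hx.1 hx.2))
      simp only [φ] at this
      rw [this, zero_mul])] at hI
  rw [integral_biUnion_finset Z (fun z hz => (hU z hz).1.measurableSet)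
    (fun a ha b hb hab => (hVd ha hb hab).mono ((hU a ha).2.2.1.trans inter_subset_left)
      ((hU b hb).2.2.1.trans inter_subset_left))
    (fun z hz => hInt.mono_set (((hU z hz).2.2.1.trans inter_subset_right).trans interior_subset))] at hI
  have hone : ∀ z ∈ Z, ∫ x in U z, φ (D x) * (fderiv ℝ D x).det ∂μ =
      (sg (fderiv ℝ D z).det : ℝ) * ∫ y, φ y ∂μ := by
    intro z hz
    obtain ⟨h1, h2, h3, h4, h5, h6⟩ := hU z hz
    have hcv := integral_image_eq_integral_abs_det_fderiv_smul μ h1.measurableSet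
      (fun x _ => ((hD.differentiable (by norm_num)) x).hasFDerivAt.hasFDerivWithinAt) h4 φ
    rw [setIntegral_eq_integral_of_forall_compl_eq_zero] at hcv
    · rw [hcv, ← integral_const_mul]
      refine setIntegral_congr_fun h1.measurableSet (fun x hx => ?_)
      simp only [smul_eq_mul]
      rw [← h6 x hx]
      conv_lhs => rw [sg_mul_abs (fderiv ℝ D x).det]
      ring
    · intro y hy
      refine hΨ2 y ?_
      by_contra hcon
      push Not at hcon
      exact hy (hεU z hz (by simpa using hcon))
  rw [Finset.sum_congr rfl hone, ← Finset.sum_mul] at hI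
  rcases mul_eq_zero.1 hI with h | h
  · exact_mod_cast h
  · exact absurd h hφpos.ne'
end DEG
end VK

open Set
noncomputable section
namespace VK
set_option linter.unusedVariables false
set_option linter.unusedSectionVars false
set_option linter.deprecated false
set_option linter.unusedSimpArgs false
open Topology Filter MeasureTheory

section GLsec
variable {ι : Type*} [Fintype ι] [DecidableEq ι]

/-- connected through invertible matrices -/
def GJ (A B : Matrix ι ι ℝ) : Prop :=
  ∃ γ : ℝ → Matrix ι ι ℝ, Continuous γ ∧ γ 0 = A ∧ γ 1 = B ∧ ∀ t ∈ Icc (0:ℝ) 1, (γ t).det ≠ 0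

theorem GJ.mul {A B A' B' : Matrix ι ι ℝ} (h : GJ A A') (h' : GJ B B') : GJ (A * B) (A' * B') := by
  obtain ⟨γ, h1, h2, h3, h4⟩ := h
  obtain ⟨δ, k1, k2, k3, k4⟩ := h'
  refine ⟨fun t => γ t * δ t, h1.mul k1, by simp only [h2, k2], by simp only [h3, k3], fun t ht => ?_⟩
  rw [Matrix.det_mul]; exact mul_ne_zero (h4 t ht) (k4 t ht)

theorem GJ.trans {A B C : Matrix ι ι ℝ} (h : GJ A B) (h' : GJ B C) : GJ A C := by
  obtain ⟨γ, h1, h2, h3, h4⟩ := h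
  obtain ⟨δ, k1, k2, k3, k4⟩ := h'
  refine ⟨fun t => if t ≤ 1/2 then γ (2*t) else δ (2*t-1), ?_, ?_, ?_, ?_⟩
  · refine Continuous.if_le (by fun_prop) (by fun_prop) continuous_id continuous_const ?_
    intro t ht; subst ht; norm_num [h3, k2]
  · norm_num [h2]
  · norm_num [k3]
  · intro t ht
    dsimp only
    split_ifs with hh
    · exact h4 _ ⟨by linarith [ht.1], by linarith⟩
    · exact k4 _ ⟨by linarith, by linarith [ht.2]⟩

theorem GJ.transvection (i j : ι) (hij : i ≠ j) (c : ℝ) : GJ 1 (Matrix.transvection i j c) := by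
  refine ⟨fun t => Matrix.transvection i j (t * c), ?_, by simp, by simp, fun t _ => ?_⟩
  · unfold Matrix.transvection
    refine continuous_const.add ?_
    refine continuous_matrix fun a b => ?_
    simp only [Matrix.single_apply]
    split_ifs <;> fun_prop
  · rw [Matrix.det_transvection_of_ne _ _ hij]; norm_num

/-- reflection -/
def rf (i : ι) : Matrix ι ι ℝ := Matrix.diagonal (Function.update (fun _ => 1) i (-1))

theorem rf_mul_self (i : ι) : rf i * rf i = 1 := by
  unfold rf
  rw [Matrix.diagonal_mul_diagonal, ← Matrix.diagonal_one]
  congr 1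
  ext k
  by_cases h : k = i
  · subst h; simp
  · simp [h]

theorem rf_eq (i : ι) : rf i = 1 - (2:ℝ) • Matrix.single i i (1:ℝ) := by
  ext a b
  unfold rf
  by_cases hab : a = b
  · subst hab
    by_cases h : a = i
    · subst h; simp; norm_num
    · simp [h, Matrix.single_apply, Ne.symm h]
  · simp [hab, Matrix.single_apply]
    grind

theorem rf_mul_rf {i j : ι} (hij : i ≠ j) : rf i * rf j =
    (Matrix.transvection i j 1 * Matrix.transvection j i (-1) * Matrix.transvection i j 1) *
    (Matrix.transvection i j 1 * Matrix.transvection j i (-1) * Matrix.transvection i j 1) := by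
  have hw : Matrix.transvection i j (1:ℝ) * Matrix.transvection j i (-1) * Matrix.transvection i j 1 =
      1 + Matrix.single i j 1 - Matrix.single j i 1 - Matrix.single i i 1 - Matrix.single j j 1 := by
    have e : Matrix.single j i (-1:ℝ) = - Matrix.single j i 1 := by
      rw [← Matrix.single_neg]
    unfold Matrix.transvection
    rw [e]
    simp only [mul_add, add_mul, mul_one, one_mul, mul_neg, neg_mul, Matrix.single_mul_single_same,
      Matrix.single_mul_single_of_ne _ _ _ _ hij, Matrix.single_mul_single_of_ne _ _ _ _ hij.symm]
    abel
  rw [hw, rf_eq, rf_eq]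
  simp only [mul_add, add_mul, mul_sub, sub_mul, mul_one, one_mul, mul_neg, neg_mul, Matrix.single_mul_single_same,
      Matrix.single_mul_single_of_ne _ _ _ _ hij, Matrix.single_mul_single_of_ne _ _ _ _ hij.symm,
      Matrix.smul_mul, Matrix.mul_smul, two_smul]
  simp
  abel

theorem GJ.refl {A : Matrix ι ι ℝ} (h : A.det ≠ 0) : GJ A A :=
  ⟨fun _ => A, continuous_const, rfl, rfl, fun _ _ => h⟩

theorem GJ.rf_rf (i j : ι) : GJ 1 (rf i * rf j) := by
  by_cases hij : i = j
  · subst hij; rw [rf_mul_self]; exact GJ.refl (by simp)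
  · rw [rf_mul_rf hij]
    have h1 := GJ.transvection i j hij 1
    have h2 := GJ.transvection j i (Ne.symm hij) (-1)
    have := ((h1.mul h2).mul h1).mul ((h1.mul h2).mul h1)
    simpa using this

theorem det_rf (i : ι) : (rf i).det = -1 := by
  unfold rf
  rw [Matrix.det_diagonal, Finset.prod_update_of_mem (Finset.mem_univ i)]
  simp

theorem GJ.rf_to (i j : ι) : GJ (rf j) (rf i) := by
  have := (GJ.rf_rf i j).mul (GJ.refl (A := rf j) (by rw [det_rf]; norm_num))
  rwa [one_mul, mul_assoc, rf_mul_self, mul_one] at this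

theorem GJ.all (M : Matrix ι ι ℝ) (hM : M.det ≠ 0) : GJ 1 M ∨ ∃ i, GJ (rf i) M := by
  have hmul : ∀ A B : Matrix ι ι ℝ, (GJ 1 A ∨ ∃ i, GJ (rf i) A) → (GJ 1 B ∨ ∃ i, GJ (rf i) B) →
      (GJ 1 (A * B) ∨ ∃ i, GJ (rf i) (A * B)) := by
    rintro A B (hA | ⟨i, hA⟩) (hB | ⟨j, hB⟩)
    · left; simpa using hA.mul hB
    · right; exact ⟨j, by simpa using hA.mul hB⟩
    · right; exact ⟨i, by simpa using hA.mul hB⟩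
    · left; exact (GJ.rf_rf i j).trans (hA.mul hB)
  refine Matrix.diagonal_transvection_induction_of_det_ne_zero
    (fun M => GJ 1 M ∨ ∃ i, GJ (rf i) M) M hM ?_ ?_ (fun A B _ _ => hmul A B)
  · intro D hD
    rw [Matrix.det_diagonal, Finset.prod_ne_zero_iff] at hD
    have hs : ∀ s : Finset ι, GJ 1 (Matrix.diagonal (fun i => if i ∈ s then D i else 1)) ∨
        ∃ i, GJ (rf i) (Matrix.diagonal (fun i => if i ∈ s then D i else 1)) := by
      intro s
      induction s using Finset.induction_on with
      | empty => left; simpa using GJ.refl (A := (1 : Matrix ι ι ℝ)) (by simp)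
      | insert a s ha ih =>
        have : Matrix.diagonal (fun i => if i ∈ insert a s then D i else 1) =
            Matrix.diagonal (Function.update (fun _ => 1) a (D a)) *
              Matrix.diagonal (fun i => if i ∈ s then D i else 1) := by
          rw [Matrix.diagonal_mul_diagonal]
          congr 1
          ext k
          by_cases hk : k = a
          · subst hk; simp [ha]
          · simp [hk]
        rw [this]
        refine hmul _ _ ?_ ih
        have hcont : ∀ c : ℝ, Continuous (fun t : ℝ => Matrix.diagonal
            (Function.update (fun _ : ι => (1:ℝ)) a ((1 - t) * c + t * D a))) := by
          intro c
          refine Continuous.matrix_diagonal ?_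
          exact continuous_const.update a (by fun_prop)
        have hdet : ∀ x : ℝ, (Matrix.diagonal (Function.update (fun _ : ι => (1:ℝ)) a x)).det = x := by
          intro x
          rw [Matrix.det_diagonal, Finset.prod_update_of_mem (Finset.mem_univ a)]; simp
        rcases lt_or_gt_of_ne (hD a (Finset.mem_univ a)) with h | h
        · right
          refine ⟨a, _, hcont (-1), by simp [rf], by simp, fun t ht => ?_⟩
          rw [hdet]
          have : (1 - t) * (-1) + t * D a < 0 := by
            rcases ht.1.eq_or_lt with h0 | h0
            · rw [← h0]; norm_num
            · nlinarith [ht.2]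
          exact this.ne
        · left
          refine ⟨_, hcont 1, ?_, by simp, fun t ht => ?_⟩
          · simp
          rw [hdet]
          have : 0 < (1 - t) * 1 + t * D a := by
            rcases ht.1.eq_or_lt with h0 | h0
            · rw [← h0]; norm_num
            · nlinarith [ht.2]
          exact this.ne'
    simpa using hs Finset.univ
  · intro t
    left
    exact GJ.transvection t.i t.j t.hij t.c

theorem GJ.det_pos {A B : Matrix ι ι ℝ} (h : GJ A B) : 0 < A.det * B.det := by
  obtain ⟨γ, h1, h2, h3, h4⟩ := h
  by_contra hcon
  push Not at hcon
  have hc : ContinuousOn (fun t => A.det * (γ t).det) (Icc 0 1) := by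
    exact (continuous_const.mul (Continuous.matrix_det h1)).continuousOn
  have hA : A.det ≠ 0 := by rw [← h2]; exact h4 0 (by simp)
  obtain ⟨t, ht, h⟩ := intermediate_value_Icc' zero_le_one hc
    (show (0:ℝ) ∈ Icc _ _ from ⟨by simpa [h3] using hcon, by simp only [h2]; exact mul_self_nonneg _⟩)
  rcases mul_eq_zero.1 h with h | h
  · exact hA h
  · exact h4 t ht h

theorem GJ.of_det_pos (M : Matrix ι ι ℝ) (hM : 0 < M.det) : GJ 1 M := by
  rcases GJ.all M hM.ne' with h | ⟨i, h⟩
  · exact h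
  · have := h.det_pos
    rw [det_rf] at this; linarith
end GLsec

section
variable {X : Type*} [NormedAddCommGroup X] [NormedSpace ℝ X] [FiniteDimensional ℝ X]

theorem gl_pos (M : X →L[ℝ] X) (hM : 0 < M.det) : ∃ γ : ℝ → X →L[ℝ] X, Continuous γ ∧
    γ 0 = ContinuousLinearMap.id ℝ X ∧ γ 1 = M ∧ ∀ t ∈ Icc (0:ℝ) 1, (γ t).det ≠ 0 := by
  let b := Module.finBasis ℝ X
  have hM' : 0 < (LinearMap.toMatrix b b (M : X →ₗ[ℝ] X)).det := by
    rw [LinearMap.det_toMatrix]; exact hM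
  obtain ⟨γ, h1, h2, h3, h4⟩ := GJ.of_det_pos _ hM'
  let Φ : Matrix (Fin (Module.finrank ℝ X)) (Fin (Module.finrank ℝ X)) ℝ →ₗ[ℝ] (X →L[ℝ] X) :=
    (LinearMap.toContinuousLinearMap : (X →ₗ[ℝ] X) ≃ₗ[ℝ] (X →L[ℝ] X)).toLinearMap.comp
      (Matrix.toLin b b).toLinearMap
  have hΦ : Continuous Φ := LinearMap.continuous_of_finiteDimensional Φ
  refine ⟨fun t => Φ (γ t), hΦ.comp h1, ?_, ?_, fun t ht => ?_⟩
  · simp only [h2]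
    ext x
    simp [Φ]
  · simp only [h3]
    ext x
    simp [Φ]
  · have : (Φ (γ t)).det = (γ t).det := by
      rw [ContinuousLinearMap.det]
      simp [Φ, LinearMap.det_toLin]
    rw [this]; exact h4 t ht

theorem gl_path (A B : X →L[ℝ] X) (h : 0 < A.det * B.det) : ∃ γ : ℝ → X →L[ℝ] X, Continuous γ ∧
    γ 0 = A ∧ γ 1 = B ∧ ∀ t ∈ Icc (0:ℝ) 1, (γ t).det ≠ 0 := by
  have hA : A.det ≠ 0 := fun h0 => by rw [h0, zero_mul] at h; exact lt_irrefl _ h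
  obtain ⟨e, he⟩ := equiv_of_det hA
  have hinv : A.comp (e.symm : X →L[ℝ] X) = ContinuousLinearMap.id ℝ X := by
    rw [← he]; ext x; simp
  have hM : 0 < ((e.symm : X →L[ℝ] X).comp B).det := by
    have h1 : A.det * ((e.symm : X →L[ℝ] X)).det = 1 := by
      rw [← det_comp_clm, hinv]
      exact LinearMap.det_id
    rw [det_comp_clm]
    have h2 : 0 < (A.det * ((e.symm : X →L[ℝ] X)).det) * (A.det * ((e.symm : X →L[ℝ] X)).det) := by
      rw [h1]; norm_num
    have h3 : 0 < A.det * A.det := mul_self_pos.2 hA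
    have h4 : 0 < (A.det * A.det) * (((e.symm : X →L[ℝ] X)).det * B.det) := by
      have : (A.det * A.det) * (((e.symm : X →L[ℝ] X)).det * B.det) =
        (A.det * ((e.symm : X →L[ℝ] X)).det) * (A.det * B.det) := by ring
      rw [this, h1]; linarith
    exact pos_of_mul_pos_right h4 h3.le
  obtain ⟨γ, h1, h2, h3, h4⟩ := gl_pos _ hM
  refine ⟨fun t => A.comp (γ t), by fun_prop, ?_, ?_, fun t ht => ?_⟩
  · simp only [h2]; ext x; simp
  · simp only [h3]; rw [← ContinuousLinearMap.comp_assoc, hinv]; ext x; simp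
  · rw [det_comp_clm]; exact mul_ne_zero hA (h4 t ht)
end
end VK

open Set
noncomputable section
namespace VK
set_option linter.unusedVariables false
set_option linter.unusedSectionVars false
set_option linter.deprecated false
set_option linter.unusedSimpArgs false
open Topology Filter MeasureTheory

/-- free loops contract -/
def SC {E : Type*} [TopologicalSpace E] (C : Set E) : Prop :=
  ∀ lam : ℝ → E, ContinuousOn lam (Icc 0 1) → MapsTo lam (Icc 0 1) C → lam 0 = lam 1 →
    ∃ Γ : ℝ × ℝ → E, ContinuousOn Γ (Icc 0 1 ×ˢ Icc 0 1) ∧ MapsTo Γ (Icc 0 1 ×ˢ Icc 0 1) C ∧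
      (∀ τ ∈ Icc (0:ℝ) 1, Γ (τ, 0) = lam τ) ∧ (∀ t ∈ Icc (0:ℝ) 1, Γ (0, t) = Γ (1, t)) ∧
      ∀ τ ∈ Icc (0:ℝ) 1, Γ (τ, 1) = Γ (0, 1)

section
variable {X E : Type*} [TopologicalSpace X] [TopologicalSpace E]

/-- three pieces according to a height function -/
def tp (l : X → ℝ) (a b c : X → E) (z : X) : E :=
  if l z ≤ -(1/2) then a z else if l z ≤ 1/2 then b z else c z

theorem tp_cont {D : Set X} (hD : IsClosed D) {l : X → ℝ} (hl : Continuous l) {a b c : X → E} {C : Set E}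
    (ha : ContinuousOn a (D ∩ {z | l z ≤ -(1/2)})) (hb : ContinuousOn b (D ∩ {z | -(1/2) ≤ l z ∧ l z ≤ 1/2}))
    (hc : ContinuousOn c (D ∩ {z | 1/2 ≤ l z})) (hab : ∀ z ∈ D, l z = -(1/2) → a z = b z)
    (hbc : ∀ z ∈ D, l z = 1/2 → b z = c z) : ContinuousOn (tp l a b c) D := by
  have c1 : IsClosed (D ∩ {z | l z ≤ -(1/2)}) := hD.inter (isClosed_le hl continuous_const)
  have c2 : IsClosed (D ∩ {z | -(1/2) ≤ l z ∧ l z ≤ 1/2}) :=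
    hD.inter ((isClosed_le continuous_const hl).inter (isClosed_le hl continuous_const))
  have c3 : IsClosed (D ∩ {z | 1/2 ≤ l z}) := hD.inter (isClosed_le continuous_const hl)
  have hU : D ⊆ (D ∩ {z | l z ≤ -(1/2)}) ∪ ((D ∩ {z | -(1/2) ≤ l z ∧ l z ≤ 1/2}) ∪ (D ∩ {z | 1/2 ≤ l z})) := by
    intro z hz
    rcases le_total (l z) (-(1/2)) with h | h
    · left; exact ⟨hz, h⟩
    · right
      rcases le_total (l z) (1/2) with h' | h'
      · left; exact ⟨hz, h, h'⟩
      · right; exact ⟨hz, h'⟩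
  refine (continuousOn_union_closed c1 (c2.union c3) ?_ (continuousOn_union_closed c2 c3 ?_ ?_)).mono hU
  · refine ha.congr fun z hz => ?_
    have h := hz.2; simp only [mem_setOf_eq] at h
    simp only [tp, h, if_true]
  · refine hb.congr fun z hz => ?_
    have h := hz.2; simp only [mem_setOf_eq] at h
    unfold tp
    split_ifs with h1 h2
    · exact hab z hz.1 (le_antisymm h1 h.1)
    · rfl
    · exact absurd h.2 h2
  · refine hc.congr fun z hz => ?_
    have h := hz.2; simp only [mem_setOf_eq] at h
    unfold tp
    split_ifs with h1 h2
    · linarith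
    · exact hbc z hz.1 (le_antisymm h2 h)
    · rfl

theorem tp_maps {D : Set X} {l : X → ℝ} {a b c : X → E} {C : Set E}
    (ha : MapsTo a (D ∩ {z | l z ≤ -(1/2)}) C) (hb : MapsTo b (D ∩ {z | -(1/2) ≤ l z ∧ l z ≤ 1/2}) C)
    (hc : MapsTo c (D ∩ {z | 1/2 ≤ l z}) C) : MapsTo (tp l a b c) D C := by
  intro z hz
  unfold tp
  split_ifs with h1 h2
  · exact ha ⟨hz, h1⟩
  · exact hb ⟨hz, (not_le.1 h1).le, h2⟩
  · exact hc ⟨hz, (not_le.1 h2).le⟩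

theorem tp_hmt {D : Set X} (hD : IsClosed D) {l : X → ℝ} (hl : Continuous l) {a b c : ℝ × X → E} {C : Set E}
    (ha : ContinuousOn a (Icc 0 1 ×ˢ (D ∩ {z | l z ≤ -(1/2)})))
    (hb : ContinuousOn b (Icc 0 1 ×ˢ (D ∩ {z | -(1/2) ≤ l z ∧ l z ≤ 1/2})))
    (hc : ContinuousOn c (Icc 0 1 ×ˢ (D ∩ {z | 1/2 ≤ l z})))
    (ma : MapsTo a (Icc 0 1 ×ˢ (D ∩ {z | l z ≤ -(1/2)})) C)
    (mb : MapsTo b (Icc 0 1 ×ˢ (D ∩ {z | -(1/2) ≤ l z ∧ l z ≤ 1/2})) C)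
    (mc : MapsTo c (Icc 0 1 ×ˢ (D ∩ {z | 1/2 ≤ l z})) C)
    (hab : ∀ t ∈ Icc (0:ℝ) 1, ∀ z ∈ D, l z = -(1/2) → a (t, z) = b (t, z))
    (hbc : ∀ t ∈ Icc (0:ℝ) 1, ∀ z ∈ D, l z = 1/2 → b (t, z) = c (t, z)) :
    Hmt D C (tp l (fun z => a (0, z)) (fun z => b (0, z)) (fun z => c (0, z)))
      (tp l (fun z => a (1, z)) (fun z => b (1, z)) (fun z => c (1, z))) := by
  have hset : ∀ T : Set X, (Icc (0:ℝ) 1 ×ˢ (D ∩ T)) = (Icc (0:ℝ) 1 ×ˢ D) ∩ {p : ℝ × X | p.2 ∈ T} := by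
    intro T; ext p; simp only [mem_prod, mem_inter_iff, mem_setOf_eq]; tauto
  rw [hset] at ha hb hc ma mb mc
  refine ⟨tp (fun p : ℝ × X => l p.2) a b c, ?_, ?_, fun x hx => rfl, fun x hx => rfl⟩
  · exact tp_cont (C := C) (isClosed_Icc.prod hD) (hl.comp continuous_snd) ha hb hc
      (fun z hz h => hab z.1 hz.1 z.2 hz.2 h) (fun z hz h => hbc z.1 hz.1 z.2 hz.2 h)
  · exact tp_maps ma mb mc
end

/-- clamp to [0,1] -/
def cl (r : ℝ) : ℝ := max 0 (min 1 r)
theorem cl_cont : Continuous cl := by unfold cl; fun_prop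
theorem cl_mem (r : ℝ) : cl r ∈ Icc (0:ℝ) 1 := ⟨le_max_left _ _, max_le (by norm_num) (min_le_left _ _)⟩
theorem cl_of_mem {r : ℝ} (h : r ∈ Icc (0:ℝ) 1) : cl r = r := by
  unfold cl; rw [min_eq_right h.2, max_eq_right h.1]
theorem cl_of_le {r : ℝ} (h : r ≤ 0) : cl r = 0 := by
  unfold cl; rw [min_eq_right (by linarith), max_eq_left h]
theorem cl_of_ge {r : ℝ} (h : 1 ≤ r) : cl r = 1 := by
  unfold cl; rw [min_eq_left h]; norm_num
theorem cl_one_sub (r : ℝ) : cl (1 - r) = 1 - cl r := by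
  rcases le_total r 0 with h | h
  · rw [cl_of_le h, cl_of_ge (by linarith)]; ring
  · rcases le_total r 1 with h' | h'
    · rw [cl_of_mem ⟨h, h'⟩, cl_of_mem ⟨by linarith, by linarith⟩]
    · rw [cl_of_ge h', cl_of_le (by linarith)]; ring

theorem Hmt.post {X Y E : Type*} [TopologicalSpace X] [TopologicalSpace Y] [TopologicalSpace E]
    {S : Set X} {C : Set Y} {B : Set E} {φ ψ : X → Y} (h : Hmt S C φ ψ) {k : Y → E}
    (hk : ContinuousOn k C) (hm : MapsTo k C B) : Hmt S B (fun x => k (φ x)) (fun x => k (ψ x)) := by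
  obtain ⟨H, a, b, c, d⟩ := h
  exact ⟨fun p => k (H p), hk.comp a b, fun p hp => hm (b hp), fun x hx => by simp only [c x hx],
    fun x hx => by simp only [d x hx]⟩

theorem Hmt.right_cont {X E : Type*} [TopologicalSpace X] [TopologicalSpace E]
    {S : Set X} {C : Set E} {φ ψ : X → E} (h : Hmt S C φ ψ) : ContinuousOn ψ S ∧ MapsTo ψ S C := by
  obtain ⟨H, a, b, c, d⟩ := h
  have hm : MapsTo (fun x : X => ((1:ℝ), x)) S (Icc 0 1 ×ˢ S) := fun x hx =>
    ⟨⟨zero_le_one, le_refl _⟩, hx⟩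
  refine ⟨(a.comp (by fun_prop) hm).congr fun x hx => (d x hx).symm, fun x hx => ?_⟩
  rw [← d x hx]; exact b (hm hx)

section Dumbbell
variable {X E : Type*} [NormedAddCommGroup X] [NormedSpace ℝ X] [FiniteDimensional ℝ X]
  [NormedAddCommGroup E] [NormedSpace ℝ E] [FiniteDimensional ℝ E]

/-- an even map on the boundary of a box extends -/
theorem even_extend {C : Set E} {w : X} {l : X →L[ℝ] ℝ} (hlw : l w = 1)
    {r : ℝ} (hr : 0 < r) {F : X → E}
    {N : Set X} (hN : N = {z | |l z| ≤ 1 ∧ ‖z - l z • w‖ ≤ r})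
    {D : Set X} (hD : D = {z | z ∈ N ∧ (|l z| = 1 ∨ ‖z - l z • w‖ = r)})
    (hF : ContinuousOn F D) (hFC : MapsTo F D C) (heven : ∀ z ∈ D, F (z - (2 * l z) • w) = F z) :
    ∃ G : X → E, ContinuousOn G N ∧ MapsTo G N C ∧ EqOn G F D := by
  have hlc : Continuous l := l.continuous
  let nu : X → ℝ := fun z => max |l z| (‖z - l z • w‖ / r)
  have hnuc : Continuous nu := by
    have : Continuous fun z : X => ‖z - l z • w‖ / r := by fun_prop
    exact (hlc.abs).max this
  have hnuN : ∀ z, z ∈ N ↔ nu z ≤ 1 := by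
    intro z; rw [hN, mem_setOf_eq]; simp only [nu, max_le_iff, div_le_one hr]
  have hnuD : ∀ z, nu z = 1 → z ∈ D := by
    intro z hz
    rw [hD, mem_setOf_eq]
    refine ⟨(hnuN z).2 hz.le, ?_⟩
    rcases max_choice |l z| (‖z - l z • w‖ / r) with h | h
    · left; rw [← h]; exact hz
    · right
      have : ‖z - l z • w‖ / r = 1 := by rw [← h]; exact hz
      rwa [div_eq_one_iff_eq hr.ne'] at this
  have hDnu : ∀ z ∈ D, nu z = 1 := by
    intro z hz
    rw [hD, mem_setOf_eq] at hz
    refine le_antisymm ((hnuN z).1 hz.1) ?_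
    rcases hz.2 with h | h
    · rw [← h]; exact le_max_left _ _
    · refine le_trans ?_ (le_max_right _ _)
      rw [h, div_self hr.ne']
  have hnus : ∀ c : ℝ, 0 ≤ c → ∀ z, nu (c • z) = c * nu z := by
    intro c hc z
    simp only [nu, map_smul, smul_eq_mul, abs_mul, abs_of_nonneg hc, mul_max_of_nonneg _ _ hc]
    rw [mul_smul, ← smul_sub, norm_smul, Real.norm_eq_abs, abs_of_nonneg hc, mul_div_assoc]
  let y : X → X := fun z => z - (l z + |l z|) • w - (2 * (1 - nu z)) • w
  have hyc : Continuous y := by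
    have := hlc.abs
    fun_prop
  have hly : ∀ z, l (y z) = - (|l z| + 2 * (1 - nu z)) := by
    intro z; simp only [y, map_sub, map_smul, hlw, smul_eq_mul]; ring
  have hyp : ∀ z ∈ N, 0 < nu (y z) := by
    intro z hz
    have h1 := (hnuN z).1 hz
    rcases h1.lt_or_eq with h | h
    · refine lt_of_lt_of_le ?_ (le_max_left _ _)
      rw [hly, abs_neg, abs_of_pos] <;> linarith [abs_nonneg (l z)]
    · have h2 : l (y z) = -|l z| := by rw [hly, h]; ring
      have h3 : y z - l (y z) • w = z - l z • w := by rw [h2]; simp only [y, h]; module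
      have : nu (y z) = nu z := by simp only [nu, h3]; rw [h2]; simp
      rw [this, h]; exact one_pos
  have hR : ∀ z ∈ N, (nu (y z))⁻¹ • y z ∈ D := by
    intro z hz
    apply hnuD
    rw [hnus _ (inv_nonneg.2 (hyp z hz).le), inv_mul_cancel₀ (hyp z hz).ne']
  refine ⟨fun z => F ((nu (y z))⁻¹ • y z), ?_, fun z hz => hFC (hR z hz), ?_⟩
  · refine hF.comp ?_ hR
    refine ContinuousOn.smul ?_ hyc.continuousOn
    exact (hnuc.comp hyc).continuousOn.inv₀ fun z hz => (hyp z hz).ne'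
  · intro z hz
    have h1 := hDnu z hz
    have hy : y z = z - (l z + |l z|) • w := by simp only [y, h1]; module
    have key : F (y z) = F z ∧ nu (y z) = 1 := by
      rcases le_total 0 (l z) with h | h
      · have hy' : y z = z - (2 * l z) • w := by rw [hy, abs_of_nonneg h]; module
        refine ⟨by rw [hy', heven z hz], ?_⟩
        have h2 : l (y z) = - l z := by rw [hly, h1, abs_of_nonneg h]; ring
        have h3 : y z - l (y z) • w = z - l z • w := by rw [h2, hy']; module
        rw [← h1]
        simp only [nu, h3]; rw [h2, abs_neg]
      · have hy' : y z = z := by rw [hy, abs_of_nonpos h]; module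
        rw [hy']; exact ⟨rfl, h1⟩
    simp only [key.2, inv_one, one_smul, key.1]

set_option maxHeartbeats 2000000 in
theorem dumbbell {C : Set E} (hC : IsOpen C) (hSC : SC C) {w : X} {l : X →L[ℝ] ℝ} (hlw : l w = 1)
    {r a : ℝ} (hr : 0 < r) (ha : 0 < a) (ha1 : a < 1) {g : X → E}
    {N : Set X} (hN : N = {z | |l z| ≤ 1 ∧ ‖z - l z • w‖ ≤ r})
    {D : Set X} (hD : D = {z | z ∈ N ∧ (|l z| = 1 ∨ ‖z - l z • w‖ = r)})
    (hg : ContinuousOn g (N \ {a • w, -(a • w)})) (hgC : MapsTo g (N \ {a • w, -(a • w)}) C)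
    (hm : ∀ K0 : Set X, IsCompact K0 → (0:X) ∉ K0 → ∃ ε0 > 0, ∀ ε : ℝ, 0 < ε → ε < ε0 →
      Hmt K0 C (fun u => g (-(a • w) + ε • u)) (fun u => g (a • w + ε • (u - (2 * l u) • w)))) :
    ∃ G : X → E, ContinuousOn G N ∧ MapsTo G N C ∧ EqOn G g D := by
  have : ProperSpace X := FiniteDimensional.proper ℝ X
  have hlc : Continuous l := l.continuous
  have hπ : ∀ s : ℝ, ∀ z : X, l z = 0 → l (s • w + z) = s ∧ (s • w + z) - l (s • w + z) • w = z := by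
    intro s z hz
    have : l (s • w + z) = s := by rw [map_add, map_smul, hlw, hz]; simp
    exact ⟨this, by rw [this]; abel⟩
  have hπ0 : ∀ z, l (z - l z • w) = 0 := fun z => by rw [map_sub, map_smul, hlw]; simp
  have hNc : IsClosed N := by
    rw [hN]
    exact (isClosed_le (f := fun z => |l z|) (by fun_prop) continuous_const).inter
      (isClosed_le (f := fun z => ‖z - l z • w‖) (by fun_prop) continuous_const)
  have hNb : IsCompact N := by
    refine Metric.isCompact_of_isClosed_isBounded hNc ?_
    refine (Metric.isBounded_closedBall (x := (0:X)) (r := ‖w‖ + r)).subset ?_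
    intro z hz
    rw [hN] at hz
    rw [Metric.mem_closedBall, dist_zero_right]
    have : z = l z • w + (z - l z • w) := by abel
    rw [this]
    refine (norm_add_le _ _).trans (add_le_add ?_ hz.2)
    rw [norm_smul, Real.norm_eq_abs]
    nlinarith [hz.1, norm_nonneg w]
  have hDN : D ⊆ N := by rw [hD]; exact fun z hz => hz.1
  have hDc : IsClosed D := by
    rw [hD]
    exact hNc.inter ((isClosed_eq (f := fun z => |l z|) (by fun_prop) continuous_const).union
      (isClosed_eq (f := fun z => ‖z - l z • w‖) (by fun_prop) continuous_const))
  have hDb : IsCompact D := hNb.of_isClosed_subset hDc hDN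
  -- the left cap
  let cap : X → X := fun z => (4 * l z + 3) • w + (-1 - 2 * l z) • (z - l z • w)
  have hcapc : Continuous cap := by fun_prop
  have hlcap : ∀ z, l (cap z) = 4 * l z + 3 := fun z =>
    (hπ _ _ (by rw [map_smul, hπ0, smul_zero])).1
  have hDm : ∀ z ∈ D, |l z| ≤ 1 ∧ ‖z - l z • w‖ ≤ r ∧ (|l z| = 1 ∨ ‖z - l z • w‖ = r) := by
    intro z hz; rw [hD, mem_setOf_eq, hN] at hz; exact ⟨hz.1.1, hz.1.2, hz.2⟩
  have hcap0 : ∀ z ∈ D, l z ≤ -(1/2) → cap z ≠ 0 := by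
    intro z hz hl h0
    have h1 := hlcap z
    rw [h0, map_zero] at h1
    have h2 : l z = -(3/4) := by linarith
    obtain ⟨-, -, h | h⟩ := hDm z hz
    · rw [h2] at h; norm_num at h
    · have h3 : cap z = (1/2 : ℝ) • (z - l z • w) := by
        simp only [cap]
        rw [h2]; norm_num
      rw [h0] at h3
      have h4 : z - l z • w = 0 := by
        rcases smul_eq_zero.1 h3.symm with h | h
        · norm_num at h
        · exact h
      rw [h4, norm_zero] at h; linarith
  have hK : IsCompact (cap '' (D ∩ {z | l z ≤ -(1/2)}) ∪ {w}) :=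
    ((hDb.inter_right (isClosed_le hlc continuous_const)).image hcapc).union isCompact_singleton
  obtain ⟨ε0, hε0, hε0'⟩ := hm _ hK (by
    rintro (⟨z, hz, h⟩ | h)
    · exact hcap0 z hz.1 hz.2 h
    · rw [mem_singleton_iff] at h
      rw [← h, map_zero] at hlw; norm_num at hlw)
  obtain ⟨ε, hε, hεε0, hεa, hεa1, hεr⟩ : ∃ ε : ℝ, 0 < ε ∧ ε < ε0 ∧ ε < a ∧ ε < 1 - a ∧ ε < r := by
    have : 0 < min ε0 (min a (min (1 - a) r)) := by
      have := sub_pos.2 ha1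
      positivity
    refine ⟨min ε0 (min a (min (1 - a) r)) / 2, by linarith, ?_, ?_, ?_, ?_⟩ <;>
    [have := min_le_left ε0 (min a (min (1 - a) r));
     have := (min_le_right ε0 (min a (min (1 - a) r))).trans (min_le_left _ _);
     have := (min_le_right ε0 (min a (min (1 - a) r))).trans ((min_le_right _ _).trans (min_le_left _ _));
     have := (min_le_right ε0 (min a (min (1 - a) r))).trans ((min_le_right _ _).trans (min_le_right _ _))] <;>
    linarith
  obtain ⟨h, hh1, hh2, hh3, hh4⟩ := hε0' ε hε hεε0
  set K0 := cap '' (D ∩ {z | l z ≤ -(1/2)}) ∪ {w} with hK0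
  simp only at hh3 hh4
  have hwK : w ∈ K0 := Or.inr (mem_singleton w)
  have hcK : ∀ z ∈ D, l z ≤ -(1/2) → cap z ∈ K0 := fun z hz h => Or.inl ⟨z, ⟨hz, h⟩, rfl⟩
  let ρ : X → X := fun z => z - (2 * l z) • w
  have hρc : Continuous ρ := by fun_prop
  have hlρ : ∀ z, l (ρ z) = - l z := fun z => by
    simp only [ρ, map_sub, map_smul, hlw, smul_eq_mul]; ring
  have hπρ : ∀ z, ρ z - l (ρ z) • w = z - l z • w := fun z => by
    rw [hlρ]; simp only [ρ]; module
  have hρD : ∀ z ∈ D, ρ z ∈ D := by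
    intro z hz
    rw [hD, hN] at hz ⊢
    simp only [mem_setOf_eq, hπρ] at hz ⊢
    simp only [hlρ, abs_neg] at hz ⊢
    exact hz
  -- pieces of the dumbbell
  let dl : X → X := fun z => -(a • w) + ε • cap z
  let dm : X → X := fun z => (2 * (a - ε) * l z) • w
  let dr : X → X := fun z => a • w + ε • (cap (ρ z) - (2 * l (cap (ρ z))) • w)
  have capw : ∀ z, l z = -(1/2) → cap z = w := fun z hz => by
    simp only [cap, hz]; norm_num
  have e1 : ∀ z, l z = -(1/2) → dl z = dm z := fun z hz => by
    simp only [dl, dm, capw z hz, hz]; module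
  have e2 : ∀ z, l z = 1/2 → dm z = dr z := fun z hz => by
    simp only [dr, dm, capw (ρ z) (by rw [hlρ, hz]), hz, hlw]; module
  have hdc : ContinuousOn (tp l dl dm dr) D := by
    refine tp_cont (C := univ) hDc hlc ?_ ?_ ?_ (fun z _ h => e1 z h) (fun z _ h => e2 z h) <;>
    · refine Continuous.continuousOn ?_
      fun_prop
  have hform : ∀ z ∈ D, ∃ A B : ℝ, tp l dl dm dr z = A • w + B • (z - l z • w) ∧ |A| ≤ 1 ∧ 0 ≤ B ∧ B ≤ 1 ∧
      (l z = -1 → A < -a) ∧ (l z = 1 → a < A) ∧ (B = 0 → |A| < a) := by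
    intro z hz
    obtain ⟨h1, -, -⟩ := hDm z hz
    rw [abs_le] at h1
    unfold tp
    split_ifs with k1 k2
    · refine ⟨-a + ε * (4 * l z + 3), ε * (-1 - 2 * l z), ?_, ?_, ?_, ?_, ?_, ?_, ?_⟩
      · simp only [dl, cap]; module
      · rw [abs_le]; constructor <;> nlinarith
      · nlinarith
      · nlinarith
      · intro h; rw [h]; linarith
      · intro h; linarith
      · intro h
        have : l z = -(1/2) := by
          rcases mul_eq_zero.1 h with h | h <;> linarith
        rw [this, abs_lt]; constructor <;> linarith
    · refine ⟨2 * (a - ε) * l z, 0, ?_, ?_, le_refl _, zero_le_one, ?_, ?_, ?_⟩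
      · simp only [dm]; module
      · rw [abs_le]; constructor <;> nlinarith
      · intro h; linarith
      · intro h; linarith
      · intro h; rw [abs_lt]; constructor <;> nlinarith
    · refine ⟨a + ε * (4 * l z - 3), ε * (-1 + 2 * l z), ?_, ?_, ?_, ?_, ?_, ?_, ?_⟩
      · have : l (cap (ρ z)) = - (4 * l z) + 3 := by rw [hlcap, hlρ]; ring
        simp only [dr, this]
        simp only [cap, hπρ, hlρ]; module
      · rw [abs_le]; constructor <;> nlinarith
      · nlinarith
      · nlinarith
      · intro h; linarith
      · intro h; rw [h]; linarith
      · intro h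
        have : l z = (1/2) := by
          rcases mul_eq_zero.1 h with h | h <;> linarith
        rw [this, abs_lt]; constructor <;> linarith
  have hN' : ∀ A : ℝ, ∀ y : X, l y = 0 → |A| ≤ 1 → ‖y‖ ≤ r → (y = 0 → |A| ≠ a) →
      A • w + y ∈ N \ {a • w, -(a • w)} := by
    intro A y hy hA hyr hne
    obtain ⟨q1, q2⟩ := hπ A y hy
    refine ⟨?_, ?_⟩
    · rw [hN, mem_setOf_eq, q2, q1]; exact ⟨hA, hyr⟩
    · rintro (h | h)
      · have hl : l (A • w + y) = a := by rw [h, map_smul, hlw]; simp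
        have : A = a := by rw [← q1, hl]
        refine hne ?_ (by rw [this, abs_of_pos ha])
        rw [this] at h; simpa using h
      · rw [mem_singleton_iff] at h
        have hl : l (A • w + y) = -a := by rw [h, map_neg, map_smul, hlw]; simp
        have : A = -a := by rw [← q1, hl]
        refine hne ?_ (by rw [this, abs_neg, abs_of_pos ha])
        rw [this] at h; simpa using h
  have hseg : Hmt D (N \ {a • w, -(a • w)}) (fun z => z) (tp l dl dm dr) := by
    refine Hmt.segment continuousOn_id hdc ?_
    intro z hz t ht
    obtain ⟨A, B, hd, hA, hB0, hB1, hm1, hp1, hB⟩ := hform z hz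
    obtain ⟨h1, h2, h3⟩ := hDm z hz
    have hz' : z = l z • w + (z - l z • w) := by abel
    have heq : (1 - t) • z + t • tp l dl dm dr z =
        ((1 - t) * l z + t * A) • w + ((1 - t) + t * B) • (z - l z • w) := by
      rw [hd]; module
    rw [heq]
    have t0 := ht.1
    have t1 := ht.2
    have hc0 : 0 ≤ (1 - t) + t * B := by nlinarith
    have hc1 : (1 - t) + t * B ≤ 1 := by nlinarith
    refine hN' _ _ (by rw [map_smul, hπ0, smul_zero]) ?_ ?_ ?_
    · rw [abs_le] at *; constructor <;> nlinarith
    · rw [norm_smul, Real.norm_eq_abs, abs_of_nonneg hc0]; nlinarith [norm_nonneg (z - l z • w)]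
    · intro h0
      rcases smul_eq_zero.1 h0 with h | h
      · have ht1 : t = 1 := by nlinarith
        rw [ht1] at h ⊢
        have := hB (by linarith)
        rw [show (1 - 1 : ℝ) * l z + 1 * A = A by ring]; exact this.ne
      · have hl1 : |l z| = 1 := by
          rcases h3 with h3 | h3
          · exact h3
          · rw [h, norm_zero] at h3; linarith
        rcases (abs_eq zero_le_one).1 hl1 with hl | hl
        · have := hp1 hl
          rw [hl]
          have h5 : a < (1 - t) * 1 + t * A := by
            rcases t0.eq_or_lt with h | h
            · rw [← h]; linarith
            · nlinarith
          rw [abs_of_pos (by linarith)]; exact h5.ne'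
        · have := hm1 hl
          rw [hl]
          have h5 : (1 - t) * (-1) + t * A < -a := by
            rcases t0.eq_or_lt with h | h
            · rw [← h]; linarith
            · nlinarith
          rw [abs_of_neg (by linarith)]; intro h6; linarith
  have H0 := hseg.post hg hgC
  have hmem := hseg.right_cont.2
  have tpR : ∀ z, 1/2 ≤ l z → tp l dl dm dr z = dr z := by
    intro z hz
    unfold tp
    rw [if_neg (by linarith)]
    split_ifs with h
    · exact e2 z (le_antisymm h hz)
    · rfl
  have hdrm : ∀ z ∈ D, 1/2 ≤ l z → dr z ∈ N \ {a • w, -(a • w)} := fun z hz h => by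
    rw [← tpR z h]; exact hmem hz
  have hwm : ∀ s : ℝ, |s| < a → s • w ∈ N \ {a • w, -(a • w)} := by
    intro s hs
    have := hN' s 0 (map_zero _) (by linarith) (by simpa using hr.le) (fun _ => hs.ne)
    simpa using this
  have hcapρ : ∀ z ∈ D, 1/2 ≤ l z → cap (ρ z) ∈ K0 := fun z hz h =>
    hcK _ (hρD z hz) (by rw [hlρ]; linarith)
  have hgdr : ∀ z ∈ D, 1/2 ≤ l z → h (1, cap (ρ z)) = g (dr z) := fun z hz hl =>
    hh4 _ (hcapρ z hz hl)
  let kap : ℝ → E := fun s => if s ≤ 0 then h (-s, w) else g ((2 * (a - ε) * (s - 1/2)) • w)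
  have hk0 : h (0, w) = g ((2 * (a - ε) * (0 - 1/2)) • w) := by
    rw [hh3 w hwK]; congr 1; module
  have kapn : ∀ s ≤ 0, kap s = h (-s, w) := fun s hs => by simp only [kap, hs, if_true]
  have kapp : ∀ s, 0 ≤ s → kap s = g ((2 * (a - ε) * (s - 1/2)) • w) := by
    intro s hs
    rcases hs.eq_or_lt with h | h
    · rw [← h, kapn 0 le_rfl, neg_zero, hk0]
    · simp only [kap, not_le.2 h, if_false]
  have kapm1 : kap (-1) = g ((a - ε) • w) := by
    rw [kapn _ (by norm_num), neg_neg, hh4 w hwK, hlw]; congr 1; module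
  have kap1 : kap 1 = g ((a - ε) • w) := by
    rw [kapp _ (by norm_num)]; congr 1; module
  have kapsm : ∀ s ∈ Icc (0:ℝ) 1, (2 * (a - ε) * (s - 1/2)) • w ∈ N \ {a • w, -(a • w)} := by
    intro s hs
    apply hwm
    rw [abs_lt]; constructor <;> nlinarith [hs.1, hs.2]
  have kapc : ContinuousOn kap (Icc (-1) 1) := by
    have : Icc (-1:ℝ) 1 ⊆ Icc (-1) 0 ∪ Icc 0 1 := by
      intro s hs
      rcases le_total s 0 with h | h
      · left; exact ⟨hs.1, h⟩
      · right; exact ⟨h, hs.2⟩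
    refine (continuousOn_union_closed isClosed_Icc isClosed_Icc ?_ ?_).mono this
    · refine ContinuousOn.congr ?_ (fun s hs => kapn s hs.2)
      refine hh1.comp (by fun_prop) ?_
      intro s hs
      exact ⟨⟨by linarith [hs.2], by linarith [hs.1]⟩, hwK⟩
    · refine ContinuousOn.congr ?_ (fun s hs => kapp s hs.1)
      exact hg.comp (by fun_prop) kapsm
  have kapC : MapsTo kap (Icc (-1) 1) C := by
    intro s hs
    rcases le_total s 0 with h | h
    · rw [kapn s h]; exact hh2 ⟨⟨by linarith, by linarith [hs.1]⟩, hwK⟩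
    · rw [kapp s h]; exact hgC (kapsm s ⟨h, hs.2⟩)
  -- stage one
  have H1 := tp_hmt (C := C) hDc hlc (a := fun p => h (p.1, cap p.2))
    (b := fun p => kap (-p.1 + (1 + p.1) * (l p.2 + 1/2))) (c := fun p => g (dr p.2))
    (hh1.comp (by fun_prop) (fun p hp => ⟨hp.1, hcK _ hp.2.1 hp.2.2⟩))
    (kapc.comp (by fun_prop) (by
      rintro ⟨t, z⟩ ⟨⟨t0, t1⟩, hz, z0, z1⟩
      simp only at t0 t1 z0 z1
      exact ⟨by simp only; nlinarith, by simp only; nlinarith⟩))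
    (hg.comp (by fun_prop) (fun p hp => hdrm _ hp.2.1 hp.2.2))
    (fun p hp => hh2 ⟨hp.1, hcK _ hp.2.1 hp.2.2⟩)
    (by
      rintro ⟨t, z⟩ ⟨⟨t0, t1⟩, hz, z0, z1⟩
      simp only at t0 t1 z0 z1
      exact kapC ⟨by simp only; nlinarith, by simp only; nlinarith⟩)
    (fun p hp => hgC (hdrm _ hp.2.1 hp.2.2))
    (by
      intro t ht z hz hl
      simp only
      rw [hl, capw z hl, kapn _ (by linarith [ht.1])]
      congr 2; ring)
    (by
      intro t ht z hz hl
      simp only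
      rw [← e2 z hl, hl, show -t + (1 + t) * (1/2 + 1/2) = 1 by ring, kap1]
      congr 1; simp only [dm, hl]; module)
  -- stage two
  obtain ⟨Γ, Γc, ΓC, Γ0, Γs, Γ1⟩ := hSC (fun τ => kap (-1 + 2 * τ))
    (kapc.comp (by fun_prop) (fun τ hτ => ⟨by linarith [hτ.1], by linarith [hτ.2]⟩))
    (fun τ hτ => kapC ⟨by linarith [hτ.1], by linarith [hτ.2]⟩)
    (by norm_num; rw [kapm1, kap1])
  have hrm : ∀ t ∈ Icc (0:ℝ) 1, ∀ s : ℝ, -t ≤ s → s ≤ 1 + t → (cl s, t - |s - cl s|) ∈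
      Icc (0:ℝ) 1 ×ˢ Icc (0:ℝ) 1 := by
    intro t ht s h1 h2
    refine ⟨cl_mem s, ?_, ?_⟩
    · simp only
      rcases le_total s 0 with h | h
      · rw [cl_of_le h, abs_of_nonpos] <;> linarith
      · rcases le_total s 1 with h' | h'
        · rw [cl_of_mem ⟨h, h'⟩]; simp [ht.1]
        · rw [cl_of_ge h', abs_of_nonneg] <;> linarith
    · simp only; linarith [abs_nonneg (s - cl s), ht.2]
  have hclc : Continuous cl := cl_cont
  have hrr : ∀ t ∈ Icc (0:ℝ) 1, ∀ z, -(1/2) ≤ l z → l z ≤ 1/2 →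
      -t ≤ -t + (1 + 2 * t) * (l z + 1/2) ∧ -t + (1 + 2 * t) * (l z + 1/2) ≤ 1 + t := by
    intro t ht z h1 h2
    have := ht.1
    have := ht.2
    constructor <;> nlinarith
  have hmcont : Continuous fun p : ℝ × X => ((cl (-p.1 + (1 + 2 * p.1) * (l p.2 + 1/2)),
      p.1 - |(-p.1 + (1 + 2 * p.1) * (l p.2 + 1/2)) - cl (-p.1 + (1 + 2 * p.1) * (l p.2 + 1/2))|) : ℝ × ℝ) := by
    have h1 : Continuous fun p : ℝ × X => (-p.1 + (1 + 2 * p.1) * (l p.2 + 1/2)) := by fun_prop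
    exact (hclc.comp h1).prodMk (continuous_fst.sub (h1.sub (hclc.comp h1)).abs)
  have H2 := tp_hmt (C := C) hDc hlc (a := fun p => h (1, cap p.2))
    (b := fun p => Γ (cl (-p.1 + (1 + 2 * p.1) * (l p.2 + 1/2)),
      p.1 - |(-p.1 + (1 + 2 * p.1) * (l p.2 + 1/2)) - cl (-p.1 + (1 + 2 * p.1) * (l p.2 + 1/2))|))
    (c := fun p => g (dr p.2))
    (hh1.comp (by fun_prop) (fun p hp => ⟨⟨zero_le_one, le_rfl⟩, hcK _ hp.2.1 hp.2.2⟩))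
    (Γc.comp hmcont.continuousOn (by
      rintro ⟨t, z⟩ ⟨ht, hz, z0, z1⟩
      exact hrm t ht _ (hrr t ht z z0 z1).1 (hrr t ht z z0 z1).2))
    (hg.comp (by fun_prop) (fun p hp => hdrm _ hp.2.1 hp.2.2))
    (fun p hp => hh2 ⟨⟨zero_le_one, le_rfl⟩, hcK _ hp.2.1 hp.2.2⟩)
    (by
      rintro ⟨t, z⟩ ⟨ht, hz, z0, z1⟩
      exact ΓC (hrm t ht _ (hrr t ht z z0 z1).1 (hrr t ht z z0 z1).2))
    (fun p hp => hgC (hdrm _ hp.2.1 hp.2.2))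
    (by
      intro t ht z hz hl
      simp only
      have h1 : -t + (1 + 2 * t) * (l z + 1/2) = -t := by rw [hl]; ring
      rw [h1, cl_of_le (by linarith [ht.1]), sub_zero, abs_neg, abs_of_nonneg ht.1, sub_self,
        Γ0 0 ⟨le_rfl, zero_le_one⟩, capw z hl, kapn _ (by norm_num)]
      congr 2; norm_num)
    (by
      intro t ht z hz hl
      simp only
      have h1 : -t + (1 + 2 * t) * (l z + 1/2) = 1 + t := by rw [hl]; ring
      rw [h1, cl_of_ge (by linarith [ht.1]), add_sub_cancel_left, abs_of_nonneg ht.1, sub_self,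
        Γ0 1 ⟨zero_le_one, le_rfl⟩, ← e2 z hl, show (-1 + 2 * 1 : ℝ) = 1 by norm_num, kap1]
      congr 1; simp only [dm, hl]; module)
  have J0 : EqOn (fun z => g (tp l dl dm dr z)) (tp l (fun z => h (0, cap z))
      (fun z => kap (-0 + (1 + 0) * (l z + 1/2))) (fun z => g (dr z))) D := by
    intro z hz
    have := (abs_le.1 (hDm z hz).1)
    unfold tp
    simp only
    split_ifs with h1 h2
    · exact (hh3 _ (hcK z hz h1)).symm
    · rw [kapp _ (by linarith)]
      congr 1; simp only [dm]; congr 1; ring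
    · rfl
  have J1 : EqOn (tp l (fun z => h (1, cap z)) (fun z => kap (-1 + (1 + 1) * (l z + 1/2))) (fun z => g (dr z)))
      (tp l (fun z => h (1, cap z)) (fun z => Γ (cl (-0 + (1 + 2 * 0) * (l z + 1/2)),
      0 - |(-0 + (1 + 2 * 0) * (l z + 1/2)) - cl (-0 + (1 + 2 * 0) * (l z + 1/2))|)) (fun z => g (dr z))) D := by
    intro z hz
    unfold tp
    simp only
    split_ifs with h1 h2
    · rfl
    · have h3 : -0 + (1 + 2 * 0) * (l z + 1/2) = l z + 1/2 := by ring
      have h4 : l z + 1/2 ∈ Icc (0:ℝ) 1 := ⟨by linarith, by linarith⟩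
      rw [h3, cl_of_mem h4, sub_self, abs_zero, sub_zero, Γ0 _ h4]
      congr 1; ring
    · rfl
  have HH := ((H0.congr (fun _ _ => rfl) J0.symm).trans (H1.congr (fun _ _ => rfl) J1.symm)).trans H2
  obtain ⟨F2c, F2C⟩ := HH.right_cont
  set F2 := (tp l (fun z => h (1, cap z)) (fun z => Γ (cl (-1 + (1 + 2 * 1) * (l z + 1/2)),
      1 - |(-1 + (1 + 2 * 1) * (l z + 1/2)) - cl (-1 + (1 + 2 * 1) * (l z + 1/2))|)) (fun z => g (dr z))) with hF2
  have hρρ : ∀ z, ρ (ρ z) = z := by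
    intro z
    have := hlρ z
    simp only [ρ] at this ⊢
    rw [this]; module
  have hmid : ∀ s, (cl (1 - s), 1 - |(1 - s) - cl (1 - s)|) = (1 - cl s, 1 - |s - cl s|) := by
    intro s
    rw [cl_one_sub, show 1 - s - (1 - cl s) = -(s - cl s) by ring, abs_neg]
  have hΓeven : ∀ s, -1 ≤ s → s ≤ 2 → Γ (1 - cl s, 1 - |s - cl s|) = Γ (cl s, 1 - |s - cl s|) := by
    intro s h1 h2
    rcases le_total s 0 with h | h
    · have := (hrm 1 ⟨zero_le_one, le_rfl⟩ s h1 (by linarith)).2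
      rw [cl_of_le h] at this ⊢
      rw [sub_zero (1:ℝ)]; exact (Γs _ this).symm
    · rcases le_total s 1 with h' | h'
      · rw [cl_of_mem ⟨h, h'⟩, sub_self, abs_zero, sub_zero, Γ1 _ ⟨h, h'⟩,
          Γ1 _ ⟨by linarith, by linarith⟩]
      · have := (hrm 1 ⟨zero_le_one, le_rfl⟩ s h1 (by linarith)).2
        rw [cl_of_ge h'] at this ⊢
        rw [sub_self (1:ℝ)]; exact (Γs _ this)
  have heven0 : ∀ z ∈ D, l z < -(1/2) → F2 (ρ z) = F2 z := by
    intro z hz hl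
    have h1 : l (ρ z) = - l z := hlρ z
    rw [hF2]; unfold tp
    rw [h1, if_neg (by linarith), if_neg (by linarith), if_pos hl.le]
    simp only
    rw [← hgdr (ρ z) (hρD z hz) (by rw [h1]; linarith), hρρ]
  have heven : ∀ z ∈ D, F2 (z - (2 * l z) • w) = F2 z := by
    intro z hz
    change F2 (ρ z) = F2 z
    rcases lt_or_ge (l z) (-(1/2)) with h1 | h1
    · exact heven0 z hz h1
    · rcases lt_or_ge (1/2) (l z) with h2 | h2
      · have := heven0 (ρ z) (hρD z hz) (by rw [hlρ]; linarith)
        rw [hρρ] at this; exact this.symm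
      · have hmidv : ∀ y ∈ D, -(1/2) ≤ l y → l y ≤ 1/2 → F2 y = Γ (cl (-1 + (1 + 2 * 1) * (l y + 1/2)),
            1 - |(-1 + (1 + 2 * 1) * (l y + 1/2)) - cl (-1 + (1 + 2 * 1) * (l y + 1/2))|) := by
          intro y hy k1 k2
          rw [hF2]; unfold tp
          split_ifs with k3
          · have k4 : l y = -(1/2) := le_antisymm k3 k1
            have k5 : -1 + (1 + 2 * 1) * (l y + 1/2) = -1 := by rw [k4]; norm_num
            rw [k5, cl_of_le (by norm_num), sub_zero, abs_neg, abs_one, sub_self,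
              Γ0 0 ⟨le_rfl, zero_le_one⟩]
            simp only
            rw [capw y k4, kapn _ (by norm_num)]
            congr 2; norm_num
          · rfl
        rw [hmidv z hz h1 h2, hmidv _ (hρD z hz) (by rw [hlρ]; linarith) (by rw [hlρ]; linarith), hlρ,
          show -1 + (1 + 2 * 1) * (- l z + 1/2) = 1 - (-1 + (1 + 2 * 1) * (l z + 1/2)) by ring, hmid,
          hΓeven _ (by linarith) (by linarith)]
  obtain ⟨G0, c1, c2, c3⟩ := even_extend hlw hr hN hD F2c F2C heven
  exact extend_of_hmt hNb hDc hDN hC (HH.congr (fun _ _ => rfl) c3) c1 c2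
end Dumbbell
end VK

open Set
noncomputable section
namespace VK
set_option linter.unusedVariables false
set_option linter.unusedSectionVars false
set_option linter.deprecated false
set_option linter.unusedSimpArgs false
open Topology Filter MeasureTheory

/-- gluing along relatively closed pieces -/
theorem continuousOn_cover {X Y : Type*} [TopologicalSpace X] [TopologicalSpace Y]
    {S A B : Set X} (hA : IsClosed A) (hB : IsClosed B) (hS : S ⊆ A ∪ B) {f : X → Y}
    (h1 : ContinuousOn f (S ∩ A)) (h2 : ContinuousOn f (S ∩ B)) : ContinuousOn f S := by
  intro p hp
  have hSu : S = (S ∩ A) ∪ (S ∩ B) := by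
    rw [← inter_union_distrib_left]; exact (inter_eq_left.2 hS).symm
  rw [ContinuousWithinAt, hSu, nhdsWithin_union, tendsto_sup]
  constructor
  · by_cases h : p ∈ A
    · exact h1 p ⟨hp, h⟩
    · have : 𝓝[S ∩ A] p = ⊥ := by
        rw [← notMem_closure_iff_nhdsWithin_eq_bot]
        exact fun hc => h (hA.closure_eq ▸ closure_mono inter_subset_right hc)
      rw [this]; exact tendsto_bot
  · by_cases h : p ∈ B
    · exact h2 p ⟨hp, h⟩
    · have : 𝓝[S ∩ B] p = ⊥ := by
        rw [← notMem_closure_iff_nhdsWithin_eq_bot]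
        exact fun hc => h (hB.closure_eq ▸ closure_mono inter_subset_right hc)
      rw [this]; exact tendsto_bot

section Cancel
variable {X E : Type*} [NormedAddCommGroup X] [NormedSpace ℝ X] [FiniteDimensional ℝ X]
  [NormedAddCommGroup E] [NormedSpace ℝ E] [FiniteDimensional ℝ E]

theorem small_nbhd {K0 : Set X} (hK : IsCompact K0) {U : Set X} (hU : U ∈ 𝓝 (0:X)) :
    ∃ ε0 > 0, ∀ ε : ℝ, 0 < ε → ε < ε0 → ∀ u ∈ K0, ε • u ∈ U := by
  obtain ⟨δ, hδ, hb⟩ := Metric.mem_nhds_iff.1 hU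
  obtain ⟨R, hR⟩ := hK.isBounded.exists_norm_le
  have hR1 : 0 < |R| + 1 := by positivity
  refine ⟨δ / (|R| + 1), by positivity, fun ε h1 h2 u hu => hb ?_⟩
  rw [Metric.mem_ball, dist_zero_right, norm_smul, Real.norm_eq_abs, abs_of_pos h1]
  rw [lt_div_iff₀ hR1] at h2
  have := (hR u hu).trans (le_abs_self R)
  nlinarith

/-- the local link maps at two singular points agree up to an orientation reversing map -/
def Match (C : Set E) (g : X → E) (x x' : X) : Prop :=
  ∀ K0 : Set X, IsCompact K0 → (0:X) ∉ K0 → ∀ M : X →L[ℝ] X, M.det < 0 → ∃ ε0 > 0, ∀ ε : ℝ, 0 < ε → ε < ε0 →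
    Hmt K0 C (fun u => g (x + ε • u)) (fun u => g (x' + ε • M u))

theorem Match.transport {C : Set E} {g g' : X → E} {x x' x1 x1' : X} (h : Match C g x x')
    (h1 : ∀ᶠ y in 𝓝 (0:X), g' (x1 + y) = g (x + y)) (h2 : ∀ᶠ y in 𝓝 (0:X), g' (x1' + y) = g (x' + y)) :
    Match C g' x1 x1' := by
  intro K0 hK h0 M hM
  obtain ⟨ε0, p0, q0⟩ := h K0 hK h0 M hM
  obtain ⟨ε1, p1, q1⟩ := small_nbhd hK h1
  obtain ⟨ε2, p2, q2⟩ := small_nbhd (hK.image M.continuous) h2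
  refine ⟨min ε0 (min ε1 ε2), by positivity, fun ε e1 e2 => ?_⟩
  simp only [lt_min_iff] at e2
  refine (q0 ε e1 e2.1).congr (fun u hu => ?_) (fun u hu => ?_)
  · exact q1 ε e1 e2.2.1 u hu
  · exact q2 ε e1 e2.2.2 _ ⟨u, hu, rfl⟩

theorem det_refl_neg (l : X →L[ℝ] ℝ) (w : X) (hlw : l w = 1) :
    (ContinuousLinearMap.id ℝ X - (2 : ℝ) • l.smulRight w).det < 0 := by
  have : ((ContinuousLinearMap.id ℝ X - (2 : ℝ) • l.smulRight w : X →L[ℝ] X) : X →ₗ[ℝ] X) =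
      LinearMap.transvection (l : X →ₗ[ℝ] ℝ) ((-2 : ℝ) • w) := by
    ext x
    simp [LinearMap.transvection]; module
  unfold ContinuousLinearMap.det
  rw [this, LinearMap.transvection.det]
  simp [hlw]

theorem cancel_straight {C : Set E} (hC : IsOpen C) (hSC : SC C) {Q : Set X}
    {P : Finset X} {g : X → E} (hg : ContinuousOn g (Q \ P)) (hgC : MapsTo g (Q \ P) C)
    {x x' : X} (hx : x ∈ P) (hx' : x' ∈ P) (hne : x ≠ x') (hm : Match C g x x')
    (hsQ : segment ℝ x x' ⊆ interior Q)
    (hsP : ∀ z ∈ P, z ≠ x → z ≠ x' → z ∉ segment ℝ x x') :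
    ∃ g' : X → E, ∃ T : Set X, IsClosed T ∧ T ⊆ interior Q ∧ (∀ z ∈ P, z ≠ x → z ≠ x' → z ∉ T) ∧
      (∀ z ∉ T, g' z = g z) ∧ ContinuousOn g' (Q \ {z | z ∈ P ∧ z ≠ x ∧ z ≠ x'}) ∧
      MapsTo g' (Q \ {z | z ∈ P ∧ z ≠ x ∧ z ≠ x'}) C := by
  classical
  set P' : Set X := {z | z ∈ P ∧ z ≠ x ∧ z ≠ x'} with hP'
  have hP'f : P'.Finite := (P.finite_toSet).subset fun z hz => hz.1
  have hUo : IsOpen (interior Q \ P') := isOpen_interior.sdiff hP'f.isClosed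
  have hsU : segment ℝ x x' ⊆ interior Q \ P' := fun z hz =>
    ⟨hsQ hz, fun h => hsP z h.1 h.2.1 h.2.2 hz⟩
  have hsc : IsCompact (segment ℝ x x') := by
    rw [segment_eq_image]
    exact isCompact_Icc.image (by fun_prop)
  obtain ⟨δ, hδ, hδU⟩ := hsc.exists_thickening_subset_open hUo hsU
  set d := x' - x with hd
  have hd0 : d ≠ 0 := sub_ne_zero.2 hne.symm
  have hdp : 0 < ‖d‖ := norm_pos_iff.2 hd0
  set κ := δ / (4 * ‖d‖) with hκ
  have hκp : 0 < κ := by positivity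
  have hκd : κ * ‖d‖ = δ / 4 := by rw [hκ]; field_simp
  set w := (1/2 + κ) • d with hw
  have hw0 : w ≠ 0 := smul_ne_zero (by positivity) hd0
  obtain ⟨l, hlw⟩ := SeparatingDual.exists_eq_one (R := ℝ) hw0
  set a := 1 / (1 + 2 * κ) with ha
  have hap : 0 < a := by positivity
  have ha1 : a < 1 := by rw [ha, div_lt_one (by positivity)]; linarith
  have haw : a • w = (1/2 : ℝ) • d := by
    rw [hw, smul_smul]; congr 1; rw [ha]; field_simp
  set c := (1/2 : ℝ) • (x + x') with hc
  have hcx : c + -(a • w) = x := by rw [haw, hc, hd]; module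
  have hcx' : c + a • w = x' := by rw [haw, hc, hd]; module
  set r := δ / 4 with hr
  have hrp : 0 < r := by positivity
  set N : Set X := {z | |l z| ≤ 1 ∧ ‖z - l z • w‖ ≤ r} with hN
  set D : Set X := {z | z ∈ N ∧ (|l z| = 1 ∨ ‖z - l z • w‖ = r)} with hD
  have hNU : ∀ z ∈ N, c + z ∈ interior Q \ P' := by
    intro z hz
    apply hδU
    rw [Metric.mem_thickening_iff]
    refine ⟨c + (l z / 2) • d, ?_, ?_⟩
    · have h1 := abs_le.1 hz.1
      refine ⟨1/2 - l z / 2, 1/2 + l z / 2, by linarith, by linarith, by ring, ?_⟩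
      rw [hc, hd]; module
    · rw [dist_eq_norm]
      have h1 : c + z - (c + (l z / 2) • d) = (l z * κ) • d + (z - l z • w) := by
        rw [hw]; module
      rw [h1]
      refine (norm_add_le _ _).trans_lt ?_
      have h2 : ‖(l z * κ) • d‖ ≤ δ / 4 := by
        rw [norm_smul, Real.norm_eq_abs, abs_mul, abs_of_pos hκp, mul_assoc, hκd]
        have := hz.1; nlinarith
      have := hz.2
      linarith
  have hPx : ∀ z ∈ N, c + z ∈ P → z = a • w ∨ z = -(a • w) := by
    intro z hz hzP
    by_cases h1 : c + z = x
    · right; rw [← hcx] at h1; exact add_left_cancel h1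
    · by_cases h2 : c + z = x'
      · left; rw [← hcx'] at h2; exact add_left_cancel h2
      · exact absurd ⟨hzP, h1, h2⟩ (hNU z hz).2
  have hNm : MapsTo (fun z => c + z) (N \ {a • w, -(a • w)}) (Q \ P) := by
    rintro z ⟨hz, hz'⟩
    refine ⟨interior_subset (hNU z hz).1, fun h => hz' ?_⟩
    rcases hPx z hz h with h | h
    · left; exact h
    · right; exact h
  obtain ⟨G, hGc, hGC, hGD⟩ := dumbbell hC hSC hlw hrp hap ha1 (g := fun z => g (c + z)) hN hD
    (hg.comp (by fun_prop) hNm) (fun z hz => hgC (hNm hz)) (by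
      intro K0 hK h0
      obtain ⟨ε0, p0, q0⟩ := hm K0 hK h0 _ (det_refl_neg l w hlw)
      refine ⟨ε0, p0, fun ε e1 e2 => (q0 ε e1 e2).congr (fun u hu => ?_) (fun u hu => ?_)⟩
      · simp only; rw [← add_assoc, hcx]
      · simp only; rw [← add_assoc, hcx']
        congr 3
        simp [smul_smul])
  have hNcl : IsClosed N := by
    rw [hN]
    exact (isClosed_le (f := fun z => |l z|) (by fun_prop) continuous_const).inter
      (isClosed_le (f := fun z => ‖z - l z • w‖) (by fun_prop) continuous_const)
  have hTcl : IsClosed {z | z - c ∈ N} := hNcl.preimage (by fun_prop)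
  have hcan : ∀ z, c + (z - c) = z := fun z => by abel
  refine ⟨fun z => if z - c ∈ N then G (z - c) else g z, {z | z - c ∈ N}, hTcl, ?_, ?_, ?_, ?_, ?_⟩
  · intro z hz
    have := (hNU _ hz).1
    rwa [hcan] at this
  · intro z hz h1 h2 h3
    have := (hNU _ h3).2
    rw [hcan] at this
    exact this ⟨hz, h1, h2⟩
  · intro z hz; simp only [mem_setOf_eq] at hz ⊢; rw [if_neg hz]
  · have hBcl : IsClosed {z | z - c ∉ N ∨ z - c ∈ D} := by
      have : {z : X | z - c ∉ N ∨ z - c ∈ D} = {z | 1 ≤ |l (z - c)| ∨ r ≤ ‖(z - c) - l (z - c) • w‖} := by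
        ext z
        simp only [mem_setOf_eq, hD, hN, not_and_or, not_le]
        constructor
        · rintro ((h | h) | ⟨-, h | h⟩)
          · left; exact h.le
          · right; exact h.le
          · left; exact h.ge
          · right; exact h.ge
        · intro h
          by_cases h3 : 1 < |l (z - c)|
          · exact Or.inl (Or.inl h3)
          · by_cases h4 : r < ‖(z - c) - l (z - c) • w‖
            · exact Or.inl (Or.inr h4)
            · push Not at h3 h4
              refine Or.inr ⟨⟨h3, h4⟩, ?_⟩
              rcases h with h | h
              · left; exact le_antisymm h3 h
              · right; exact le_antisymm h4 h
      rw [this]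
      exact (isClosed_le continuous_const (g := fun z => |l (z - c)|) (by fun_prop)).union
        (isClosed_le continuous_const (g := fun z => ‖(z - c) - l (z - c) • w‖) (by fun_prop))
    refine continuousOn_cover hTcl hBcl ?_ ?_ ?_
    · intro z hz
      by_cases h : z - c ∈ N
      · left; exact h
      · right; left; exact h
    · have : ContinuousOn (fun z => G (z - c)) ((Q \ P') ∩ {z | z - c ∈ N}) :=
        hGc.comp (by fun_prop) (fun z hz => hz.2)
      refine this.congr fun z hz => ?_
      have := hz.2
      simp only [mem_setOf_eq] at this
      simp only [this, if_true]
    · refine (hg.mono ?_).congr (f := g) fun z hz => ?_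
      · rintro z ⟨⟨hzQ, hzP'⟩, h⟩
        refine ⟨hzQ, fun hzP => ?_⟩
        have hzN : z - c ∈ N := by
          by_cases h1 : z = x
          · rw [h1, ← hcx, add_sub_cancel_left]
            refine ⟨by simp [hlw, abs_of_pos hap, ha1.le], ?_⟩
            simp [hlw, hrp.le]
          · by_cases h2 : z = x'
            · rw [h2, ← hcx', add_sub_cancel_left]
              refine ⟨by simp [hlw, abs_of_pos hap, ha1.le], ?_⟩
              simp [hlw, hrp.le]
            · exact absurd ⟨hzP, h1, h2⟩ hzP'
        have hzD : z - c ∈ D := by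
          rcases h with h | h
          · exact absurd hzN h
          · exact h
        have h3 := hPx _ hzN (by rw [hcan]; exact hzP)
        rcases h3 with h3 | h3 <;> rcases hzD.2 with h4 | h4 <;> rw [h3] at h4 <;>
          simp [hlw, abs_of_pos hap] at h4 <;> linarith
      · split_ifs with h1
        · rcases hz.2 with h | h
          · exact absurd h1 h
          · have h5 := hGD h
            simp only at h5
            rw [h5, hcan]
        · rfl
  · rintro z ⟨hzQ, hzP'⟩
    beta_reduce
    split_ifs with h1
    · exact hGC h1
    · refine hgC ⟨hzQ, fun hzP => ?_⟩
      by_cases h2 : z = x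
      · apply h1
        rw [h2, ← hcx, add_sub_cancel_left]
        refine ⟨by simp [hlw, abs_of_pos hap, ha1.le], ?_⟩
        simp [hlw, hrp.le]
      · by_cases h3 : z = x'
        · apply h1
          rw [h3, ← hcx', add_sub_cancel_left]
          refine ⟨by simp [hlw, abs_of_pos hap, ha1.le], ?_⟩
          simp [hlw, hrp.le]
        · exact hzP' ⟨hzP, h2, h3⟩

theorem cancel {C : Set E} (hC : IsOpen C) (hSC : SC C) (hdim : 2 ≤ Module.finrank ℝ X) {Q : Set X}
    (hQ : Convex ℝ Q) {P : Finset X} (hPQ : ∀ z ∈ P, z ∈ interior Q) {g : X → E}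
    (hg : ContinuousOn g (Q \ P)) (hgC : MapsTo g (Q \ P) C)
    {x x' : X} (hx : x ∈ P) (hx' : x' ∈ P) (hne : x ≠ x') (hm : Match C g x x') :
    ∃ g' : X → E, ∃ T : Set X, IsClosed T ∧ T ⊆ interior Q ∧ (∀ z ∈ P, z ≠ x → z ≠ x' → z ∉ T) ∧
      (∀ z ∉ T, g' z = g z) ∧ ContinuousOn g' (Q \ {z | z ∈ P ∧ z ≠ x ∧ z ≠ x'}) ∧
      MapsTo g' (Q \ {z | z ∈ P ∧ z ≠ x ∧ z ≠ x'}) C := by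
  classical
  obtain ⟨R0, hR0, hball⟩ : ∃ R0 > 0, Metric.ball x R0 ⊆ interior Q \ (P.erase x : Finset X) := by
    refine Metric.isOpen_iff.1 (isOpen_interior.sdiff (Finset.finite_toSet _).isClosed) x ⟨hPQ x hx, ?_⟩
    simp
  set R := R0 / 2 with hR
  have hRp : 0 < R := by positivity
  -- generic push
  have hthin : Thin (⋃ z : P, (fun t : ℝ => x' - x + t • ((z : X) - x')) '' univ) := by
    refine Thin.iUnion fun z => thin_image_lt (by rw [Module.finrank_self]; omega) fun t _ => ?_
    refine DifferentiableAt.differentiableWithinAt ?_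
    fun_prop
  obtain ⟨v, hv, hvn⟩ := hthin.exists_near 0 (ε := R / 2) (by positivity)
  rw [sub_zero] at hv
  set x1 := x + v with hx1
  have hx1b : x1 ∈ Metric.ball x R0 := by
    rw [Metric.mem_ball, dist_eq_norm, hx1, add_sub_cancel_left]; linarith
  have hx'b : x' ∉ Metric.ball x R0 := fun h => (hball h).2 (by simp [hx', hne.symm])
  have hx1x' : x1 ≠ x' := fun h => hx'b (h ▸ hx1b)
  let χ : X → ℝ := fun z => max 0 (min 1 (2 - 2 * ‖z - x‖ / R))
  have hχc : Continuous χ := by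
    have : Continuous fun z : X => 2 - 2 * ‖z - x‖ / R := by fun_prop
    exact continuous_const.max (continuous_const.min this)
  have hχ0 : ∀ z, 0 ≤ χ z := fun z => le_max_left _ _
  have hχ1 : ∀ z, χ z ≤ 1 := fun z => max_le zero_le_one (min_le_left _ _)
  have hχin : ∀ z, ‖z - x‖ ≤ R / 2 → χ z = 1 := by
    intro z hz
    have : 1 ≤ 2 - 2 * ‖z - x‖ / R := by
      rw [le_sub_comm, div_le_iff₀ hRp]; linarith
    simp only [χ, min_eq_left this]; norm_num
  have hχout : ∀ z, R ≤ ‖z - x‖ → χ z = 0 := by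
    intro z hz
    have : 2 - 2 * ‖z - x‖ / R ≤ 0 := by
      rw [sub_nonpos, le_div_iff₀ hRp]; linarith
    simp only [χ]
    rw [min_eq_right (by linarith), max_eq_left this]
  let φ : X → X := fun z => z - χ z • v
  have hφc : Continuous φ := by fun_prop
  have hχv : ∀ z, ‖χ z • v‖ < R / 2 := by
    intro z
    rw [norm_smul, Real.norm_eq_abs, abs_of_nonneg (hχ0 z)]
    nlinarith [hχ0 z, hχ1 z, norm_nonneg v]
  have hφb : ∀ z, ‖z - x‖ < R → φ z ∈ Metric.ball x R0 := by
    intro z hz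
    rw [Metric.mem_ball, dist_eq_norm]
    have : φ z - x = (z - x) - χ z • v := by simp only [φ]; abel
    rw [this]
    refine (norm_sub_le _ _).trans_lt ?_
    have := hχv z
    linarith
  have hφout : ∀ z, R ≤ ‖z - x‖ → φ z = z := fun z hz => by simp [φ, hχout z hz]
  have hφx : ∀ z, φ z = x → z = x1 := by
    intro z hz
    have h1 : z - x = χ z • v := by
      have : z - χ z • v = x := hz
      rw [← this]; abel
    have h2 : χ z = 1 := hχin z (by rw [h1]; exact (hχv z).le)
    rw [h2, one_smul] at h1
    rw [hx1, ← h1]; abel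
  have hφP : ∀ z, φ z ∈ P → z = x1 ∨ (z ∈ P ∧ z ≠ x) := by
    intro z hz
    rcases lt_or_ge ‖z - x‖ R with h | h
    · left
      have h1 := (hball (hφb z h)).2
      have h2 : φ z = x := by
        by_contra h3
        exact h1 (by simp [h3, hz])
      exact hφx z h2
    · right
      rw [hφout z h] at hz
      refine ⟨hz, ?_⟩
      rintro rfl
      rw [sub_self, norm_zero] at h; linarith
  set P1 : Finset X := insert x1 (P.erase x) with hP1
  have hφm : MapsTo φ (Q \ P1) (Q \ P) := by
    rintro z ⟨hzQ, hzP⟩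
    refine ⟨?_, fun h => hzP ?_⟩
    · rcases lt_or_ge ‖z - x‖ R with h | h
      · exact interior_subset (hball (hφb z h)).1
      · rw [hφout z h]; exact hzQ
    · rw [hP1]
      rcases hφP z h with h | h
      · simp [h]
      · simp [h.1, h.2]
  have hm1 : Match C (fun z => g (φ z)) x1 x' := by
    refine hm.transport ?_ ?_
    · have h1 : ∀ᶠ y in 𝓝 (0:X), ‖v + y‖ < R / 2 := by
        have : ContinuousAt (fun y : X => ‖v + y‖) 0 := by fun_prop
        refine this.eventually_lt continuousAt_const ?_
        simpa using hv
      filter_upwards [h1] with y hy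
      have : χ (x1 + y) = 1 := hχin _ (by rw [hx1, add_assoc, add_sub_cancel_left]; exact hy.le)
      simp only [φ, this, one_smul]
      congr 1; rw [hx1]; abel
    · have h1 : ∀ᶠ y in 𝓝 (0:X), R < ‖x' - x + y‖ := by
        have : ContinuousAt (fun y : X => ‖x' - x + y‖) 0 := by fun_prop
        refine continuousAt_const.eventually_lt this ?_
        rw [Metric.mem_ball, dist_eq_norm, not_lt] at hx'b
        rw [add_zero]; linarith
      filter_upwards [h1] with y hy
      rw [hφout _ (by rw [add_sub_right_comm]; exact hy.le)]
  have hseg : segment ℝ x1 x' ⊆ interior Q :=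
    hQ.interior.segment_subset (hball hx1b).1 (hPQ x' hx')
  have hsegP : ∀ z ∈ P1, z ≠ x1 → z ≠ x' → z ∉ segment ℝ x1 x' := by
    intro z hz h1 h2 h3
    have hzP : z ∈ P := by
      rw [hP1, Finset.mem_insert] at hz
      rcases hz with h | h
      · exact absurd h h1
      · exact Finset.mem_of_mem_erase h
    obtain ⟨p, q, hp, hq, hpq, hz'⟩ := h3
    have hp0 : p ≠ 0 := by
      rintro rfl
      rw [zero_add] at hpq
      rw [hpq, zero_smul, one_smul, zero_add] at hz'
      exact h2 hz'.symm
    refine hvn (mem_iUnion.2 ⟨⟨z, hzP⟩, p⁻¹, mem_univ _, ?_⟩)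
    have hq' : q = 1 - p := by linarith
    have : z - x' = p • (x1 - x') := by rw [← hz', hq']; module
    simp only
    rw [this, smul_smul, inv_mul_cancel₀ hp0, one_smul, hx1]; abel
  obtain ⟨g', T, t1, t2, t3, t4, t5, t6⟩ := cancel_straight hC hSC (Q := Q) (P := P1) (g := fun z => g (φ z))
    (x := x1) (x' := x') (hg.comp hφc.continuousOn hφm) (fun z hz => hgC (hφm hz)) (by simp [hP1])
    (by simp [hP1, hx', hne.symm]) hx1x' hm1 hseg hsegP
  have hsub : Q \ {z | z ∈ P ∧ z ≠ x ∧ z ≠ x'} ⊆ Q \ {z | z ∈ P1 ∧ z ≠ x1 ∧ z ≠ x'} := by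
    rintro z ⟨h1, h2⟩
    refine ⟨h1, fun h3 => h2 ?_⟩
    obtain ⟨h4, h5, h6⟩ := h3
    rw [hP1, Finset.mem_insert, Finset.mem_erase] at h4
    rcases h4 with h4 | h4
    · exact absurd h4 h5
    · exact ⟨h4.2, h4.1, h6⟩
  refine ⟨g', T ∪ Metric.closedBall x R, t1.union Metric.isClosed_closedBall, ?_, ?_, ?_, t5.mono hsub,
    t6.mono_left hsub⟩
  · have hcb : Metric.closedBall x R ⊆ Metric.ball x R0 := Metric.closedBall_subset_ball (by linarith)
    exact union_subset t2 fun z hz => (hball (hcb hz)).1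
  · intro z hz h1 h2 h3
    have hzb : z ∉ Metric.ball x R0 := fun h => (hball h).2 (by simp [hz, h1])
    rcases h3 with h3 | h3
    · exact t3 z (by simp [hP1, hz, h1]) (fun h => hzb (h ▸ hx1b)) h2 h3
    · exact hzb (Metric.closedBall_subset_ball (by linarith) h3)
  · intro z hz
    rw [mem_union, not_or] at hz
    rw [t4 z hz.1]
    have h1 := hz.2
    rw [Metric.mem_closedBall, dist_eq_norm, not_le] at h1
    rw [hφout z h1.le]

/-- removal of all singular points -/
theorem remove_all {C : Set E} (hC : IsOpen C) (hSC : SC C) (hdim : 2 ≤ Module.finrank ℝ X) {Q : Set X}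
    (hQ : Convex ℝ Q) {ι : Type*} [DecidableEq ι] (lab : X → ι) (s : X → ℤ) : ∀ (n : ℕ) (P : Finset X)
    (hn : P.card = n) (hPQ : ∀ z ∈ P, z ∈ interior Q) (g : X → E)
    (hg : ContinuousOn g (Q \ P)) (hgC : MapsTo g (Q \ P) C)
    (hs : ∀ z ∈ P, s z = 1 ∨ s z = -1)
    (hsum : ∀ i, ∑ z ∈ P with lab z = i, s z = 0)
    (hm : ∀ x ∈ P, ∀ x' ∈ P, lab x = lab x' → s x = - s x' → Match C g x x'),
    ∃ g' : X → E, ∃ T : Set X, IsClosed T ∧ T ⊆ interior Q ∧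
      (∀ z ∉ T, g' z = g z) ∧ ContinuousOn g' Q ∧ MapsTo g' Q C := by
  classical
  intro n
  induction n using Nat.strong_induction_on with
  | _ n ih =>
  intro P hn hPQ g hg hgC hs hsum hm
  rcases P.eq_empty_or_nonempty with hP | ⟨x, hx⟩
  · subst hP
    refine ⟨g, ∅, isClosed_empty, empty_subset _, fun _ _ => rfl, ?_, ?_⟩
    · simpa using hg
    · simpa using hgC
  · obtain ⟨x', hx', hl, hss⟩ : ∃ x' ∈ P, lab x = lab x' ∧ s x = - s x' := by
      by_contra hcon
      push Not at hcon
      have h1 : ∀ z ∈ P.filter (fun z => lab z = lab x), s z = s x := by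
        intro z hz
        rw [Finset.mem_filter] at hz
        have := hcon z hz.1 hz.2.symm
        rcases hs z hz.1 with h | h <;> rcases hs x hx with h' | h' <;> rw [h, h'] at this <;> rw [h, h'] <;>
          norm_num at this
      have h2 := hsum (lab x)
      rw [Finset.sum_congr rfl h1, Finset.sum_const, smul_eq_zero] at h2
      rcases h2 with h2 | h2
      · rw [Finset.card_eq_zero] at h2
        have : x ∈ P.filter (fun z => lab z = lab x) := by simp [hx]
        rw [h2] at this; simp at this
      · rcases hs x hx with h' | h' <;> rw [h'] at h2 <;> norm_num at h2
    have hne : x ≠ x' := by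
      rintro rfl
      rcases hs x hx with h' | h' <;> rw [h'] at hss <;> norm_num at hss
    obtain ⟨g1, T1, a1, a2, a3, a4, a5, a6⟩ := cancel hC hSC hdim hQ hPQ hg hgC hx hx' hne (hm x hx x' hx' hl hss)
    set P1 := (P.erase x).erase x' with hP1
    have hPP : ({z | z ∈ P ∧ z ≠ x ∧ z ≠ x'} : Set X) = P1 := by
      ext z; simp [hP1]; tauto
    rw [hPP] at a5 a6
    have hmem : ∀ z ∈ P1, z ∈ P ∧ z ≠ x ∧ z ≠ x' := fun z hz => by
      simp [hP1] at hz; tauto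
    have hev : ∀ z ∈ P1, ∀ᶠ y in 𝓝 (0:X), g1 (z + y) = g (z + y) := by
      intro z hz
      obtain ⟨b1, b2, b3⟩ := hmem z hz
      have h1 : T1ᶜ ∈ 𝓝 z := a1.isOpen_compl.mem_nhds (a3 z b1 b2 b3)
      have h2 : Tendsto (fun y => z + y) (𝓝 (0:X)) (𝓝 z) := by
        have : ContinuousAt (fun y : X => z + y) 0 := by fun_prop
        simpa [ContinuousAt] using this
      filter_upwards [h2 h1] with y hy
      exact a4 _ hy
    have hcard : P1.card < n := by
      rw [← hn]
      exact Finset.card_lt_card ((Finset.ssubset_iff_of_subset ((Finset.erase_subset _ _).trans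
        (Finset.erase_subset _ _))).2 ⟨x, hx, by simp [hP1]⟩)
    obtain ⟨g2, T2, b1, b2, b3, b4, b5⟩ := ih _ hcard P1 rfl (fun z hz => hPQ z (hmem z hz).1) g1 a5 a6
      (fun z hz => hs z (hmem z hz).1) (by
        intro i
        by_cases hi : i = lab x
        · subst hi
          have h3 := hsum (lab x)
          rw [← Finset.add_sum_erase _ _ (show x ∈ P.filter (fun z => lab z = lab x) by simp [hx]),
            ← Finset.add_sum_erase _ _ (show x' ∈ (P.filter (fun z => lab z = lab x)).erase x by
              simp [hx', hne.symm, hl]), ← add_assoc, hss, neg_add_cancel, zero_add] at h3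
          rw [hP1, ← h3]
          congr 1
          ext z; simp; tauto
        · rw [← hsum i]
          congr 1
          ext z; simp [hP1]
          intro h2
          constructor
          · tauto
          · intro h1
            refine ⟨?_, ?_, h1⟩
            · rintro rfl; exact hi (h2.symm.trans hl.symm)
            · rintro rfl; exact hi h2.symm)
      (fun y hy y' hy' h1 h2 => (hm y (hmem y hy).1 y' (hmem y' hy').1 h1 h2).transport (hev y hy) (hev y' hy'))
    refine ⟨g2, T1 ∪ T2, a1.union b1, union_subset a2 b2, fun z hz => ?_, b4, b5⟩
    rw [mem_union, not_or] at hz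
    rw [b3 z hz.2, a4 z hz.1]
end Cancel
end VK

open Set
noncomputable section
namespace VK
set_option linter.unusedVariables false
set_option linter.unusedSectionVars false
set_option linter.deprecated false
set_option linter.unusedSimpArgs false
open Topology Filter MeasureTheory

section
variable {W E : Type*} [NormedAddCommGroup W] [NormedSpace ℝ W] [FiniteDimensional ℝ W]
  [NormedAddCommGroup E] [NormedSpace ℝ E] [FiniteDimensional ℝ E]

/-- complements of low-dimensional sets are simply connected -/
theorem sc_compl {C : Set E} (hC : IsOpen C) {ι : Type*} [Countable ι] (f : ι → W → E) (S : ι → Set W)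
    (hf : ∀ i, ∀ y ∈ S i, DifferentiableAt ℝ (f i) y)
    (hd : Module.finrank ℝ W + 2 < Module.finrank ℝ E)
    (hX : ∀ z ∉ C, ∃ i, ∃ y ∈ S i, f i y = z) : SC C := by
  intro lam hlam hlamC hloop
  have hcpt : IsCompact (lam '' Icc 0 1) := isCompact_Icc.image_of_continuousOn hlam
  obtain ⟨δ, hδ, hth⟩ := hcpt.exists_thickening_subset_open hC hlamC.image_subset
  obtain ⟨l1, hl1, hl1a⟩ := exists_smooth_approx (isCompact_Icc (a := (0:ℝ)) (b := 1)) hlam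
    (show 0 < δ / 3 by positivity)
  let l2 : ℝ → E := fun τ => l1 τ + τ • (l1 0 - l1 1)
  have hl1d : Differentiable ℝ l1 := hl1.differentiable (by simp)
  have hl2d : Differentiable ℝ l2 := by
    intro τ
    exact (hl1d τ).add (differentiableAt_id.smul (differentiableAt_const _))
  have hl2a : ∀ τ ∈ Icc (0:ℝ) 1, ‖l2 τ - lam τ‖ < δ := by
    intro τ hτ
    have h1 := hl1a τ hτ
    have h2 := hl1a 0 (by simp)
    have h3 := hl1a 1 (by simp)
    have e : l2 τ - lam τ = (l1 τ - lam τ) + τ • ((l1 0 - lam 0) - (l1 1 - lam 1)) := by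
      simp only [l2, hloop]; congr 2; abel_nf
    rw [e]
    have h4 : ‖(l1 0 - lam 0) - (l1 1 - lam 1)‖ < δ/3 + δ/3 :=
      (norm_sub_le _ _).trans_lt (by linarith)
    calc _ ≤ ‖l1 τ - lam τ‖ + ‖τ • ((l1 0 - lam 0) - (l1 1 - lam 1))‖ := norm_add_le _ _
      _ ≤ ‖l1 τ - lam τ‖ + ‖(l1 0 - lam 0) - (l1 1 - lam 1)‖ := by
          gcongr
          rw [norm_smul, Real.norm_of_nonneg hτ.1]
          exact mul_le_of_le_one_left (norm_nonneg _) hτ.2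
      _ < _ := by linarith
  -- generic point
  let φ : ι → ℝ × ℝ × W → E := fun i p => p.1⁻¹ • (f i p.2.2 - (1 - p.1) • l2 p.2.1)
  let T : ι → Set (ℝ × ℝ × W) := fun i => {p | p.1 ≠ 0 ∧ p.2.2 ∈ S i}
  have hthin : Thin (⋃ i, φ i '' T i) := by
    refine Thin.iUnion fun i => thin_image_lt ?_ ?_
    · simp only [Module.finrank_prod, Module.finrank_self]; omega
    · rintro ⟨t, τ, y⟩ ⟨h1, h2⟩
      apply DifferentiableAt.differentiableWithinAt
      have a1 : DifferentiableAt ℝ (fun p : ℝ × ℝ × W => p.1⁻¹) (t, τ, y) :=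
        differentiableAt_fst.inv h1
      have a2 : DifferentiableAt ℝ (fun p : ℝ × ℝ × W => f i p.2.2) (t, τ, y) :=
        DifferentiableAt.comp (t, τ, y) (g := f i) (f := fun p : ℝ × ℝ × W => p.2.2) (hf i y h2) (by fun_prop)
      have a3 : DifferentiableAt ℝ (fun p : ℝ × ℝ × W => l2 p.2.1) (t, τ, y) :=
        DifferentiableAt.comp (t, τ, y) (g := l2) (f := fun p : ℝ × ℝ × W => p.2.1) (hl2d _) (by fun_prop)
      have a4 : DifferentiableAt ℝ (fun p : ℝ × ℝ × W => 1 - p.1) (t, τ, y) := by fun_prop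
      exact a1.smul (a2.sub (a4.smul a3))
  obtain ⟨z, -, hz⟩ := hthin.exists_near 0 one_pos
  have hz' : ∀ q : ℝ, q ≠ 0 → ∀ τ, (1 - q) • l2 τ + q • z ∈ C := by
    intro q hq τ
    by_contra hcon
    obtain ⟨i, y, hy, hyz⟩ := hX _ hcon
    apply hz
    refine mem_iUnion.2 ⟨i, (q, τ, y), ⟨hq, hy⟩, ?_⟩
    simp only [φ, hyz]
    rw [add_sub_cancel_left, smul_smul, inv_mul_cancel₀ hq, one_smul]
  have hseg : ∀ τ ∈ Icc (0:ℝ) 1, ∀ p ∈ Icc (0:ℝ) 1, (1 - p) • lam τ + p • l2 τ ∈ C := by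
    intro τ hτ p hp
    apply hth
    rw [Metric.mem_thickening_iff]
    refine ⟨lam τ, mem_image_of_mem _ hτ, ?_⟩
    rw [dist_eq_norm]
    have e : (1 - p) • lam τ + p • l2 τ - lam τ = p • (l2 τ - lam τ) := by
      rw [sub_smul, one_smul, smul_sub]; abel
    rw [e, norm_smul, Real.norm_of_nonneg hp.1]
    exact (mul_le_of_le_one_left (norm_nonneg _) hp.2).trans_lt (hl2a τ hτ)
  refine ⟨fun p => (1 - cl (2 * p.2 - 1)) • ((1 - cl (2 * p.2)) • lam p.1 + cl (2 * p.2) • l2 p.1) +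
    cl (2 * p.2 - 1) • z, ?_, ?_, ?_, ?_, ?_⟩
  · have c1 : ContinuousOn (fun p : ℝ × ℝ => lam p.1) (Icc 0 1 ×ˢ Icc 0 1) :=
      hlam.comp continuousOn_fst (fun p hp => hp.1)
    have c2 : Continuous (fun p : ℝ × ℝ => cl (2 * p.2 - 1)) := cl_cont.comp (by fun_prop)
    have c3 : Continuous (fun p : ℝ × ℝ => cl (2 * p.2)) := cl_cont.comp (by fun_prop)
    have c4 : Continuous (fun p : ℝ × ℝ => l2 p.1) := hl2d.continuous.comp (by fun_prop)
    exact ((continuousOn_const.sub c2.continuousOn).smul (((continuousOn_const.sub c3.continuousOn).smul c1).add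
      (c3.continuousOn.smul c4.continuousOn))).add (c2.continuousOn.smul continuousOn_const)
  · rintro ⟨τ, t⟩ ⟨hτ, ht⟩
    simp only at hτ ht ⊢
    rcases le_total t (1/2) with h | h
    · rw [cl_of_le (show 2 * t - 1 ≤ 0 by linarith)]
      simpa using hseg τ hτ _ (cl_mem (2 * t))
    · rw [cl_of_ge (show 1 ≤ 2 * t by linarith)]
      by_cases hq : cl (2 * t - 1) = 0
      · rw [hq]; simpa using hseg τ hτ 1 (by simp)
      · simpa using hz' _ hq τ
  · intro τ hτ
    simp [cl_of_le (show (-1:ℝ) ≤ 0 by norm_num), cl_of_le (le_refl (0:ℝ))]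
  · intro t ht
    simp only [hloop, l2]; simp
  · intro τ hτ
    have e1 : cl (2 * 1 - 1) = 1 := cl_of_ge (by norm_num)
    simp only [e1]; simp

end
end VK

open Set
noncomputable section
namespace VK
set_option linter.unusedVariables false
set_option linter.unusedSectionVars false
set_option linter.deprecated false
set_option linter.unusedSimpArgs false
open Topology Filter MeasureTheory

section
variable {U W E : Type*} [NormedAddCommGroup W] [NormedSpace ℝ W] [FiniteDimensional ℝ W]
  [NormedAddCommGroup U] [NormedSpace ℝ U] [FiniteDimensional ℝ U]
  [NormedAddCommGroup E] [NormedSpace ℝ E] [FiniteDimensional ℝ E]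

/-- near `h y`, the obstacle is the image of a neighbourhood of `y` -/
def Good (C : Set E) (h : W → E) (y : W) : Prop :=
  ∀ N ∈ 𝓝 y, ∃ V ∈ 𝓝 (h y), ∀ z ∈ V, z ∉ C → z ∈ h '' N

theorem slide_local {C : Set E} {h : W → E} {y0 : W} {T0 : W →L[ℝ] E} (hh : HasStrictFDerivAt h T0 y0)
    (hgood : Good C h y0) {A0 : U →L[ℝ] E} (hinj : Function.Injective (A0.coprod T0)) {K0 : Set U}
    (hK0 : IsCompact K0) (h0 : (0:U) ∉ K0) :
    ∃ δ > 0, ∀ y ∈ Metric.ball y0 δ, ∀ A : U →L[ℝ] E, ‖A - A0‖ < δ → ∀ ε : ℝ, 0 < ε → ε < δ →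
      ∀ u ∈ K0, ∀ e : E, ‖e‖ ≤ δ * ε → h y + ε • A u + e ∈ C := by
  obtain ⟨k, hk, hanti⟩ := LinearMap.exists_antilipschitzWith ((A0.coprod T0 : U × W →L[ℝ] E) : U × W →ₗ[ℝ] E)
    (LinearMap.ker_eq_bot.2 hinj)
  obtain ⟨R, hR0, hR⟩ := hK0.isBounded.exists_pos_norm_le
  obtain ⟨r, hr, hrK⟩ : ∃ r > 0, ∀ u ∈ K0, r ≤ ‖u‖ := by
    have : K0ᶜ ∈ 𝓝 (0:U) := hK0.isClosed.isOpen_compl.mem_nhds h0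
    obtain ⟨r, hr, hrs⟩ := Metric.mem_nhds_iff.1 this
    refine ⟨r, hr, fun u hu => ?_⟩
    by_contra hcon
    exact hrs (by simpa using hcon : u ∈ Metric.ball (0:U) r) hu
  let c : ℝ := (k:ℝ)⁻¹
  have hc : 0 < c := inv_pos.2 (by exact_mod_cast hk)
  have hlow : ∀ u w, c * max ‖u‖ ‖w‖ ≤ ‖A0 u + T0 w‖ := by
    intro u w
    have := hanti.le_mul_dist (u, w) 0
    simp only [map_zero, dist_zero_right, ContinuousLinearMap.coe_coe, ContinuousLinearMap.coprod_apply] at this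
    rw [Prod.norm_def] at this
    simp only [c]
    rw [inv_mul_le_iff₀ (by exact_mod_cast hk)]
    exact this
  have hN : ∃ N ∈ 𝓝 y0, ∀ y ∈ N, ∀ y' ∈ N, ‖h y - h y' - T0 (y - y')‖ ≤ c / 2 * ‖y - y'‖ := by
    have := hh.isLittleO.def (half_pos hc)
    rw [nhds_prod_eq] at this
    obtain ⟨N, hN, hN'⟩ := Filter.mem_prod_same_iff.1 this
    exact ⟨N, hN, fun y hy y' hy' => hN' (⟨hy, hy'⟩ : ((y, y') : W × W) ∈ N ×ˢ N)⟩
  obtain ⟨N, hN, hNs⟩ := hN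
  obtain ⟨V, hV, hVN⟩ := hgood N hN
  obtain ⟨ρ, hρ, hρV⟩ := Metric.mem_nhds_iff.1 hV
  obtain ⟨δ1, hδ1, hδN⟩ := Metric.mem_nhds_iff.1 hN
  obtain ⟨δ2, hδ2, hδh⟩ := Metric.continuousAt_iff.1 hh.hasFDerivAt.continuousAt (ρ/2) (half_pos hρ)
  let δ3 : ℝ := ρ / 2 / ((‖A0‖ + 1) * R + 1) / 2
  let δ4 : ℝ := c * r / (2 * (R + 1)) / 2
  have hδ3 : 0 < δ3 := by positivity
  have hδ4 : 0 < δ4 := by positivity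
  refine ⟨min (min 1 δ1) (min δ2 (min δ3 δ4)), by positivity, ?_⟩
  intro y hy A hA ε hε hεδ u hu e he
  set δ := min (min 1 δ1) (min δ2 (min δ3 δ4)) with hδ
  have d0 : δ ≤ 1 := (min_le_left _ _).trans (min_le_left _ _)
  have d1 : δ ≤ δ1 := (min_le_left _ _).trans (min_le_right _ _)
  have d2 : δ ≤ δ2 := (min_le_right _ _).trans (min_le_left _ _)
  have d3 : δ ≤ δ3 := (min_le_right _ _).trans ((min_le_right _ _).trans (min_le_left _ _))
  have d4 : δ ≤ δ4 := (min_le_right _ _).trans ((min_le_right _ _).trans (min_le_right _ _))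
  have hδp : 0 < δ := by positivity
  by_contra hcon
  have hAu : ‖A u‖ ≤ (‖A0‖ + 1) * R := by
    refine (A.le_opNorm u).trans ?_
    have : ‖A‖ ≤ ‖A0‖ + 1 := by
      have := norm_add_le (A - A0) A0
      rw [sub_add_cancel] at this; linarith
    gcongr
    exact hR u hu
  have hzV : h y + ε • A u + e ∈ V := by
    apply hρV
    rw [Metric.mem_ball, dist_eq_norm]
    have e1 : h y + ε • A u + e - h y0 = (h y - h y0) + (ε • A u + e) := by abel
    rw [e1]
    have i1 : ‖h y - h y0‖ < ρ / 2 := by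
      rw [← dist_eq_norm]; exact hδh (lt_of_lt_of_le hy d2)
    have i2 : ‖ε • A u + e‖ ≤ δ3 * ((‖A0‖ + 1) * R + 1) := by
      calc _ ≤ ‖ε • A u‖ + ‖e‖ := norm_add_le _ _
        _ ≤ ε * ((‖A0‖ + 1) * R) + 1 * ε := by
            rw [norm_smul, Real.norm_of_nonneg hε.le]
            have : δ * ε ≤ 1 * ε := by gcongr
            have h3 := mul_le_mul_of_nonneg_left hAu hε.le
            linarith
        _ = ε * ((‖A0‖ + 1) * R + 1) := by ring
        _ ≤ _ := by gcongr; linarith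
    have i3 : δ3 * ((‖A0‖ + 1) * R + 1) = ρ / 4 := by
      simp only [δ3]; field_simp; norm_num
    have := norm_add_le (h y - h y0) (ε • A u + e)
    linarith
  obtain ⟨y', hy', hyz⟩ := hVN _ hzV hcon
  have hyN : y ∈ N := hδN (Metric.ball_subset_ball d1 hy)
  have k1 := hNs y' hy' y hyN
  rw [hyz] at k1
  have k2 := hlow (ε • u) (-(y' - y))
  have k3 : A0 (ε • u) + T0 (-(y' - y)) = (h y + ε • A u + e - h y - T0 (y' - y)) - (ε • (A - A0) u + e) := by
    simp only [map_neg, map_smul, ContinuousLinearMap.sub_apply, smul_sub]; abel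
  rw [k3] at k2
  have k4 := norm_sub_le (h y + ε • A u + e - h y - T0 (y' - y)) (ε • (A - A0) u + e)
  have k5 : ‖ε • (A - A0) u + e‖ ≤ ε * δ * (R + 1) := by
    calc _ ≤ ‖ε • (A - A0) u‖ + ‖e‖ := norm_add_le _ _
      _ ≤ ε * (δ * R) + δ * ε := by
          rw [norm_smul, Real.norm_of_nonneg hε.le]
          have : ‖(A - A0) u‖ ≤ δ * R := ((A - A0).le_opNorm u).trans (by gcongr; exact hR u hu)
          gcongr
      _ = _ := by ring
  have k6 : ε * r ≤ max ‖ε • u‖ ‖-(y' - y)‖ := by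
    refine le_trans ?_ (le_max_left _ _)
    rw [norm_smul, Real.norm_of_nonneg hε.le]
    gcongr; exact hrK u hu
  have k7 : ‖y' - y‖ ≤ max ‖ε • u‖ ‖-(y' - y)‖ := by rw [norm_neg]; exact le_max_right _ _
  set Mx := max ‖ε • u‖ ‖-(y' - y)‖
  have k8 : c / 2 * Mx ≤ ε * δ * (R + 1) := by
    have := mul_le_mul_of_nonneg_left k7 (half_pos hc).le
    linarith
  have k9 : c / 2 * (ε * r) ≤ ε * δ * (R + 1) := (mul_le_mul_of_nonneg_left k6 (half_pos hc).le).trans k8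
  have k10 : ε * δ * (R + 1) ≤ ε * δ4 * (R + 1) := by gcongr
  have k11 : ε * δ4 * (R + 1) = c / 2 * (ε * r) / 2 := by
    simp only [δ4]; field_simp
  have k12 : 0 < c / 2 * (ε * r) := by positivity
  linarith

/-- eventually homotopic small linear balls -/
def Slide (C : Set E) (h : W → E) (K0 : Set U) (y : W) (A : U →L[ℝ] E) (y' : W) (A' : U →L[ℝ] E) : Prop :=
  ∀ᶠ ε : ℝ in 𝓝[>] 0, Hmt K0 C (fun u => h y + ε • A u) (fun u => h y' + ε • A' u)

theorem Slide.symm {C : Set E} {h : W → E} {K0 : Set U} {y y' : W} {A A' : U →L[ℝ] E}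
    (H : Slide C h K0 y A y' A') : Slide C h K0 y' A' y A := by
  filter_upwards [H] with ε hε using hε.symm

theorem Slide.trans {C : Set E} {h : W → E} {K0 : Set U} {y y' y'' : W} {A A' A'' : U →L[ℝ] E}
    (H : Slide C h K0 y A y' A') (H' : Slide C h K0 y' A' y'' A'') : Slide C h K0 y A y'' A'' := by
  filter_upwards [H, H'] with ε hε hε' using hε.trans hε'

theorem slide_near {C : Set E} {h : W → E} (hcont : Continuous h) {y0 : W} {T0 : W →L[ℝ] E} (hh : HasStrictFDerivAt h T0 y0)
    (hgood : Good C h y0) {A0 : U →L[ℝ] E} (hinj : Function.Injective (A0.coprod T0)) {K0 : Set U}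
    (hK0 : IsCompact K0) (h0 : (0:U) ∉ K0) :
    ∃ δ > 0, ∀ y ∈ Metric.ball y0 δ, ∀ y' ∈ Metric.ball y0 δ, ∀ A ∈ Metric.ball A0 δ, ∀ A' ∈ Metric.ball A0 δ,
      Slide C h K0 y A y' A' := by
  obtain ⟨δ, hδ, H⟩ := slide_local hh hgood hinj hK0 h0
  refine ⟨δ, hδ, fun y hy y' hy' A hA A' hA' => ?_⟩
  filter_upwards [Ioo_mem_nhdsGT hδ] with ε hε
  refine ⟨fun p => h ((1 - p.1) • y + p.1 • y') + ε • (((1 - p.1) • A + p.1 • A') p.2), ?_, ?_, ?_, ?_⟩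
  · apply Continuous.continuousOn
    have : Continuous (fun p : ℝ × U => ((1 - p.1) • A + p.1 • A') p.2) := by
      simp only [ContinuousLinearMap.add_apply, ContinuousLinearMap.smul_apply]
      fun_prop
    fun_prop
  · rintro ⟨t, u⟩ ⟨ht, hu⟩
    simp only at ht hu ⊢
    have m1 : (1 - t) • y + t • y' ∈ Metric.ball y0 δ :=
      (convex_ball y0 δ) hy hy' (by linarith [ht.2]) ht.1 (by ring)
    have m2 : (1 - t) • A + t • A' ∈ Metric.ball A0 δ :=
      (convex_ball A0 δ) hA hA' (by linarith [ht.2]) ht.1 (by ring)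
    have := H _ m1 _ (by rwa [Metric.mem_ball, dist_eq_norm] at m2) ε hε.1 hε.2 u hu 0
      (by rw [norm_zero]; exact (mul_pos hδ hε.1).le)
    rwa [add_zero] at this
  · intro u hu; simp
  · intro u hu; simp

/-- the sign determinant of a transverse frame -/
def dt (J : E ≃L[ℝ] U × W) (T : W →L[ℝ] E) (A : U →L[ℝ] E) : ℝ :=
  ((J : E →L[ℝ] U × W).comp (A.coprod T)).det

theorem dt_inj {J : E ≃L[ℝ] U × W} {T : W →L[ℝ] E} {A : U →L[ℝ] E} (h : dt J T A ≠ 0) :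
    Function.Injective (A.coprod T) := by
  obtain ⟨e, he⟩ := equiv_of_det h
  have : Function.Injective ((J : E →L[ℝ] U × W).comp (A.coprod T)) := by
    rw [← he]; exact e.injective
  intro a b hab
  apply this
  simp only [ContinuousLinearMap.comp_apply, hab]

theorem dt_of_inj (J : E ≃L[ℝ] U × W) {T : W →L[ℝ] E} {A : U →L[ℝ] E}
    (h : Function.Injective (A.coprod T)) : dt J T A ≠ 0 := by
  have h1 : Function.Injective ((J : E →L[ℝ] U × W).comp (A.coprod T)) := by
    rw [ContinuousLinearMap.coe_comp]; exact J.injective.comp h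
  have h2 : LinearMap.ker (((J : E →L[ℝ] U × W).comp (A.coprod T)) : U × W →ₗ[ℝ] U × W) = ⊥ :=
    LinearMap.ker_eq_bot.2 h1
  have h3 := (LinearMap.isUnit_iff_ker_eq_bot _).2 h2
  exact ((LinearMap.isUnit_iff_isUnit_det _).1 h3).ne_zero

theorem dt_cont (J : E ≃L[ℝ] U × W) : Continuous (fun p : (W →L[ℝ] E) × (U →L[ℝ] E) => dt J p.1 p.2) := by
  unfold dt
  apply ContinuousLinearMap.continuous_det.comp
  have : (fun p : (W →L[ℝ] E) × (U →L[ℝ] E) => (J : E →L[ℝ] U × W).comp (p.2.coprod p.1)) =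
      fun p => (J : E →L[ℝ] U × W).comp (p.2.comp (ContinuousLinearMap.fst ℝ U W) +
        p.1.comp (ContinuousLinearMap.snd ℝ U W)) := by
    funext p; congr 1
  rw [this]
  fun_prop

theorem dt_comp (J : E ≃L[ℝ] U × W) (T : W →L[ℝ] E) (A : U →L[ℝ] E) (M : U →L[ℝ] U) :
    dt J T (A.comp M) = dt J T A * M.det := by
  have e : (J : E →L[ℝ] U × W).comp ((A.comp M).coprod T) =
      ((J : E →L[ℝ] U × W).comp (A.coprod T)).comp (M.prodMap (ContinuousLinearMap.id ℝ W)) := by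
    ext u <;> simp
  unfold dt
  rw [e, det_comp_clm]
  congr 1
  have := LinearMap.det_prodMap (M : U →ₗ[ℝ] U) (LinearMap.id : W →ₗ[ℝ] W)
  rw [LinearMap.det_id, mul_one] at this
  exact this

def shear (N : U →L[ℝ] W) : U × W →L[ℝ] U × W :=
  (ContinuousLinearMap.fst ℝ U W).prod (N.comp (ContinuousLinearMap.fst ℝ U W) + ContinuousLinearMap.snd ℝ U W)

theorem shear_comp (N N' : U →L[ℝ] W) : (shear N).comp (shear N') = shear (N + N') := by
  ext u <;> simp [shear] 

theorem shear_zero : shear (0 : U →L[ℝ] W) = ContinuousLinearMap.id ℝ _ := by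
  ext u <;> simp [shear]

theorem shear_det (N : U →L[ℝ] W) : 0 < (shear N).det := by
  have h1 : (shear N).det ≠ 0 := by
    intro h0
    have : ((shear N).comp (shear (-N))).det = 1 := by
      rw [shear_comp, add_neg_cancel, shear_zero]; exact LinearMap.det_id
    rw [det_comp_clm, h0, zero_mul] at this
    exact zero_ne_one this
  have h2 : (shear N).det = (shear ((1/2:ℝ) • N)).det * (shear ((1/2:ℝ) • N)).det := by
    rw [← det_comp_clm, shear_comp, ← add_smul]; norm_num
  rw [h2] at h1 ⊢
  exact lt_of_le_of_ne (mul_self_nonneg _) h1.symm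

theorem dt_shear (J : E ≃L[ℝ] U × W) (T : W →L[ℝ] E) (A : U →L[ℝ] E) (N : U →L[ℝ] W) :
    dt J T (A + T.comp N) = dt J T A * (shear N).det := by
  unfold dt
  rw [← det_comp_clm]
  congr 1
  ext u <;> simp [shear]

theorem dt_path (J : E ≃L[ℝ] U × W) (T : W →L[ℝ] E) (A A' : U →L[ℝ] E) (h : 0 < dt J T A * dt J T A') :
    ∃ γ : ℝ → U →L[ℝ] E, Continuous γ ∧ γ 0 = A ∧ γ 1 = A' ∧ ∀ s ∈ Icc (0:ℝ) 1, dt J T (γ s) ≠ 0 := by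
  have hA : dt J T A ≠ 0 := fun h0 => by rw [h0, zero_mul] at h; exact lt_irrefl _ h
  obtain ⟨e, he⟩ := equiv_of_det hA
  let B : U →L[ℝ] U × W := (e.symm : U × W →L[ℝ] U × W).comp ((J : E →L[ℝ] U × W).comp A')
  let M : U →L[ℝ] U := (ContinuousLinearMap.fst ℝ U W).comp B
  let N : U →L[ℝ] W := (ContinuousLinearMap.snd ℝ U W).comp B
  have hA' : A' = A.comp M + T.comp N := by
    ext u
    apply J.injective
    have h1 : (e : U × W →L[ℝ] U × W) (B u) = J (A' u) := by simp [B]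
    rw [he] at h1
    rw [← h1]
    simp [M, N]
  have hM : 0 < (ContinuousLinearMap.id ℝ U).det * M.det := by
    have h1 : (ContinuousLinearMap.id ℝ U).det = 1 := LinearMap.det_id
    rw [h1, one_mul]
    have h2 : dt J T A' = dt J T A * M.det * (shear N).det := by
      rw [hA', dt_shear, dt_comp]
    rw [h2] at h
    have h3 : 0 < (dt J T A * dt J T A * (shear N).det) * M.det := by nlinarith
    exact pos_of_mul_pos_right h3 (mul_nonneg (mul_self_nonneg _) (shear_det N).le)
  obtain ⟨γ, hγ, g0, g1, gd⟩ := gl_path _ _ hM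
  refine ⟨fun s => A.comp (γ s) + T.comp (s • N), ?_, ?_, ?_, ?_⟩
  · fun_prop
  · simp [g0]
  · simp [g1, hA']
  · intro s hs
    rw [dt_shear, dt_comp]
    exact mul_ne_zero (mul_ne_zero hA (gd s hs)) (shear_det _).ne'

theorem exists_transverse (J : E ≃L[ℝ] U × W) {T : W →L[ℝ] E} (hT : Function.Injective T) :
    ∃ A : U →L[ℝ] E, dt J T A ≠ 0 := by
  obtain ⟨Q, hQ⟩ := Submodule.exists_isCompl (LinearMap.range (T : W →ₗ[ℝ] E))
  have f1 := Submodule.finrank_add_eq_of_isCompl hQ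
  have f2 : Module.finrank ℝ (LinearMap.range (T : W →ₗ[ℝ] E)) = Module.finrank ℝ W :=
    LinearMap.finrank_range_of_inj hT
  have f3 : Module.finrank ℝ E = Module.finrank ℝ U + Module.finrank ℝ W := by
    rw [J.toLinearEquiv.finrank_eq, Module.finrank_prod]
  have f4 : Module.finrank ℝ U = Module.finrank ℝ Q := by omega
  let e : U ≃ₗ[ℝ] Q := LinearEquiv.ofFinrankEq _ _ f4
  refine ⟨LinearMap.toContinuousLinearMap (Q.subtype.comp (e : U →ₗ[ℝ] Q)), dt_of_inj J ?_⟩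
  rw [injective_iff_map_eq_zero]
  rintro ⟨u, w⟩ huw
  simp only [ContinuousLinearMap.coprod_apply, LinearMap.coe_toContinuousLinearMap', LinearMap.comp_apply,
    Submodule.subtype_apply, LinearEquiv.coe_coe] at huw
  have m1 : T w ∈ LinearMap.range (T : W →ₗ[ℝ] E) := ⟨w, rfl⟩
  have m2 : T w ∈ Q := by
    rw [eq_neg_of_add_eq_zero_right huw]; exact Q.neg_mem (e u).2
  have m3 : T w = 0 := by
    have := Submodule.disjoint_def.1 hQ.disjoint _ m1 m2; exact this
  rw [m3, add_zero] at huw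
  have m4 : e u = 0 := Subtype.ext huw
  have m5 : u = 0 := by simpa using m4
  have m6 : w = 0 := hT (by rw [m3, map_zero])
  rw [m5, m6]; rfl

theorem exists_neg_det [Nontrivial U] : ∃ R : U →L[ℝ] U, R.det < 0 := by
  obtain ⟨w, hw⟩ := exists_ne (0:U)
  obtain ⟨l, hl⟩ := SeparatingDual.exists_eq_one (R := ℝ) hw
  exact ⟨_, det_refl_neg l w hl⟩

theorem pos_of_ne_of_not {a b : ℝ} (ha : a ≠ 0) (hb : b ≠ 0) (h : ¬ 0 < a * b) (c : ℝ) (hc : c < 0) :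
    0 < a * (b * c) := by
  have h1 : a * b < 0 := lt_of_le_of_ne (not_lt.1 h) (mul_ne_zero ha hb)
  nlinarith

theorem exists_transverse_sign [Nontrivial U] (J : E ≃L[ℝ] U × W) {T : W →L[ℝ] E} (hT : Function.Injective T) :
    ∃ A B : U →L[ℝ] E, ∀ a : ℝ, a ≠ 0 → 0 < a * dt J T A ∨ 0 < a * dt J T B := by
  obtain ⟨A, hA⟩ := exists_transverse J hT
  obtain ⟨R, hR⟩ := exists_neg_det (U := U)
  refine ⟨A, A.comp R, fun a ha => ?_⟩
  by_cases h : 0 < a * dt J T A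
  · exact Or.inl h
  · right; rw [dt_comp]; exact pos_of_ne_of_not ha hA h _ hR

theorem slide_fiber (J : E ≃L[ℝ] U × W) {C : Set E} {h : W → E} (hh : ContDiff ℝ 1 h) {y : W}
    (hgood : Good C h y) {K0 : Set U} (hK0 : IsCompact K0) (h0 : (0:U) ∉ K0) {A A' : U →L[ℝ] E}
    (hd : 0 < dt J (fderiv ℝ h y) A * dt J (fderiv ℝ h y) A') : Slide C h K0 y A y A' := by
  obtain ⟨γ, hγ, g0, g1, gd⟩ := dt_path J _ A A' hd
  rw [← g0, ← g1]
  refine (isPreconnected_Icc (a := (0:ℝ)) (b := 1)).induction₂ (fun s s' => Slide C h K0 y (γ s) y (γ s'))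
    ?_ (fun _ _ _ _ _ _ => Slide.trans) (fun _ _ _ _ => Slide.symm) (left_mem_Icc.2 zero_le_one)
    (right_mem_Icc.2 zero_le_one)
  intro s hs
  obtain ⟨δ, hδ, H⟩ := slide_near hh.continuous (hh.hasStrictFDerivAt (by simp)) hgood (dt_inj (gd s hs)) hK0 h0
  have : ∀ᶠ s' in 𝓝 s, γ s' ∈ Metric.ball (γ s) δ := hγ.continuousAt.eventually (Metric.ball_mem_nhds _ hδ)
  filter_upwards [nhdsWithin_le_nhds this] with s' hs'
  exact H y (Metric.mem_ball_self hδ) y (Metric.mem_ball_self hδ) _ (Metric.mem_ball_self hδ) _ hs'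

theorem slide_all [Nontrivial U] (J : E ≃L[ℝ] U × W) {C : Set E} {h : W → E} (hh : ContDiff ℝ 1 h) {S : Set W}
    (hS : IsPreconnected S) (hgood : ∀ y ∈ S, Good C h y) (hinj : ∀ y ∈ S, Function.Injective (fderiv ℝ h y))
    {K0 : Set U} (hK0 : IsCompact K0) (h0 : (0:U) ∉ K0) {y y' : W} (hy : y ∈ S) (hy' : y' ∈ S) {A A' : U →L[ℝ] E}
    (hd : 0 < dt J (fderiv ℝ h y) A * dt J (fderiv ℝ h y') A') : Slide C h K0 y A y' A' := by
  suffices H : ∀ A A' : U →L[ℝ] E, 0 < dt J (fderiv ℝ h y) A * dt J (fderiv ℝ h y') A' →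
      Slide C h K0 y A y' A' from H A A' hd
  have hTc : Continuous (fun z => fderiv ℝ h z) := hh.continuous_fderiv (by simp)
  refine hS.induction₂ (fun y y' => ∀ A A' : U →L[ℝ] E, 0 < dt J (fderiv ℝ h y) A * dt J (fderiv ℝ h y') A' →
      Slide C h K0 y A y' A') ?_ ?_ ?_ hy hy'
  · intro z hz
    obtain ⟨A0, A1, hs⟩ := exists_transverse_sign (U := U) J (hinj z hz)
    have key : ∀ B : U →L[ℝ] E, ∀ᶠ z' in 𝓝[S] z, dt J (fderiv ℝ h z) B ≠ 0 → 0 < dt J (fderiv ℝ h z) B * dt J (fderiv ℝ h z') B ∧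
        Slide C h K0 z B z' B := by
      intro B
      by_cases hB : dt J (fderiv ℝ h z) B = 0
      · simp [hB]
      obtain ⟨δ, hδ, H⟩ := slide_near hh.continuous (hh.hasStrictFDerivAt (by simp)) (hgood z hz) (dt_inj hB) hK0 h0
      have c1 : ContinuousAt (fun z' => dt J (fderiv ℝ h z) B * dt J (fderiv ℝ h z') B) z := by
        have : Continuous (fun z' => dt J (fderiv ℝ h z') B) :=
          (dt_cont J).comp (hTc.prodMk continuous_const)
        exact (continuous_const.mul this).continuousAt
      have c2 := c1.eventually (lt_mem_nhds (lt_of_le_of_ne (mul_self_nonneg _) (mul_self_ne_zero.2 hB).symm))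
      filter_upwards [nhdsWithin_le_nhds c2, nhdsWithin_le_nhds (Metric.ball_mem_nhds z hδ)] with z' h1 h2 _
      exact ⟨h1, H z (Metric.mem_ball_self hδ) z' h2 _ (Metric.mem_ball_self hδ) _ (Metric.mem_ball_self hδ)⟩
    filter_upwards [key A0, key A1, self_mem_nhdsWithin] with z' k0 k1 hz' A A' hAA
    have fin : ∀ B : U →L[ℝ] E, 0 < dt J (fderiv ℝ h z) A * dt J (fderiv ℝ h z) B →
        0 < dt J (fderiv ℝ h z) B * dt J (fderiv ℝ h z') B → Slide C h K0 z B z' B → Slide C h K0 z A z' A' := by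
      intro B h1 h2 h3
      refine (slide_fiber J hh (hgood z hz) hK0 h0 h1).trans (h3.trans (slide_fiber J hh (hgood z' hz') hK0 h0 ?_))
      have h4 := mul_pos (mul_pos h1 h2) hAA
      have h5 : 0 < (dt J (fderiv ℝ h z) A * dt J (fderiv ℝ h z) B) ^ 2 *
          (dt J (fderiv ℝ h z') B * dt J (fderiv ℝ h z') A') := by
        have := mul_pos h1 h4
        nlinarith [mul_self_nonneg (dt J (fderiv ℝ h z) A)]
      exact pos_of_mul_pos_right h5 (sq_nonneg _)
    have hA0 : dt J (fderiv ℝ h z) A ≠ 0 := fun h0 => by rw [h0, zero_mul] at hAA; exact lt_irrefl _ hAA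
    rcases hs _ hA0 with h' | h'
    · have hn : dt J (fderiv ℝ h z) A0 ≠ 0 := fun h0 => by rw [h0, mul_zero] at h'; exact lt_irrefl _ h'
      exact fin _ h' (k0 hn).1 (k0 hn).2
    · have hn : dt J (fderiv ℝ h z) A1 ≠ 0 := fun h0 => by rw [h0, mul_zero] at h'; exact lt_irrefl _ h'
      exact fin _ h' (k1 hn).1 (k1 hn).2
  · intro x z w hx hz hw h1 h2 A A' hAA
    obtain ⟨A0, A1, hs⟩ := exists_transverse_sign (U := U) J (hinj z hz)
    have fin : ∀ B : U →L[ℝ] E, 0 < dt J (fderiv ℝ h x) A * dt J (fderiv ℝ h z) B → Slide C h K0 x A w A' := by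
      intro B hB
      refine (h1 A B hB).trans (h2 B A' ?_)
      have h5 : 0 < (dt J (fderiv ℝ h x) A) ^ 2 *
          (dt J (fderiv ℝ h z) B * dt J (fderiv ℝ h w) A') := by
        have := mul_pos hB hAA
        nlinarith
      exact pos_of_mul_pos_right h5 (sq_nonneg _)
    have hA0 : dt J (fderiv ℝ h x) A ≠ 0 := fun h0 => by rw [h0, zero_mul] at hAA; exact lt_irrefl _ hAA
    rcases hs _ hA0 with h | h
    · exact fin _ h
    · exact fin _ h
  · intro x z hx hz h1 A A' hAA
    exact (h1 A' A (by rwa [mul_comm])).symm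

theorem slide_end {C : Set E} {h : W → E} (hh : ContDiff ℝ 1 h) {y : W} (hgood : Good C h y)
    {K0 : Set U} (hK0 : IsCompact K0) (h0 : (0:U) ∉ K0) {g : U → E} {x : U} {L : U →L[ℝ] E}
    (hg : HasFDerivAt g L x) (hgc : ∀ᶠ z in 𝓝 x, ContinuousAt g z) (hxy : g x = h y) (B : U →L[ℝ] U)
    (hinj : Function.Injective ((L.comp B).coprod (fderiv ℝ h y))) :
    ∀ᶠ ε : ℝ in 𝓝[>] 0, Hmt K0 C (fun u => g (x + ε • B u)) (fun u => h y + ε • (L.comp B) u) := by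
  obtain ⟨δ, hδ, H⟩ := slide_local (hh.hasStrictFDerivAt (by simp)) hgood hinj hK0 h0
  obtain ⟨R, hR0, hR⟩ := hK0.isBounded.exists_pos_norm_le
  have hRB : 0 < ‖B‖ * R + 1 := by positivity
  have hlo : ∀ᶠ z in 𝓝 (0:U), ‖g (x + z) - g x - L z‖ ≤ δ / (‖B‖ * R + 1) * ‖z‖ :=
    (hasFDerivAt_iff_isLittleO_nhds_zero.1 hg).def (by positivity)
  have hgc' : ∀ᶠ z in 𝓝 (0:U), ContinuousAt g (x + z) := by
    have : Tendsto (fun z : U => x + z) (𝓝 0) (𝓝 x) := by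
      have : Continuous (fun z : U => x + z) := by fun_prop
      simpa using this.tendsto 0
    exact this.eventually hgc
  obtain ⟨ε1, hε1, hsm⟩ := small_nbhd (hK0.image B.continuous) (hlo.and hgc')
  filter_upwards [Ioo_mem_nhdsGT hδ, Ioo_mem_nhdsGT hε1] with ε h1 h2
  have hsm' : ∀ u ∈ K0, ‖g (x + ε • B u) - g x - L (ε • B u)‖ ≤ δ / (‖B‖ * R + 1) * ‖ε • B u‖ ∧
    ContinuousAt g (x + ε • B u) := fun u hu => hsm ε h2.1 h2.2 (B u) (mem_image_of_mem _ hu)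
  apply Hmt.segment
  · intro u hu
    apply ContinuousAt.continuousWithinAt
    exact ContinuousAt.comp (f := fun u => x + ε • B u) (g := g) (x := u) (hsm' u hu).2 (by fun_prop)
  · fun_prop
  · intro u hu t ht
    have e1 : (1 - t) • g (x + ε • B u) + t • (h y + ε • (L.comp B) u) =
        h y + ε • (L.comp B) u + (1 - t) • (g (x + ε • B u) - g x - L (ε • B u)) := by
      simp only [hxy, ContinuousLinearMap.comp_apply, map_smul]; module
    rw [e1]
    apply H y (Metric.mem_ball_self hδ) _ (by simpa using hδ) ε h1.1 h1.2 u hu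
    rw [norm_smul, Real.norm_of_nonneg (by linarith [ht.2])]
    have i1 : ‖ε • B u‖ ≤ ε * (‖B‖ * R) := by
      rw [norm_smul, Real.norm_of_nonneg h1.1.le]
      have : ‖B u‖ ≤ ‖B‖ * R := (B.le_opNorm u).trans (by gcongr; exact hR u hu)
      have := h1.1
      gcongr
    calc (1 - t) * ‖g (x + ε • B u) - g x - L (ε • B u)‖ ≤ 1 * ‖g (x + ε • B u) - g x - L (ε • B u)‖ := by
          gcongr; linarith [ht.1]
      _ ≤ δ / (‖B‖ * R + 1) * ‖ε • B u‖ := by rw [one_mul]; exact (hsm' u hu).1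
      _ ≤ δ / (‖B‖ * R + 1) * (ε * (‖B‖ * R + 1)) := by
          gcongr
          refine i1.trans ?_
          have := h1.1
          gcongr; linarith
      _ = δ * ε := by field_simp

/-- matching of two singular points whose images are joined by a path in the obstacle -/
theorem match_of_slide (hU : 2 ≤ Module.finrank ℝ U) (J : E ≃L[ℝ] U × W) {C : Set E} {h : W → E} (hh : ContDiff ℝ 1 h) {S : Set W}
    (hS : IsPreconnected S) (hgood : ∀ y ∈ S, Good C h y) (hinj : ∀ y ∈ S, Function.Injective (fderiv ℝ h y))
    {g : U → E} {x x' : U} {L L' : U →L[ℝ] E} (hg : HasFDerivAt g L x) (hg' : HasFDerivAt g L' x')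
    (hgc : ∀ᶠ z in 𝓝 x, ContinuousAt g z) (hgc' : ∀ᶠ z in 𝓝 x', ContinuousAt g z)
    {y y' : W} (hy : y ∈ S) (hy' : y' ∈ S) (hxy : g x = h y) (hxy' : g x' = h y')
    (hd : dt J (fderiv ℝ h y) L * dt J (fderiv ℝ h y') L' < 0) : Match C g x x' := by
  intro K0 hK0 h0 M hM
  have : Nontrivial U := Module.nontrivial_of_finrank_pos (R := ℝ) (by omega)
  have n1 : dt J (fderiv ℝ h y) L ≠ 0 := fun h0 => by rw [h0, zero_mul] at hd; exact lt_irrefl _ hd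
  have n2 : dt J (fderiv ℝ h y') L' ≠ 0 := fun h0 => by rw [h0, mul_zero] at hd; exact lt_irrefl _ hd
  have e1 := slide_end hh (hgood y hy) hK0 h0 hg hgc hxy (ContinuousLinearMap.id ℝ U)
    (by rw [ContinuousLinearMap.comp_id]; exact dt_inj n1)
  have e2 := slide_end hh (hgood y' hy') hK0 h0 hg' hgc' hxy' M
    (dt_inj (J := J) (by rw [dt_comp]; exact mul_ne_zero n2 hM.ne))
  have e3 := slide_all J hh hS hgood hinj hK0 h0 hy hy' (A := L) (A' := L'.comp M)
    (by rw [dt_comp]; nlinarith)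
  have := (e1.and (e2.and e3))
  rw [eventually_nhdsWithin_iff, Metric.eventually_nhds_iff] at this
  obtain ⟨ε0, hε0, H⟩ := this
  refine ⟨ε0, hε0, fun ε h1 h2 => ?_⟩
  obtain ⟨q1, q2, q3⟩ := H (y := ε) (by rwa [Real.dist_0_eq_abs, abs_of_pos h1]) h1
  exact (q1.trans q3).trans q2.symm

end
end VK

open Set
noncomputable section
namespace VK
set_option linter.unusedVariables false
set_option linter.unusedSectionVars false
set_option linter.deprecated false
set_option linter.unusedSimpArgs false
open Topology Filter MeasureTheory

section
variable {V : Type*} [Fintype V] [DecidableEq V]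

/-- the geometric simplex spanned by `s` in barycentric coordinates -/
def Dl (s : Finset V) : Set (V → ℝ) := {w | (∀ v, 0 ≤ w v) ∧ ∑ v, w v = 1 ∧ ∀ v ∉ s, w v = 0}

theorem Dl_mono {s t : Finset V} (h : s ⊆ t) : Dl s ⊆ Dl t :=
  fun w hw => ⟨hw.1, hw.2.1, fun v hv => hw.2.2 v (fun h' => hv (h h'))⟩

theorem Dl_inter {s t : Finset V} {w : V → ℝ} (h : w ∈ Dl s) (h' : w ∈ Dl t) : w ∈ Dl (s ∩ t) := by
  refine ⟨h.1, h.2.1, fun v hv => ?_⟩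
  rw [Finset.mem_inter, not_and_or] at hv
  exact hv.elim (h.2.2 v) (h'.2.2 v)

theorem Dl_sum {s : Finset V} {w : V → ℝ} (h : w ∈ Dl s) : ∑ v ∈ s, w v = 1 := by
  rw [← h.2.1]
  exact Finset.sum_subset (Finset.subset_univ _) (fun v _ hv => h.2.2 v hv)

theorem Dl_pos {s : Finset V} {w : V → ℝ} (h : w ∈ Dl s) : ∃ v ∈ s, 0 < w v := by
  by_contra hcon
  push Not at hcon
  have : ∑ v ∈ s, w v ≤ 0 := Finset.sum_nonpos hcon
  rw [Dl_sum h] at this; linarith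

theorem Dl_disj {s t : Finset V} (hst : Disjoint s t) {x y : V → ℝ} (hx : x ∈ Dl s) (hy : y ∈ Dl t) :
    ∃ v ∈ s, 0 < x v ∧ y v = 0 := by
  obtain ⟨v, hv, h⟩ := Dl_pos hx
  exact ⟨v, hv, h, hy.2.2 v (Finset.disjoint_left.1 hst hv)⟩

theorem Dl_disj_ne {s t : Finset V} (hst : Disjoint s t) {x y : V → ℝ} (hx : x ∈ Dl s) (hy : y ∈ Dl t) :
    x - y ≠ 0 := by
  obtain ⟨v, hv, h1, h2⟩ := Dl_disj hst hx hy
  intro h0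
  have := congrFun h0 v
  simp only [Pi.sub_apply, h2, Pi.zero_apply] at this; linarith

theorem Dl_convex (s : Finset V) : Convex ℝ (Dl s) := by
  intro x hx y hy a b ha hb hab
  refine ⟨fun v => ?_, ?_, fun v hv => ?_⟩
  · have := hx.1 v; have := hy.1 v
    simp only [Pi.add_apply, Pi.smul_apply, smul_eq_mul]; positivity
  · simp only [Pi.add_apply, Pi.smul_apply, smul_eq_mul, Finset.sum_add_distrib, ← Finset.mul_sum, hx.2.1, hy.2.1]
    linarith
  · simp [hx.2.2 v hv, hy.2.2 v hv]

theorem Dl_closed (s : Finset V) : IsClosed (Dl s) := by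
  have : Dl s = (⋂ v, {w : V → ℝ | 0 ≤ w v}) ∩ ({w : V → ℝ | ∑ v, w v = 1} ∩ ⋂ v, ⋂ (_ : v ∉ s), {w : V → ℝ | w v = 0}) := by
    ext w; simp [Dl]
  rw [this]
  refine (isClosed_iInter fun v => isClosed_le continuous_const (continuous_apply v)).inter
    ((isClosed_eq (by fun_prop) continuous_const).inter (isClosed_iInter fun v => isClosed_iInter fun _ =>
      isClosed_eq (continuous_apply v) continuous_const))

theorem Dl_le_one {s : Finset V} {w : V → ℝ} (h : w ∈ Dl s) (v : V) : w v ≤ 1 := by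
  rw [← h.2.1]; exact Finset.single_le_sum (fun u _ => h.1 u) (Finset.mem_univ v)

theorem Dl_compact (s : Finset V) : IsCompact (Dl s) := by
  refine (isCompact_univ_pi (fun _ : V => isCompact_Icc (a := (0:ℝ)) (b := 1))).of_isClosed_subset (Dl_closed s) ?_
  intro w hw v _
  exact ⟨hw.1 v, Dl_le_one hw v⟩

variable {k : ℕ}

/-- the standard solid simplex -/
def St (k : ℕ) : Set (Fin k → ℝ) := {x | (∀ i, 0 ≤ x i) ∧ ∑ i, x i ≤ 1}
/-- the open standard simplex -/
def So (k : ℕ) : Set (Fin k → ℝ) := {x | (∀ i, 0 < x i) ∧ ∑ i, x i < 1}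

theorem So_open : IsOpen (So k) := by
  have : So k = (⋂ i, {x : Fin k → ℝ | 0 < x i}) ∩ {x : Fin k → ℝ | ∑ i, x i < 1} := by
    ext x; simp [So]
  rw [this]
  exact (isOpen_iInter_of_finite fun i => isOpen_lt continuous_const (continuous_apply i)).inter
    (isOpen_lt (by fun_prop) continuous_const)

theorem So_subset : So k ⊆ St k := fun x hx => ⟨fun i => (hx.1 i).le, hx.2.le⟩

theorem So_subset_interior : So k ⊆ interior (St k) := interior_maximal So_subset So_open

theorem St_convex : Convex ℝ (St k) := by
  intro x hx y hy a b ha hb hab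
  refine ⟨fun v => ?_, ?_⟩
  · have := hx.1 v; have := hy.1 v
    simp only [Pi.add_apply, Pi.smul_apply, smul_eq_mul]; positivity
  · simp only [Pi.add_apply, Pi.smul_apply, smul_eq_mul, Finset.sum_add_distrib, ← Finset.mul_sum]
    have := hx.2; have := hy.2
    nlinarith

theorem So_convex : Convex ℝ (So k) := by
  intro x hx y hy a b ha hb hab
  have hab' : 0 < a ∨ 0 < b := by
    rcases ha.eq_or_lt with h | h
    · right; linarith
    · exact Or.inl h
  refine ⟨fun v => ?_, ?_⟩
  · have := hx.1 v; have := hy.1 v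
    simp only [Pi.add_apply, Pi.smul_apply, smul_eq_mul]
    rcases hab' with h | h <;> positivity
  · simp only [Pi.add_apply, Pi.smul_apply, smul_eq_mul, Finset.sum_add_distrib, ← Finset.mul_sum]
    have := hx.2; have := hy.2
    rcases hab' with h | h <;> nlinarith

theorem St_closed : IsClosed (St k) := by
  have : St k = (⋂ i, {x : Fin k → ℝ | 0 ≤ x i}) ∩ {x : Fin k → ℝ | ∑ i, x i ≤ 1} := by
    ext x; simp [St]
  rw [this]
  exact (isClosed_iInter fun i => isClosed_le continuous_const (continuous_apply i)).inter
    (isClosed_le (by fun_prop) continuous_const)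

theorem St_compact : IsCompact (St k) := by
  refine (isCompact_univ_pi (fun _ : Fin k => isCompact_Icc (a := (0:ℝ)) (b := 1))).of_isClosed_subset St_closed ?_
  intro w hw v _
  exact ⟨hw.1 v, (Finset.single_le_sum (fun u _ => hw.1 u) (Finset.mem_univ v)).trans hw.2⟩

def hat (x : Fin k → ℝ) : Fin (k+1) → ℝ := Fin.cons (1 - ∑ i, x i) x

theorem hat_zero (x : Fin k → ℝ) : hat x 0 = 1 - ∑ i, x i := rfl
theorem hat_succ (x : Fin k → ℝ) (i : Fin k) : hat x i.succ = x i := by simp [hat]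
theorem hat_sum (x : Fin k → ℝ) : ∑ i, hat x i = 1 := by
  rw [Fin.sum_univ_succ]; simp [hat_zero, hat_succ]
theorem hat_nonneg {x : Fin k → ℝ} (hx : x ∈ St k) (i : Fin (k+1)) : 0 ≤ hat x i := by
  refine Fin.cases ?_ (fun j => ?_) i
  · rw [hat_zero]; linarith [hx.2]
  · rw [hat_succ]; exact hx.1 j
theorem mem_St_of_hat {x : Fin k → ℝ} (h : ∀ i, 0 ≤ hat x i) : x ∈ St k :=
  ⟨fun i => by simpa [hat_succ] using h i.succ, by have := h 0; rw [hat_zero] at this; linarith⟩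
theorem mem_So_of_hat {x : Fin k → ℝ} (h : ∀ i, 0 < hat x i) : x ∈ So k :=
  ⟨fun i => by simpa [hat_succ] using h i.succ, by have := h 0; rw [hat_zero] at this; linarith⟩
theorem hat_pos {x : Fin k → ℝ} (hx : x ∈ So k) (i : Fin (k+1)) : 0 < hat x i := by
  refine Fin.cases ?_ (fun j => ?_) i
  · rw [hat_zero]; linarith [hx.2]
  · rw [hat_succ]; exact hx.1 j

def sp (e : Fin (k+1) → V) : (Fin (k+1) → ℝ) →L[ℝ] (V → ℝ) :=
  ∑ i, (ContinuousLinearMap.proj (R := ℝ) (φ := fun _ : Fin (k+1) => ℝ) i).smulRight (Pi.single (e i) (1:ℝ))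

theorem sp_apply (e : Fin (k+1) → V) (a : Fin (k+1) → ℝ) (v : V) :
    sp e a v = ∑ i, if e i = v then a i else 0 := by
  simp only [sp, ContinuousLinearMap.sum_apply, ContinuousLinearMap.smulRight_apply, Finset.sum_apply,
    Pi.smul_apply, smul_eq_mul, ContinuousLinearMap.proj_apply, Pi.single_apply, mul_ite, mul_one, mul_zero]
  exact Finset.sum_congr rfl fun i _ => by simp only [eq_comm]

theorem sp_inj {e : Fin (k+1) → V} (he : Function.Injective e) (a : Fin (k+1) → ℝ) (i : Fin (k+1)) :
    sp e a (e i) = a i := by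
  rw [sp_apply]; simp [he.eq_iff]

theorem sp_off {e : Fin (k+1) → V} (a : Fin (k+1) → ℝ) {v : V} (hv : ∀ i, e i ≠ v) : sp e a v = 0 := by
  rw [sp_apply]; simp [hv]

theorem sp_sum (e : Fin (k+1) → V) (a : Fin (k+1) → ℝ) : ∑ v, sp e a v = ∑ i, a i := by
  simp only [sp_apply]; rw [Finset.sum_comm]; simp

/-- linear part of the barycentric chart -/
def hatl (k : ℕ) : (Fin k → ℝ) →L[ℝ] (Fin (k+1) → ℝ) :=
  ContinuousLinearMap.pi (Fin.cons (-∑ i, ContinuousLinearMap.proj i) (fun i => ContinuousLinearMap.proj i))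

theorem hatl_zero (x : Fin k → ℝ) : hatl k x 0 = - ∑ i, x i := by
  simp [hatl]
theorem hatl_succ (x : Fin k → ℝ) (i : Fin k) : hatl k x i.succ = x i := by simp [hatl]
theorem hatl_sum (x : Fin k → ℝ) : ∑ i, hatl k x i = 0 := by
  rw [Fin.sum_univ_succ]; simp [hatl_zero, hatl_succ]

theorem hat_eq (x : Fin k → ℝ) : hat x = Pi.single 0 1 + hatl k x := by
  funext i
  refine Fin.cases ?_ (fun j => ?_) i
  · simp [hat_zero, hatl_zero]; ring
  · simp [hat_succ, hatl_succ]

def lin (e : Fin (k+1) → V) : (Fin k → ℝ) →L[ℝ] (V → ℝ) := (sp e).comp (hatl k)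
/-- barycentric chart -/
def bc (e : Fin (k+1) → V) (x : Fin k → ℝ) : V → ℝ := sp e (hat x)
/-- coordinates -/
def co (e : Fin (k+1) → V) : (V → ℝ) →L[ℝ] (Fin k → ℝ) :=
  ContinuousLinearMap.pi (fun i => ContinuousLinearMap.proj (e i.succ))

theorem co_apply (e : Fin (k+1) → V) (w : V → ℝ) (i : Fin k) : co e w i = w (e i.succ) := by simp [co]

theorem bc_eq (e : Fin (k+1) → V) : bc e = fun x => sp e (Pi.single 0 1) + lin e x := by
  funext x; simp only [bc, hat_eq, map_add, lin, ContinuousLinearMap.comp_apply]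

theorem bc_hasFDerivAt (e : Fin (k+1) → V) (x : Fin k → ℝ) : HasFDerivAt (bc e) (lin e) x := by
  rw [bc_eq]; exact (lin e).hasFDerivAt.const_add _

theorem bc_contDiff (e : Fin (k+1) → V) {n : WithTop ℕ∞} : ContDiff ℝ n (bc e) := by
  rw [bc_eq]; exact contDiff_const.add (lin e).contDiff

theorem bc_cont (e : Fin (k+1) → V) : Continuous (bc e) := (bc_contDiff e (n := 1)).continuous

theorem bc_sub (e : Fin (k+1) → V) (x y : Fin k → ℝ) : bc e x - bc e y = lin e (x - y) := by
  rw [bc_eq]; simp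

theorem bc_sum (e : Fin (k+1) → V) (x : Fin k → ℝ) : ∑ v, bc e x v = 1 := by
  rw [bc, sp_sum, hat_sum]

theorem lin_sum (e : Fin (k+1) → V) (x : Fin k → ℝ) : ∑ v, lin e x v = 0 := by
  rw [lin, ContinuousLinearMap.comp_apply, sp_sum, hatl_sum]

theorem bc_off {e : Fin (k+1) → V} (x : Fin k → ℝ) {v : V} (hv : v ∉ Finset.univ.image e) : bc e x v = 0 :=
  sp_off _ (fun i hi => hv (by simp only [Finset.mem_image, Finset.mem_univ, true_and]; exact ⟨i, hi⟩))

theorem lin_off {e : Fin (k+1) → V} (x : Fin k → ℝ) {v : V} (hv : v ∉ Finset.univ.image e) : lin e x v = 0 :=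
  sp_off _ (fun i hi => hv (by simp only [Finset.mem_image, Finset.mem_univ, true_and]; exact ⟨i, hi⟩))

theorem bc_mem (e : Fin (k+1) → V) {x : Fin k → ℝ} (hx : x ∈ St k) : bc e x ∈ Dl (Finset.univ.image e) := by
  refine ⟨fun v => ?_, bc_sum e x, fun v hv => bc_off x hv⟩
  rw [bc, sp_apply]
  refine Finset.sum_nonneg fun i _ => ?_
  split_ifs
  · exact hat_nonneg hx i
  · exact le_rfl

theorem bc_surj (e : Fin (k+1) → V) {w : V → ℝ} (hw : w ∈ Dl (Finset.univ.image e)) :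
    ∃ x ∈ St k, bc e x = w := by
  have hex : ∀ v ∈ Finset.univ.image e, ∃ i, e i = v := by
    intro v hv; simpa using hv
  choose! sct hsct using hex
  let a : Fin (k+1) → ℝ := fun i => if sct (e i) = i then w (e i) else 0
  have hspa : sp e a = w := by
    funext v
    rw [sp_apply]
    by_cases hv : v ∈ Finset.univ.image e
    · rw [Finset.sum_eq_single (sct v)]
      · simp only [a]; rw [if_pos (hsct v hv), hsct v hv, if_pos rfl]
      · intro i _ hi
        split_ifs with h
        · simp only [a]; rw [if_neg]; rw [h]; exact fun h' => hi h'.symm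
        · rfl
      · simp
    · rw [hw.2.2 v hv]
      refine Finset.sum_eq_zero fun i _ => if_neg ?_
      rintro rfl
      exact hv (by simp)
  have hasum : ∑ i, a i = 1 := by rw [← sp_sum e, hspa]; exact hw.2.1
  let x : Fin k → ℝ := fun i => a i.succ
  have hx : hat x = a := by
    funext i
    refine Fin.cases ?_ (fun j => ?_) i
    · rw [hat_zero]; rw [Fin.sum_univ_succ] at hasum; simp only [x]; linarith
    · rw [hat_succ]
  refine ⟨x, mem_St_of_hat fun i => ?_, by rw [bc, hx, hspa]⟩
  rw [hx]; simp only [a]; split_ifs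
  · exact hw.1 _
  · exact le_rfl

variable {e : Fin (k+1) → V}

theorem bc_apply (he : Function.Injective e) (x : Fin k → ℝ) (i : Fin (k+1)) : bc e x (e i) = hat x i :=
  sp_inj he _ i

theorem co_bc (he : Function.Injective e) (x : Fin k → ℝ) : co e (bc e x) = x := by
  funext i; rw [co_apply, bc_apply he, hat_succ]

theorem co_lin (he : Function.Injective e) (x : Fin k → ℝ) : co e (lin e x) = x := by
  funext i
  rw [co_apply, lin, ContinuousLinearMap.comp_apply, sp_inj he, hatl_succ]

theorem bc_co (he : Function.Injective e) {w : V → ℝ} (hw : w ∈ Dl (Finset.univ.image e)) : bc e (co e w) = w := by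
  obtain ⟨x, hx, rfl⟩ := bc_surj e hw
  rw [co_bc he]

theorem co_mem (he : Function.Injective e) {w : V → ℝ} (hw : w ∈ Dl (Finset.univ.image e)) : co e w ∈ St k := by
  obtain ⟨x, hx, rfl⟩ := bc_surj e hw
  rwa [co_bc he]

theorem lin_co (he : Function.Injective e) {z : V → ℝ} (hz : ∀ v ∉ Finset.univ.image e, z v = 0) (hs : ∑ v, z v = 0) :
    lin e (co e z) = z := by
  have h1 : sp e (fun i => z (e i)) = z := by
    funext v
    by_cases hv : v ∈ Finset.univ.image e
    · obtain ⟨i, -, rfl⟩ := Finset.mem_image.1 hv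
      rw [sp_inj he]
    · rw [hz v hv, sp_off]
      rintro i rfl; exact hv (by simp)
  have h2 : hatl k (co e z) = fun i => z (e i) := by
    funext i
    refine Fin.cases ?_ (fun j => ?_) i
    · rw [hatl_zero]
      have : ∑ i, z (e i) = 0 := by rw [← sp_sum e (fun i => z (e i)), h1, hs]
      rw [Fin.sum_univ_succ] at this
      simp only [co_apply]; linarith
    · rw [hatl_succ, co_apply]
  rw [lin, ContinuousLinearMap.comp_apply, h2, h1]

theorem lin_injective (he : Function.Injective e) : Function.Injective (lin e) := fun x y h => by
  rw [← co_lin he x, h, co_lin he]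

theorem bc_pos (he : Function.Injective e) {x : Fin k → ℝ} (hx : x ∈ So k) {v : V} (hv : v ∈ Finset.univ.image e) :
    0 < bc e x v := by
  obtain ⟨i, -, rfl⟩ := Finset.mem_image.1 hv
  rw [bc_apply he]; exact hat_pos hx i

theorem co_So (he : Function.Injective e) {w : V → ℝ} (hw : w ∈ Dl (Finset.univ.image e))
    (hpos : ∀ v ∈ Finset.univ.image e, 0 < w v) : co e w ∈ So k := by
  apply mem_So_of_hat
  intro i
  rw [← bc_apply he, bc_co he hw]
  exact hpos _ (by simp)

theorem bc_not_So (he : Function.Injective e) {x : Fin k → ℝ} (hx : x ∈ St k) (hx' : x ∉ So k) :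
    ∃ v ∈ Finset.univ.image e, bc e x ∈ Dl ((Finset.univ.image e).erase v) := by
  have : ∃ i, hat x i = 0 := by
    by_contra hcon
    push Not at hcon
    exact hx' (mem_So_of_hat fun i => lt_of_le_of_ne (hat_nonneg hx i) (hcon i).symm)
  obtain ⟨i, hi⟩ := this
  refine ⟨e i, by simp, ?_⟩
  have h1 := bc_mem e hx
  refine ⟨h1.1, h1.2.1, fun v hv => ?_⟩
  rw [Finset.mem_erase, not_and_or, not_not] at hv
  rcases hv with rfl | hv
  · rw [bc_apply he, hi]
  · exact h1.2.2 v hv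

theorem interior_St : interior (St k) = So k := by
  refine Subset.antisymm ?_ So_subset_interior
  intro x hx
  have hxS := interior_subset hx
  rw [mem_interior_iff_mem_nhds, Metric.mem_nhds_iff] at hx
  obtain ⟨r, hr, hb⟩ := hx
  refine ⟨fun i => ?_, ?_⟩
  · have : x - Pi.single i (r/2) ∈ St k := hb (by
      rw [Metric.mem_ball, dist_eq_norm, sub_sub_cancel_left, norm_neg, Pi.norm_single, Real.norm_of_nonneg (by positivity)]
      linarith)
    have := this.1 i
    simp only [Pi.sub_apply, Pi.single_eq_same] at this; linarith
  · rcases Nat.eq_zero_or_pos k with rfl | hk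
    · simp
    · have : x + Pi.single ⟨0, hk⟩ (r/2) ∈ St k := hb (by
        rw [Metric.mem_ball, dist_eq_norm, add_sub_cancel_left, Pi.norm_single, Real.norm_of_nonneg (by positivity)]
        linarith)
      have := this.2
      simp only [Pi.add_apply, Finset.sum_add_distrib, Finset.sum_pi_single', Finset.mem_univ, if_true] at this
      linarith

/-- the barycentre -/
def cen (k : ℕ) : Fin k → ℝ := fun _ => 1 / (k + 1)

theorem cen_mem : cen k ∈ So k := by
  refine ⟨fun i => by simp only [cen]; positivity, ?_⟩
  simp only [cen, Finset.sum_const, Finset.card_univ, Fintype.card_fin, nsmul_eq_mul]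
  rw [mul_one_div, div_lt_one (by positivity)]; linarith

theorem exists_enum {s : Finset V} (hs : s.card = k + 1) :
    ∃ e : Fin (k+1) → V, Function.Injective e ∧ Finset.univ.image e = s := by
  let q := s.equivFin.trans (finCongr hs)
  refine ⟨fun i => q.symm i, Subtype.val_injective.comp q.symm.injective, ?_⟩
  ext v
  simp only [Finset.mem_image, Finset.mem_univ, true_and]
  constructor
  · rintro ⟨i, rfl⟩; exact (q.symm i).2
  · intro hv; exact ⟨q ⟨v, hv⟩, by simp⟩

theorem exists_param {s : Finset V} (hs : s.card ≤ k + 1) (hne : s.Nonempty) :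
    ∃ e : Fin (k+1) → V, Finset.univ.image e = s := by
  obtain ⟨v0, hv0⟩ := hne
  have hex : ∃ g : {x // x ∈ s} ↪ Fin (k+1), True := by
    have : Fintype.card {x // x ∈ s} ≤ Fintype.card (Fin (k+1)) := by simpa using hs
    exact ⟨(Function.Embedding.nonempty_of_card_le this).some, trivial⟩
  obtain ⟨g, -⟩ := hex
  classical
  have : Nonempty {x // x ∈ s} := ⟨⟨v0, hv0⟩⟩
  refine ⟨fun i => (Function.invFun g i : {x // x ∈ s}), ?_⟩
  ext v
  simp only [Finset.mem_image, Finset.mem_univ, true_and]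
  constructor
  · rintro ⟨i, rfl⟩; exact (Function.invFun g i).2
  · intro hv
    exact ⟨g ⟨v, hv⟩, by rw [Function.leftInverse_invFun g.injective]⟩

end
end VK

open Set
noncomputable section
namespace VK
set_option linter.unusedVariables false
set_option linter.unusedSectionVars false
set_option linter.deprecated false
set_option linter.unusedSimpArgs false
open Topology Filter MeasureTheory

section
variable {V : Type*} [Fintype V] [DecidableEq V]
variable {E : Type*} [NormedAddCommGroup E] [NormedSpace ℝ E] [FiniteDimensional ℝ E]

def poly (K : Finset (Finset V)) : Set (V → ℝ) := ⋃ s ∈ K, Dl s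

theorem mem_poly {K : Finset (Finset V)} {w : V → ℝ} : w ∈ poly K ↔ ∃ s ∈ K, w ∈ Dl s := by
  simp [poly]

theorem poly_compact (K : Finset (Finset V)) : IsCompact (poly K) :=
  K.isCompact_biUnion fun s _ => Dl_compact s

/-- properness on pairs of disjoint faces of small total dimension -/
def Pr (K : Finset (Finset V)) (m : ℕ) (f : (V → ℝ) → E) : Prop :=
  ∀ s ∈ K, ∀ t ∈ K, Disjoint s t → s.card + t.card ≤ 2 * m + 1 → ∀ x ∈ Dl s, ∀ y ∈ Dl t, f x ≠ f y

def Nl (f : (V → ℝ) → E) (s t : Finset V) : Prop :=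
  ∃ G : (V → ℝ) × (V → ℝ) → E, ContinuousOn G (Dl s ×ˢ Dl t) ∧ (∀ p ∈ Dl s ×ˢ Dl t, G p ≠ 0) ∧
    ∀ p ∈ Dl s ×ˢ Dl t, ((∃ v ∈ s, p.1 v = 0) ∨ ∃ v ∈ t, p.2 v = 0) → G p = f p.1 - f p.2

structure Inv (K : Finset (Finset V)) (m : ℕ) (P : Finset (Finset V)) (f : (V → ℝ) → E) : Prop where
  cont : ContinuousOn f (poly K)
  pr : Pr K m f
  nl : ∀ s ∈ K, ∀ t ∈ K, Disjoint s t → s.card = m + 1 → t.card = m + 1 → Nl f s t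
  dn : ∀ s ∈ P, ∀ t ∈ K, Disjoint s t → ∀ x ∈ Dl s, ∀ y ∈ Dl t, f x ≠ f y

/-- nonvanishing on a compact set is stable -/
theorem stable_ne {X : Type*} [TopologicalSpace X] {S : Set X} (hS : IsCompact S) {G : X → E}
    (hG : ContinuousOn G S) (h0 : ∀ x ∈ S, G x ≠ 0) :
    ∀ᶠ ε in 𝓝[>] (0:ℝ), ∀ x ∈ S, ∀ z : E, ‖z‖ < ε → G x + z ≠ 0 := by
  rcases S.eq_empty_or_nonempty with rfl | hne
  · simp
  obtain ⟨x0, hx0, hmin⟩ := hS.exists_isMinOn hne hG.norm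
  have hpos : 0 < ‖G x0‖ := norm_pos_iff.2 (h0 x0 hx0)
  have : ∀ᶠ ε in 𝓝[>] (0:ℝ), ε < ‖G x0‖ :=
    mem_nhdsWithin_of_mem_nhds (Iio_mem_nhds hpos)
  filter_upwards [this] with ε hε x hx z hz h
  have h1 : ‖G x0‖ ≤ ‖G x‖ := hmin hx
  have h2 : G x = -z := eq_neg_of_add_eq_zero_left h
  rw [h2, norm_neg] at h1; linarith

theorem Inv.stable {K : Finset (Finset V)} {m : ℕ} {P : Finset (Finset V)} {f : (V → ℝ) → E}
    (hP : P ⊆ K) (h : Inv K m P f) :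
    ∃ ε > 0, ∀ f' : (V → ℝ) → E, ContinuousOn f' (poly K) → (∀ w ∈ poly K, ‖f' w - f w‖ < ε) → Inv K m P f' := by
  have hsub : ∀ s ∈ K, Dl s ⊆ poly K := fun s hs w hw => mem_poly.2 ⟨s, hs, hw⟩
  have hD : ∀ s ∈ K, ∀ t ∈ K, ContinuousOn (fun p : (V → ℝ) × (V → ℝ) => f p.1 - f p.2) (Dl s ×ˢ Dl t) := by
    intro s hs t ht
    exact ((h.cont.mono (hsub s hs)).comp continuousOn_fst (fun p hp => hp.1)).sub
      ((h.cont.mono (hsub t ht)).comp continuousOn_snd (fun p hp => hp.2))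
  have key : ∀ s ∈ K, ∀ t ∈ K, (∀ x ∈ Dl s, ∀ y ∈ Dl t, f x ≠ f y) → ∀ᶠ ε in 𝓝[>] (0:ℝ),
      ∀ f' : (V → ℝ) → E, (∀ w ∈ poly K, ‖f' w - f w‖ < ε / 2) → ∀ x ∈ Dl s, ∀ y ∈ Dl t, f' x ≠ f' y := by
    intro s hs t ht hne
    filter_upwards [stable_ne ((Dl_compact s).prod (Dl_compact t)) (hD s hs t ht)
      (fun p hp h0 => hne _ hp.1 _ hp.2 (sub_eq_zero.1 h0))] with ε hε f' hf' x hx y hy heq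
    refine hε (x, y) ⟨hx, hy⟩ ((f' x - f x) - (f' y - f y)) ?_ ?_
    · have := norm_sub_le (f' x - f x) (f' y - f y)
      have := hf' x (hsub s hs hx); have := hf' y (hsub t ht hy)
      linarith
    · simp only [heq]; abel
  have key2 : ∀ s ∈ K, ∀ t ∈ K, Nl f s t → ∀ᶠ ε in 𝓝[>] (0:ℝ),
      ∀ f' : (V → ℝ) → E, ContinuousOn f' (poly K) → (∀ w ∈ poly K, ‖f' w - f w‖ < ε / 2) → Nl f' s t := by
    rintro s hs t ht ⟨G, hG, hG0, hGb⟩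
    filter_upwards [stable_ne ((Dl_compact s).prod (Dl_compact t)) hG hG0] with ε hε f' hc' hf'
    refine ⟨fun p => G p + ((f' p.1 - f p.1) - (f' p.2 - f p.2)), ?_, ?_, ?_⟩
    · refine hG.add ?_
      exact (((hc'.sub h.cont).mono (hsub s hs)).comp continuousOn_fst (fun p hp => hp.1)).sub
        (((hc'.sub h.cont).mono (hsub t ht)).comp continuousOn_snd (fun p hp => hp.2))
    · intro p hp
      refine hε p hp _ ?_
      have := norm_sub_le (f' p.1 - f p.1) (f' p.2 - f p.2)
      have := hf' p.1 (hsub s hs hp.1); have := hf' p.2 (hsub t ht hp.2)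
      linarith
    · intro p hp hb
      simp only [hGb p hp hb]; abel
  have e1 : ∀ᶠ ε in 𝓝[>] (0:ℝ), ∀ s ∈ K, ∀ t ∈ K, (∀ x ∈ Dl s, ∀ y ∈ Dl t, f x ≠ f y) →
      ∀ f' : (V → ℝ) → E, (∀ w ∈ poly K, ‖f' w - f w‖ < ε / 2) → ∀ x ∈ Dl s, ∀ y ∈ Dl t, f' x ≠ f' y := by
    rw [Finset.eventually_all]; intro s hs
    rw [Finset.eventually_all]; intro t ht
    by_cases hne : ∀ x ∈ Dl s, ∀ y ∈ Dl t, f x ≠ f y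
    · filter_upwards [key s hs t ht hne] with ε hε _ using hε
    · exact Eventually.of_forall fun ε hh => absurd hh hne
  have e2 : ∀ᶠ ε in 𝓝[>] (0:ℝ), ∀ s ∈ K, ∀ t ∈ K, Nl f s t →
      ∀ f' : (V → ℝ) → E, ContinuousOn f' (poly K) → (∀ w ∈ poly K, ‖f' w - f w‖ < ε / 2) → Nl f' s t := by
    rw [Finset.eventually_all]; intro s hs
    rw [Finset.eventually_all]; intro t ht
    by_cases hne : Nl f s t
    · filter_upwards [key2 s hs t ht hne] with ε hε _ using hε
    · exact Eventually.of_forall fun ε hh => absurd hh hne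
  obtain ⟨ε, ⟨h1, h2⟩, hε⟩ := ((e1.and e2).and self_mem_nhdsWithin).exists
  refine ⟨ε / 2, half_pos hε, fun f' hc' hf' => ⟨hc', ?_, ?_, ?_⟩⟩
  · intro s hs t ht hst hcard
    exact h1 s hs t ht (h.pr s hs t ht hst hcard) f' hf'
  · intro s hs t ht hst hc1 hc2
    exact h2 s hs t ht (h.nl s hs t ht hst hc1 hc2) f' hc' hf'
  · intro s hs t ht hst
    exact h1 s (hP hs) t ht (h.dn s hs t ht hst) f' hf'

def yt {m : ℕ} (y : Fin m → ℝ) (t : ℝ) : Fin m → ℝ := (1 - t) • y + t • cen m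

structure Gen (m : ℕ) (σ : Finset V) (f : (V → ℝ) → E) : Prop where
  g1 : ∀ e e' : Fin (m+1) → V, Finset.univ.image e = σ → Disjoint σ (Finset.univ.image e') → ∀ u : (Fin m → ℝ) × (Fin m → ℝ),
    f (bc e u.1) = f (bc e' u.2) →
      Function.Surjective (fderiv ℝ (fun u : (Fin m → ℝ) × (Fin m → ℝ) => f (bc e u.1) - f (bc e' u.2)) u)
  g2 : ∀ e e' e'' : Fin (m+1) → V, Finset.univ.image e = σ → Disjoint σ (Finset.univ.image e') →
    Disjoint σ (Finset.univ.image e'') → ∀ (x y : Fin m → ℝ) (t : ℝ) (z : Fin m → ℝ), f (bc e x) = f (bc e' y) →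
      f (bc e' (yt y t)) = f (bc e'' z) → bc e' (yt y t) = bc e'' z
  g3 : ∀ e e' : Fin (m+1) → V, Finset.univ.image e = σ → Disjoint σ (Finset.univ.image e') →
    ∀ (x y : Fin m → ℝ) (t : ℝ) (ξ : Fin m → ℝ), f (bc e x) = f (bc e' y) →
      fderiv ℝ f (bc e' (yt y t)) (lin e' ξ) = 0 → lin e' ξ = 0

def pert (f : (V → ℝ) → E) (Θ : V → E) (w : V → ℝ) : E := f w + ∑ v, w v • Θ v

theorem pert_contDiff {f : (V → ℝ) → E} {n : WithTop ℕ∞} (hf : ContDiff ℝ n f) (Θ : V → E) : ContDiff ℝ n (pert f Θ) := by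
  unfold pert
  refine hf.add (ContDiff.sum fun v _ => ?_)
  exact (contDiff_apply ℝ ℝ v).smul contDiff_const

theorem pert_fderiv {f : (V → ℝ) → E} (hf : Differentiable ℝ f) (Θ : V → E) (w z : V → ℝ) :
    fderiv ℝ (pert f Θ) w z = fderiv ℝ f w z + ∑ v, z v • Θ v := by
  have h1 : HasFDerivAt (pert f Θ) (fderiv ℝ f w +
      ∑ v, (ContinuousLinearMap.proj (R := ℝ) (φ := fun _ : V => ℝ) v).smulRight (Θ v)) w := by
    unfold pert
    refine (hf w).hasFDerivAt.add ?_
    have : (fun w : V → ℝ => ∑ v, w v • Θ v) = fun w => (∑ v, (ContinuousLinearMap.proj (R := ℝ) (φ := fun _ : V => ℝ) v).smulRight (Θ v)) w := by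
      funext w; simp [ContinuousLinearMap.sum_apply]
    rw [this]
    exact ContinuousLinearMap.hasFDerivAt _
  rw [h1.fderiv]; simp [ContinuousLinearMap.sum_apply]

theorem bc_disj {m : ℕ} {σ : Finset V} {e e' : Fin (m+1) → V} (he : Finset.univ.image e = σ)
    (he' : Disjoint σ (Finset.univ.image e')) (x : Fin m → ℝ) :
    ∃ v ∈ σ, bc e x v ≠ 0 ∧ ∀ y, bc e' y v = 0 := by
  by_contra hcon
  push Not at hcon
  have h0 : ∀ v, bc e x v = 0 := by
    intro v
    by_cases hv : v ∈ σ
    · by_contra hne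
      obtain ⟨y, hy⟩ := hcon v hv hne
      exact hy (bc_off y (Finset.disjoint_left.1 he' hv))
    · exact bc_off x (by rwa [he])
  have := bc_sum e x
  simp [h0] at this

theorem gen_exists {m : ℕ} (hm : 3 ≤ m) (hE : Module.finrank ℝ E = 2 * m) (σ : Finset V) {f : (V → ℝ) → E}
    (hf : ContDiff ℝ (⊤ : ℕ∞) f) {ε : ℝ} (hε : 0 < ε) : ∃ Θ : V → E, ‖Θ‖ < ε ∧ Gen m σ (pert f Θ) := by
  have hfd : Differentiable ℝ f := hf.differentiable (by simp)
  have hbd : ∀ e : Fin (m+1) → V, Differentiable ℝ (bc e) := fun e => (bc_contDiff e (n := 1)).differentiable (by simp)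
  let B1 : (Fin (m+1) → V) × (Fin (m+1) → V) → Set (V → E) := fun p => {Θ : V → E | ∃ u : (Fin m → ℝ) × (Fin m → ℝ),
      bc p.1 u.1 - bc p.2 u.2 ≠ 0 ∧ ∑ v, (bc p.1 u.1 - bc p.2 u.2) v • Θ v = -(f (bc p.1 u.1) - f (bc p.2 u.2)) ∧
      ¬ Function.Surjective (fderiv ℝ (fun u : (Fin m → ℝ) × (Fin m → ℝ) =>
        ∑ v, (bc p.1 u.1 - bc p.2 u.2) v • Θ v - -(f (bc p.1 u.1) - f (bc p.2 u.2))) u)}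
  have hyt : Differentiable ℝ (fun u : (Fin m → ℝ) × ℝ => yt u.1 u.2) := by
    unfold yt; fun_prop
  have hB1 : ∀ p, Thin (B1 p) := by
    intro p
    refine gp_regular (r := fun u : (Fin m → ℝ) × (Fin m → ℝ) => bc p.1 u.1 - bc p.2 u.2) ?_ ?_ ?_
    · exact ((hbd _).comp differentiable_fst).sub ((hbd _).comp differentiable_snd)
    · exact ((hfd.comp ((hbd _).comp differentiable_fst)).sub (hfd.comp ((hbd _).comp differentiable_snd))).neg
    · rw [hE]; simp; omega
  let U := ((Fin m → ℝ) × (Fin m → ℝ)) × (ℝ × (Fin m → ℝ))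
  have hU : Module.finrank ℝ U < 2 * Module.finrank ℝ E := by
    rw [hE]; simp [U]; omega
  have hx : Differentiable ℝ (fun u : U => u.1.1) := differentiable_fst.comp differentiable_fst
  have hy : Differentiable ℝ (fun u : U => u.1.2) := differentiable_snd.comp differentiable_fst
  have hz : Differentiable ℝ (fun u : U => u.2.2) := differentiable_snd.comp differentiable_snd
  have ht : Differentiable ℝ (fun u : U => u.2.1) := differentiable_fst.comp differentiable_snd
  have hyt' : Differentiable ℝ (fun u : U => yt u.1.2 u.2.1) := hyt.comp (hy.prodMk ht)
  have hr : ∀ e e' : Fin (m+1) → V, Differentiable ℝ (fun u : U => bc e u.1.1 - bc e' u.1.2) := fun e e' =>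
    ((hbd e).comp hx).sub ((hbd e').comp hy)
  have hα : ∀ e e' : Fin (m+1) → V, Differentiable ℝ (fun u : U => -(f (bc e u.1.1) - f (bc e' u.1.2))) := fun e e' =>
    ((hfd.comp ((hbd e).comp hx)).sub (hfd.comp ((hbd e').comp hy))).neg
  let B2 : (Fin (m+1) → V) × (Fin (m+1) → V) × (Fin (m+1) → V) → Set (V → E) := fun p => {Θ : V → E | ∃ u : U,
      (∃ v, (bc p.1 u.1.1 - bc p.2.1 u.1.2) v ≠ 0 ∧ (bc p.2.1 (yt u.1.2 u.2.1) - bc p.2.2 u.2.2) v = 0) ∧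
      bc p.2.1 (yt u.1.2 u.2.1) - bc p.2.2 u.2.2 ≠ 0 ∧
      ∑ v, (bc p.1 u.1.1 - bc p.2.1 u.1.2) v • Θ v = -(f (bc p.1 u.1.1) - f (bc p.2.1 u.1.2)) ∧
      ∑ v, (bc p.2.1 (yt u.1.2 u.2.1) - bc p.2.2 u.2.2) v • Θ v = -(f (bc p.2.1 (yt u.1.2 u.2.1)) - f (bc p.2.2 u.2.2))}
  have hB2 : ∀ p, Thin (B2 p) := by
    intro p
    exact gp_avoid₂ (r := fun u : U => bc p.1 u.1.1 - bc p.2.1 u.1.2)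
      (s := fun u : U => bc p.2.1 (yt u.1.2 u.2.1) - bc p.2.2 u.2.2) (hr _ _)
      (((hbd _).comp hyt').sub ((hbd _).comp hz)) (hα _ _)
      (((hfd.comp ((hbd _).comp hyt')).sub (hfd.comp ((hbd _).comp hz))).neg) hU
  let B3 : (Fin (m+1) → V) × (Fin (m+1) → V) → Set (V → E) := fun p => {Θ : V → E | ∃ u : U,
      (∃ v, (bc p.1 u.1.1 - bc p.2 u.1.2) v ≠ 0 ∧ (lin p.2 u.2.2) v = 0) ∧
      lin p.2 u.2.2 ≠ 0 ∧
      ∑ v, (bc p.1 u.1.1 - bc p.2 u.1.2) v • Θ v = -(f (bc p.1 u.1.1) - f (bc p.2 u.1.2)) ∧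
      ∑ v, (lin p.2 u.2.2) v • Θ v = -(fderiv ℝ f (bc p.2 (yt u.1.2 u.2.1)) (lin p.2 u.2.2))}
  have hf' : Differentiable ℝ (fderiv ℝ f) := by
    have : ContDiff ℝ 1 (fderiv ℝ f) := hf.fderiv_right (by norm_cast)
    exact this.differentiable (by simp)
  have hB3 : ∀ p, Thin (B3 p) := by
    intro p
    refine gp_avoid₂ (r := fun u : U => bc p.1 u.1.1 - bc p.2 u.1.2)
      (s := fun u : U => lin p.2 u.2.2) (hr _ _) ((lin p.2).differentiable.comp hz) (hα _ _) ?_ hU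
    exact ((hf'.comp ((hbd _).comp hyt')).clm_apply ((lin p.2).differentiable.comp hz)).neg
  obtain ⟨Θ, hΘ, hΘB⟩ := (((Thin.iUnion hB1).union (Thin.iUnion hB2)).union (Thin.iUnion hB3)).exists_near 0 hε
  simp only [mem_union, mem_iUnion, not_or, not_exists] at hΘB
  obtain ⟨⟨h1, h2⟩, h3⟩ := hΘB
  have hpd : ∀ a b : V → ℝ, ∑ v, (a - b) v • Θ v - -(f a - f b) = pert f Θ a - pert f Θ b := by
    intro a b; simp only [pert, Pi.sub_apply, sub_smul, Finset.sum_sub_distrib]; abel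
  have hpd' : ∀ a b : V → ℝ, pert f Θ a = pert f Θ b → ∑ v, (a - b) v • Θ v = -(f a - f b) := by
    intro a b h; rw [← sub_eq_zero, hpd, h, sub_self]
  refine ⟨Θ, by simpa using hΘ, ⟨?_, ?_, ?_⟩⟩
  · intro e e' he he' u hu
    by_contra hns
    refine h1 (e, e') ⟨u, ?_, hpd' _ _ hu, ?_⟩
    · obtain ⟨v, hv, hv1, hv2⟩ := bc_disj he he' u.1
      intro h0
      have := congrFun h0 v
      simp only [Pi.sub_apply, hv2, Pi.zero_apply, sub_zero] at this
      exact hv1 this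
    · simpa only [hpd] using hns
  · intro e e' e'' he he' he'' x y t z hxy hyz
    by_contra hne
    refine h2 (e, e', e'') ⟨((x, y), (t, z)), ?_, sub_ne_zero.2 hne, hpd' _ _ hxy, hpd' _ _ hyz⟩
    obtain ⟨v, hv, hv1, hv2⟩ := bc_disj he he' x
    refine ⟨v, by simpa [hv2] using hv1, ?_⟩
    have := bc_off (e := e'') z (Finset.disjoint_left.1 he'' hv)
    simp [hv2, this]
  · intro e e' he he' x y t ξ hxy hd
    by_contra hne
    refine h3 (e, e') ⟨((x, y), (t, ξ)), ?_, hne, hpd' _ _ hxy, ?_⟩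
    · obtain ⟨v, hv, hv1, hv2⟩ := bc_disj he he' x
      refine ⟨v, by simpa [hv2] using hv1, ?_⟩
      exact lin_off ξ (Finset.disjoint_left.1 he' hv)
    · rw [pert_fderiv hfd] at hd
      exact eq_neg_of_add_eq_zero_right hd

end
end VK

open Set
noncomputable section
namespace VK
set_option linter.unusedVariables false
set_option linter.unusedSectionVars false
set_option linter.deprecated false
set_option linter.unusedSimpArgs false
open Topology Filter MeasureTheory

section
variable {V : Type*} [Fintype V] [DecidableEq V]
variable {E : Type*} [NormedAddCommGroup E] [NormedSpace ℝ E] [FiniteDimensional ℝ E]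

theorem fderiv_pair {m : ℕ} {f : (V → ℝ) → E} (hf : ContDiff ℝ 1 f) (e e' : Fin (m+1) → V) (u : (Fin m → ℝ) × (Fin m → ℝ)) :
    HasFDerivAt (fun u : (Fin m → ℝ) × (Fin m → ℝ) => f (bc e u.1) - f (bc e' u.2))
      ((fderiv ℝ (f ∘ bc e) u.1).coprod (-(fderiv ℝ (f ∘ bc e') u.2))) u := by
  have h : ∀ e : Fin (m+1) → V, Differentiable ℝ (f ∘ bc e) := fun e => (hf.comp (bc_contDiff e)).differentiable (by simp)
  have h1 : HasFDerivAt (fun u : (Fin m → ℝ) × (Fin m → ℝ) => f (bc e u.1)) ((fderiv ℝ (f ∘ bc e) u.1).comp (ContinuousLinearMap.fst ℝ _ _)) u :=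
    (h e u.1).hasFDerivAt.comp u hasFDerivAt_fst
  have h2 : HasFDerivAt (fun u : (Fin m → ℝ) × (Fin m → ℝ) => f (bc e' u.2)) ((fderiv ℝ (f ∘ bc e') u.2).comp (ContinuousLinearMap.snd ℝ _ _)) u :=
    (h e' u.2).hasFDerivAt.comp u hasFDerivAt_snd
  refine (h1.sub h2).congr_fderiv ?_
  ext z <;> simp

theorem zero_data {m : ℕ} {f : (V → ℝ) → E} (hf : ContDiff ℝ 1 f) {e e' : Fin (m+1) → V} (he : Function.Injective e)
    (he' : Function.Injective e') (J : E ≃L[ℝ] (Fin m → ℝ) × (Fin m → ℝ))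
    (hreg : ∀ u : (Fin m → ℝ) × (Fin m → ℝ), f (bc e u.1) = f (bc e' u.2) →
      Function.Surjective (fderiv ℝ (fun u : (Fin m → ℝ) × (Fin m → ℝ) => f (bc e u.1) - f (bc e' u.2)) u))
    (hN : Nl f (Finset.univ.image e) (Finset.univ.image e')) :
    ∃ Z : Finset ((Fin m → ℝ) × (Fin m → ℝ)), (∀ z, z ∈ Z ↔ (z.1 ∈ St m ∧ z.2 ∈ St m) ∧ f (bc e z.1) = f (bc e' z.2)) ∧
      (∀ z ∈ Z, dt J (fderiv ℝ (f ∘ bc e') z.2) (fderiv ℝ (f ∘ bc e) z.1) ≠ 0) ∧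
      ∑ z ∈ Z, sg (dt J (fderiv ℝ (f ∘ bc e') z.2) (fderiv ℝ (f ∘ bc e) z.1)) = 0 := by
  let X := (Fin m → ℝ) × (Fin m → ℝ)
  let M : X →L[ℝ] X := (ContinuousLinearMap.id ℝ (Fin m → ℝ)).prodMap (-(ContinuousLinearMap.id ℝ (Fin m → ℝ)))
  have hMM : M.det * M.det = 1 := by
    rw [← det_comp_clm]
    have : M.comp M = ContinuousLinearMap.id ℝ X := by
      refine ContinuousLinearMap.ext fun z => ?_
      show (z.1, - -z.2) = z
      simp
    rw [this]; exact LinearMap.det_id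
  have hM0 : M.det ≠ 0 := fun h => by simp [h] at hMM
  let D : X → X := fun u => J (f (bc e u.1) - f (bc e' u.2))
  have hDc : ContDiff ℝ 1 D := by
    refine J.contDiff.comp (ContDiff.sub ?_ ?_)
    · exact hf.comp ((bc_contDiff e).comp contDiff_fst)
    · exact hf.comp ((bc_contDiff e').comp contDiff_snd)
  have hDd : ∀ u : X, fderiv ℝ D u = ((J : E →L[ℝ] X).comp ((fderiv ℝ (f ∘ bc e) u.1).coprod (fderiv ℝ (f ∘ bc e') u.2))).comp M := by
    intro u
    have h1 := (J : E →L[ℝ] X).hasFDerivAt.comp u (fderiv_pair hf e e' u)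
    have h2 : fderiv ℝ D u = (J : E →L[ℝ] X).comp ((fderiv ℝ (f ∘ bc e) u.1).coprod (-(fderiv ℝ (f ∘ bc e') u.2))) := h1.fderiv
    rw [h2]
    ext z <;> simp [M]
  have hDdet : ∀ u : X, (fderiv ℝ D u).det = dt J (fderiv ℝ (f ∘ bc e') u.2) (fderiv ℝ (f ∘ bc e) u.1) * M.det := by
    intro u; rw [hDd, det_comp_clm]; rfl
  have hD0 : ∀ u : X, D u = 0 ↔ f (bc e u.1) = f (bc e' u.2) := by
    intro u
    simp only [D, EmbeddingLike.map_eq_zero_iff, sub_eq_zero]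
  have hDreg : ∀ u : X, D u = 0 → (fderiv ℝ D u).det ≠ 0 := by
    intro u hu
    have hs := hreg u ((hD0 u).1 hu)
    rw [(fderiv_pair hf e e' u).fderiv] at hs
    have h2 : fderiv ℝ D u = (J : E →L[ℝ] X).comp ((fderiv ℝ (f ∘ bc e) u.1).coprod (-(fderiv ℝ (f ∘ bc e') u.2))) :=
      ((J : E →L[ℝ] X).hasFDerivAt.comp u (fderiv_pair hf e e' u)).fderiv
    have hsurj : Function.Surjective (fderiv ℝ D u) := by
      rw [h2]; exact J.surjective.comp hs
    have hinj : LinearMap.ker (fderiv ℝ D u : X →ₗ[ℝ] X) = ⊥ :=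
      LinearMap.ker_eq_bot.2 ((LinearMap.injective_iff_surjective (f := (fderiv ℝ D u : X →ₗ[ℝ] X))).2 hsurj)
    intro h0
    exact (LinearMap.bot_lt_ker_of_det_eq_zero (f := (fderiv ℝ D u : X →ₗ[ℝ] X)) h0).ne hinj.symm
  let B : Set X := St m ×ˢ St m
  have hB : IsCompact B := St_compact.prod St_compact
  have hfin : {x ∈ B | D x = 0}.Finite := zeros_finite hDc hB (fun x _ hx => hDreg x hx)
  have hZ : ∀ z, z ∈ hfin.toFinset ↔ z ∈ B ∧ D z = 0 := by intro z; simp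
  obtain ⟨G, hG, hG0, hGb⟩ := hN
  have hmap : MapsTo (fun u : X => (bc e u.1, bc e' u.2)) B (Dl (Finset.univ.image e) ×ˢ Dl (Finset.univ.image e')) :=
    fun u hu => ⟨bc_mem e hu.1, bc_mem e' hu.2⟩
  have hdeg := deg_zero hDc hB (G := fun u => J (G (bc e u.1, bc e' u.2))) ?_ ?_ ?_ hfin.toFinset hZ
    (fun z hz => hDreg z ((hZ z).1 hz).2)
  · refine ⟨hfin.toFinset, fun z => ?_, fun z hz => ?_, ?_⟩
    · rw [hZ, hD0]; rfl
    · have := hDreg z ((hZ z).1 hz).2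
      rw [hDdet] at this
      exact left_ne_zero_of_mul this
    · have hsg : ∀ z ∈ hfin.toFinset, sg (fderiv ℝ D z).det = sg M.det * sg (dt J (fderiv ℝ (f ∘ bc e') z.2) (fderiv ℝ (f ∘ bc e) z.1)) := by
        intro z hz
        have h1 := hDreg z ((hZ z).1 hz).2
        rw [hDdet] at h1 ⊢
        have h2 := left_ne_zero_of_mul h1
        unfold sg
        rcases h2.lt_or_gt with h3 | h3 <;> rcases hM0.lt_or_gt with h4 | h4
        · simp [mul_pos_of_neg_of_neg h3 h4, h3.not_gt, h4.not_gt]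
        · simp [(mul_neg_of_neg_of_pos h3 h4).not_gt, h3.not_gt, h4]
        · simp [(mul_neg_of_pos_of_neg h3 h4).not_gt, h3, h4.not_gt]
        · simp [mul_pos h3 h4, h3, h4]
      rw [Finset.sum_congr rfl hsg, ← Finset.mul_sum] at hdeg
      refine (mul_eq_zero.1 hdeg).resolve_left ?_
      unfold sg; split_ifs <;> simp
  · refine J.continuous.comp_continuousOn (hG.comp (Continuous.continuousOn ?_) hmap)
    exact ((bc_cont e).comp continuous_fst).prodMk ((bc_cont e').comp continuous_snd)
  · intro u hu h0
    simp only [EmbeddingLike.map_eq_zero_iff] at h0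
    exact hG0 _ (hmap hu) h0
  · intro u hu
    have huB : u ∈ B := hB.isClosed.frontier_subset hu
    have huI : u ∉ interior B := hu.2
    have hintg : interior B = So m ×ˢ So m := by rw [interior_prod_eq, interior_St]
    rw [hintg] at huI
    simp only [D]
    congr 1
    refine hGb _ (hmap huB) ?_
    by_cases h1 : u.1 ∈ So m
    · have h2 : u.2 ∉ So m := fun h => huI ⟨h1, h⟩
      obtain ⟨v, hv, hv'⟩ := bc_not_So he' huB.2 h2
      exact Or.inr ⟨v, hv, hv'.2.2 v (by simp)⟩
    · obtain ⟨v, hv, hv'⟩ := bc_not_So he huB.1 h1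
      exact Or.inl ⟨v, hv, hv'.2.2 v (by simp)⟩

theorem good_pt {m : ℕ} {f : (V → ℝ) → E} (hf : Continuous f) {K : Finset (Finset V)} {σ : Finset V}
    (hcard : ∀ s ∈ K, s.card ≤ m + 1) {e' : Fin (m+1) → V} (he' : Function.Injective e')
    {y : Fin m → ℝ} (hy : y ∈ So m)
    (h2 : ∀ e'' : Fin (m+1) → V, Disjoint σ (Finset.univ.image e'') → ∀ z, f (bc e' y) = f (bc e'' z) → bc e' y = bc e'' z) :
    Good ((f '' (⋃ t ∈ K.filter (fun t => Disjoint σ t), Dl t))ᶜ) (f ∘ bc e') y := by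
  set Y : Set (V → ℝ) := ⋃ t ∈ K.filter (fun t => Disjoint σ t), Dl t with hY
  have hYc : IsCompact Y := Finset.isCompact_biUnion _ fun t _ => Dl_compact t
  have hmY : ∀ w, w ∈ Y ↔ ∃ t ∈ K, Disjoint σ t ∧ w ∈ Dl t := by
    intro w; simp [hY, and_assoc]
  intro N hN
  let O : Set (V → ℝ) := (⋂ v ∈ Finset.univ.image e', {w : V → ℝ | 0 < w v}) ∩ co e' ⁻¹' interior N
  have hO : IsOpen O := by
    refine IsOpen.inter ?_ (isOpen_interior.preimage (co e').continuous)
    exact isOpen_biInter_finset fun v _ => isOpen_lt continuous_const (continuous_apply v)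
  have hyO : bc e' y ∈ O := by
    refine ⟨mem_iInter₂.2 fun v hv => bc_pos he' hy hv, ?_⟩
    show co e' (bc e' y) ∈ interior N
    rw [co_bc he']; exact mem_interior_iff_mem_nhds.2 hN
  have hcl : IsClosed (f '' (Y \ O)) := ((hYc.diff hO).image hf).isClosed
  refine ⟨(f '' (Y \ O))ᶜ, hcl.isOpen_compl.mem_nhds ?_, ?_⟩
  · rintro ⟨w, ⟨hwY, hwO⟩, hw⟩
    obtain ⟨t, ht, hdis, hwt⟩ := (hmY w).1 hwY
    obtain ⟨v, hv, -⟩ := Dl_pos hwt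
    obtain ⟨e'', he''⟩ := exists_param (hcard t ht) ⟨v, hv⟩
    rw [← he''] at hwt hdis
    obtain ⟨z, -, rfl⟩ := bc_surj e'' hwt
    have := h2 e'' hdis z hw.symm
    rw [this] at hyO
    exact hwO hyO
  · intro z hz hzC
    have hzC' : z ∈ f '' Y := by simpa using hzC
    obtain ⟨w, hwY, rfl⟩ := hzC'
    have hwO : w ∈ O := by
      by_contra h; exact hz ⟨w, ⟨hwY, h⟩, rfl⟩
    obtain ⟨t, ht, hdis, hwt⟩ := (hmY w).1 hwY
    have hsub : Finset.univ.image e' ⊆ t := by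
      intro v hv
      by_contra hvt
      have h0 := hwt.2.2 v hvt
      have h1 : 0 < w v := mem_iInter₂.1 hwO.1 v hv
      linarith
    have hc' : (Finset.univ.image e').card = m + 1 := by
      rw [Finset.card_image_of_injective _ he']; simp
    have heq : Finset.univ.image e' = t := Finset.eq_of_subset_of_card_le hsub (by rw [hc']; exact hcard t ht)
    rw [← heq] at hwt
    refine ⟨co e' w, interior_subset hwO.2, ?_⟩
    simp only [Function.comp, bc_co he' hwt]
end
end VK

open Set
noncomputable section
namespace VK
set_option linter.unusedVariables false
set_option linter.unusedSectionVars false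
set_option linter.deprecated false
set_option linter.unusedSimpArgs false
open Topology Filter MeasureTheory

section
variable {V : Type*} [Fintype V] [DecidableEq V]
variable {E : Type*} [NormedAddCommGroup E] [NormedSpace ℝ E] [FiniteDimensional ℝ E]

theorem sg_cases (x : ℝ) : sg x = 1 ∨ sg x = -1 := by unfold sg; split_ifs <;> simp

theorem sg_neg_mul {a b : ℝ} (ha : a ≠ 0) (hb : b ≠ 0) (h : sg a = - sg b) : a * b < 0 := by
  unfold sg at h
  rcases ha.lt_or_gt with h1 | h1 <;> rcases hb.lt_or_gt with h2 | h2
  · simp [h1.not_gt, h2.not_gt] at h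
  · exact mul_neg_of_neg_of_pos h1 h2
  · exact mul_neg_of_pos_of_neg h1 h2
  · simp [h1, h2] at h

theorem yt_So {m : ℕ} {y : Fin m → ℝ} (hy : y ∈ So m) {t : ℝ} (ht : t ∈ Icc (0:ℝ) 1) : yt y t ∈ So m :=
  So_convex hy cen_mem (by linarith [ht.2]) ht.1 (by ring)

theorem exists_J {m : ℕ} (hE : Module.finrank ℝ E = 2 * m) : Nonempty (E ≃L[ℝ] (Fin m → ℝ) × (Fin m → ℝ)) := by
  refine ⟨ContinuousLinearEquiv.ofFinrankEq ?_⟩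
  rw [hE]; simp; omega

set_option maxHeartbeats 2000000 in
/-- removing all intersections of the face `σ` with disjoint faces -/
theorem clean_face {m : ℕ} (hm : 3 ≤ m) (hE : Module.finrank ℝ E = 2 * m) {K : Finset (Finset V)}
    (hdown : ∀ s ∈ K, ∀ t, t ⊆ s → t ∈ K) (hcard : ∀ s ∈ K, s.card ≤ m + 1) {f : (V → ℝ) → E}
    (hf : ContDiff ℝ 1 f) (hpr : Pr K m f)
    (hnl : ∀ s ∈ K, ∀ t ∈ K, Disjoint s t → s.card = m + 1 → t.card = m + 1 → Nl f s t)
    {σ : Finset V} (hσ : σ ∈ K) {e : Fin (m+1) → V} (he : Function.Injective e) (heσ : Finset.univ.image e = σ)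
    (hgen : Gen m σ f) :
    ∃ g' : (Fin m → ℝ) → E, ∃ T : Set (Fin m → ℝ), T ⊆ So m ∧ (∀ z ∉ T, g' z = f (bc e z)) ∧ ContinuousOn g' (St m) ∧
      ∀ x ∈ St m, ∀ t ∈ K, Disjoint σ t → ∀ w ∈ Dl t, g' x ≠ f w := by
  obtain ⟨J⟩ := exists_J hE
  have hσc : σ.card = m + 1 := by rw [← heσ, Finset.card_image_of_injective _ he]; simp
  set Y : Set (V → ℝ) := ⋃ t ∈ K.filter (fun t => Disjoint σ t), Dl t with hY
  have hYc : IsCompact Y := Finset.isCompact_biUnion _ fun t _ => Dl_compact t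
  have hmY : ∀ w, w ∈ Y ↔ ∃ t ∈ K, Disjoint σ t ∧ w ∈ Dl t := by
    intro w; simp [hY, and_assoc]
  set C : Set E := (f '' Y)ᶜ with hC
  have hCo : IsOpen C := (hYc.image hf.continuous).isClosed.isOpen_compl
  have hpar : ∀ t ∈ K, Disjoint σ t → ∀ w ∈ Dl t, ∃ e'' : Fin (m+1) → V, Disjoint σ (Finset.univ.image e'') ∧ ∃ z, bc e'' z = w := by
    intro t ht hdis w hwt
    obtain ⟨v, hv, -⟩ := Dl_pos hwt
    obtain ⟨e'', he''⟩ := exists_param (hcard t ht) ⟨v, hv⟩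
    rw [← he''] at hwt hdis
    obtain ⟨z, -, rfl⟩ := bc_surj e'' hwt
    exact ⟨e'', hdis, z, rfl⟩
  have hSC : SC C := by
    refine sc_compl hCo (ι := Fin (m+1) → V) (fun e'' => f ∘ bc e'') (fun _ => univ) ?_ ?_ ?_
    · intro e'' y _
      exact (hf.comp (bc_contDiff e'')).differentiable (by simp) y
    · rw [hE]; simp; omega
    · intro z hz
      have hz' : z ∈ f '' Y := by simpa [hC] using hz
      obtain ⟨w, hw, rfl⟩ := hz'
      obtain ⟨t, ht, hdis, hwt⟩ := (hmY w).1 hw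
      obtain ⟨e'', -, z, rfl⟩ := hpar t ht hdis w hwt
      exact ⟨e'', z, mem_univ _, rfl⟩
  -- enumerations
  have hen : ∀ τ : Finset V, ∃ e' : Fin (m+1) → V, τ.card = m + 1 → Function.Injective e' ∧ Finset.univ.image e' = τ := by
    intro τ
    by_cases h : τ.card = m + 1
    · obtain ⟨e', h1, h2⟩ := exists_enum h
      exact ⟨e', fun _ => ⟨h1, h2⟩⟩
    · exact ⟨e, fun h' => absurd h' h⟩
  choose en hen using hen
  have hzd : ∀ τ : Finset V, ∃ Z : Finset ((Fin m → ℝ) × (Fin m → ℝ)), τ ∈ K → τ.card = m + 1 → Disjoint σ τ →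
      (∀ z, z ∈ Z ↔ (z.1 ∈ St m ∧ z.2 ∈ St m) ∧ f (bc e z.1) = f (bc (en τ) z.2)) ∧
      (∀ z ∈ Z, dt J (fderiv ℝ (f ∘ bc (en τ)) z.2) (fderiv ℝ (f ∘ bc e) z.1) ≠ 0) ∧
      ∑ z ∈ Z, sg (dt J (fderiv ℝ (f ∘ bc (en τ)) z.2) (fderiv ℝ (f ∘ bc e) z.1)) = 0 := by
    intro τ
    by_cases h : τ ∈ K ∧ τ.card = m + 1 ∧ Disjoint σ τ
    · obtain ⟨h1, h2, h3⟩ := h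
      obtain ⟨hi, him⟩ := hen τ h2
      have hN := hnl σ hσ τ h1 h3 hσc h2
      rw [← heσ, ← him] at hN
      obtain ⟨Z, hZ⟩ := zero_data hf he hi J (hgen.g1 e (en τ) heσ (by rwa [him])) hN
      exact ⟨Z, fun _ _ _ => hZ⟩
    · exact ⟨∅, fun h1 h2 h3 => absurd ⟨h1, h2, h3⟩ h⟩
  choose Z hZ using hzd
  let TT := K.filter (fun τ => τ.card = m + 1 ∧ Disjoint σ τ)
  have hTT : ∀ τ, τ ∈ TT ↔ τ ∈ K ∧ τ.card = m + 1 ∧ Disjoint σ τ := by intro τ; simp [TT]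
  have hZm : ∀ τ ∈ TT, ∀ z, z ∈ Z τ ↔ (z.1 ∈ St m ∧ z.2 ∈ St m) ∧ f (bc e z.1) = f (bc (en τ) z.2) := by
    intro τ hτ
    obtain ⟨h1, h2, h3⟩ := (hTT τ).1 hτ
    exact (hZ τ h1 h2 h3).1
  have hZi : ∀ τ ∈ TT, ∀ z ∈ Z τ, z.1 ∈ So m ∧ z.2 ∈ So m := by
    intro τ hτ z hz
    obtain ⟨h1, h2, h3⟩ := (hTT τ).1 hτ
    obtain ⟨hi, him⟩ := hen τ h2
    obtain ⟨⟨hz1, hz2⟩, hzf⟩ := (hZm τ hτ z).1 hz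
    have hm1 := bc_mem e hz1
    have hm2 := bc_mem (en τ) hz2
    constructor
    · by_contra hn
      obtain ⟨v, hv, hv'⟩ := bc_not_So he hz1 hn
      rw [heσ] at hv hv'
      rw [him] at hm2
      refine hpr (σ.erase v) (hdown σ hσ _ (Finset.erase_subset _ _)) τ h1
        (h3.mono_left (Finset.erase_subset _ _)) ?_ _ hv' _ hm2 hzf
      rw [Finset.card_erase_of_mem hv]; omega
    · by_contra hn
      obtain ⟨v, hv, hv'⟩ := bc_not_So hi hz2 hn
      rw [heσ] at hm1
      rw [him] at hv hv'
      refine hpr σ hσ (τ.erase v) (hdown τ h1 _ (Finset.erase_subset _ _))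
        (h3.mono_right (Finset.erase_subset _ _)) ?_ _ hm1 _ hv' hzf
      rw [Finset.card_erase_of_mem hv]; omega
  -- uniqueness
  have huniq : ∀ τ ∈ TT, ∀ τ' ∈ TT, ∀ x y y', (x, y) ∈ Z τ → (x, y') ∈ Z τ' → τ = τ' ∧ y = y' := by
    intro τ hτ τ' hτ' x y y' h h'
    obtain ⟨h1, h2, h3⟩ := (hTT τ).1 hτ
    obtain ⟨hi, him⟩ := hen τ h2
    obtain ⟨h1', h2', h3'⟩ := (hTT τ').1 hτ'
    obtain ⟨hi', him'⟩ := hen τ' h2'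
    have e1 := ((hZm τ hτ _).1 h).2
    have e2 := ((hZm τ' hτ' _).1 h').2
    simp only at e1 e2
    have e3 := hgen.g2 e (en τ) (en τ') heσ (by rwa [him]) (by rwa [him']) x y 0 y' e1
      (by simp only [yt, sub_zero, one_smul, zero_smul, add_zero]; rw [← e1, e2])
    simp only [yt, sub_zero, one_smul, zero_smul, add_zero] at e3
    have hττ : τ = τ' := by
      refine Finset.eq_of_subset_of_card_le ?_ (by rw [h2, h2'])
      intro v hv
      by_contra hv'
      have p1 := bc_pos hi (hZi τ hτ _ h).2 (v := v) (by rwa [him])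
      simp only at p1
      rw [e3, bc_off y' (by rwa [him'])] at p1
      exact lt_irrefl _ p1
    subst hττ
    refine ⟨rfl, ?_⟩
    rw [← co_bc hi y, e3, co_bc hi]
  let P : Finset (Fin m → ℝ) := TT.biUnion fun τ => (Z τ).image Prod.fst
  have hP : ∀ x, x ∈ P ↔ ∃ τ ∈ TT, ∃ y, (x, y) ∈ Z τ := by
    intro x; simp [P]
  have hch : ∀ x, ∃ τ : Finset V, ∃ y, x ∈ P → τ ∈ TT ∧ (x, y) ∈ Z τ := by
    intro x
    by_cases h : x ∈ P
    · obtain ⟨τ, h1, y, h2⟩ := (hP x).1 h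
      exact ⟨τ, y, fun _ => ⟨h1, h2⟩⟩
    · exact ⟨∅, 0, fun h' => absurd h' h⟩
  choose lab yy hly using hch
  let sgn : Finset V → (Fin m → ℝ) × (Fin m → ℝ) → ℤ := fun τ z => sg (dt J (fderiv ℝ (f ∘ bc (en τ)) z.2) (fderiv ℝ (f ∘ bc e) z.1))
  have hlabu : ∀ τ ∈ TT, ∀ z ∈ Z τ, z.1 ∈ P ∧ lab z.1 = τ ∧ yy z.1 = z.2 := by
    intro τ hτ z hz
    have hzP : z.1 ∈ P := (hP _).2 ⟨τ, hτ, z.2, hz⟩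
    obtain ⟨h1, h2⟩ := hly _ hzP
    exact ⟨hzP, huniq _ h1 _ hτ _ _ _ h2 hz⟩
  have hsum : ∀ i, ∑ x ∈ P with lab x = i, sgn (lab x) (x, yy x) = 0 := by
    intro τ
    by_cases hτ : τ ∈ TT
    · obtain ⟨h1, h2, h3⟩ := (hTT τ).1 hτ
      rw [← (hZ τ h1 h2 h3).2.2]
      symm
      refine Finset.sum_bij (fun z _ => z.1) ?_ ?_ ?_ ?_
      · intro z hz
        obtain ⟨a, b, c⟩ := hlabu τ hτ z hz
        exact Finset.mem_filter.2 ⟨a, b⟩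
      · intro z hz z' hz' hzz
        obtain ⟨a, b, c⟩ := hlabu τ hτ z hz
        obtain ⟨a', b', c'⟩ := hlabu τ hτ z' hz'
        refine Prod.ext hzz ?_
        rw [← c, ← c', hzz]
      · intro x hx
        obtain ⟨hx1, hx2⟩ := Finset.mem_filter.1 hx
        obtain ⟨_, hxx⟩ := hly x hx1
        rw [hx2] at hxx
        exact ⟨_, hxx, rfl⟩
      · intro z hz
        obtain ⟨a, b, c⟩ := hlabu τ hτ z hz
        simp only [b, c, sgn]
    · rw [Finset.filter_false_of_mem, Finset.sum_empty]
      intro x hx hxl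
      exact hτ (hxl ▸ (hly x hx).1)
  have hm' : ∀ x ∈ P, ∀ x' ∈ P, lab x = lab x' → sgn (lab x) (x, yy x) = - sgn (lab x') (x', yy x') → Match C (f ∘ bc e) x x' := by
    intro x hx x' hx' hl hs
    obtain ⟨hτ, hxy⟩ := hly x hx
    obtain ⟨-, hxy'⟩ := hly x' hx'
    rw [← hl] at hxy' hs
    set τ := lab x with hτdef
    obtain ⟨h1, h2, h3⟩ := (hTT τ).1 hτ
    obtain ⟨hi, him⟩ := hen τ h2
    have hdis : Disjoint σ (Finset.univ.image (en τ)) := by rwa [him]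
    have e1 := ((hZm τ hτ _).1 hxy).2
    have e2 := ((hZm τ hτ _).1 hxy').2
    simp only at e1 e2
    have hyI := (hZi τ hτ _ hxy).2
    have hyI' := (hZi τ hτ _ hxy').2
    simp only at hyI hyI'
    let S : Set (Fin m → ℝ) := (yt (yy x) '' Icc (0:ℝ) 1) ∪ (yt (yy x') '' Icc (0:ℝ) 1)
    have hytc : ∀ y : Fin m → ℝ, Continuous (yt y) := by intro y; unfold yt; fun_prop
    have hpt : ∀ q ∈ S, ∃ a b t, f (bc e a) = f (bc (en τ) b) ∧ b ∈ So m ∧ t ∈ Icc (0:ℝ) 1 ∧ q = yt b t := by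
      rintro q (⟨t, ht, rfl⟩ | ⟨t, ht, rfl⟩)
      · exact ⟨x, yy x, t, e1, hyI, ht, rfl⟩
      · exact ⟨x', yy x', t, e2, hyI', ht, rfl⟩
    have hSconn : IsPreconnected S := by
      refine IsPreconnected.union (cen m) ?_ ?_ (isPreconnected_Icc.image _ (hytc _).continuousOn)
        (isPreconnected_Icc.image _ (hytc _).continuousOn)
      · exact ⟨1, by simp, by simp [yt]⟩
      · exact ⟨1, by simp, by simp [yt]⟩
    have hgc : Continuous (f ∘ bc e) := hf.continuous.comp (bc_cont e)
    have hgd : Differentiable ℝ (f ∘ bc e) := (hf.comp (bc_contDiff e)).differentiable (by simp)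
    refine match_of_slide (by simp; omega) J (h := f ∘ bc (en τ)) (hf.comp (bc_contDiff _)) hSconn ?_ ?_
      (hgd x).hasFDerivAt (hgd x').hasFDerivAt
      (Eventually.of_forall fun z => hgc.continuousAt) (Eventually.of_forall fun z => hgc.continuousAt)
      (y := yy x) (y' := yy x') (Or.inl ⟨0, by simp, by simp [yt]⟩) (Or.inr ⟨0, by simp, by simp [yt]⟩) e1 e2 ?_
    · intro q hq
      obtain ⟨a, b, t, hab, hb, ht, rfl⟩ := hpt q hq
      exact good_pt hf.continuous hcard hi (yt_So hb ht)
        (fun e'' hd'' z hz => hgen.g2 e (en τ) e'' heσ hdis hd'' a b t z hab hz)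
    · intro q hq
      obtain ⟨a, b, t, hab, hb, ht, rfl⟩ := hpt q hq
      have hd : fderiv ℝ (f ∘ bc (en τ)) (yt b t) = (fderiv ℝ f (bc (en τ) (yt b t))).comp (lin (en τ)) :=
        ((hf.differentiable (by simp) _).hasFDerivAt.comp _ (bc_hasFDerivAt (en τ) _)).fderiv
      rw [hd]
      refine (injective_iff_map_eq_zero _).2 fun ξ hξ => ?_
      have := hgen.g3 e (en τ) heσ hdis a b t ξ hab hξ
      exact lin_injective hi (by rw [this, map_zero])
    · exact sg_neg_mul ((hZ τ h1 h2 h3).2.1 _ hxy) ((hZ τ h1 h2 h3).2.1 _ hxy') hs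
  obtain ⟨g', T, hTc, hTQ, hgT, hgc, hgC⟩ := remove_all hCo hSC (by simp; omega) (St_convex (k := m)) lab
    (fun x => sgn (lab x) (x, yy x)) P.card P rfl
    (by
      intro x hx
      obtain ⟨h1, h2⟩ := hly x hx
      rw [interior_St]
      exact (hZi _ h1 _ h2).1) (f ∘ bc e) (hf.continuous.comp (bc_cont e)).continuousOn
    (by
      rintro x ⟨hx, hxP⟩
      rintro ⟨w, hw, hwx⟩
      obtain ⟨t, ht, hdis, hwt⟩ := (hmY w).1 hw
      have htc : t.card = m + 1 := by
        by_contra hne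
        have hm1 := bc_mem e hx
        rw [heσ] at hm1
        exact hpr σ hσ t ht hdis (by have := hcard t ht; omega) _ hm1 _ hwt hwx.symm
      obtain ⟨hi, him⟩ := hen t htc
      have htT : t ∈ TT := (hTT t).2 ⟨ht, htc, hdis⟩
      rw [← him] at hwt
      refine hxP ((hP x).2 ⟨t, htT, co (en t) w, (hZm t htT _).2 ⟨⟨hx, co_mem hi hwt⟩, ?_⟩⟩)
      simp only [bc_co hi hwt]; exact hwx.symm)
    (fun x hx => sg_cases _) hsum hm'
  refine ⟨g', T, by rwa [interior_St] at hTQ, hgT, hgc, ?_⟩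
  intro x hx t ht hdis w hw h
  exact hgC hx ⟨w, (hmY w).2 ⟨t, ht, hdis, hw⟩, h.symm⟩

end
end VK

open Set
noncomputable section
namespace VK
set_option linter.unusedVariables false
set_option linter.unusedSectionVars false
set_option linter.deprecated false
set_option linter.unusedSimpArgs false
open Topology Filter MeasureTheory

section
variable {V : Type*} [Fintype V] [DecidableEq V]
variable {E : Type*} [NormedAddCommGroup E] [NormedSpace ℝ E] [FiniteDimensional ℝ E]

theorem pert_near {K : Finset (Finset V)} {f : (V → ℝ) → E} {Θ : V → E} {w : V → ℝ} (hw : w ∈ poly K) :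
    ‖pert f Θ w - f w‖ ≤ ‖Θ‖ := by
  obtain ⟨s, hs, hw⟩ := mem_poly.1 hw
  have : pert f Θ w - f w = ∑ v, w v • Θ v := by simp [pert]
  rw [this]
  calc ‖∑ v, w v • Θ v‖ ≤ ∑ v, ‖w v • Θ v‖ := norm_sum_le _ _
    _ ≤ ∑ v, w v * ‖Θ‖ := by
        refine Finset.sum_le_sum fun v _ => ?_
        rw [norm_smul, Real.norm_of_nonneg (hw.1 v)]
        exact mul_le_mul_of_nonneg_left (norm_le_pi_norm Θ v) (hw.1 v)
    _ = ‖Θ‖ := by rw [← Finset.sum_mul, hw.2.1, one_mul]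

theorem step_face {m : ℕ} (hm : 3 ≤ m) (hE : Module.finrank ℝ E = 2 * m) {K : Finset (Finset V)}
    (hdown : ∀ s ∈ K, ∀ t, t ⊆ s → t ∈ K) (hcard : ∀ s ∈ K, s.card ≤ m + 1) {P : Finset (Finset V)} (hPK : P ⊆ K)
    {f : (V → ℝ) → E} (hf : Inv K m P f) {σ : Finset V} (hσ : σ ∈ K) (hσc : σ.card = m + 1) :
    ∃ f' : (V → ℝ) → E, Inv K m (insert σ P) f' := by
  obtain ⟨ε, hε, hst⟩ := hf.stable hPK
  obtain ⟨f1, hf1, hf1n⟩ := exists_smooth_approx (poly_compact K) hf.cont (half_pos hε)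
  obtain ⟨Θ, hΘ, hgen⟩ := gen_exists hm hE σ hf1 (half_pos hε)
  set h := pert f1 Θ with hh
  have hs : ContDiff ℝ (⊤:ℕ∞) h := pert_contDiff hf1 Θ
  have hs1 : ContDiff ℝ 1 h := hs.of_le (by norm_cast)
  have hI : Inv K m P h := by
    refine hst h hs.continuous.continuousOn fun w hw => ?_
    have h1 := hf1n w hw
    have h2 : ‖h w - f1 w‖ ≤ ‖Θ‖ := pert_near hw
    have h3 : h w - f w = (h w - f1 w) + (f1 w - f w) := by abel
    rw [h3]
    have := norm_add_le (h w - f1 w) (f1 w - f w)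
    linarith
  clear_value h
  obtain ⟨e, he, heσ⟩ := exists_enum hσc
  obtain ⟨g', T, hT, hgT, hgc, hgC⟩ := clean_face hm hE hdown hcard hs1 hI.pr hI.nl hσ he heσ hgen
  classical
  let f' : (V → ℝ) → E := fun w => if w ∈ Dl σ then g' (co e w) else h w
  have hsame : ∀ w, (w ∈ Dl σ → ∃ v ∈ σ, w v = 0) → f' w = h w := by
    intro w hw
    by_cases hwσ : w ∈ Dl σ
    · simp only [f', if_pos hwσ]
      obtain ⟨v, hv, hv0⟩ := hw hwσ
      rw [← heσ] at hwσ hv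
      rw [hgT, bc_co he hwσ]
      intro hcT
      have := bc_pos he (hT hcT) hv
      rw [bc_co he hwσ, hv0] at this
      exact lt_irrefl _ this
    · simp only [f', if_neg hwσ]
  have hoth : ∀ t ∈ K, t ≠ σ → ∀ w ∈ Dl t, f' w = h w := by
    intro t ht hne w hw
    refine hsame w fun hwσ => ?_
    have : ¬ σ ⊆ t := fun hsub => hne (Finset.eq_of_subset_of_card_le hsub (by rw [hσc]; exact hcard t ht)).symm
    obtain ⟨v, hv, hvt⟩ := Finset.not_subset.1 this
    exact ⟨v, hv, hw.2.2 v hvt⟩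
  have hself : ∀ t ∈ K, Disjoint σ t → ∀ x ∈ Dl σ, ∀ y ∈ Dl t, f' x ≠ f' y := by
    intro t ht hdis x hx y hy
    have hne : t ≠ σ := by
      rintro rfl
      rw [disjoint_self] at hdis
      rw [hdis] at hσc; simp at hσc
    rw [hoth t ht hne y hy]
    simp only [f', if_pos hx]
    rw [← heσ] at hx
    exact hgC _ (co_mem he hx) t ht hdis y hy
  have hcont : ContinuousOn f' (poly K) := by
    have hB : IsClosed (⋃ t ∈ K.erase σ, Dl t) := (Finset.isCompact_biUnion _ fun t _ => Dl_compact t).isClosed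
    refine continuousOn_cover (Dl_closed σ) hB ?_ ?_ ?_
    · intro w hw
      obtain ⟨s, hs, hw⟩ := mem_poly.1 hw
      by_cases hsσ : s = σ
      · left; rwa [hsσ] at hw
      · right; simp only [mem_iUnion]; exact ⟨s, Finset.mem_erase.2 ⟨hsσ, hs⟩, hw⟩
    · have : ContinuousOn (fun w => g' (co e w)) (poly K ∩ Dl σ) :=
        hgc.comp (co e).continuous.continuousOn fun w hw => co_mem he (by rw [heσ]; exact hw.2)
      exact this.congr fun w hw => if_pos hw.2
    · refine hs.continuous.continuousOn.congr fun w hw => ?_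
      obtain ⟨-, hw⟩ := hw
      simp only [mem_iUnion] at hw
      obtain ⟨t, ht, hw⟩ := hw
      exact hoth t (Finset.mem_erase.1 ht).2 (Finset.mem_erase.1 ht).1 w hw
  -- generic transfer
  have htr : ∀ s ∈ K, ∀ t ∈ K, Disjoint s t → (∀ x ∈ Dl s, ∀ y ∈ Dl t, h x ≠ h y) → ∀ x ∈ Dl s, ∀ y ∈ Dl t, f' x ≠ f' y := by
    intro s hs t ht hdis hne x hx y hy
    by_cases h1 : s = σ
    · subst h1; exact hself t ht hdis x hx y hy
    by_cases h2 : t = σ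
    · subst h2; exact (hself s hs hdis.symm y hy x hx).symm
    rw [hoth s hs h1 x hx, hoth t ht h2 y hy]
    exact hne x hx y hy
  have hD : ∀ s ∈ K, ∀ t ∈ K, ContinuousOn (fun p : (V → ℝ) × (V → ℝ) => f' p.1 - f' p.2) (Dl s ×ˢ Dl t) := by
    intro s hs t ht
    exact ((hcont.mono (fun w hw => mem_poly.2 ⟨s, hs, hw⟩)).comp continuousOn_fst (fun p hp => hp.1)).sub
      ((hcont.mono (fun w hw => mem_poly.2 ⟨t, ht, hw⟩)).comp continuousOn_snd (fun p hp => hp.2))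
  refine ⟨f', hcont, ?_, ?_, ?_⟩
  · intro s hs t ht hdis hc
    exact htr s hs t ht hdis (hI.pr s hs t ht hdis hc)
  · intro s hs t ht hdis h1 h2
    by_cases hc : s = σ ∨ t = σ
    · refine ⟨fun p => f' p.1 - f' p.2, hD s hs t ht, fun p hp h0 => ?_, fun p hp _ => rfl⟩
      rw [sub_eq_zero] at h0
      rcases hc with rfl | rfl
      · exact hself t ht hdis _ hp.1 _ hp.2 h0
      · exact hself s hs hdis.symm _ hp.2 _ hp.1 h0.symm
    · push Not at hc
      obtain ⟨G, hG, hG0, hGb⟩ := hI.nl s hs t ht hdis h1 h2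
      refine ⟨G, hG, hG0, fun p hp hb => ?_⟩
      rw [hGb p hp hb, hoth s hs hc.1 _ hp.1, hoth t ht hc.2 _ hp.2]
  · intro s hs t ht hdis
    rcases Finset.mem_insert.1 hs with rfl | hs
    · exact hself t ht hdis
    · exact htr s (hPK hs) t ht hdis (hI.dn s hs t ht hdis)

theorem stage2 {m : ℕ} (hm : 3 ≤ m) (hE : Module.finrank ℝ E = 2 * m) {K : Finset (Finset V)}
    (hdown : ∀ s ∈ K, ∀ t, t ⊆ s → t ∈ K) (hcard : ∀ s ∈ K, s.card ≤ m + 1)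
    {f : (V → ℝ) → E} (hf : Inv K m ∅ f) :
    ∃ f' : (V → ℝ) → E, ContinuousOn f' (poly K) ∧ ∀ s ∈ K, ∀ t ∈ K, Disjoint s t → ∀ x ∈ Dl s, ∀ y ∈ Dl t, f' x ≠ f' y := by
  have hind : ∀ P : Finset (Finset V), P ⊆ K.filter (fun s => s.card = m + 1) → ∃ f' : (V → ℝ) → E, Inv K m P f' := by
    intro P
    induction P using Finset.induction_on with
    | empty => intro _; exact ⟨f, hf⟩
    | insert σ P hσ ih =>
      intro hsub
      obtain ⟨f1, hf1⟩ := ih ((Finset.subset_insert _ _).trans hsub)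
      obtain ⟨hσK, hσc⟩ := Finset.mem_filter.1 (hsub (Finset.mem_insert_self σ P))
      exact step_face hm hE hdown hcard (((Finset.subset_insert _ _).trans hsub).trans (Finset.filter_subset _ _)) hf1 hσK hσc
  obtain ⟨f', hf'⟩ := hind _ (Finset.Subset.refl _)
  refine ⟨f', hf'.cont, fun s hs t ht hdis => ?_⟩
  by_cases hc : s.card + t.card ≤ 2 * m + 1
  · exact hf'.pr s hs t ht hdis hc
  · have := hcard s hs; have := hcard t ht
    exact hf'.dn s (Finset.mem_filter.2 ⟨hs, by omega⟩) t ht hdis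

end
end VK

open Set
noncomputable section
namespace VK
set_option linter.unusedVariables false
set_option linter.unusedSectionVars false
set_option linter.deprecated false
set_option linter.unusedSimpArgs false
open Topology Filter MeasureTheory

section
variable {V : Type*} [Fintype V] [DecidableEq V]
variable {E : Type*} [NormedAddCommGroup E] [NormedSpace ℝ E] [FiniteDimensional ℝ E]

theorem smooth_odd {X : Type*} [NormedAddCommGroup X] [NormedSpace ℝ X] [FiniteDimensional ℝ X] {D : Set (X × X)}
    (hD : IsCompact D) (hsw : ∀ p ∈ D, p.swap ∈ D) {Φ : X × X → E} (hΦ : ContinuousOn Φ D) (h0 : ∀ p ∈ D, Φ p ≠ 0)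
    (hodd : ∀ p ∈ D, Φ p.swap = -Φ p) :
    ∃ Ψ : X × X → E, ContDiff ℝ (⊤ : ℕ∞) Ψ ∧ (∀ p ∈ D, Ψ p ≠ 0) ∧ ∀ p, Ψ p.swap = -Ψ p := by
  obtain ⟨ε, hε, hpos⟩ := ((stable_ne hD hΦ h0).and self_mem_nhdsWithin).exists
  obtain ⟨g, hg, hgn⟩ := exists_smooth_approx hD hΦ hpos
  refine ⟨fun p => (1/2:ℝ) • (g p - g p.swap), ?_, ?_, ?_⟩
  · exact contDiff_const.smul (hg.sub (hg.comp (contDiff_snd.prodMk contDiff_fst)))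
  · intro p hp
    have h1 := hgn p hp
    have h2 := hgn p.swap (hsw p hp)
    rw [hodd p hp] at h2
    have : (1/2:ℝ) • (g p - g p.swap) = Φ p + (1/2:ℝ) • ((g p - Φ p) - (g p.swap - -Φ p)) := by
      module
    simp only
    rw [this]
    refine hε p hp _ ?_
    rw [norm_smul]
    have h3 := norm_sub_le (g p - Φ p) (g p.swap - -Φ p)
    have h4 : ‖(1/2:ℝ)‖ = 1/2 := by norm_num
    have h5 : (0:ℝ) < ε := hpos
    rw [h4]; linarith
  · intro p
    simp only [Prod.swap_swap]; module

/-- the linear map with given vertex images -/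
def lf (Θ : V → E) : (V → ℝ) →L[ℝ] E :=
  ∑ v, (ContinuousLinearMap.proj (R := ℝ) (φ := fun _ : V => ℝ) v).smulRight (Θ v)

theorem lf_apply (Θ : V → E) (w : V → ℝ) : lf Θ w = ∑ v, w v • Θ v := by
  simp [lf, ContinuousLinearMap.sum_apply]

def Hh (F : (V → ℝ) → E) (Φ : (V → ℝ) × (V → ℝ) → E) (x y : V → ℝ) (t : ℝ) : E :=
  (1 - t) • (F x - F y) + t • Φ (x, y)

def bs (m : ℕ) (j : ℕ) : Fin m → ℝ := fun _ => 1 / ((m:ℝ) + 1 + j)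

theorem bs_mem {m : ℕ} (j : ℕ) : bs m j ∈ So m := by
  refine ⟨fun i => by simp only [bs]; positivity, ?_⟩
  simp only [bs, Finset.sum_const, Finset.card_univ, Fintype.card_fin, nsmul_eq_mul]
  rw [mul_one_div, div_lt_one (by positivity)]
  have : (0:ℝ) ≤ j := by positivity
  linarith

theorem bs_inj {m : ℕ} (hm : 0 < m) : Function.Injective (bs m) := by
  intro i j h
  have := congrFun h ⟨0, hm⟩
  simp only [bs] at this
  have h1 : ((m:ℝ) + 1 + i) = (m:ℝ) + 1 + j := by
    have := congrArg (fun x => 1 / x) this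
    simpa using this
  have : (i:ℝ) = j := by linarith
  exact_mod_cast this

structure Gn (k : ℕ) (Φ : (V → ℝ) × (V → ℝ) → E) (F : (V → ℝ) →L[ℝ] E) : Prop where
  a : ∀ z : V → ℝ, ∑ v, z v = 0 → (Finset.univ.filter (fun v => z v ≠ 0)).card ≤ 2 * k + 3 → F z = 0 → z = 0
  h1 : ∀ a b : ℕ, a + b + 1 < 2 * (k + 1) → ∀ (e : Fin (a+1) → V) (e' : Fin (b+1) → V),
    Disjoint (Finset.univ.image e) (Finset.univ.image e') → ∀ x y t, t ≠ 1 → Hh F Φ (bc e x) (bc e' y) t ≠ 0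
  h2 : ∀ (e : Fin (k+1+1) → V) (e' : Fin (k+1) → V), Disjoint (Finset.univ.image e) (Finset.univ.image e') →
    ∀ u : (Fin (k+1) → ℝ) × (Fin k → ℝ) × ℝ, u.2.2 ≠ 1 → Hh F Φ (bc e u.1) (bc e' u.2.1) u.2.2 = 0 →
      Function.Surjective (fderiv ℝ (fun u : (Fin (k+1) → ℝ) × (Fin k → ℝ) × ℝ => Hh F Φ (bc e u.1) (bc e' u.2.1) u.2.2) u)
  sg : ∀ (e : Fin (k+1+1) → V) (e' e'' : Fin (k+1) → V) (j : ℕ) (s : ℝ) (z : Fin k → ℝ),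
    F ((1 - s) • bc e (bs (k+1) j) + s • bc e' (cen k) - bc e'' z) = 0 →
      (1 - s) • bc e (bs (k+1) j) + s • bc e' (cen k) - bc e'' z = 0

theorem thin_a {k : ℕ} (hE : Module.finrank ℝ E = 2 * (k + 1)) : Thin {Θ : V → E | ∃ z : V → ℝ, z ≠ 0 ∧ ∑ v, z v = 0 ∧
    (Finset.univ.filter (fun v => z v ≠ 0)).card ≤ 2 * k + 3 ∧ lf Θ z = 0} := by
  let I := {q : Finset V × V × V // q.2.1 ∈ q.1 ∧ q.2.2 ∈ q.1 ∧ q.2.1 ≠ q.2.2 ∧ q.1.card ≤ 2 * k + 3}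
  let r : ∀ q : I, ({v // v ∈ (q.1.1.erase q.1.2.1).erase q.1.2.2} → ℝ) → V → ℝ := fun q η v =>
    if v = q.1.2.1 then 1 else if h : v ∈ (q.1.1.erase q.1.2.1).erase q.1.2.2 then η ⟨v, h⟩ else
      if v = q.1.2.2 then -1 - ∑ w, η w else 0
  have hthin : ∀ q : I, Thin {Θ : V → E | ∃ u, r q u ≠ 0 ∧ ∑ v, r q u v • Θ v = 0} := by
    intro q
    refine gp_avoid (r := r q) (α := fun _ => 0) ?_ (differentiable_const _) ?_
    · refine differentiable_pi.2 fun v => ?_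
      simp only [r]
      split_ifs <;> fun_prop
    · obtain ⟨⟨T, v0, v1⟩, h1, h2, h3, h4⟩ := q
      rw [hE, Module.finrank_fintype_fun_eq_card, Fintype.card_coe]
      simp only at h1 h2 h3 h4 ⊢
      rw [Finset.card_erase_of_mem (Finset.mem_erase.2 ⟨h3.symm, h2⟩), Finset.card_erase_of_mem h1]
      omega
  refine (Thin.iUnion hthin).mono ?_
  rintro Θ ⟨z, hz0, hzs, hzc, hzF⟩
  obtain ⟨v0, hv0⟩ : ∃ v, z v ≠ 0 := by
    by_contra h; push Not at h; exact hz0 (funext h)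
  obtain ⟨v1, hv1, hv10⟩ : ∃ v, z v ≠ 0 ∧ v0 ≠ v := by
    by_contra h; push Not at h
    have : ∑ v, z v = z v0 := Finset.sum_eq_single v0 (fun v _ hv => by
      by_contra h'; exact hv (h v h').symm) (by simp)
    exact hv0 (by rw [← this, hzs])
  let T := Finset.univ.filter (fun v => z v ≠ 0)
  have hT : ∀ v, v ∈ T ↔ z v ≠ 0 := by intro v; simp [T]
  let q : I := ⟨(T, v0, v1), (hT _).2 hv0, (hT _).2 hv1, hv10, hzc⟩
  have hr : r q (fun v => z v / z v0) = fun v => z v / z v0 := by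
    have hsum : ∑ w : {v // v ∈ (T.erase v0).erase v1}, z w / z v0 = -1 - z v1 / z v0 := by
      rw [Finset.sum_coe_sort ((T.erase v0).erase v1) (fun v => z v / z v0)]
      have e1 := Finset.add_sum_erase (T.erase v0) (fun v => z v / z v0) (Finset.mem_erase.2 ⟨hv10.symm, (hT v1).2 hv1⟩)
      have e2 := Finset.add_sum_erase T (fun v => z v / z v0) ((hT v0).2 hv0)
      have e3 : ∑ v ∈ T, z v / z v0 = 0 := by
        rw [← Finset.sum_div, Finset.sum_filter_ne_zero, hzs, zero_div]
      rw [div_self hv0] at e2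
      linarith
    funext v
    simp only [r]
    split_ifs with h1 h2 h3
    · rw [h1, div_self hv0]
    · rfl
    · rw [h3]
      show -1 - ∑ w : {v // v ∈ (T.erase v0).erase v1}, z w / z v0 = _
      rw [hsum]; ring
    · have : z v = 0 := by
        by_contra hne
        exact h2 (Finset.mem_erase.2 ⟨h3, Finset.mem_erase.2 ⟨h1, (hT v).2 hne⟩⟩)
      rw [this, zero_div]
  refine mem_iUnion.2 ⟨q, (fun v => z v / z v0), ?_, ?_⟩
  · rw [hr]; intro h
    have := congrFun h v0
    simp [hv0] at this
  · rw [hr]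
    rw [lf_apply] at hzF
    have : ∀ v, (z v / z v0) • Θ v = (z v0)⁻¹ • (z v • Θ v) := fun v => by
      rw [smul_smul]; congr 1; field_simp
    simp only [this, ← Finset.smul_sum, hzF, smul_zero]

theorem bc_disj' {a b : ℕ} {e : Fin (a+1) → V} {e' : Fin (b+1) → V}
    (he' : Disjoint (Finset.univ.image e) (Finset.univ.image e')) (x : Fin a → ℝ) (y : Fin b → ℝ) : bc e x - bc e' y ≠ 0 := by
  intro h
  have h0 : ∀ v, bc e x v = 0 := by
    intro v
    by_cases hv : v ∈ Finset.univ.image e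
    · have := congrFun h v
      rw [Pi.sub_apply, bc_off y (Finset.disjoint_left.1 he' hv)] at this
      simpa using this
    · exact bc_off x hv
  have := bc_sum e x
  simp [h0] at this

theorem Hh_lf (Θ : V → E) (Φ : (V → ℝ) × (V → ℝ) → E) (x y : V → ℝ) (t : ℝ) :
    Hh (lf Θ) Φ x y t = ∑ v, ((1 - t) • (x - y)) v • Θ v - -(t • Φ (x, y)) := by
  rw [← lf_apply, map_smul, map_sub, Hh]; abel

theorem gn_exists {k : ℕ} (hE : Module.finrank ℝ E = 2 * (k + 1)) {Φ : (V → ℝ) × (V → ℝ) → E}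
    (hΦ : ContDiff ℝ (⊤ : ℕ∞) Φ) : ∃ Θ : V → E, Gn k Φ (lf Θ) := by
  have hΦd : Differentiable ℝ Φ := hΦ.differentiable (by simp)
  have hbd : ∀ {a : ℕ} (e : Fin (a+1) → V), Differentiable ℝ (bc e) := fun e => (bc_contDiff e (n := 1)).differentiable (by simp)
  have hT1 : ∀ (a b : ℕ) (e : Fin (a+1) → V) (e' : Fin (b+1) → V), Differentiable ℝ (fun u : (Fin a → ℝ) × (Fin b → ℝ) × ℝ =>
      (1 - u.2.2) • (bc e u.1 - bc e' u.2.1)) := by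
    intro a b e e'
    have h1 := (hbd e).comp (differentiable_fst (𝕜 := ℝ) (E := Fin a → ℝ) (F := (Fin b → ℝ) × ℝ))
    have h2 := (hbd e').comp (differentiable_fst.comp (differentiable_snd (𝕜 := ℝ) (E := Fin a → ℝ) (F := (Fin b → ℝ) × ℝ)))
    have h3 := (differentiable_snd.comp (differentiable_snd (𝕜 := ℝ) (E := Fin a → ℝ) (F := (Fin b → ℝ) × ℝ)))
    exact ((differentiable_const _).sub h3).smul (h1.sub h2)
  have hT2 : ∀ (a b : ℕ) (e : Fin (a+1) → V) (e' : Fin (b+1) → V), Differentiable ℝ (fun u : (Fin a → ℝ) × (Fin b → ℝ) × ℝ =>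
      -(u.2.2 • Φ (bc e u.1, bc e' u.2.1))) := by
    intro a b e e'
    have h1 := (hbd e).comp (differentiable_fst (𝕜 := ℝ) (E := Fin a → ℝ) (F := (Fin b → ℝ) × ℝ))
    have h2 := (hbd e').comp (differentiable_fst.comp (differentiable_snd (𝕜 := ℝ) (E := Fin a → ℝ) (F := (Fin b → ℝ) × ℝ)))
    have h3 := (differentiable_snd.comp (differentiable_snd (𝕜 := ℝ) (E := Fin a → ℝ) (F := (Fin b → ℝ) × ℝ)))
    exact (h3.smul (hΦd.comp (h1.prodMk h2))).neg
  have hB1 : ∀ q : Σ a : ℕ, Σ b : ℕ, {p : (Fin (a+1) → V) × (Fin (b+1) → V) // a + b + 1 < 2 * (k + 1)},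
      Thin {Θ : V → E | ∃ u : (Fin q.1 → ℝ) × (Fin q.2.1 → ℝ) × ℝ,
        (1 - u.2.2) • (bc q.2.2.1.1 u.1 - bc q.2.2.1.2 u.2.1) ≠ 0 ∧
        ∑ v, ((1 - u.2.2) • (bc q.2.2.1.1 u.1 - bc q.2.2.1.2 u.2.1)) v • Θ v = -(u.2.2 • Φ (bc q.2.2.1.1 u.1, bc q.2.2.1.2 u.2.1))} := by
    rintro ⟨a, b, ⟨⟨e, e'⟩, hab⟩⟩
    refine gp_avoid (hT1 a b e e') (hT2 a b e e') ?_
    rw [hE]; simp; omega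
  have hB2 : ∀ q : (Fin (k+1+1) → V) × (Fin (k+1) → V),
      Thin {Θ : V → E | ∃ u : (Fin (k+1) → ℝ) × (Fin k → ℝ) × ℝ,
        (1 - u.2.2) • (bc q.1 u.1 - bc q.2 u.2.1) ≠ 0 ∧
        ∑ v, ((1 - u.2.2) • (bc q.1 u.1 - bc q.2 u.2.1)) v • Θ v = -(u.2.2 • Φ (bc q.1 u.1, bc q.2 u.2.1)) ∧
        ¬ Function.Surjective (fderiv ℝ (fun u : (Fin (k+1) → ℝ) × (Fin k → ℝ) × ℝ =>
          ∑ v, ((1 - u.2.2) • (bc q.1 u.1 - bc q.2 u.2.1)) v • Θ v - -(u.2.2 • Φ (bc q.1 u.1, bc q.2 u.2.1))) u)} := by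
    rintro ⟨e, e'⟩
    refine gp_regular (hT1 (k+1) k e e') (hT2 (k+1) k e e') ?_
    rw [hE]; simp; omega
  have hB3 : ∀ q : ((Fin (k+1+1) → V) × (Fin (k+1) → V) × (Fin (k+1) → V)) × ℕ,
      Thin {Θ : V → E | ∃ u : ℝ × (Fin k → ℝ),
        (1 - u.1) • bc q.1.1 (bs (k+1) q.2) + u.1 • bc q.1.2.1 (cen k) - bc q.1.2.2 u.2 ≠ 0 ∧
        ∑ v, ((1 - u.1) • bc q.1.1 (bs (k+1) q.2) + u.1 • bc q.1.2.1 (cen k) - bc q.1.2.2 u.2) v • Θ v = 0} := by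
    rintro ⟨⟨e, e', e''⟩, j⟩
    refine gp_avoid (r := fun u : ℝ × (Fin k → ℝ) => (1 - u.1) • bc e (bs (k+1) j) + u.1 • bc e' (cen k) - bc e'' u.2)
      (α := fun _ => 0) ?_ (differentiable_const _) ?_
    · have h2 := (hbd e'').comp (differentiable_snd (𝕜 := ℝ) (E := ℝ) (F := (Fin k → ℝ)))
      have h3 := (differentiable_fst (𝕜 := ℝ) (E := ℝ) (F := (Fin k → ℝ)))
      exact ((((differentiable_const _).sub h3).smul (differentiable_const _)).add (h3.smul (differentiable_const _))).sub h2
    · rw [hE]; simp; omega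
  obtain ⟨Θ, -, hΘ⟩ := ((((thin_a (V := V) hE).union (Thin.iUnion hB1)).union (Thin.iUnion hB2)).union (Thin.iUnion hB3)).exists_near 0 one_pos
  simp only [mem_union, mem_iUnion, not_or, not_exists] at hΘ
  obtain ⟨⟨⟨ha, h1⟩, h2⟩, h3⟩ := hΘ
  refine ⟨Θ, ?_, ?_, ?_, ?_⟩
  · intro z hz hc hF
    by_contra h0
    exact ha ⟨z, h0, hz, hc, hF⟩
  · intro a b hab e e' hdis x y t ht h0
    refine h1 ⟨a, b, ⟨(e, e'), hab⟩⟩ ⟨(x, y, t), ?_, ?_⟩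
    · exact smul_ne_zero (sub_ne_zero.2 ht.symm) (bc_disj' hdis x y)
    · rw [Hh_lf, sub_eq_zero] at h0; exact h0
  · intro e e' hdis u ht h0
    by_contra hns
    refine h2 (e, e') ⟨u, ?_, ?_, ?_⟩
    · exact smul_ne_zero (sub_ne_zero.2 ht.symm) (bc_disj' hdis _ _)
    · rw [Hh_lf, sub_eq_zero] at h0; exact h0
    · simpa only [Hh_lf] using hns
  · intro e e' e'' j s z h0
    by_contra hne
    refine h3 ((e, e', e''), j) ⟨(s, z), hne, ?_⟩
    rw [lf_apply] at h0; exact h0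

end
end VK

open Set
noncomputable section
namespace VK
set_option linter.unusedVariables false
set_option linter.unusedSectionVars false
set_option linter.deprecated false
set_option linter.unusedSimpArgs false
open Topology Filter MeasureTheory

section
variable {V : Type*} [Fintype V] [DecidableEq V]
variable {E : Type*} [NormedAddCommGroup E] [NormedSpace ℝ E] [FiniteDimensional ℝ E]

theorem sg_ne (x : ℝ) : sg x ≠ 0 := by unfold sg; split_ifs <;> simp

/-- removing the zeros of a map with vanishing total sign -/
theorem kill {U : Type*} [NormedAddCommGroup U] [NormedSpace ℝ U] [FiniteDimensional ℝ U]
    (hU : 3 ≤ Module.finrank ℝ U) (J : E ≃L[ℝ] U × (Fin 0 → ℝ)) {Q : Set U} (hQ : Convex ℝ Q)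
    {g : U → E} (hg : Continuous g) (P : Finset U) (hPQ : ∀ z ∈ P, z ∈ interior Q)
    (hgP : ∀ z ∈ Q, g z = 0 ↔ z ∈ P) (L : U → U →L[ℝ] E) (hL : ∀ z ∈ P, HasFDerivAt g (L z) z)
    (hd : ∀ z ∈ P, dt J 0 (L z) ≠ 0) (hsum : ∑ z ∈ P, sg (dt J 0 (L z)) = 0) :
    ∃ g' : U → E, ∃ T : Set U, IsClosed T ∧ T ⊆ interior Q ∧
      (∀ z ∉ T, g' z = g z) ∧ ContinuousOn g' Q ∧ ∀ z ∈ Q, g' z ≠ 0 := by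
  have hfr : Module.finrank ℝ E = Module.finrank ℝ U := by
    rw [J.toLinearEquiv.finrank_eq]; simp
  have hCo : IsOpen ({0}ᶜ : Set E) := isOpen_compl_singleton
  have hSC : SC ({0}ᶜ : Set E) := by
    refine sc_compl (W := Fin 0 → ℝ) hCo (ι := Unit) (fun _ _ => 0) (fun _ => univ) ?_ ?_ ?_
    · intro i y _; exact differentiableAt_const _
    · rw [hfr]; simp; omega
    · intro z hz
      exact ⟨(), 0, mem_univ _, (not_not.1 hz).symm⟩
  obtain ⟨g', T, h1, h2, h3, h4, h5⟩ := remove_all hCo hSC (by omega) hQ (fun _ => ()) (fun z => sg (dt J 0 (L z)))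
    P.card P rfl hPQ g hg.continuousOn (fun z hz => by
      intro h0
      exact hz.2 ((hgP z hz.1).1 h0)) (fun z _ => sg_cases _) (fun _ => by simpa using hsum) (by
      intro x hx x' hx' _ hs
      have hgood : ∀ y ∈ (univ : Set (Fin 0 → ℝ)), Good ({0}ᶜ : Set E) (fun _ => 0) y := by
        intro y _ N hN
        refine ⟨univ, univ_mem, fun z _ hz => ⟨y, mem_of_mem_nhds hN, ?_⟩⟩
        exact (not_not.1 hz).symm
      refine match_of_slide (W := Fin 0 → ℝ) (by omega) J (h := fun _ => 0) contDiff_const (S := univ) isPreconnected_univ hgood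
        (fun y _ a b _ => Subsingleton.elim a b) (hL x hx) (hL x' hx') (Eventually.of_forall fun z => hg.continuousAt)
        (Eventually.of_forall fun z => hg.continuousAt) (y := 0) (y' := 0) (mem_univ _) (mem_univ _)
        ((hgP x (interior_subset (hPQ x hx))).2 hx) ((hgP x' (interior_subset (hPQ x' hx'))).2 hx') ?_
      have e : fderiv ℝ (fun _ : Fin 0 → ℝ => (0:E)) 0 = 0 := by simp
      rw [e]
      exact sg_neg_mul (hd x hx) (hd x' hx') hs)
  exact ⟨g', T, h1, h2, h3, h4, fun z hz h0 => h5 hz h0⟩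

abbrev UU (k : ℕ) := (Fin (k+1) → ℝ) × (Fin k → ℝ) × ℝ

theorem Gn.split {k : ℕ} {Φ : (V → ℝ) × (V → ℝ) → E} {F : (V → ℝ) →L[ℝ] E} (hF : Gn k Φ F)
    {s t : Finset V} (hst : Disjoint s t) (hc : s.card + t.card ≤ 2 * k + 3) {p q : V → ℝ} (hp : ∀ v ∉ s, p v = 0) (hq : ∀ v ∉ t, q v = 0)
    (hs : ∑ v, p v = ∑ v, q v) (h : F p = F q) : p = 0 ∧ q = 0 := by
  have hz : p - q = 0 := by
    refine hF.a _ (by simp [hs]) ?_ (by rw [map_sub, h, sub_self])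
    calc _ ≤ (s ∪ t).card := by
            refine Finset.card_le_card fun v hv => ?_
            simp only [Finset.mem_filter, Finset.mem_univ, true_and, Pi.sub_apply] at hv
            rw [Finset.mem_union]
            by_contra hcon
            rw [not_or] at hcon
            rw [hp v hcon.1, hq v hcon.2, sub_zero] at hv
            exact hv rfl
      _ ≤ _ := (Finset.card_union_le _ _).trans hc
  have hpq : p = q := sub_eq_zero.1 hz
  have hp0 : p = 0 := by
    funext v
    by_cases hv : v ∈ s
    · rw [hpq]; exact hq v (Finset.disjoint_left.1 hst hv)
    · exact hp v hv
  exact ⟨hp0, hpq ▸ hp0⟩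

/-- the displacement of one finger -/
def Dp {k : ℕ} (F : (V → ℝ) →L[ℝ] E) (e : Fin (k+1+1) → V) (e' : Fin (k+1) → V) (b : Fin (k+1) → ℝ)
    (R : (Fin (k+1) → ℝ) →L[ℝ] (Fin (k+1) → ℝ)) (x : Fin (k+1) → ℝ) : E :=
  F ((2:ℝ) • (lin e (R (x - b) - (x - b)) + (bc e' (cen k) - bc e b)))

theorem Dp_cont {k : ℕ} (F : (V → ℝ) →L[ℝ] E) (e : Fin (k+1+1) → V) (e' : Fin (k+1) → V) (b : Fin (k+1) → ℝ)
    (R : (Fin (k+1) → ℝ) →L[ℝ] (Fin (k+1) → ℝ)) : Continuous (Dp F e e' b R) := by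
  unfold Dp
  fun_prop

theorem Dp_zero {k : ℕ} {Φ : (V → ℝ) × (V → ℝ) → E} {F : (V → ℝ) →L[ℝ] E} (hF : Gn k Φ F)
    {e : Fin (k+1+1) → V} {e' : Fin (k+1) → V} (he : Function.Injective e) (he' : Function.Injective e')
    (hdis : Disjoint (Finset.univ.image e) (Finset.univ.image e')) {b : Fin (k+1) → ℝ}
    {R : (Fin (k+1) → ℝ) →L[ℝ] (Fin (k+1) → ℝ)} (hR : Function.Injective R) {x : Fin (k+1) → ℝ} {c : ℝ}
    {y : V → ℝ} (hy : y ∈ Dl (Finset.univ.image e')) (h : F (bc e x) + c • Dp F e e' b R x = F y) :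
    x = b ∧ y = bc e' (cen k) ∧ c = 1/2 := by
  have hcd : (Finset.univ.image e).card + (Finset.univ.image e').card ≤ 2 * k + 3 := by
    have h1 := Finset.card_image_le (s := Finset.univ) (f := e)
    have h2 := Finset.card_image_le (s := Finset.univ) (f := e')
    simp only [Finset.card_univ, Fintype.card_fin] at h1 h2
    omega
  obtain ⟨hp, hq⟩ := hF.split hdis hcd (p := bc e x + (2 * c) • lin e (R (x - b) - (x - b)) - (2 * c) • bc e b)
    (q := y - (2 * c) • bc e' (cen k)) (fun v hv => by simp [bc_off _ hv, lin_off _ hv])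
    (fun v hv => by simp [bc_off _ hv, hy.2.2 v hv]) (by
      simp only [Pi.sub_apply, Pi.add_apply, Pi.smul_apply, smul_eq_mul, Finset.sum_sub_distrib, Finset.sum_add_distrib,
        ← Finset.mul_sum, bc_sum, lin_sum, hy.2.1]; ring) (by
      rw [map_sub F y, ← h, Dp, ← map_smul F c, ← map_add, ← map_sub]
      congr 1; module)
  have hc : c = 1/2 := by
    have h1 := congrArg (fun z => ∑ v, z v) hq
    simp only [Pi.sub_apply, Pi.smul_apply, smul_eq_mul, Finset.sum_sub_distrib, ← Finset.mul_sum, bc_sum, hy.2.1, Pi.zero_apply,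
      Finset.sum_const_zero] at h1
    linarith
  subst hc
  refine ⟨?_, ?_, rfl⟩
  · have h2 : lin e (R (x - b)) = 0 := by
      rw [← hp, map_sub (lin e) (R (x-b)), ← bc_sub e x b]; module
    have h3 := lin_injective he (h2.trans (map_zero _).symm)
    have h4 := hR (h3.trans (map_zero _).symm)
    exact sub_eq_zero.1 h4
  · have : y - bc e' (cen k) = 0 := by rw [← hq]; module
    exact sub_eq_zero.1 this

theorem finger_avoid {k : ℕ} {Φ : (V → ℝ) × (V → ℝ) → E} {F : (V → ℝ) →L[ℝ] E} (hF : Gn k Φ F)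
    {e : Fin (k+1+1) → V} {e' : Fin (k+1) → V} (he : Function.Injective e) (he' : Function.Injective e')
    (hdis : Disjoint (Finset.univ.image e) (Finset.univ.image e')) (j : ℕ)
    (R : (Fin (k+1) → ℝ) →L[ℝ] (Fin (k+1) → ℝ)) :
    ∀ᶠ x in 𝓝 (bs (k+1) j), ∀ ρ : Finset V, ρ.card ≤ k + 1 → Disjoint (Finset.univ.image e) ρ → ρ ≠ Finset.univ.image e' →
      ∀ c ∈ Icc (0:ℝ) 1, ∀ y ∈ Dl ρ, F (bc e x) + c • Dp F e e' (bs (k+1) j) R x ≠ F y := by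
  rw [eventually_all]
  intro ρ
  by_cases hρ : ρ.card ≤ k + 1 ∧ Disjoint (Finset.univ.image e) ρ ∧ ρ ≠ Finset.univ.image e'
  swap
  · exact Eventually.of_forall fun x h1 h2 h3 => absurd ⟨h1, h2, h3⟩ hρ
  obtain ⟨h1, h2, h3⟩ := hρ
  have key : ∀ᶠ x in 𝓝 (bs (k+1) j), ∀ q ∈ Icc (0:ℝ) 1 ×ˢ Dl ρ, F (bc e x) + q.1 • Dp F e e' (bs (k+1) j) R x ≠ F q.2 := by
    refine (isCompact_Icc.prod (Dl_compact ρ)).eventually_forall_of_forall_eventually fun q hq => ?_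
    have hc : Continuous fun z : (Fin (k+1) → ℝ) × ℝ × (V → ℝ) => F (bc e z.1) + z.2.1 • Dp F e e' (bs (k+1) j) R z.1 - F z.2.2 := by
      have := Dp_cont F e e' (bs (k+1) j) R
      have := bc_cont e
      fun_prop
    have hne : F (bc e (bs (k+1) j)) + q.1 • Dp F e e' (bs (k+1) j) R (bs (k+1) j) - F q.2 ≠ 0 := by
      intro h0
      obtain ⟨v0, hv0, -⟩ := Dl_pos hq.2
      obtain ⟨e'', he''⟩ := exists_param h1 ⟨v0, hv0⟩
      obtain ⟨z, -, hz⟩ := bc_surj e'' (by rw [he'']; exact hq.2)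
      have h4 := hF.sg e e' e'' j (2 * q.1) z (by
        rw [← h0, hz, Dp, ← map_smul, ← map_add, ← map_sub]
        congr 1
        rw [sub_self, map_zero, sub_zero, map_zero]; module)
      -- supports
      have hsub : Finset.univ.image e' ⊆ ρ := by
        have hs : 1 - 2 * q.1 = 0 := by
          by_contra hs
          obtain ⟨v, hv⟩ : ∃ v, v ∈ Finset.univ.image e := ⟨e 0, by simp⟩
          have h5 := congrFun h4 v
          have h6 := bc_pos he (bs_mem j) hv
          simp only [Pi.sub_apply, Pi.add_apply, Pi.smul_apply, smul_eq_mul, Pi.zero_apply, hz,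
            hq.2.2.2 v (Finset.disjoint_left.1 h2 hv), bc_off _ (Finset.disjoint_left.1 hdis hv)] at h5
          have : (1 - 2 * q.1) * bc e (bs (k+1) j) v = 0 := by linarith
          rcases mul_eq_zero.1 this with h | h
          · exact hs h
          · linarith
        intro v hv
        by_contra hvρ
        have h5 := congrFun h4 v
        have h6 := bc_pos he' cen_mem hv
        simp only [Pi.sub_apply, Pi.add_apply, Pi.smul_apply, smul_eq_mul, Pi.zero_apply, hz, hs, hq.2.2.2 v hvρ] at h5
        have : 2 * q.1 = 1 := by linarith
        rw [this] at h5
        linarith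
      refine h3 (Finset.eq_of_subset_of_card_le hsub ?_).symm
      rw [Finset.card_image_of_injective _ he']; simpa using h1
    have := (hc.continuousAt (x := (bs (k+1) j, q))).eventually_ne hne
    exact this.mono fun z hz h => hz (sub_eq_zero.2 h)
  filter_upwards [key] with x hx _ _ _ c hc y hy
  exact hx (c, y) ⟨hc, hy⟩

end
end VK

open Set
noncomputable section
namespace VK
set_option linter.unusedVariables false
set_option linter.unusedSectionVars false
set_option linter.deprecated false
set_option linter.unusedSimpArgs false
open Topology Filter MeasureTheory

section
variable {V : Type*} [Fintype V] [DecidableEq V]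
variable {E : Type*} [NormedAddCommGroup E] [NormedSpace ℝ E] [FiniteDimensional ℝ E]

theorem cl_one {r : ℝ} (h : 1 ≤ r) : cl r = 1 := by unfold cl; rw [min_eq_left h]; simp
theorem cl_zero {r : ℝ} (h : r ≤ 0) : cl r = 0 := by unfold cl; rw [max_eq_left]; exact (min_le_right _ _).trans h
theorem cl_continuous : Continuous cl := by unfold cl; fun_prop

/-- derivative data of a standard finger crossing -/
def L0 {k : ℕ} (F : (V → ℝ) →L[ℝ] E) (e : Fin (k+1+1) → V) (e' : Fin (k+1) → V) (b : Fin (k+1) → ℝ) : UU k →L[ℝ] E :=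
  F.comp (((lin e).comp (ContinuousLinearMap.fst ℝ _ _) -
    (lin e').comp ((ContinuousLinearMap.fst ℝ _ _).comp (ContinuousLinearMap.snd ℝ _ _))) -
    ((ContinuousLinearMap.snd ℝ _ _).comp (ContinuousLinearMap.snd ℝ _ _)).smulRight ((2:ℝ) • (bc e' (cen k) - bc e b)))

theorem L0_apply {k : ℕ} (F : (V → ℝ) →L[ℝ] E) (e : Fin (k+1+1) → V) (e' : Fin (k+1) → V) (b : Fin (k+1) → ℝ) (u : UU k) :
    L0 F e e' b u = F (lin e u.1 - lin e' u.2.1 - u.2.2 • (2:ℝ) • (bc e' (cen k) - bc e b)) := by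
  simp [L0]

theorem L0_inj {k : ℕ} {Φ : (V → ℝ) × (V → ℝ) → E} {F : (V → ℝ) →L[ℝ] E} (hF : Gn k Φ F)
    {e : Fin (k+1+1) → V} {e' : Fin (k+1) → V} (he : Function.Injective e) (he' : Function.Injective e')
    (hdis : Disjoint (Finset.univ.image e) (Finset.univ.image e')) (b : Fin (k+1) → ℝ) :
    Function.Injective (L0 F e e' b) := by
  rw [injective_iff_map_eq_zero]
  rintro ⟨x, y, t⟩ h
  rw [L0_apply] at h
  have hcd : (Finset.univ.image e).card + (Finset.univ.image e').card ≤ 2 * k + 3 := by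
    have h1 := Finset.card_image_le (s := Finset.univ) (f := e)
    have h2 := Finset.card_image_le (s := Finset.univ) (f := e')
    simp only [Finset.card_univ, Fintype.card_fin] at h1 h2
    omega
  obtain ⟨hp, hq⟩ := hF.split hdis hcd (p := lin e x + (2 * t) • bc e b)
    (q := lin e' y + (2 * t) • bc e' (cen k)) (fun v hv => by simp [bc_off _ hv, lin_off _ hv])
    (fun v hv => by simp [bc_off _ hv, lin_off _ hv]) (by
      simp only [Pi.add_apply, Pi.smul_apply, smul_eq_mul, Finset.sum_add_distrib,
        ← Finset.mul_sum, bc_sum, lin_sum]) (by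
      rw [← sub_eq_zero, ← map_sub, ← h]
      congr 1; module)
  have ht : t = 0 := by
    have h1 := congrArg (fun z => ∑ v, z v) hq
    simp only [Pi.add_apply, Pi.smul_apply, smul_eq_mul, Finset.sum_add_distrib, ← Finset.mul_sum, bc_sum, lin_sum, Pi.zero_apply,
      Finset.sum_const_zero] at h1
    linarith
  subst ht
  simp only [mul_zero, zero_smul, add_zero] at hp hq
  have h1 := lin_injective he (hp.trans (map_zero _).symm)
  have h2 := lin_injective he' (hq.trans (map_zero _).symm)
  rw [h1, h2]; rfl

theorem finger_R {k : ℕ} {Φ : (V → ℝ) × (V → ℝ) → E} {F : (V → ℝ) →L[ℝ] E} (hF : Gn k Φ F)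
    {e : Fin (k+1+1) → V} {e' : Fin (k+1) → V} (he : Function.Injective e) (he' : Function.Injective e')
    (hdis : Disjoint (Finset.univ.image e) (Finset.univ.image e')) (b : Fin (k+1) → ℝ) (J : E ≃L[ℝ] UU k × (Fin 0 → ℝ))
    {ε : ℤ} (hε : ε = 1 ∨ ε = -1) :
    ∃ R : (Fin (k+1) → ℝ) →L[ℝ] (Fin (k+1) → ℝ), Function.Injective R ∧
      dt J 0 ((L0 F e e' b).comp (R.prodMap (ContinuousLinearMap.id ℝ _))) ≠ 0 ∧
      sg (dt J 0 ((L0 F e e' b).comp (R.prodMap (ContinuousLinearMap.id ℝ _)))) = ε := by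
  have h0 : dt J 0 (L0 F e e' b) ≠ 0 := by
    refine dt_of_inj J ?_
    rintro ⟨x, y⟩ ⟨x', y'⟩ h
    simp only [ContinuousLinearMap.coprod_apply, ContinuousLinearMap.zero_apply, add_zero] at h
    rw [L0_inj hF he he' hdis b h, Subsingleton.elim y y']
  have hdet : ∀ R : (Fin (k+1) → ℝ) →L[ℝ] (Fin (k+1) → ℝ),
      (R.prodMap (ContinuousLinearMap.id ℝ ((Fin k → ℝ) × ℝ))).det = R.det := by
    intro R
    have := LinearMap.det_prodMap (R := ℝ) (R : (Fin (k+1) → ℝ) →ₗ[ℝ] _) (LinearMap.id : ((Fin k → ℝ) × ℝ) →ₗ[ℝ] _)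
    rw [LinearMap.det_id, mul_one] at this
    exact this
  obtain ⟨R0, hR0⟩ := exists_neg_det (U := Fin (k+1) → ℝ)
  have hid : (ContinuousLinearMap.id ℝ (Fin (k+1) → ℝ)).det = 1 := LinearMap.det_id
  by_cases hs : sg (dt J 0 (L0 F e e' b)) = ε
  · refine ⟨ContinuousLinearMap.id ℝ _, fun x y h => h, ?_, ?_⟩
    · rw [dt_comp, hdet, hid, mul_one]; exact h0
    · rw [dt_comp, hdet, hid, mul_one]; exact hs
  · have hneg : dt J 0 (L0 F e e' b) * R0.det ≠ 0 := mul_ne_zero h0 hR0.ne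
    refine ⟨R0, ?_, ?_, ?_⟩
    · obtain ⟨A, hA⟩ := equiv_of_det hR0.ne
      rw [← hA]; exact A.injective
    · rw [dt_comp, hdet]; exact hneg
    · rw [dt_comp, hdet]
      unfold sg at hs ⊢
      rcases lt_or_gt_of_ne h0 with h | h
      · have h1 := mul_pos_of_neg_of_neg h hR0
        rw [if_pos h1]
        rw [if_neg (not_lt.2 h.le)] at hs
        rcases hε with h | h
        · exact h.symm
        · exact absurd h.symm hs
      · have h1 := mul_neg_of_pos_of_neg h hR0
        rw [if_neg (not_lt.2 h1.le)]
        rw [if_pos h] at hs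
        rcases hε with h | h
        · exact absurd h.symm hs
        · exact h.symm

set_option maxHeartbeats 1000000 in
theorem finger {k : ℕ} {Φ : (V → ℝ) × (V → ℝ) → E} {F : (V → ℝ) →L[ℝ] E} (hF : Gn k Φ F)
    {e : Fin (k+1+1) → V} (he : Function.Injective e) {I : Type*} [Fintype I] (en : I → Fin (k+1) → V)
    (hen : ∀ i, Function.Injective (en i)) (hdis : ∀ i, Disjoint (Finset.univ.image e) (Finset.univ.image (en i)))
    (J : E ≃L[ℝ] UU k × (Fin 0 → ℝ)) (ε : I → ℤ) (hε : ∀ i, ε i = 1 ∨ ε i = -1) :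
    ∃ φ : (Fin (k+1) → ℝ) → E, ∃ b : I → (Fin (k+1) → ℝ), ∃ L : I → UU k →L[ℝ] E,
      Continuous φ ∧ (∀ x, x ∉ So (k+1) → φ x = 0) ∧ Function.Injective b ∧ (∀ i, b i ∈ So (k+1)) ∧
      (∀ x, ∀ s ∈ Icc (0:ℝ) 1, ∀ ρ : Finset V, ρ.card ≤ k + 1 → Disjoint (Finset.univ.image e) ρ → x ∈ St (k+1) → ∀ y ∈ Dl ρ,
        F (bc e x) + s • φ x = F y → ∃ i, ρ = Finset.univ.image (en i) ∧ x = b i ∧ y = bc (en i) (cen k) ∧ s = 1/2) ∧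
      (∀ i, F (bc e (b i)) + (1/2:ℝ) • φ (b i) = F (bc (en i) (cen k))) ∧
      ∀ i, HasFDerivAt (fun u : UU k => F (bc e u.1) + (-u.2.2) • φ u.1 - F (bc (en i) u.2.1)) (L i) (b i, cen k, -1/2) ∧
        dt J 0 (L i) ≠ 0 ∧ sg (dt J 0 (L i)) = ε i := by
  let b : I → Fin (k+1) → ℝ := fun i => bs (k+1) (Fintype.equivFin I i)
  have hb : Function.Injective b := by
    intro i j h
    have := bs_inj (Nat.succ_pos k) h
    exact (Fintype.equivFin I).injective (Fin.ext this)
  have hbS : ∀ i, b i ∈ So (k+1) := fun i => bs_mem _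
  choose R hRi hR0 hRs using fun i => finger_R hF he (hen i) (hdis i) (b i) J (hε i)
  let D : I → (Fin (k+1) → ℝ) → E := fun i => Dp F e (en i) (b i) (R i)
  have hDc : ∀ i, Continuous (D i) := fun i => Dp_cont _ _ _ _ _
  have hδ : ∃ δ > 0, ∀ i, (∀ x, dist x (b i) < δ → x ∈ So (k+1) ∧ ∀ ρ : Finset V, ρ.card ≤ k + 1 → Disjoint (Finset.univ.image e) ρ →
      ρ ≠ Finset.univ.image (en i) → ∀ c ∈ Icc (0:ℝ) 1, ∀ y ∈ Dl ρ, F (bc e x) + c • D i x ≠ F y) ∧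
      ∀ j, j ≠ i → 2 * δ < dist (b i) (b j) := by
    have h1 : ∀ i, ∀ᶠ δ in 𝓝[>] (0:ℝ), (∀ x, dist x (b i) < δ → x ∈ So (k+1) ∧ ∀ ρ : Finset V, ρ.card ≤ k + 1 → Disjoint (Finset.univ.image e) ρ →
      ρ ≠ Finset.univ.image (en i) → ∀ c ∈ Icc (0:ℝ) 1, ∀ y ∈ Dl ρ, F (bc e x) + c • D i x ≠ F y) ∧
      ∀ j, j ≠ i → 2 * δ < dist (b i) (b j) := by
      intro i
      refine Eventually.and ?_ ?_
      · obtain ⟨δ0, hδ0, hball⟩ := Metric.eventually_nhds_iff.1 ((So_open.eventually_mem (hbS i)).and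
          (finger_avoid hF he (hen i) (hdis i) (Fintype.equivFin I i) (R i)))
        filter_upwards [Ioo_mem_nhdsGT hδ0] with δ hδ x hx
        exact hball (hx.trans hδ.2)
      · rw [eventually_all]
        intro j
        by_cases hj : j = i
        · exact Eventually.of_forall fun δ h => absurd hj h
        have hd : 0 < dist (b i) (b j) / 2 := half_pos (dist_pos.2 fun h => hj (hb h).symm)
        filter_upwards [Ioo_mem_nhdsGT hd] with δ hδ _
        linarith [hδ.2]
    obtain ⟨δ, h, hpos⟩ := ((eventually_all.2 h1).and self_mem_nhdsWithin).exists
    exact ⟨δ, hpos, h⟩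
  obtain ⟨δ, hδ, hprop⟩ := hδ
  let κ : I → (Fin (k+1) → ℝ) → ℝ := fun i x => cl (2 - 2 * dist x (b i) / δ)
  have hκ1 : ∀ i x, dist x (b i) ≤ δ / 2 → κ i x = 1 := by
    intro i x h
    refine cl_one ?_
    have : 2 * dist x (b i) / δ ≤ 1 := by rw [div_le_one hδ]; linarith
    linarith
  have hκ0 : ∀ i x, δ ≤ dist x (b i) → κ i x = 0 := by
    intro i x h
    refine cl_zero ?_
    have : 2 ≤ 2 * dist x (b i) / δ := by rw [le_div_iff₀ hδ]; linarith
    linarith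
  have hκm : ∀ i x, κ i x ∈ Icc (0:ℝ) 1 := fun i x => cl_mem _
  have hκc : ∀ i, Continuous (κ i) := by
    intro i
    refine cl_continuous.comp ?_
    fun_prop
  let φ : (Fin (k+1) → ℝ) → E := fun x => ∑ i, κ i x • D i x
  have hφ1 : ∀ i x, dist x (b i) < δ → φ x = κ i x • D i x := by
    intro i x h
    refine Finset.sum_eq_single i (fun j _ hj => ?_) (by simp)
    rw [hκ0 j x, zero_smul]
    have h1 := (hprop i).2 j hj
    have h2 := dist_triangle (b i) x (b j)
    rw [dist_comm (b i) x] at h2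
    linarith
  have hφ0 : ∀ x, (∀ i, δ ≤ dist x (b i)) → φ x = 0 := by
    intro x h
    exact Finset.sum_eq_zero fun i _ => by rw [hκ0 i x (h i), zero_smul]
  have hDb : ∀ i, D i (b i) = F ((2:ℝ) • (bc (en i) (cen k) - bc e (b i))) := by
    intro i
    simp only [D, Dp, sub_self, map_zero, zero_add]
  refine ⟨φ, b, fun i => (L0 F e (en i) (b i)).comp ((R i).prodMap (ContinuousLinearMap.id ℝ _)), ?_, ?_, hb, hbS, ?_, ?_, ?_⟩
  · exact continuous_finset_sum _ fun i _ => (hκc i).smul (hDc i)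
  · intro x hx
    refine hφ0 x fun i => ?_
    by_contra h
    exact hx ((hprop i).1 x (not_le.1 h)).1
  · intro x s hs ρ hρc hρ hxS y hy h
    by_cases hex : ∃ i, dist x (b i) < δ
    · obtain ⟨i, hi⟩ := hex
      rw [hφ1 i x hi, smul_smul] at h
      by_cases hρi : ρ = Finset.univ.image (en i)
      · subst hρi
        obtain ⟨h1, h2, h3⟩ := Dp_zero hF he (hen i) (hdis i) (hRi i) hy h
        refine ⟨i, rfl, h1, h2, ?_⟩
        rwa [hκ1 i x (by rw [h1, dist_self]; linarith), mul_one] at h3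
      · exact absurd h (((hprop i).1 x hi).2 ρ hρc hρ hρi _ ⟨mul_nonneg hs.1 (hκm i x).1,
          mul_le_one₀ hs.2 (hκm i x).1 (hκm i x).2⟩ y hy)
    · push Not at hex
      rw [hφ0 x hex, smul_zero, add_zero] at h
      have hcd : (Finset.univ.image e).card + ρ.card ≤ 2 * k + 3 := by
        have h1 := Finset.card_image_le (s := Finset.univ) (f := e)
        simp only [Finset.card_univ, Fintype.card_fin] at h1
        omega
      obtain ⟨h1, h2⟩ := hF.split hρ hcd (p := bc e x) (q := y) (fun v hv => bc_off _ hv) (fun v hv => hy.2.2 v hv)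
        (by rw [bc_sum, hy.2.1]) h
      have := hy.2.1
      rw [h2] at this
      simp at this
  · intro i
    rw [hφ1 i (b i) (by rw [dist_self]; exact hδ), hκ1 i (b i) (by rw [dist_self]; linarith), hDb, one_smul, ← map_smul, ← map_add]
    congr 1; module
  · intro i
    refine ⟨?_, hR0 i, hRs i⟩
    have hloc : (fun u : UU k => F (bc e u.1) + (-u.2.2) • φ u.1 - F (bc (en i) u.2.1)) =ᶠ[𝓝 (b i, cen k, -1/2)]
        fun u : UU k => F (bc e u.1) + (-u.2.2) • D i u.1 - F (bc (en i) u.2.1) := by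
      have : ∀ᶠ u : UU k in 𝓝 (b i, cen k, -1/2), dist u.1 (b i) < δ / 2 := by
        refine (continuous_fst.tendsto (b i, (cen k, (-1/2:ℝ)))).eventually (Metric.ball_mem_nhds _ (half_pos hδ))
      filter_upwards [this] with u hu
      rw [hφ1 i u.1 (by linarith), hκ1 i u.1 hu.le, one_smul]
    refine HasFDerivAt.congr_of_eventuallyEq ?_ hloc
    have hp1 : HasFDerivAt (fun u : UU k => u.1) (ContinuousLinearMap.fst ℝ _ _) (b i, cen k, -1/2) := hasFDerivAt_fst
    have hp2 : HasFDerivAt (fun u : UU k => u.2) (ContinuousLinearMap.snd ℝ _ _) (b i, cen k, -1/2) := hasFDerivAt_snd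
    have hp3 : HasFDerivAt (fun u : UU k => u.2.1) ((ContinuousLinearMap.fst ℝ _ _).comp (ContinuousLinearMap.snd ℝ _ _)) (b i, cen k, -1/2) := hp2.fst
    have hp4 : HasFDerivAt (fun u : UU k => u.2.2) ((ContinuousLinearMap.snd ℝ _ _).comp (ContinuousLinearMap.snd ℝ _ _)) (b i, cen k, -1/2) := hp2.snd
    have hb1 : HasFDerivAt (fun u : UU k => bc e u.1) ((lin e).comp (ContinuousLinearMap.fst ℝ _ _)) (b i, cen k, -1/2) :=
      HasFDerivAt.comp (g := bc e) (f := fun u : UU k => u.1) (b i, cen k, (-1/2:ℝ)) (bc_hasFDerivAt e (b i)) hp1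
    have hb2 : HasFDerivAt (fun u : UU k => bc (en i) u.2.1) ((lin (en i)).comp ((ContinuousLinearMap.fst ℝ _ _).comp (ContinuousLinearMap.snd ℝ _ _))) (b i, cen k, -1/2) :=
      HasFDerivAt.comp (g := bc (en i)) (f := fun u : UU k => u.2.1) (b i, cen k, (-1/2:ℝ)) (bc_hasFDerivAt (en i) (cen k)) hp3
    have hb3 : HasFDerivAt (fun u : UU k => -u.2.2) (-((ContinuousLinearMap.snd ℝ _ _).comp (ContinuousLinearMap.snd ℝ _ _))) (b i, cen k, -1/2) :=
      hp4.neg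
    let Q : (Fin (k+1) → ℝ) →L[ℝ] E := F.comp ((2:ℝ) • (lin e).comp (R i - ContinuousLinearMap.id ℝ _))
    have hDe : D i = fun x => Q (x - b i) + D i (b i) := by
      funext x
      rw [hDb]
      simp only [D, Dp, Q, ContinuousLinearMap.comp_apply, ContinuousLinearMap.smul_apply, ContinuousLinearMap.sub_apply,
        ContinuousLinearMap.id_apply]
      rw [← map_add]
      congr 1; module
    have hb4 : HasFDerivAt (fun u : UU k => D i u.1) (Q.comp (ContinuousLinearMap.fst ℝ _ _)) (b i, cen k, -1/2) := by
      rw [hDe]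
      exact (Q.hasFDerivAt.comp (b i, cen k, (-1/2:ℝ)) (hp1.sub_const (b i))).add_const _
    have := ((F.hasFDerivAt.comp (b i, cen k, (-1/2:ℝ)) hb1).add (hb3.smul hb4)).sub (F.hasFDerivAt.comp (b i, cen k, (-1/2:ℝ)) hb2)
    refine this.congr_fderiv (ContinuousLinearMap.ext fun u => ?_)
    simp only [ContinuousLinearMap.comp_apply, ContinuousLinearMap.add_apply, ContinuousLinearMap.sub_apply, ContinuousLinearMap.smul_apply,
      ContinuousLinearMap.smulRight_apply, ContinuousLinearMap.neg_apply, ContinuousLinearMap.coe_fst', ContinuousLinearMap.coe_snd',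
      L0_apply, ContinuousLinearMap.coe_prodMap', Prod.map, ContinuousLinearMap.id_apply, hDb, Q, ← map_smul F, ← map_add, ← map_sub]
    congr 1
    simp only [map_sub]
    module

end
end VK

open Set
noncomputable section
namespace VK
set_option linter.unusedVariables false
set_option linter.unusedSectionVars false
set_option linter.deprecated false
set_option linter.unusedSimpArgs false
open Topology Filter MeasureTheory

section
variable {V : Type*} [Fintype V] [DecidableEq V]
variable {E : Type*} [NormedAddCommGroup E] [NormedSpace ℝ E] [FiniteDimensional ℝ E]

theorem Gn.ne {k : ℕ} {Φ : (V → ℝ) × (V → ℝ) → E} {F : (V → ℝ) →L[ℝ] E} (hF : Gn k Φ F) {s t : Finset V} (hst : Disjoint s t)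
    (hc : s.card + t.card ≤ 2 * k + 2) {x y : V → ℝ} (hx : x ∈ Dl s) (hy : y ∈ Dl t) {r : ℝ} (hr : r ≠ 1) :
    Hh F Φ x y r ≠ 0 := by
  obtain ⟨v, hv, -⟩ := Dl_pos hx
  obtain ⟨w, hw, -⟩ := Dl_pos hy
  have h1 : s.card = (s.card - 1) + 1 := by have := Finset.card_pos.2 ⟨v, hv⟩; omega
  have h2 : t.card = (t.card - 1) + 1 := by have := Finset.card_pos.2 ⟨w, hw⟩; omega
  obtain ⟨e, he, hes⟩ := exists_enum h1
  obtain ⟨e', he', het⟩ := exists_enum h2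
  rw [← hes] at hx
  rw [← het] at hy
  obtain ⟨x', -, rfl⟩ := bc_surj e hx
  obtain ⟨y', -, rfl⟩ := bc_surj e' hy
  exact hF.h1 _ _ (by omega) e e' (by rw [hes, het]; exact hst) x' y' r hr

theorem Gn.ne0 {k : ℕ} {Φ : (V → ℝ) × (V → ℝ) → E} {F : (V → ℝ) →L[ℝ] E} (hF : Gn k Φ F) {s t : Finset V} (hst : Disjoint s t)
    (hc : s.card + t.card ≤ 2 * k + 3) {x y : V → ℝ} (hx : x ∈ Dl s) (hy : y ∈ Dl t) : F x ≠ F y := by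
  intro h
  obtain ⟨h1, h2⟩ := hF.split hst hc (p := x) (q := y) hx.2.2 hy.2.2 (by rw [hx.2.1, hy.2.1]) h
  have := hx.2.1
  rw [h1] at this
  simp at this

theorem det_ne_of_inj {X : Type*} [NormedAddCommGroup X] [NormedSpace ℝ X] [FiniteDimensional ℝ X] {A : X →L[ℝ] X}
    (h : Function.Injective A) : A.det ≠ 0 := by
  have h2 : LinearMap.ker (A : X →ₗ[ℝ] X) = ⊥ := LinearMap.ker_eq_bot.2 h
  have h3 := (LinearMap.isUnit_iff_ker_eq_bot _).2 h2
  exact ((LinearMap.isUnit_iff_isUnit_det _).1 h3).ne_zero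

def HU {k : ℕ} (F : (V → ℝ) →L[ℝ] E) (Φ : (V → ℝ) × (V → ℝ) → E) (e : Fin (k+1+1) → V) (e' : Fin (k+1) → V) (u : UU k) : E :=
  Hh F Φ (bc e u.1) (bc e' u.2.1) u.2.2

theorem HU_contDiff {k : ℕ} (F : (V → ℝ) →L[ℝ] E) {Φ : (V → ℝ) × (V → ℝ) → E} (hΦ : ContDiff ℝ 1 Φ) (e : Fin (k+1+1) → V)
    (e' : Fin (k+1) → V) : ContDiff ℝ 1 (HU F Φ e e') := by
  have h1 : ContDiff ℝ 1 (fun u : UU k => bc e u.1) := (bc_contDiff e).comp contDiff_fst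
  have h2 : ContDiff ℝ 1 (fun u : UU k => bc e' u.2.1) := (bc_contDiff e').comp (contDiff_fst.comp contDiff_snd)
  have h3 : ContDiff ℝ 1 (fun u : UU k => u.2.2) := (contDiff_snd.comp contDiff_snd)
  exact ((contDiff_const.sub h3).smul ((F.contDiff.comp h1).sub (F.contDiff.comp h2))).add (h3.smul (hΦ.comp (h1.prodMk h2)))

theorem zeros_HU {k : ℕ} (hE : Module.finrank ℝ E = 2 * (k + 1)) {Φ : (V → ℝ) × (V → ℝ) → E} (hΦ : ContDiff ℝ 1 Φ) {F : (V → ℝ) →L[ℝ] E} (hF : Gn k Φ F)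
    {e : Fin (k+1+1) → V} {e' : Fin (k+1) → V} (he : Function.Injective e) (he' : Function.Injective e')
    (hdis : Disjoint (Finset.univ.image e) (Finset.univ.image e'))
    (h0 : ∀ x ∈ Dl (Finset.univ.image e), ∀ y ∈ Dl (Finset.univ.image e'), Φ (x, y) ≠ 0) (J : E ≃L[ℝ] UU k × (Fin 0 → ℝ)) :
    ∃ Z : Finset (UU k), (∀ u, u ∈ Z ↔ (u.1 ∈ St (k+1) ∧ u.2.1 ∈ St k ∧ u.2.2 ∈ Icc (0:ℝ) 1) ∧ HU F Φ e e' u = 0) ∧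
      ∀ u ∈ Z, (u.1 ∈ So (k+1) ∧ u.2.1 ∈ So k ∧ u.2.2 ∈ Ioo (0:ℝ) 1) ∧ dt J 0 (fderiv ℝ (HU F Φ e e') u) ≠ 0 := by
  have hce : (Finset.univ.image e).card = k + 2 := by rw [Finset.card_image_of_injective _ he]; simp
  have hce' : (Finset.univ.image e').card = k + 1 := by rw [Finset.card_image_of_injective _ he']; simp
  have hfr : Module.finrank ℝ E = Module.finrank ℝ (UU k) := by rw [hE]; simp; omega
  have hintg : ∀ u : UU k, u.1 ∈ St (k+1) → u.2.1 ∈ St k → u.2.2 ∈ Icc (0:ℝ) 1 → HU F Φ e e' u = 0 →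
      u.1 ∈ So (k+1) ∧ u.2.1 ∈ So k ∧ u.2.2 ∈ Ioo (0:ℝ) 1 := by
    rintro ⟨x, y, t⟩ hx hy ht h
    simp only at hx hy ht ⊢
    simp only [HU] at h
    have ht1 : t ≠ 1 := by
      rintro rfl
      simp only [Hh, sub_self, zero_smul, zero_add, one_smul] at h
      exact h0 _ (bc_mem e hx) _ (bc_mem e' hy) h
    have ht0 : t ≠ 0 := by
      rintro rfl
      simp only [Hh, sub_zero, zero_smul, add_zero, one_smul] at h
      exact hF.ne0 hdis (by omega) (bc_mem e hx) (bc_mem e' hy) (sub_eq_zero.1 h)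
    refine ⟨?_, ?_, lt_of_le_of_ne ht.1 ht0.symm, lt_of_le_of_ne ht.2 ht1⟩
    · by_contra hcon
      obtain ⟨v, hv, hb⟩ := bc_not_So he hx hcon
      refine hF.ne (hdis.mono_left (Finset.erase_subset v _)) ?_ hb (bc_mem e' hy) ht1 h
      rw [Finset.card_erase_of_mem hv]; omega
    · by_contra hcon
      have hcon' : ∃ v ∈ Finset.univ.image e', bc e' y ∈ Dl ((Finset.univ.image e').erase v) := bc_not_So he' hy hcon
      obtain ⟨v, hv, hb⟩ := hcon'
      refine hF.ne (hdis.mono_right (Finset.erase_subset v _)) ?_ (bc_mem e hx) hb ht1 h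
      rw [Finset.card_erase_of_mem hv]; omega
  have hinj : ∀ u : UU k, u.1 ∈ St (k+1) → u.2.1 ∈ St k → u.2.2 ∈ Icc (0:ℝ) 1 → HU F Φ e e' u = 0 →
      Function.Injective (fderiv ℝ (HU F Φ e e') u) := by
    intro u h1 h2 h3 h4
    have hs := hF.h2 e e' hdis u (hintg u h1 h2 h3 h4).2.2.2.ne h4
    exact (LinearMap.injective_iff_surjective_of_finrank_eq_finrank (f := (fderiv ℝ (HU F Φ e e') u : UU k →ₗ[ℝ] E)) hfr.symm).2 hs
  let J1 : E ≃L[ℝ] UU k := ContinuousLinearEquiv.ofFinrankEq hfr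
  have hD : ContDiff ℝ 1 (fun u => J1 (HU F Φ e e' u)) := J1.contDiff.comp (HU_contDiff F hΦ e e')
  have hfin := zeros_finite hD (B := St (k+1) ×ˢ St k ×ˢ Icc (0:ℝ) 1) (St_compact.prod (St_compact.prod isCompact_Icc)) (by
    intro u hu hz
    have hz' : HU F Φ e e' u = 0 := by simpa using hz
    refine det_ne_of_inj ?_
    have h1 := (J1 : E →L[ℝ] UU k).hasFDerivAt.comp u ((HU_contDiff F hΦ e e').differentiable (by simp) u).hasFDerivAt
    have h2 : fderiv ℝ (fun u => J1 (HU F Φ e e' u)) u = (J1 : E →L[ℝ] UU k).comp (fderiv ℝ (HU F Φ e e') u) := h1.fderiv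
    rw [h2]
    exact J1.injective.comp (hinj u hu.1 hu.2.1 hu.2.2 hz'))
  refine ⟨hfin.toFinset, ?_, ?_⟩
  · intro u
    rw [Set.Finite.mem_toFinset]
    simp only [mem_setOf_eq, mem_prod, EmbeddingLike.map_eq_zero_iff]
  · intro u hu
    rw [Set.Finite.mem_toFinset] at hu
    obtain ⟨⟨h1, h2, h3⟩, hz⟩ := hu
    have hz' : HU F Φ e e' u = 0 := by simpa using hz
    refine ⟨hintg u h1 h2 h3 hz', dt_of_inj J ?_⟩
    rintro ⟨x, y⟩ ⟨x', y'⟩ h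
    simp only [ContinuousLinearMap.coprod_apply, ContinuousLinearMap.zero_apply, add_zero] at h
    rw [hinj u h1 h2 h3 hz' h, Subsingleton.elim y y']

set_option maxHeartbeats 1000000 in
theorem cell {k : ℕ} (hk : 2 ≤ k) (hE : Module.finrank ℝ E = 2 * (k + 1)) {Φ : (V → ℝ) × (V → ℝ) → E} (hΦ : ContDiff ℝ 1 Φ) {F : (V → ℝ) →L[ℝ] E}
    (hF : Gn k Φ F)
    {e : Fin (k+1+1) → V} {e' : Fin (k+1) → V} (he : Function.Injective e) (he' : Function.Injective e')
    (hdis : Disjoint (Finset.univ.image e) (Finset.univ.image e'))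
    (J : E ≃L[ℝ] UU k × (Fin 0 → ℝ)) (Z : Finset (UU k))
    (hZ : ∀ u, u ∈ Z ↔ (u.1 ∈ St (k+1) ∧ u.2.1 ∈ St k ∧ u.2.2 ∈ Icc (0:ℝ) 1) ∧ HU F Φ e e' u = 0)
    (hZ' : ∀ u ∈ Z, (u.1 ∈ So (k+1) ∧ u.2.1 ∈ So k ∧ u.2.2 ∈ Ioo (0:ℝ) 1) ∧ dt J 0 (fderiv ℝ (HU F Φ e e') u) ≠ 0)
    {φ : (Fin (k+1) → ℝ) → E} (hφ : Continuous φ) (B : Finset (Fin (k+1) → ℝ)) (L : (Fin (k+1) → ℝ) → UU k →L[ℝ] E)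
    (hB : ∀ b ∈ B, b ∈ So (k+1))
    (hBz : ∀ x ∈ St (k+1), ∀ s ∈ Icc (0:ℝ) 1, ∀ y ∈ Dl (Finset.univ.image e'), F (bc e x) + s • φ x = F y →
      x ∈ B ∧ y = bc e' (cen k) ∧ s = 1/2)
    (hB0 : ∀ b ∈ B, F (bc e b) + (1/2:ℝ) • φ b = F (bc e' (cen k)))
    (hL : ∀ b ∈ B, HasFDerivAt (fun u : UU k => F (bc e u.1) + (-u.2.2) • φ u.1 - F (bc e' u.2.1)) (L b) (b, cen k, -1/2) ∧
        dt J 0 (L b) ≠ 0)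
    (hsum : ∑ b ∈ B, sg (dt J 0 (L b)) + ∑ z ∈ Z, sg (dt J 0 (fderiv ℝ (HU F Φ e e') z)) = 0) :
    ∃ G : UU k → E, ContinuousOn G (St (k+1) ×ˢ St k ×ˢ Icc (-1:ℝ) 1) ∧ (∀ u ∈ St (k+1) ×ˢ St k ×ˢ Icc (-1:ℝ) 1, G u ≠ 0) ∧
      ∀ u ∈ St (k+1) ×ˢ St k ×ˢ Icc (-1:ℝ) 1, (u.1 ∉ So (k+1) ∨ u.2.1 ∉ So k ∨ u.2.2 = 1 ∨ u.2.2 = -1) →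
        G u = (1 - max u.2.2 0) • (F (bc e u.1) + max (-u.2.2) 0 • φ u.1 - F (bc e' u.2.1)) + max u.2.2 0 • Φ (bc e u.1, bc e' u.2.1) := by
  let g : UU k → E := fun u => (1 - max u.2.2 0) • (F (bc e u.1) + max (-u.2.2) 0 • φ u.1 - F (bc e' u.2.1)) + max u.2.2 0 • Φ (bc e u.1, bc e' u.2.1)
  have hgc : Continuous g := by
    have h1 := bc_cont e
    have h2 := bc_cont e'
    have h3 := hΦ.continuous
    simp only [g]
    fun_prop
  have hgp : ∀ u : UU k, 0 ≤ u.2.2 → g u = HU F Φ e e' u := by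
    intro u hu
    simp only [g, HU, Hh]
    rw [max_eq_left hu, max_eq_right (by linarith : -u.2.2 ≤ 0), zero_smul, add_zero]
  have hgn : ∀ u : UU k, u.2.2 ≤ 0 → g u = F (bc e u.1) + (-u.2.2) • φ u.1 - F (bc e' u.2.1) := by
    intro u hu
    simp only [g]
    rw [max_eq_right hu, max_eq_left (by linarith : 0 ≤ -u.2.2), zero_smul, add_zero, sub_zero, one_smul]
  let pt : (Fin (k+1) → ℝ) → UU k := fun b => (b, cen k, -1/2)
  have hpt : Function.Injective pt := fun b b' h => congrArg Prod.fst h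
  have hZpos : ∀ u ∈ Z, 0 < u.2.2 := fun u hu => (hZ' u hu).1.2.2.1
  let Q : Set (UU k) := St (k+1) ×ˢ St k ×ˢ Icc (-1:ℝ) 1
  have hQi : interior Q = So (k+1) ×ˢ So k ×ˢ Ioo (-1:ℝ) 1 := by
    simp only [Q, interior_prod_eq, interior_St, interior_Icc]
  let P : Finset (UU k) := Z ∪ B.image pt
  have hPd : Disjoint Z (B.image pt) := by
    rw [Finset.disjoint_left]
    intro u hu hu'
    obtain ⟨b, -, rfl⟩ := Finset.mem_image.1 hu'
    have := hZpos _ hu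
    simp only [pt] at this
    norm_num at this
  let LL : UU k → UU k →L[ℝ] E := fun u => if 0 < u.2.2 then fderiv ℝ (HU F Φ e e') u else L u.1
  have hLZ : ∀ u ∈ Z, LL u = fderiv ℝ (HU F Φ e e') u := fun u hu => if_pos (hZpos u hu)
  have hLB : ∀ b, LL (pt b) = L b := by
    intro b
    have : ¬ (0:ℝ) < (pt b).2.2 := by simp only [pt]; norm_num
    exact if_neg this
  have htc : Continuous (fun w : UU k => w.2.2) := by fun_prop
  have hQ : Convex ℝ Q := St_convex.prod (St_convex.prod (convex_Icc _ _))
  obtain ⟨g', T, hT, hTQ, hgT, hg'c, hg'0⟩ := kill (U := UU k) (by simp; omega) J hQ hgc P (by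
      intro u hu
      rw [hQi]
      rcases Finset.mem_union.1 hu with hu | hu
      · obtain ⟨⟨h1, h2, h3⟩, -⟩ := hZ' u hu
        exact ⟨h1, h2, by linarith [h3.1], h3.2⟩
      · obtain ⟨b, hb, rfl⟩ := Finset.mem_image.1 hu
        exact ⟨hB b hb, cen_mem, by simp only [pt]; norm_num, by simp only [pt]; norm_num⟩) (by
      intro u hu
      obtain ⟨h1, h2, h3⟩ := hu
      rw [Finset.mem_union]
      rcases le_total 0 u.2.2 with ht | ht
      · rw [hgp u ht]
        constructor
        · intro h; left; exact (hZ u).2 ⟨⟨h1, h2, ht, h3.2⟩, h⟩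
        · rintro (h | h)
          · exact ((hZ u).1 h).2
          · obtain ⟨b, hb, rfl⟩ := Finset.mem_image.1 h
            simp only [pt] at ht; norm_num at ht
      · constructor
        · intro h
          rw [hgn u ht, sub_eq_zero] at h
          obtain ⟨hx, hy, hs⟩ := hBz u.1 h1 (-u.2.2) ⟨by linarith, by linarith [h3.1]⟩ _ (bc_mem e' h2) h
          right
          refine Finset.mem_image.2 ⟨u.1, hx, ?_⟩
          have hy' : u.2.1 = cen k := by rw [← co_bc he' u.2.1, hy, co_bc he']
          refine Prod.ext rfl (Prod.ext hy'.symm ?_)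
          simp only [pt]; linarith
        · rintro (h | h)
          · exact absurd (hZpos u h) (not_lt.2 ht)
          · obtain ⟨b, hb, rfl⟩ := Finset.mem_image.1 h
            rw [hgn _ ht, sub_eq_zero]
            have := hB0 b hb
            simp only [pt]
            rw [← this]; norm_num) LL (by
      intro u hu
      rcases Finset.mem_union.1 hu with hu | hu
      · rw [hLZ u hu]
        refine ((HU_contDiff F hΦ e e').differentiable (by simp) u).hasFDerivAt.congr_of_eventuallyEq ?_
        have : ∀ᶠ w : UU k in 𝓝 u, 0 < w.2.2 := htc.continuousAt.eventually_const_lt (hZpos u hu)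
        filter_upwards [this] with w hw
        exact hgp w hw.le
      · obtain ⟨b, hb, rfl⟩ := Finset.mem_image.1 hu
        rw [hLB]
        refine (hL b hb).1.congr_of_eventuallyEq ?_
        have : ∀ᶠ w : UU k in 𝓝 (pt b), w.2.2 < 0 := htc.continuousAt.eventually_lt_const (by simp only [pt]; norm_num)
        filter_upwards [this] with w hw
        exact hgn w hw.le) (by
      intro u hu
      rcases Finset.mem_union.1 hu with hu | hu
      · rw [hLZ u hu]; exact (hZ' u hu).2
      · obtain ⟨b, hb, rfl⟩ := Finset.mem_image.1 hu
        rw [hLB]; exact (hL b hb).2) (by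
      rw [Finset.sum_union hPd, Finset.sum_image fun _ _ _ _ h => hpt h, add_comm, ← hsum]
      congr 1
      · exact Finset.sum_congr rfl fun b _ => by rw [hLB b]
      · exact Finset.sum_congr rfl fun u hu => by rw [hLZ u hu])
  refine ⟨g', hg'c, hg'0, fun u hu hb => hgT u fun hcon => ?_⟩
  have := hTQ hcon
  rw [hQi] at this
  obtain ⟨h1, h2, h3⟩ := this
  rcases hb with h | h | h | h
  · exact h h1
  · exact h h2
  · exact h3.2.ne h
  · exact h3.1.ne' h

end
end VK

open Set
noncomputable section
namespace VK
set_option linter.unusedVariables false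
set_option linter.unusedSectionVars false
set_option linter.deprecated false
set_option linter.unusedSimpArgs false
open Topology Filter MeasureTheory

section
variable {V : Type*} [Fintype V] [DecidableEq V]
variable {E : Type*} [NormedAddCommGroup E] [NormedSpace ℝ E] [FiniteDimensional ℝ E]

/-- the piecewise homotopy from the final map to the equivariant map -/
def Hg (F : (V → ℝ) →L[ℝ] E) (Φ : (V → ℝ) × (V → ℝ) → E) (a : E) (x y : V → ℝ) (t : ℝ) : E :=
  (1 - max t 0) • (F x + max (-t) 0 • a - F y) + max t 0 • Φ (x, y)

set_option maxHeartbeats 1000000 in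
theorem face_finger {k : ℕ} (hk : 2 ≤ k) (hE : Module.finrank ℝ E = 2 * (k + 1)) {Φ : (V → ℝ) × (V → ℝ) → E} (hΦ : ContDiff ℝ 1 Φ)
    {F : (V → ℝ) →L[ℝ] E} (hF : Gn k Φ F) (R : Finset (Finset V)) {e : Fin (k+1+1) → V} (he : Function.Injective e)
    (hR : ∀ ρ ∈ R, ρ.card = k + 1 ∧ Disjoint (Finset.univ.image e) ρ)
    (h0 : ∀ ρ ∈ R, ∀ x ∈ Dl (Finset.univ.image e), ∀ y ∈ Dl ρ, Φ (x, y) ≠ 0) :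
    ∃ φ : (Fin (k+1) → ℝ) → E, Continuous φ ∧ (∀ x, x ∉ So (k+1) → φ x = 0) ∧
      (∀ ρ : Finset V, ρ.card ≤ k + 1 → Disjoint (Finset.univ.image e) ρ → ∀ x ∈ St (k+1), ∀ y ∈ Dl ρ, F (bc e x) + φ x ≠ F y) ∧
      ∀ ρ ∈ R, ∃ G : (V → ℝ) × (V → ℝ) × ℝ → E, ContinuousOn G (Dl (Finset.univ.image e) ×ˢ Dl ρ ×ˢ Icc (-1:ℝ) 1) ∧
        (∀ p ∈ Dl (Finset.univ.image e) ×ˢ Dl ρ ×ˢ Icc (-1:ℝ) 1, G p ≠ 0) ∧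
        ∀ p ∈ Dl (Finset.univ.image e) ×ˢ Dl ρ ×ˢ Icc (-1:ℝ) 1,
          ((∃ v ∈ Finset.univ.image e, p.1 v = 0) ∨ (∃ v ∈ ρ, p.2.1 v = 0) ∨ p.2.2 = 1 ∨ p.2.2 = -1) →
          G p = Hg F Φ (φ (co e p.1)) p.1 p.2.1 p.2.2 := by
  have hfr : Module.finrank ℝ E = Module.finrank ℝ (UU k × (Fin 0 → ℝ)) := by rw [hE]; simp; omega
  let J : E ≃L[ℝ] UU k × (Fin 0 → ℝ) := ContinuousLinearEquiv.ofFinrankEq hfr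
  haveI : Nonempty V := ⟨e 0⟩
  choose! en hen henρ using fun ρ (hρ : ρ ∈ R) => exists_enum (hR ρ hρ).1
  choose! Z hZ hZ' using fun ρ (hρ : ρ ∈ R) => zeros_HU hE hΦ hF he (hen ρ hρ) (by rw [henρ ρ hρ]; exact (hR ρ hρ).2)
    (by rw [henρ ρ hρ]; exact h0 ρ hρ) J
  let T : Finset (Σ _ : Finset V, UU k) := R.sigma Z
  have hT : ∀ i : T, i.1.1 ∈ R ∧ i.1.2 ∈ Z i.1.1 := fun i => Finset.mem_sigma.1 i.2
  let ε : T → ℤ := fun i => - sg (dt J 0 (fderiv ℝ (HU F Φ e (en i.1.1)) i.1.2))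
  obtain ⟨φ, b, L, hφ, hφ0, hb, hbS, hz, hz0, hd⟩ := finger hF he (fun i : T => en i.1.1) (fun i => hen _ (hT i).1)
    (fun i => by rw [henρ _ (hT i).1]; exact (hR _ (hT i).1).2) J ε (fun i => by
      simp only [ε]
      rcases sg_cases (dt J 0 (fderiv ℝ (HU F Φ e (en i.1.1)) i.1.2)) with h | h <;> rw [h] <;> simp)
  refine ⟨φ, hφ, hφ0, ?_, ?_⟩
  · intro ρ hρ hρd x hx y hy h
    obtain ⟨i, -, -, -, h1⟩ := hz x 1 ⟨zero_le_one, le_rfl⟩ ρ hρ hρd hx y hy (by rwa [one_smul])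
    norm_num at h1
  · intro ρ hρ
    let S : Finset T := Finset.univ.filter (fun i => i.1.1 = ρ)
    have hS : ∀ i, i ∈ S ↔ i.1.1 = ρ := fun i => by simp [S]
    have heρ := hen ρ hρ
    have hρd : Disjoint (Finset.univ.image e) (Finset.univ.image (en ρ)) := by rw [henρ ρ hρ]; exact (hR ρ hρ).2
    obtain ⟨G, hG, hG0, hGb⟩ := cell hk hE hΦ hF he heρ hρd J (Z ρ) (hZ ρ hρ) (hZ' ρ hρ) hφ (S.image b) (Function.extend b L 0) (by
        intro x hx
        obtain ⟨i, -, rfl⟩ := Finset.mem_image.1 hx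
        exact hbS i) (by
        intro x hx s hs y hy h
        rw [henρ ρ hρ] at hy
        obtain ⟨i, h1, h2, h3, h4⟩ := hz x s hs ρ (hR ρ hρ).1.le (hR ρ hρ).2 hx y hy h
        rw [henρ _ (hT i).1] at h1
        refine ⟨Finset.mem_image.2 ⟨i, (hS i).2 h1.symm, h2.symm⟩, ?_, h4⟩
        rw [h3, ← h1]) (by
        intro x hx
        obtain ⟨i, hi, rfl⟩ := Finset.mem_image.1 hx
        have := hz0 i
        rwa [(hS i).1 hi] at this) (by
        intro x hx
        obtain ⟨i, hi, rfl⟩ := Finset.mem_image.1 hx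
        rw [hb.extend_apply]
        have := hd i
        rw [(hS i).1 hi] at this
        exact ⟨this.1, this.2.1⟩) (by
        rw [Finset.sum_image fun _ _ _ _ h => hb h]
        have h1 : ∑ i ∈ S, sg (dt J 0 (Function.extend b L 0 (b i))) = ∑ z ∈ Z ρ, - sg (dt J 0 (fderiv ℝ (HU F Φ e (en ρ)) z)) := by
          refine Finset.sum_bij (fun i _ => i.1.2) ?_ ?_ ?_ ?_
          · intro i hi
            have := (hT i).2
            rwa [(hS i).1 hi] at this
          · intro i hi j hj h
            refine Subtype.ext (Sigma.ext ?_ (heq_of_eq h))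
            rw [(hS i).1 hi, (hS j).1 hj]
          · intro z hz
            exact ⟨⟨⟨ρ, z⟩, Finset.mem_sigma.2 ⟨hρ, hz⟩⟩, (hS _).2 rfl, rfl⟩
          · intro i hi
            rw [hb.extend_apply, (hd i).2.2]
            simp only [ε]
            rw [(hS i).1 hi]
        rw [h1, Finset.sum_neg_distrib, neg_add_cancel])
    have hmaps : ∀ p ∈ Dl (Finset.univ.image e) ×ˢ Dl ρ ×ˢ Icc (-1:ℝ) 1,
        ((co e p.1, co (en ρ) p.2.1, p.2.2) : UU k) ∈ St (k+1) ×ˢ St k ×ˢ Icc (-1:ℝ) 1 := by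
      intro p hp
      refine ⟨co_mem he hp.1, co_mem heρ ?_, hp.2.2⟩
      rw [henρ ρ hρ]; exact hp.2.1
    refine ⟨fun p => G (co e p.1, co (en ρ) p.2.1, p.2.2), ?_, ?_, ?_⟩
    · refine hG.comp (Continuous.continuousOn ?_) hmaps
      fun_prop
    · intro p hp
      exact hG0 _ (hmaps p hp)
    · intro p hp hpb
      have hp2 : p.2.1 ∈ Dl (Finset.univ.image (en ρ)) := by rw [henρ ρ hρ]; exact hp.2.1
      beta_reduce
      rw [hGb _ (hmaps p hp)]
      · simp only [Hg]
        rw [bc_co he hp.1, bc_co heρ hp2]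
      · rcases hpb with ⟨v, hv, hv0⟩ | ⟨v, hv, hv0⟩ | h | h
        · left
          intro hcon
          have := bc_pos he hcon hv
          rw [bc_co he hp.1] at this
          exact this.ne' hv0
        · right; left
          intro hcon
          have := bc_pos heρ hcon (by rw [henρ ρ hρ]; exact hv)
          rw [bc_co heρ hp2] at this
          exact this.ne' hv0
        · right; right; left; exact h
        · right; right; right; exact h

end
end VK

open Set
noncomputable section
namespace VK
set_option linter.unusedVariables false
set_option linter.unusedSectionVars false
set_option linter.deprecated false
set_option linter.unusedSimpArgs false
open Topology Filter MeasureTheory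

section
variable {V : Type*} [Fintype V] [DecidableEq V]
variable {E : Type*} [NormedAddCommGroup E] [NormedSpace ℝ E] [FiniteDimensional ℝ E]

set_option maxHeartbeats 1000000 in
theorem stage1a {k : ℕ} (hk : 2 ≤ k) (hE : Module.finrank ℝ E = 2 * (k + 1)) {Φ : (V → ℝ) × (V → ℝ) → E} (hΦ : ContDiff ℝ 1 Φ)
    {F : (V → ℝ) →L[ℝ] E} (hF : Gn k Φ F) {K : Finset (Finset V)} (hcard : ∀ s ∈ K, s.card ≤ k + 2)
    (h0 : ∀ s ∈ K, ∀ t ∈ K, Disjoint s t → ∀ x ∈ Dl s, ∀ y ∈ Dl t, Φ (x, y) ≠ 0) :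
    ∃ ψ : (V → ℝ) → E, ContinuousOn ψ (poly K) ∧ (∀ ρ ∈ K, ρ.card ≤ k + 1 → ∀ w ∈ Dl ρ, ψ w = 0) ∧
      (∀ σ ∈ K, ∀ ρ ∈ K, Disjoint σ ρ → ρ.card ≤ k + 1 → ∀ x ∈ Dl σ, ∀ y ∈ Dl ρ, F x + ψ x ≠ F y) ∧
      ∀ σ ∈ K, ∀ ρ ∈ K, Disjoint σ ρ → σ.card = k + 2 → ρ.card = k + 1 →
        ∃ G : (V → ℝ) × (V → ℝ) × ℝ → E, ContinuousOn G (Dl σ ×ˢ Dl ρ ×ˢ Icc (-1:ℝ) 1) ∧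
        (∀ p ∈ Dl σ ×ˢ Dl ρ ×ˢ Icc (-1:ℝ) 1, G p ≠ 0) ∧
        ∀ p ∈ Dl σ ×ˢ Dl ρ ×ˢ Icc (-1:ℝ) 1,
          ((∃ v ∈ σ, p.1 v = 0) ∨ (∃ v ∈ ρ, p.2.1 v = 0) ∨ p.2.2 = 1 ∨ p.2.2 = -1) →
          G p = Hg F Φ (ψ p.1) p.1 p.2.1 p.2.2 := by
  classical
  by_cases hV : Nonempty V
  swap
  · have hno : ∀ s : Finset V, ∀ w, w ∉ Dl s := by
      intro s w hw
      obtain ⟨v, -, -⟩ := Dl_pos hw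
      exact hV ⟨v⟩
    refine ⟨fun _ => 0, continuousOn_const, fun _ _ _ _ _ => rfl, fun σ _ _ _ _ _ x hx => absurd hx (hno σ x), ?_⟩
    intro σ _ ρ _ _ _ _
    exact ⟨fun _ => 0, continuousOn_const, fun p hp => absurd hp.1 (hno _ _), fun p hp => absurd hp.1 (hno _ _)⟩
  let M := K.filter (fun s => s.card = k + 2)
  have hM : ∀ s, s ∈ M ↔ s ∈ K ∧ s.card = k + 1 + 1 := fun s => by simp [M]
  choose! e he heσ using fun σ (hσ : σ ∈ M) => exists_enum ((hM σ).1 hσ).2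
  have hface : ∀ σ ∈ M, _ := fun σ hσ => face_finger hk hE hΦ hF (K.filter (fun ρ => ρ.card = k + 1 ∧ Disjoint σ ρ)) (he σ hσ) (by
    intro ρ hρ
    rw [heσ σ hσ]
    exact (Finset.mem_filter.1 hρ).2) (by
    intro ρ hρ
    rw [heσ σ hσ]
    obtain ⟨h1, h2, h3⟩ := Finset.mem_filter.1 hρ
    exact h0 σ ((hM σ).1 hσ).1 ρ h1 h3)
  choose! φ hφ hφ0 hφne hφG using hface
  let X : Finset V → (V → ℝ) → E := fun σ w => if w ∈ Dl σ then φ σ (co (e σ) w) else 0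
  have hX0 : ∀ σ ∈ M, ∀ w, (∃ v ∈ σ, w v = 0) → X σ w = 0 := by
    rintro σ hσ w ⟨v, hv, hv0⟩
    simp only [X]
    split_ifs with hw
    · refine hφ0 σ hσ _ fun hcon => ?_
      rw [← heσ σ hσ] at hw hv
      have := bc_pos (he σ hσ) hcon hv
      rw [bc_co (he σ hσ) hw] at this
      exact this.ne' hv0
    · rfl
  have hXt : ∀ σ ∈ M, ∀ t ∈ K, t ≠ σ → ∀ w ∈ Dl t, X σ w = 0 := by
    intro σ hσ t ht hne w hw
    have : ¬ σ ⊆ t := fun hsub => hne (Finset.eq_of_subset_of_card_le hsub (by rw [((hM σ).1 hσ).2]; exact hcard t ht)).symm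
    obtain ⟨v, hv, hvt⟩ := Finset.not_subset.1 this
    exact hX0 σ hσ w ⟨v, hv, hw.2.2 v hvt⟩
  let ψ : (V → ℝ) → E := fun w => ∑ σ ∈ M, X σ w
  have hψσ : ∀ σ ∈ M, ∀ w ∈ Dl σ, ψ w = φ σ (co (e σ) w) := by
    intro σ hσ w hw
    have : ψ w = X σ w := Finset.sum_eq_single σ (fun τ hτ hne => hXt τ hτ σ ((hM σ).1 hσ).1 hne.symm w hw) (fun h => absurd hσ h)
    rw [this]
    exact if_pos hw
  have hψρ : ∀ ρ ∈ K, ρ.card ≤ k + 1 → ∀ w ∈ Dl ρ, ψ w = 0 := by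
    intro ρ hρ hc w hw
    refine Finset.sum_eq_zero fun σ hσ => hXt σ hσ ρ hρ ?_ w hw
    rintro rfl
    have := ((hM ρ).1 hσ).2
    omega
  refine ⟨ψ, ?_, hψρ, ?_, ?_⟩
  · refine continuousOn_finset_sum _ fun σ hσ => ?_
    have hB : IsClosed (⋃ t ∈ K.erase σ, Dl t) := (Finset.isCompact_biUnion _ fun t _ => Dl_compact t).isClosed
    refine continuousOn_cover (Dl_closed σ) hB ?_ ?_ ?_
    · intro w hw
      obtain ⟨s, hs, hw⟩ := mem_poly.1 hw
      by_cases hsσ : s = σ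
      · left; rwa [hsσ] at hw
      · right; simp only [mem_iUnion]; exact ⟨s, Finset.mem_erase.2 ⟨hsσ, hs⟩, hw⟩
    · have : Continuous (fun w => φ σ (co (e σ) w)) := (hφ σ hσ).comp (co (e σ)).continuous
      exact this.continuousOn.congr fun w hw => if_pos hw.2
    · refine (continuousOn_const (c := (0:E))).congr fun w hw => ?_
      obtain ⟨-, hw⟩ := hw
      simp only [mem_iUnion] at hw
      obtain ⟨t, ht, hw⟩ := hw
      exact hXt σ hσ t (Finset.mem_erase.1 ht).2 (Finset.mem_erase.1 ht).1 w hw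
  · intro σ hσ ρ hρ hdis hc x hx y hy
    by_cases hσM : σ ∈ M
    · rw [hψσ σ hσM x hx]
      have hx' : x ∈ Dl (Finset.univ.image (e σ)) := by rw [heσ σ hσM]; exact hx
      have := hφne σ hσM ρ hc (by rw [heσ σ hσM]; exact hdis) _ (co_mem (he σ hσM) hx') y hy
      rwa [bc_co (he σ hσM) hx'] at this
    · have hc' : σ.card ≤ k + 1 := by
        have h1 := hcard σ hσ
        have h2 : σ.card ≠ k + 1 + 1 := fun h => hσM ((hM σ).2 ⟨hσ, h⟩)
        omega
      rw [hψρ σ hσ hc' x hx, add_zero]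
      exact hF.ne0 hdis (by omega) hx hy
  · intro σ hσ ρ hρ hdis hc hc'
    have hσM : σ ∈ M := (hM σ).2 ⟨hσ, hc⟩
    obtain ⟨G, h1, h2, h3⟩ := hφG σ hσM ρ (Finset.mem_filter.2 ⟨hρ, hc', hdis⟩)
    rw [heσ σ hσM] at h1 h2 h3
    refine ⟨G, h1, h2, fun p hp hb => ?_⟩
    rw [h3 p hp hb, hψσ σ hσM _ hp.1]

theorem glue {X Y ι : Type*} [TopologicalSpace X] [TopologicalSpace Y] [Nonempty Y] [Finite ι] (S : ι → Set X) (hS : ∀ i, IsClosed (S i))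
    (G : ι → X → Y) (hG : ∀ i, ContinuousOn (G i) (S i)) (B : X → Y) (hB : ∀ i j, i ≠ j → ∀ x ∈ S i, x ∈ S j → G i x = B x) :
    ∃ g : X → Y, ContinuousOn g (⋃ i, S i) ∧ ∀ i, ∀ x ∈ S i, g x = G i x := by
  classical
  let g : X → Y := fun x => if h : ∃ i, x ∈ S i then G h.choose x else Classical.arbitrary Y
  have hg : ∀ i, ∀ x ∈ S i, g x = G i x := by
    intro i x hx
    have h : ∃ i, x ∈ S i := ⟨i, hx⟩
    have h1 : g x = G h.choose x := dif_pos h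
    rw [h1]
    by_cases hi : h.choose = i
    · rw [hi]
    · rw [hB _ _ hi x h.choose_spec hx, hB _ _ (Ne.symm hi) x hx h.choose_spec]
  exact ⟨g, (locallyFinite_of_finite S).continuousOn_iUnion hS fun i => (hG i).congr (hg i), hg⟩

theorem Hg_swap (F : (V → ℝ) →L[ℝ] E) {Φ : (V → ℝ) × (V → ℝ) → E} (hodd : ∀ p, Φ p.swap = -Φ p) (a : E) (x y : V → ℝ) (t : ℝ) :
    -Hg F Φ a y x t = Hg F Φ (-a) x y t := by
  have := hodd (x, y)
  simp only [Prod.swap_prod_mk] at this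
  simp only [Hg, this]
  module

set_option maxHeartbeats 1000000 in
theorem stage1 {k : ℕ} (hk : 2 ≤ k) (hE : Module.finrank ℝ E = 2 * (k + 1)) {Φ : (V → ℝ) × (V → ℝ) → E} (hΦ : ContDiff ℝ (⊤ : ℕ∞) Φ)
    (hodd : ∀ p, Φ p.swap = -Φ p) {K : Finset (Finset V)} (hdown : ∀ s ∈ K, ∀ t, t ⊆ s → t ∈ K) (hcard : ∀ s ∈ K, s.card ≤ k + 2)
    (h0 : ∀ s ∈ K, ∀ t ∈ K, Disjoint s t → ∀ x ∈ Dl s, ∀ y ∈ Dl t, Φ (x, y) ≠ 0) :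
    ∃ f : (V → ℝ) → E, Inv K (k+1) ∅ f := by
  obtain ⟨Θ, hF⟩ := gn_exists hE hΦ
  generalize lf Θ = F at hF
  have hΦ1 : ContDiff ℝ 1 Φ := hΦ.of_le (by norm_cast)
  obtain ⟨ψ, hψ, hψ0, hne, hcell⟩ := stage1a hk hE hΦ1 hF hcard h0
  have hfc : ContinuousOn (fun w => F w + ψ w) (poly K) := F.continuous.continuousOn.add hψ
  refine ⟨fun w => F w + ψ w, hfc, ?_, ?_, by simp⟩
  · intro s hs t ht hdis hc x hx y hy
    by_cases h : t.card ≤ k + 1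
    · simp only [hψ0 t ht h y hy, add_zero]
      exact hne s hs t ht hdis h x hx y hy
    · have h' : s.card ≤ k + 1 := by omega
      simp only [hψ0 s hs h' x hx, add_zero]
      exact (hne t ht s hs hdis.symm h' y hy x hx).symm
  · intro σ hσ τ hτ hdis hc hc'
    have hcell1 : ∀ v : {v // v ∈ τ}, _ := fun v => hcell σ hσ (τ.erase v) (hdown τ hτ _ (Finset.erase_subset _ _))
      (hdis.mono_right (Finset.erase_subset _ _)) hc (by rw [Finset.card_erase_of_mem v.2]; omega)
    have hcell2 : ∀ v : {v // v ∈ σ}, _ := fun v => hcell τ hτ (σ.erase v) (hdown σ hσ _ (Finset.erase_subset _ _))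
      (hdis.symm.mono_right (Finset.erase_subset _ _)) hc' (by rw [Finset.card_erase_of_mem v.2]; omega)
    choose G1 hG1 hG10 hG1b using hcell1
    choose G2 hG2 hG20 hG2b using hcell2
    let S : {v // v ∈ τ} ⊕ {v // v ∈ σ} → Set (ℝ × ((V → ℝ) × (V → ℝ))) := Sum.elim
      (fun v => Icc (0:ℝ) 1 ×ˢ (Dl σ ×ˢ Dl (τ.erase v))) (fun v => Icc (0:ℝ) 1 ×ˢ (Dl (σ.erase v) ×ˢ Dl τ))
    let G : {v // v ∈ τ} ⊕ {v // v ∈ σ} → ℝ × ((V → ℝ) × (V → ℝ)) → E := Sum.elim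
      (fun v q => G1 v (q.2.1, q.2.2, 2 * q.1 - 1)) (fun v q => - G2 v (q.2.2, q.2.1, 2 * q.1 - 1))
    let B : ℝ × ((V → ℝ) × (V → ℝ)) → E := fun q => Hg F Φ (ψ q.2.1 - ψ q.2.2) q.2.1 q.2.2 (2 * q.1 - 1)
    have hI : ∀ r ∈ Icc (0:ℝ) 1, 2 * r - 1 ∈ Icc (-1:ℝ) 1 := fun r hr => ⟨by linarith [hr.1], by linarith [hr.2]⟩
    have hψτ : ∀ v : {v // v ∈ τ}, ∀ y ∈ Dl (τ.erase v), ψ y = 0 := fun v y hy =>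
      hψ0 _ (hdown τ hτ _ (Finset.erase_subset _ _)) (by rw [Finset.card_erase_of_mem v.2]; omega) y hy
    have hψσ : ∀ v : {v // v ∈ σ}, ∀ y ∈ Dl (σ.erase v), ψ y = 0 := fun v y hy =>
      hψ0 _ (hdown σ hσ _ (Finset.erase_subset _ _)) (by rw [Finset.card_erase_of_mem v.2]; omega) y hy
    have hb1 : ∀ v : {v // v ∈ τ}, ∀ q ∈ S (Sum.inl v), ((∃ w ∈ σ, q.2.1 w = 0) ∨ (∃ w ∈ τ.erase v, q.2.2 w = 0) ∨ q.1 = 0 ∨ q.1 = 1) →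
        G (Sum.inl v) q = B q := by
      intro v q hq hb
      have := hG1b v (q.2.1, q.2.2, 2 * q.1 - 1) ⟨hq.2.1, hq.2.2, hI _ hq.1⟩ (by
        rcases hb with h | h | h | h
        · exact Or.inl h
        · exact Or.inr (Or.inl h)
        · right; right; right; simp only [h]; norm_num
        · right; right; left; simp only [h]; norm_num)
      simp only [G, B, Sum.elim_inl]
      rw [this, hψτ v _ hq.2.2, sub_zero]
    have hb2 : ∀ v : {v // v ∈ σ}, ∀ q ∈ S (Sum.inr v), ((∃ w ∈ τ, q.2.2 w = 0) ∨ (∃ w ∈ σ.erase v, q.2.1 w = 0) ∨ q.1 = 0 ∨ q.1 = 1) →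
        G (Sum.inr v) q = B q := by
      intro v q hq hb
      have := hG2b v (q.2.2, q.2.1, 2 * q.1 - 1) ⟨hq.2.2, hq.2.1, hI _ hq.1⟩ (by
        rcases hb with h | h | h | h
        · exact Or.inl h
        · exact Or.inr (Or.inl h)
        · right; right; right; simp only [h]; norm_num
        · right; right; left; simp only [h]; norm_num)
      simp only [G, B, Sum.elim_inr]
      rw [this, hψσ v _ hq.2.1, zero_sub, Hg_swap F hodd]
    have hz : ∀ (s : Finset V) (v : V) (w : V → ℝ), w ∈ Dl (s.erase v) → w v = 0 := fun s v w hw => hw.2.2 v (Finset.notMem_erase v s)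
    obtain ⟨g, hg, hgG⟩ := glue S (by
        rintro (v | v)
        · exact isClosed_Icc.prod ((Dl_closed _).prod (Dl_closed _))
        · exact isClosed_Icc.prod ((Dl_closed _).prod (Dl_closed _))) G (by
        rintro (v | v)
        · exact (hG1 v).comp (Continuous.continuousOn (by fun_prop)) fun q hq => ⟨hq.2.1, hq.2.2, hI _ hq.1⟩
        · exact ((hG2 v).comp (f := fun q : ℝ × ((V → ℝ) × (V → ℝ)) => (q.2.2, q.2.1, 2 * q.1 - 1)) (Continuous.continuousOn (by fun_prop))
            fun q hq => ⟨hq.2.2, hq.2.1, hI _ hq.1⟩).neg) B (by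
        rintro (v | v) (w | w) hne q hq hq'
        · refine hb1 v q hq (Or.inr (Or.inl ⟨w, Finset.mem_erase.2 ⟨?_, w.2⟩, hz _ _ _ hq'.2.2⟩))
          intro h; exact hne (by rw [Subtype.ext h])
        · exact hb1 v q hq (Or.inl ⟨w, w.2, hz _ _ _ hq'.2.1⟩)
        · exact hb2 v q hq (Or.inl ⟨w, w.2, hz _ _ _ hq'.2.2⟩)
        · refine hb2 v q hq (Or.inr (Or.inl ⟨w, Finset.mem_erase.2 ⟨?_, w.2⟩, hz _ _ _ hq'.2.1⟩))
          intro h; exact hne (by rw [Subtype.ext h]))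
    let D : Set ((V → ℝ) × (V → ℝ)) := {p | p ∈ Dl σ ×ˢ Dl τ ∧ ((∃ v ∈ σ, p.1 v = 0) ∨ ∃ v ∈ τ, p.2 v = 0)}
    have hcov : ∀ r ∈ Icc (0:ℝ) 1, ∀ p ∈ D, ∃ i, (r, p) ∈ S i := by
      rintro r hr p ⟨hp, ⟨v, hv, hv0⟩ | ⟨v, hv, hv0⟩⟩
      · refine ⟨Sum.inr ⟨v, hv⟩, hr, ⟨hp.1.1, hp.1.2.1, fun w hw => ?_⟩, hp.2⟩
        by_cases hwv : w = v
        · rw [hwv]; exact hv0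
        · exact hp.1.2.2 w fun h => hw (Finset.mem_erase.2 ⟨hwv, h⟩)
      · refine ⟨Sum.inl ⟨v, hv⟩, hr, hp.1, ⟨hp.2.1, hp.2.2.1, fun w hw => ?_⟩⟩
        by_cases hwv : w = v
        · rw [hwv]; exact hv0
        · exact hp.2.2.2 w fun h => hw (Finset.mem_erase.2 ⟨hwv, h⟩)
    have hend : ∀ r : ℝ, (r = 0 ∨ r = 1) → ∀ p ∈ D, g (r, p) = B (r, p) := by
      intro r hr p hp
      obtain ⟨i, hi⟩ := hcov r (by rcases hr with rfl | rfl <;> simp) p hp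
      rw [hgG i _ hi]
      rcases i with v | v
      · exact hb1 v _ hi (Or.inr (Or.inr hr))
      · exact hb2 v _ hi (Or.inr (Or.inr hr))
    have hH : Hmt D ({0}ᶜ : Set E) (fun p => (F p.1 + ψ p.1) - (F p.2 + ψ p.2)) Φ := by
      refine ⟨g, hg.mono fun q hq => ?_, fun q hq => ?_, fun p hp => ?_, fun p hp => ?_⟩
      · obtain ⟨i, hi⟩ := hcov q.1 hq.1 q.2 hq.2
        exact mem_iUnion.2 ⟨i, hi⟩
      · obtain ⟨i, hi⟩ := hcov q.1 hq.1 q.2 hq.2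
        have hi' : q ∈ S i := hi
        rw [mem_compl_singleton_iff, hgG i q hi']
        rcases i with v | v
        · exact hG10 v _ ⟨hi.2.1, hi.2.2, hI _ hi.1⟩
        · exact neg_ne_zero.2 (hG20 v _ ⟨hi.2.2, hi.2.1, hI _ hi.1⟩)
      · rw [hend 0 (Or.inl rfl) p hp]
        simp only [B, Hg]
        norm_num
        abel
      · rw [hend 1 (Or.inr rfl) p hp]
        simp only [B, Hg]
        norm_num
    have hDc : IsClosed D := by
      have : D = (Dl σ ×ˢ Dl τ) ∩ ((⋃ v ∈ σ, {p : ((V → ℝ) × (V → ℝ)) | p.1 v = 0}) ∪ ⋃ v ∈ τ, {p : ((V → ℝ) × (V → ℝ)) | p.2 v = 0}) := by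
        ext p; simp [D]; exact and_or_left.symm
      rw [this]
      refine ((Dl_closed _).prod (Dl_closed _)).inter (IsClosed.union ?_ ?_)
      · exact isClosed_biUnion_finset fun v _ => isClosed_eq (by fun_prop) continuous_const
      · exact isClosed_biUnion_finset fun v _ => isClosed_eq (by fun_prop) continuous_const
    obtain ⟨N, h1, h2, h3⟩ := extend_of_hmt ((Dl_compact σ).prod (Dl_compact τ)) hDc (fun p hp => hp.1) isOpen_compl_singleton hH
      hΦ1.continuous.continuousOn (fun p hp => h0 σ hσ τ hτ hdis _ hp.1 _ hp.2)
    exact ⟨N, h1, fun p hp h => h2 hp h, fun p hp hb => h3 ⟨hp, hb⟩⟩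

theorem vk_abs {m : ℕ} (hm : 3 ≤ m) (hE : Module.finrank ℝ E = 2 * m) {K : Finset (Finset V)}
    (hdown : ∀ s ∈ K, ∀ t, t ⊆ s → t ∈ K) (hcard : ∀ s ∈ K, s.card ≤ m + 1) {Φ : (V → ℝ) × (V → ℝ) → E}
    (hΦ : ContinuousOn Φ {p | ∃ s ∈ K, ∃ t ∈ K, Disjoint s t ∧ p.1 ∈ Dl s ∧ p.2 ∈ Dl t})
    (h0 : ∀ s ∈ K, ∀ t ∈ K, Disjoint s t → ∀ x ∈ Dl s, ∀ y ∈ Dl t, Φ (x, y) ≠ 0)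
    (hodd : ∀ s ∈ K, ∀ t ∈ K, Disjoint s t → ∀ x ∈ Dl s, ∀ y ∈ Dl t, Φ (y, x) = - Φ (x, y)) :
    ∃ f : (V → ℝ) → E, ContinuousOn f (poly K) ∧ ∀ s ∈ K, ∀ t ∈ K, Disjoint s t → ∀ x ∈ Dl s, ∀ y ∈ Dl t, f x ≠ f y := by
  obtain ⟨k, rfl⟩ : ∃ k, m = k + 1 := ⟨m - 1, by omega⟩
  have hc : IsCompact {p : (V → ℝ) × (V → ℝ) | ∃ s ∈ K, ∃ t ∈ K, Disjoint s t ∧ p.1 ∈ Dl s ∧ p.2 ∈ Dl t} := by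
    have : {p : (V → ℝ) × (V → ℝ) | ∃ s ∈ K, ∃ t ∈ K, Disjoint s t ∧ p.1 ∈ Dl s ∧ p.2 ∈ Dl t} =
        ⋃ q ∈ (K ×ˢ K).filter (fun q => Disjoint q.1 q.2), Dl q.1 ×ˢ Dl q.2 := by
      ext p
      simp only [mem_setOf_eq, mem_iUnion, Finset.mem_filter, Finset.mem_product, mem_prod, exists_prop, Prod.exists]
      constructor
      · rintro ⟨s, hs, t, ht, hd, h1, h2⟩; exact ⟨s, t, ⟨⟨hs, ht⟩, hd⟩, h1, h2⟩
      · rintro ⟨s, t, ⟨⟨hs, ht⟩, hd⟩, h1, h2⟩; exact ⟨s, hs, t, ht, hd, h1, h2⟩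
    rw [this]
    exact Finset.isCompact_biUnion _ fun q _ => (Dl_compact _).prod (Dl_compact _)
  obtain ⟨Ψ, hΨ, hΨ0, hΨo⟩ := smooth_odd hc (by
      rintro p ⟨s, hs, t, ht, hd, h1, h2⟩; exact ⟨t, ht, s, hs, hd.symm, h2, h1⟩) hΦ (by
      rintro p ⟨s, hs, t, ht, hd, h1, h2⟩; exact h0 s hs t ht hd _ h1 _ h2) (by
      rintro p ⟨s, hs, t, ht, hd, h1, h2⟩; exact hodd s hs t ht hd _ h1 _ h2)
  obtain ⟨f, hf⟩ := stage1 (by omega) hE hΨ hΨo hdown hcard (fun s hs t ht hd x hx y hy => hΨ0 (x, y) ⟨s, hs, t, ht, hd, hx, hy⟩)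
  exact stage2 hm hE hdown hcard hf

end
end VK

namespace VK
set_option linter.unusedVariables false
set_option linter.unusedSectionVars false
set_option linter.deprecated false
set_option linter.unusedSimpArgs false
open Topology Filter MeasureTheory

section
variable {V : Type*} [Fintype V] [DecidableEq V]
variable {E : Type*} [NormedAddCommGroup E] [NormedSpace ℝ E] [FiniteDimensional ℝ E]

theorem coords {s : Finset E} (h : AffineIndependent ℝ ((↑) : s → E)) :
    ∃ c : E → E → ℝ, (∀ v, Continuous (c v)) ∧
      ∀ w : E → ℝ, ∑ u ∈ s, w u = 1 → ∀ v ∈ s, c v (∑ u ∈ s, w u • u) = w v := by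
  classical
  obtain ⟨t, hst, hind, htop⟩ := exists_subset_affineIndependent_affineSpan_eq_top (s := (s : Set E)) h
  let b : AffineBasis t ℝ E := ⟨(↑), hind, by rw [Subtype.range_coe]; exact htop⟩
  refine ⟨fun v x => if hv : v ∈ t then b.coord ⟨v, hv⟩ x else 0, fun v => ?_, fun w hw v hv => ?_⟩
  · by_cases hv : v ∈ t
    · simp only [hv, dif_pos]; exact continuous_barycentric_coord b _
    · simp only [hv, dif_neg, not_false_eq_true]; exact continuous_const
  · have hv' : v ∈ t := hst hv
    simp only [hv', dif_pos]
    have e : ∑ u ∈ s, w u • u = s.affineCombination ℝ id w := by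
      rw [s.affineCombination_eq_linear_combination id w hw]; rfl
    rw [e, s.map_affineCombination id w hw, s.affineCombination_eq_linear_combination _ w hw]
    rw [Finset.sum_eq_single v]
    · have : b.coord ⟨v, hv'⟩ v = 1 := b.coord_apply_eq ⟨v, hv'⟩
      simp [this]
    · intro u hu huv
      have : b.coord ⟨v, hv'⟩ u = 0 := b.coord_apply_ne (i := ⟨v, hv'⟩) (j := ⟨u, hst hu⟩) (fun h => huv (congrArg Subtype.val h).symm)
      simp [this]
    · exact fun h => absurd hv h

theorem mem_affineSpan_fin {s : Finset E} {x : E} (hx : x ∈ affineSpan ℝ (s : Set E)) :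
    ∃ w : E → ℝ, ∑ u ∈ s, w u = 1 ∧ ∑ u ∈ s, w u • u = x := by
  classical
  have hx' : x ∈ affineSpan ℝ (range ((↑) : s → E)) := by
    have : range ((↑) : s → E) = (s : Set E) := Subtype.range_coe
    rwa [this]
  obtain ⟨w, hw, hx2⟩ := eq_affineCombination_of_mem_affineSpan_of_fintype hx'
  rw [Finset.affineCombination_eq_linear_combination _ _ _ hw] at hx2
  have hz : ∀ u : s, (fun u => if hu : u ∈ s then w ⟨u, hu⟩ else 0) (u : E) = w u := fun u => by
    simp
  refine ⟨fun u => if hu : u ∈ s then w ⟨u, hu⟩ else 0, ?_, ?_⟩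
  · rw [← Finset.sum_coe_sort, ← hw]
    exact Finset.sum_congr rfl fun u _ => hz u
  · rw [← Finset.sum_coe_sort, hx2]
    exact Finset.sum_congr rfl fun u _ => by rw [← hz u]

theorem relint {s : Finset E} (h : AffineIndependent ℝ ((↑) : s → E)) {w : E → ℝ}
    (hw : ∑ u ∈ s, w u = 1) (hpos : ∀ u ∈ s, 0 < w u) :
    ∑ u ∈ s, w u • u ∈ intrinsicInterior ℝ (convexHull ℝ (s : Set E)) := by
  obtain ⟨c, hc, hcw⟩ := coords h
  have hx : ∑ u ∈ s, w u • u ∈ convexHull ℝ (s : Set E) :=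
    Finset.mem_convexHull'.2 ⟨w, fun u hu => (hpos u hu).le, hw, rfl⟩
  refine ⟨⟨_, subset_affineSpan ℝ _ hx⟩, ?_, rfl⟩
  have ho : IsOpen (⋂ u ∈ s, {q : affineSpan ℝ (convexHull ℝ (s : Set E)) | 0 < c u q}) :=
    isOpen_biInter_finset fun u _ => isOpen_lt continuous_const ((hc u).comp continuous_subtype_val)
  refine mem_interior.2 ⟨_, fun q hq => ?_, ho, ?_⟩
  · have hq' : (q : E) ∈ affineSpan ℝ (s : Set E) := by
      rw [← affineSpan_convexHull]; exact q.2
    obtain ⟨w', h1, h2⟩ := mem_affineSpan_fin hq'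
    refine Finset.mem_convexHull'.2 ⟨w', fun u hu => ?_, h1, h2⟩
    have : 0 < c u q := by simpa using mem_iInter₂.1 hq u hu
    rw [← h2, hcw w' h1 u hu] at this
    exact this.le
  · refine mem_iInter₂.2 fun u hu => ?_
    show 0 < c u (∑ u ∈ s, w u • u)
    rw [hcw w hw u hu]; exact hpos u hu

theorem exists_support {n : ℕ} {K : Geometry.SimplicialComplex ℝ (EuclideanSpace ℝ (Fin n))}
    {s : Finset (EuclideanSpace ℝ (Fin n))} (hs : s ∈ K.faces) {x : EuclideanSpace ℝ (Fin n)}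
    (hx : x ∈ convexHull ℝ (s : Set (EuclideanSpace ℝ (Fin n)))) : ∃ t ⊆ s, IsSupportFace K x t := by
  classical
  obtain ⟨w, h0, h1, rfl⟩ := Finset.mem_convexHull'.1 hx
  have hz : ∀ u ∈ s, u ∉ s.filter (fun u => 0 < w u) → w u = 0 := fun u hu h =>
    le_antisymm (not_lt.1 fun h' => h (Finset.mem_filter.2 ⟨hu, h'⟩)) (h0 u hu)
  have e1 : ∑ u ∈ s.filter (fun u => 0 < w u), w u = 1 := by
    rw [← h1]; exact Finset.sum_subset (Finset.filter_subset _ _) hz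
  have e2 : ∑ u ∈ s.filter (fun u => 0 < w u), w u • u = ∑ u ∈ s, w u • u :=
    Finset.sum_subset (Finset.filter_subset _ _) fun u hu h => by rw [hz u hu h, zero_smul]
  have hf : s.filter (fun u => 0 < w u) ∈ K.faces := by
    refine K.down_closed hs (Finset.filter_subset _ _) ?_
    rw [Finset.nonempty_iff_ne_empty]; intro h; rw [h] at e1; simp at e1
  refine ⟨_, Finset.filter_subset _ _, hf, ?_⟩
  rw [← e2]
  exact relint (K.indep hf) e1 fun u hu => (Finset.mem_filter.1 hu).2

theorem mem_deleted {n : ℕ} {K : Geometry.SimplicialComplex ℝ (EuclideanSpace ℝ (Fin n))}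
    {x : Fin 2 → EuclideanSpace ℝ (Fin n)} :
    x ∈ deletedProduct K 2 ↔ ∃ s ∈ K.faces, ∃ t ∈ K.faces, Disjoint s t ∧
      x 0 ∈ convexHull ℝ (s : Set (EuclideanSpace ℝ (Fin n))) ∧ x 1 ∈ convexHull ℝ (t : Set (EuclideanSpace ℝ (Fin n))) := by
  constructor
  · rintro ⟨s, hs, hd⟩
    exact ⟨s 0, (hs 0).1, s 1, (hs 1).1, hd (by decide), intrinsicInterior_subset (hs 0).2, intrinsicInterior_subset (hs 1).2⟩
  · rintro ⟨s, hs, t, ht, hd, hx, hy⟩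
    obtain ⟨s', hss, hs'⟩ := exists_support hs hx
    obtain ⟨t', htt, ht'⟩ := exists_support ht hy
    have hd' := hd.mono hss htt
    refine ⟨![s', t'], fun i => ?_, fun i j hij => ?_⟩
    · fin_cases i
      · exact hs'
      · exact ht'
    · fin_cases i <;> fin_cases j
      · exact absurd rfl hij
      · exact hd'
      · exact hd'.symm
      · exact absurd rfl hij

theorem tverberg_iff {n d : ℕ} {K : Geometry.SimplicialComplex ℝ (EuclideanSpace ℝ (Fin n))}
    {f : EuclideanSpace ℝ (Fin n) → EuclideanSpace ℝ (Fin d)} :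
    HasTverbergPoint K 2 f ↔ ∃ x ∈ deletedProduct K 2, f (x 0) = f (x 1) := by
  constructor
  · rintro ⟨x, s, h1, h2, h3⟩; exact ⟨x, ⟨s, h1, h2⟩, h3 0 1⟩
  · rintro ⟨x, ⟨s, h1, h2⟩, h3⟩
    refine ⟨x, s, h1, h2, fun i j => ?_⟩
    fin_cases i <;> fin_cases j
    · rfl
    · exact h3
    · exact h3.symm
    · rfl

theorem perm2 (π : Equiv.Perm (Fin 2)) : π = 1 ∨ π = Equiv.swap 0 1 := by
  revert π; decide

theorem easy {n d : ℕ} {K : Geometry.SimplicialComplex ℝ (EuclideanSpace ℝ (Fin n))}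
    {f : EuclideanSpace ℝ (Fin n) → EuclideanSpace ℝ (Fin d)} (hf : ContinuousOn f K.space)
    (hT : ¬ HasTverbergPoint K 2 f) : ExistsEquivariantMap K 2 d := by
  rw [tverberg_iff] at hT
  push Not at hT
  have hsp : ∀ i, ∀ x ∈ deletedProduct K 2, x i ∈ K.space := by
    rintro i x ⟨s, hs, -⟩
    exact K.convexHull_subset_space (hs i).1 (intrinsicInterior_subset (hs i).2)
  have hfc : ∀ i : Fin 2, ContinuousOn (fun x : Fin 2 → EuclideanSpace ℝ (Fin n) => f (x i)) (deletedProduct K 2) := fun i =>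
    hf.comp (continuous_apply i).continuousOn (hsp i)
  refine ⟨fun x i => (√2 * ‖f (x 0) - f (x 1)‖)⁻¹ • (f (x i) - f (x (Equiv.swap 0 1 i))), ?_, ?_, ?_⟩
  · refine continuousOn_pi.2 fun i => ContinuousOn.smul (ContinuousOn.inv₀ (continuousOn_const.mul ((hfc 0).sub (hfc 1)).norm) ?_) ((hfc i).sub (hfc _))
    intro x hx
    exact mul_ne_zero (by positivity) (norm_ne_zero_iff.2 (sub_ne_zero.2 (hT x hx)))
  · intro x hx
    have hne : ‖f (x 0) - f (x 1)‖ ≠ 0 := norm_ne_zero_iff.2 (sub_ne_zero.2 (hT x hx))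
    constructor
    · simp only [Fin.sum_univ_two, Equiv.swap_apply_left, Equiv.swap_apply_right]
      rw [← smul_add]; simp
    · simp only [Fin.sum_univ_two, Equiv.swap_apply_left, Equiv.swap_apply_right, norm_smul, norm_inv, norm_mul, norm_norm]
      rw [norm_sub_rev (f (x 1)), Real.norm_of_nonneg (Real.sqrt_nonneg 2), mul_pow, inv_pow, mul_pow, Real.sq_sqrt (by norm_num)]
      field_simp
      norm_num
  · intro x hx π
    rcases perm2 π with rfl | rfl
    · rfl
    · funext i
      beta_reduce
      rw [Equiv.swap_apply_left, Equiv.swap_apply_right, norm_sub_rev]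


theorem descend {W : Type*} [NormedAddCommGroup W] [NormedSpace ℝ W] {X : Set (V → ℝ)} (hX : IsCompact X)
    {β : (V → ℝ) → W} (hβ : Continuous β) (hinj : InjOn β X) {f : (V → ℝ) → E} (hf : ContinuousOn f X) :
    ∃ g : W → E, ContinuousOn g (β '' X) ∧ ∀ x ∈ X, g (β x) = f x := by
  have hg : ∀ x ∈ X, f (Function.invFunOn β X (β x)) = f x := fun x hx => by
    rw [hinj.leftInvOn_invFunOn hx]
  refine ⟨fun y => f (Function.invFunOn β X y), ?_, hg⟩
  rw [continuousOn_iff_isClosed]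
  intro t ht
  refine ⟨β '' (X ∩ f ⁻¹' t), ?_, ?_⟩
  · have h1 : IsClosed (X ∩ f ⁻¹' t) := hf.preimage_isClosed_of_isClosed hX.isClosed ht
    exact ((hX.of_isClosed_subset h1 inter_subset_left).image hβ).isClosed
  · ext y
    constructor
    · rintro ⟨hy, x, hx, rfl⟩
      refine ⟨⟨x, ⟨hx, ?_⟩, rfl⟩, x, hx, rfl⟩
      have : f (Function.invFunOn β X (β x)) ∈ t := hy
      rwa [hg x hx] at this
    · rintro ⟨⟨x, ⟨hx, hxt⟩, rfl⟩, -⟩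
      refine ⟨?_, x, hx, rfl⟩
      show f (Function.invFunOn β X (β x)) ∈ t
      rw [hg x hx]; exact hxt

def bt (A : Finset E) (w : A → ℝ) : E := ∑ v, w v • (v : E)

theorem bt_continuous (A : Finset E) : Continuous (bt A) := by
  unfold bt; fun_prop

theorem bt_eq {A : Finset E} {s : Finset A} {w : A → ℝ} (hw : w ∈ Dl s) :
    bt A w = ∑ v ∈ s, w v • (v : E) :=
  (Finset.sum_subset (Finset.subset_univ _) fun v _ hv => by rw [hw.2.2 v hv, zero_smul]).symm

theorem sum_mapv {A : Finset E} (s : Finset A) {M : Type*} [AddCommMonoid M] (g : E → M) :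
    ∑ u ∈ s.map (Function.Embedding.subtype _), g u = ∑ v ∈ s, g v := by
  rw [Finset.sum_map]; rfl

theorem bt_image {A : Finset E} (s : Finset A) :
    bt A '' Dl s = convexHull ℝ ((s.map (Function.Embedding.subtype _) : Finset E) : Set E) := by
  classical
  ext x
  rw [Finset.mem_convexHull']
  constructor
  · rintro ⟨w, hw, rfl⟩
    refine ⟨fun u => if hu : u ∈ A then w ⟨u, hu⟩ else 0, fun u hu => ?_, ?_, ?_⟩
    · beta_reduce; split_ifs
      · exact hw.1 _
      · exact le_rfl
    · rw [sum_mapv, ← Dl_sum hw]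
      exact Finset.sum_congr rfl fun v _ => by simp
    · rw [sum_mapv s (fun u => (if hu : u ∈ A then w ⟨u, hu⟩ else 0) • u), bt_eq hw]
      exact Finset.sum_congr rfl fun v _ => by simp
  · rintro ⟨w, h0, h1, rfl⟩
    rw [sum_mapv] at h1
    have hD : (fun v : A => if v ∈ s then w v else 0) ∈ Dl s := by
      refine ⟨fun v => ?_, ?_, fun v hv => if_neg hv⟩
      · beta_reduce; split_ifs with hv
        · exact h0 _ (Finset.mem_map_of_mem _ hv)
        · exact le_rfl
      · rw [← h1, Finset.sum_ite_mem, Finset.univ_inter]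
    refine ⟨_, hD, ?_⟩
    rw [bt_eq hD, sum_mapv s (fun u => w u • u)]
    exact Finset.sum_congr rfl fun v hv => by simp only [if_pos hv]

theorem bt_inj {A : Finset E} {s : Finset A}
    (h : AffineIndependent ℝ ((↑) : (s.map (Function.Embedding.subtype _) : Finset E) → E))
    {x y : A → ℝ} (hx : x ∈ Dl s) (hy : y ∈ Dl s) (hxy : bt A x = bt A y) : x = y := by
  classical
  obtain ⟨c, -, hc⟩ := coords h
  have key : ∀ w ∈ Dl s, ∀ v ∈ s, c v (bt A w) = w v := by
    intro w hw v hv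
    have := hc (fun u => if hu : u ∈ A then w ⟨u, hu⟩ else 0) (by
      rw [sum_mapv, ← Dl_sum hw]
      exact Finset.sum_congr rfl fun v _ => by simp) v (Finset.mem_map_of_mem (Function.Embedding.subtype _) hv)
    rw [sum_mapv s (fun u => (if hu : u ∈ A then w ⟨u, hu⟩ else 0) • u)] at this
    rw [bt_eq hw]
    simpa using this
  funext v
  by_cases hv : v ∈ s
  · rw [← key x hx v hv, hxy, key y hy v hv]
  · rw [hx.2.2 v hv, hy.2.2 v hv]

set_option maxHeartbeats 1000000 in
theorem hard {n m : ℕ} (hm : 3 ≤ m) {K : Geometry.SimplicialComplex ℝ (EuclideanSpace ℝ (Fin n))}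
    (hK : K.faces.Finite) (hdim : ∀ s ∈ K.faces, s.card ≤ m + 1) (hF : ExistsEquivariantMap K 2 (2 * m)) :
    ∃ f : EuclideanSpace ℝ (Fin n) → EuclideanSpace ℝ (Fin (2 * m)),
        ContinuousOn f K.space ∧ ¬ HasTverbergPoint K 2 f := by
  classical
  obtain ⟨F, hFc, hFs, hFe⟩ := hF
  let A : Finset (EuclideanSpace ℝ (Fin n)) := hK.toFinset.biUnion id
  have hA : ∀ s ∈ K.faces, s ⊆ A := fun s hs =>
    Finset.subset_biUnion_of_mem id (hK.mem_toFinset.2 hs)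
  let e : Finset A → Finset (EuclideanSpace ℝ (Fin n)) := fun s => s.map (Function.Embedding.subtype _)
  have hpre : ∀ s ∈ K.faces, ∃ s' : Finset A, e s' = s := by
    intro s hs
    refine ⟨s.subtype (· ∈ A), ?_⟩
    simp only [e]
    rw [Finset.subtype_map, Finset.filter_true_of_mem (hA s hs)]
  let L : Finset (Finset A) := Finset.univ.filter fun s => s = ∅ ∨ e s ∈ K.faces
  have hL : ∀ s, s ∈ L ↔ s = ∅ ∨ e s ∈ K.faces := fun s => by simp [L]
  have hLf : ∀ s ∈ L, ∀ x ∈ Dl s, e s ∈ K.faces := by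
    intro s hs x hx
    rcases (hL s).1 hs with rfl | h
    · obtain ⟨v, hv, -⟩ := Dl_pos hx; simp at hv
    · exact h
  have hdown : ∀ s ∈ L, ∀ t, t ⊆ s → t ∈ L := by
    intro s hs t hts
    rw [hL]
    rcases t.eq_empty_or_nonempty with h | h
    · exact Or.inl h
    · right
      rcases (hL s).1 hs with rfl | hs'
      · obtain ⟨v, hv⟩ := h; exact absurd (hts hv) (by simp)
      · exact K.down_closed hs' (Finset.map_subset_map.2 hts) (h.map)
  have hcard : ∀ s ∈ L, s.card ≤ m + 1 := by
    intro s hs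
    rcases (hL s).1 hs with rfl | hs'
    · simp
    · have := hdim _ hs'; simpa [e] using this
  have hde : ∀ s t, Disjoint s t → Disjoint (e s) (e t) := fun s t h => (Finset.disjoint_map _).2 h
  have him : ∀ s, ∀ x ∈ Dl s, bt A x ∈ convexHull ℝ ((e s : Finset _) : Set (EuclideanSpace ℝ (Fin n))) := by
    intro s x hx
    simp only [e]
    rw [← bt_image]; exact ⟨x, hx, rfl⟩
  have hdel : ∀ s ∈ L, ∀ t ∈ L, Disjoint s t → ∀ x ∈ Dl s, ∀ y ∈ Dl t, ![bt A x, bt A y] ∈ deletedProduct K 2 := by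
    intro s hs t ht hd x hx y hy
    exact mem_deleted.2 ⟨e s, hLf s hs x hx, e t, hLf t ht y hy, hde s t hd, him s x hx, him t y hy⟩
  have hsum : ∀ x ∈ deletedProduct K 2, F x 1 = - F x 0 := by
    intro x hx
    have := (hFs hx).1
    rw [Fin.sum_univ_two] at this
    exact eq_neg_of_add_eq_zero_right this
  obtain ⟨f, hf, hfne⟩ := vk_abs (E := EuclideanSpace ℝ (Fin (2 * m))) hm (by simp) hdown hcard
    (Φ := fun p => F ![bt A p.1, bt A p.2] 0) (by
      refine (continuousOn_pi.1 hFc 0).comp (f := fun p : (A → ℝ) × (A → ℝ) => ![bt A p.1, bt A p.2]) ?_ ?_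
      · refine Continuous.continuousOn (continuous_pi fun i => ?_)
        fin_cases i
        · exact (bt_continuous A).comp continuous_fst
        · exact (bt_continuous A).comp continuous_snd
      · rintro p ⟨s, hs, t, ht, hd, h1, h2⟩
        exact hdel s hs t ht hd _ h1 _ h2) (by
      intro s hs t ht hd x hx y hy h
      have hxy := hdel s hs t ht hd x hx y hy
      have h2 := (hFs hxy).2
      rw [Fin.sum_univ_two, hsum _ hxy] at h2
      beta_reduce at h
      rw [h] at h2
      simp at h2) (by
      intro s hs t ht hd x hx y hy
      have hxy := hdel s hs t ht hd x hx y hy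
      have h1 := hFe _ hxy (Equiv.swap 0 1)
      have h2 : (fun i => ![bt A x, bt A y] (Equiv.swap 0 1 i)) = ![bt A y, bt A x] := by
        funext i; fin_cases i <;> simp
      rw [h2] at h1
      beta_reduce
      rw [h1]
      beta_reduce
      rw [Equiv.swap_apply_left]
      exact hsum _ hxy)
  have hcomp : IsCompact (poly L) := L.isCompact_biUnion fun s _ => Dl_compact s
  have hinj : InjOn (bt A) (poly L) := by
    intro x hx y hy hxy
    obtain ⟨s, hs, hxs⟩ := mem_poly.1 hx
    obtain ⟨t, ht, hyt⟩ := mem_poly.1 hy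
    have hs' := hLf s hs x hxs
    have ht' := hLf t ht y hyt
    have h1 : bt A x ∈ convexHull ℝ ((e s : Set (EuclideanSpace ℝ (Fin n))) ∩ e t) :=
      K.inter_subset_convexHull hs' ht' ⟨him s x hxs, by rw [hxy]; exact him t y hyt⟩
    rw [← Finset.coe_inter] at h1
    simp only [e] at h1
    rw [← Finset.map_inter, ← bt_image] at h1
    obtain ⟨z, hz, hzx⟩ := h1
    have e1 : z = x := bt_inj (K.indep hs') (Dl_mono Finset.inter_subset_left hz) hxs hzx
    have e2 : z = y := bt_inj (K.indep ht') (Dl_mono Finset.inter_subset_right hz) hyt (hzx.trans hxy)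
    rw [← e1, ← e2]
  have hsp : ∀ s ∈ K.faces, ∀ x ∈ convexHull ℝ (s : Set (EuclideanSpace ℝ (Fin n))), ∃ s' ∈ L, e s' = s ∧ ∃ w ∈ Dl s', bt A w = x := by
    intro s hs x hx
    obtain ⟨s', hs'⟩ := hpre s hs
    refine ⟨s', (hL s').2 (Or.inr (hs' ▸ hs)), hs', ?_⟩
    rw [← hs'] at hx
    simp only [e] at hx
    rw [← bt_image] at hx
    exact hx
  obtain ⟨g, hg, hgf⟩ := descend hcomp (bt_continuous A) hinj hf
  refine ⟨g, hg.mono fun x hx => ?_, ?_⟩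
  · obtain ⟨s, hs, hxs⟩ := Geometry.SimplicialComplex.mem_space_iff.1 hx
    obtain ⟨s', hs', -, w, hw, rfl⟩ := hsp s hs x hxs
    exact ⟨w, mem_poly.2 ⟨s', hs', hw⟩, rfl⟩
  · rw [tverberg_iff]
    rintro ⟨x, hx, hxe⟩
    obtain ⟨s, hs, t, ht, hd, hx0, hx1⟩ := mem_deleted.1 hx
    obtain ⟨s', hs', he, w, hw, hwx⟩ := hsp s hs _ hx0
    obtain ⟨t', ht', he', z, hz, hzx⟩ := hsp t ht _ hx1
    rw [← hwx, ← hzx, hgf w (mem_poly.2 ⟨s', hs', hw⟩), hgf z (mem_poly.2 ⟨t', ht', hz⟩)] at hxe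
    refine hfne s' hs' t' ht' ?_ w hw z hz hxe
    rw [← he, ← he'] at hd
    exact (Finset.disjoint_map _).1 hd

end
end VK

/-- Van Kampen–Shapiro–Wu, part 1: for a finite geometric simplicial
complex `K` of dimension `m ≥ 3`, there is an almost-embedding `|K| → ℝ^{2m}` (a
continuous map without `2`-Tverberg points) iff there is an `S_2`-equivariant continuous
map `K^2_Δ → S^{2m-1}`. -/
theorem statement4 (n m : ℕ) (hm : 3 ≤ m)
    (K : Geometry.SimplicialComplex ℝ (EuclideanSpace ℝ (Fin n)))
    (hK : K.faces.Finite)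
    (hdim : HasDimension K m) :
    (∃ f : EuclideanSpace ℝ (Fin n) → EuclideanSpace ℝ (Fin (2 * m)),
        ContinuousOn f K.space ∧ ¬ HasTverbergPoint K 2 f) ↔
    ExistsEquivariantMap K 2 (2 * m) := by
  constructor
  · rintro ⟨f, hf, hT⟩
    exact VK.easy hf hT
  · exact VK.hard hm hK hdim.1
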